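/- Let n ≥ 5. The assignments t_i ↦ t_i Δ_B, ρ_B ↦ ρ_B (defining T); t_i ↦ t_{n−i}^{−1}, ρ_B ↦ ρ_B^{−1} (defining τ); and t_i ↦ t_i^{−1}, ρ_B ↦ ρ_B (defining μ), for 0 ≤ i ≤ n−1, extend to automorphisms T, τ, μ of A[B_n]. These satisfy: T has infinite order, τ^2 = μ^2 = id, τμ = μτ, μTμ = T^{−1}, τT = Tτ. Moreover Aut(A[B_n]) is generated by the inner automorphisms together with T, τ, μ, the subgroup ⟨T, τ, μ⟩ intersects Inn(A[B_n]) trivially, and consequently Aut(A[B_n]) is the internal semidirect product (Inn(A[B_n]) ⋊ ⟨T⟩) ⋊ (⟨μ⟩ × ⟨τ⟩) and Out(A[B_n]) is isomorphic to (ℤ ⋊ ℤ/2ℤ) × ℤ/2ℤ, the direct product of the infinite dihedral group with ℤ/2ℤ. -/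

import Mathlib

/-- The defining relators of the Artin group of type `Bₙ`, as elements of the free
group on `n` generators (0-indexed: generator `i` corresponds to `r_{i+1}`). -/
def BnRels (n : ℕ) : Set (FreeGroup (Fin n)) :=
  {w | (∃ i j : Fin n, (i : ℕ) + 1 = (j : ℕ) ∧ (j : ℕ) + 1 < n ∧
          w = FreeGroup.of i * FreeGroup.of j * FreeGroup.of i *
              (FreeGroup.of j * FreeGroup.of i * FreeGroup.of j)⁻¹) ∨
       (∃ i j : Fin n, (i : ℕ) + 2 = n ∧ (j : ℕ) + 1 = n ∧
          w = FreeGroup.of i * FreeGroup.of j * FreeGroup.of i * FreeGroup.of j *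
              (FreeGroup.of j * FreeGroup.of i * FreeGroup.of j * FreeGroup.of i)⁻¹) ∨
       (∃ i j : Fin n, (i : ℕ) + 2 ≤ (j : ℕ) ∧
          w = FreeGroup.of i * FreeGroup.of j * (FreeGroup.of j * FreeGroup.of i)⁻¹)}

/-- The Artin group `A[Bₙ]` of type `Bₙ`. -/
abbrev ArtinB (n : ℕ) := PresentedGroup (BnRels n)

/-- The standard generator `r_i` (1-indexed, `1 ≤ i ≤ n`). -/
def rB (n i : ℕ) : ArtinB n :=
  if h : i - 1 < n then PresentedGroup.of ⟨i - 1, h⟩ else 1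

/-- `ρ_B = r_1 r_2 ⋯ r_n`. -/
def ρB (n : ℕ) : ArtinB n := ((List.range n).map fun i => rB n (i + 1)).prod

/-- `Δ_B = ρ_B ^ n`, the generator of the center. -/
def ΔB (n : ℕ) : ArtinB n := ρB n ^ n

/-- `t_i` for `i` read modulo `n`: `t_i = r_i` for `1 ≤ i ≤ n-1`,
and `t_0 = ρ_B r_{n-1} ρ_B⁻¹`. -/
def tB (n i : ℕ) : ArtinB n :=
  if i % n = 0 then ρB n * rB n (n - 1) * (ρB n)⁻¹ else rB n (i % n)

/-- `Δ_Y = (t_1⋯t_{n-1})(t_1⋯t_{n-2})⋯(t_1t_2)t_1`, the Garside element of the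
parabolic subgroup of type `A_{n-1}`. -/
def ΔY (n : ℕ) : ArtinB n :=
  ((List.range (n - 1)).map fun k =>
    ((List.range (n - 1 - k)).map fun i => rB n (i + 1)).prod).prod

/-- `ρ_0 = t_1 t_2 ⋯ t_{n-1}`. -/
def ρ₀B (n : ℕ) : ArtinB n := ((List.range (n - 1)).map fun i => rB n (i + 1)).prod

/-- `ρ_1 = t_1⁻¹ t_2⁻¹ ⋯ t_{n-1}⁻¹`. -/
def ρ₁B (n : ℕ) : ArtinB n := ((List.range (n - 1)).map fun i => (rB n (i + 1))⁻¹).prod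

/-- `ρ_k` for `k ∈ {0,1}`. -/
def ρkB (n k : ℕ) : ArtinB n := if k = 0 then ρ₀B n else ρ₁B n

/-- `v_k = ρ_k t_{n-1} ρ_k⁻¹` for `k ∈ {0,1}`. -/
def vB (n k : ℕ) : ArtinB n := ρkB n k * rB n (n - 1) * (ρkB n k)⁻¹

/-- `δ = r_{n-1} r_{n-2} ⋯ r_2 r_1² r_2 ⋯ r_{n-2} r_{n-1}`. -/
def δB (n : ℕ) : ArtinB n :=
  ((List.range (n - 2)).map fun i => rB n (n - 1 - i)).prod * rB n 1 ^ 2 *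
  ((List.range (n - 2)).map fun i => rB n (i + 2)).prod

/-- The quotient `Ā = A[Bₙ]/Z(A[Bₙ])`. -/
abbrev AbarB (n : ℕ) := ArtinB n ⧸ Subgroup.center (ArtinB n)

/-- The canonical projection `π : A[Bₙ] → Ā`. -/
def πB (n : ℕ) : ArtinB n →* AbarB n := QuotientGroup.mk' (Subgroup.center (ArtinB n))

/-- `t̄_i = π(t_i)`. -/
def tbar (n i : ℕ) : AbarB n := πB n (tB n i)

/-- `ρ̄_B = π(ρ_B)`. -/
def ρbar (n : ℕ) : AbarB n := πB n (ρB n)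

/-- The composition `conj_x ∘ φ` of an endomorphism with an inner automorphism. -/
def conjComp {G : Type*} [Group G] (x : G) (φ : G →* G) : G →* G :=
  (MulAut.conj x).toMonoidHom.comp φ

/-- Type (1): there are commuting `g, h` with `φ(t_i) = g` for all `0 ≤ i ≤ n-1`
and `φ(ρ_B) = h`. -/
def IsType1 (n : ℕ) (φ : ArtinB n →* ArtinB n) : Prop :=
  ∃ g h : ArtinB n, g * h = h * g ∧ (∀ i < n, φ (tB n i) = g) ∧ φ (ρB n) = h

/-- Type (2a) with parameters `ε ∈ {1,-1}`, `p q : ℤ`. -/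
def IsType2a (n : ℕ) (ε p q : ℤ) (φ : ArtinB n →* ArtinB n) : Prop :=
  (ε = 1 ∨ ε = -1) ∧ (∀ i < n, φ (tB n i) = tB n i ^ ε * ΔB n ^ p) ∧
    φ (ρB n) = ρB n * ΔB n ^ q

/-- Type (2b) with parameters `ε ∈ {1,-1}`, `p q : ℤ`. -/
def IsType2b (n : ℕ) (ε p q : ℤ) (φ : ArtinB n →* ArtinB n) : Prop :=
  (ε = 1 ∨ ε = -1) ∧ (∀ i < n, φ (tB n i) = tB n (n - i) ^ ε * ΔB n ^ p) ∧
    φ (ρB n) = (ρB n)⁻¹ * ΔB n ^ q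

/-- Type (3) with parameters `ε ∈ {1,-1}`, `k ∈ {0,1}`, `p q r s : ℤ`. -/
def IsType3 (n : ℕ) (ε : ℤ) (k : ℕ) (p q r s : ℤ) (φ : ArtinB n →* ArtinB n) : Prop :=
  (ε = 1 ∨ ε = -1) ∧ (k = 0 ∨ k = 1) ∧
    (∀ i, 1 ≤ i → i ≤ n - 1 → φ (tB n i) = tB n i ^ ε * ΔY n ^ (2 * p) * ΔB n ^ q) ∧
    φ (tB n 0) = vB n k ^ ε * ΔY n ^ (2 * p) * ΔB n ^ q ∧
    φ (ρB n) = ρkB n k * ΔY n ^ (2 * r) * ΔB n ^ s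

namespace ArtinAut

open FreeGroup hiding norm norm_eq_zero IsReduced

section FreeGroupBasics

variable {α : Type*} [DecidableEq α]

/-- There is no cancellation in the product `a * b`. -/
def NoCancel (a b : FreeGroup α) : Prop := FreeGroup.norm (a * b) = FreeGroup.norm a + FreeGroup.norm b

theorem noCancel_iff_toWord {a b : FreeGroup α} :
    NoCancel a b ↔ toWord (a * b) = toWord a ++ toWord b := by
  constructor
  · intro h
    apply (toWord_mul_sublist a b).eq_of_length
    simpa [NoCancel, FreeGroup.norm] using h
  · intro h
    simp [NoCancel, FreeGroup.norm, h]

theorem noCancel_iff_isReduced {a b : FreeGroup α} :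
    NoCancel a b ↔ FreeGroup.IsReduced (toWord a ++ toWord b) := by
  rw [noCancel_iff_toWord, toWord_mul, isReduced_iff_reduce_eq]

theorem NoCancel.trans {a b c : FreeGroup α} (h1 : NoCancel a b) (h2 : NoCancel b c)
    (hb : b ≠ 1) : NoCancel (a * b) c := by
  rw [noCancel_iff_isReduced, noCancel_iff_toWord.1 h1]
  rw [noCancel_iff_isReduced] at h1 h2
  have hne : toWord b ≠ [] := by simpa using hb
  rw [FreeGroup.IsReduced] at *
  rw [List.isChain_append] at *
  rw [List.isChain_append]
  refine ⟨⟨h1.1, h1.2.1, h1.2.2⟩, h2.2.1, ?_⟩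
  intro x hx y hy
  rw [List.getLast?_append_of_ne_nil _ hne] at hx
  exact h2.2.2 x hx y hy

theorem NoCancel.trans_left {a b c : FreeGroup α} (h1 : NoCancel a b) (h2 : NoCancel b c)
    (hb : b ≠ 1) : NoCancel a (b * c) := by
  have h := h1.trans h2 hb
  unfold NoCancel at *
  rw [← mul_assoc, h, h1, h2, add_assoc]

theorem NoCancel.norm_eq {a b : FreeGroup α} (h : NoCancel a b) :
    FreeGroup.norm (a * b) = FreeGroup.norm a + FreeGroup.norm b := h

theorem NoCancel.inv {a b : FreeGroup α} (h : NoCancel a b) : NoCancel b⁻¹ a⁻¹ := by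
  unfold NoCancel at *
  rw [← mul_inv_rev, norm_inv_eq, norm_inv_eq, norm_inv_eq, h, add_comm]

theorem noCancel_one_left (a : FreeGroup α) : NoCancel 1 a := by simp [NoCancel]

theorem noCancel_one_right (a : FreeGroup α) : NoCancel a 1 := by simp [NoCancel]

/-- A letter or the inverse of a letter. -/
def letter (a : α) (b : Bool) : FreeGroup α := mk [(a, b)]

theorem letter_true (a : α) : letter a true = of a := rfl

theorem letter_false (a : α) : letter a false = (of a)⁻¹ := rfl

theorem toWord_letter (a : α) (b : Bool) : toWord (letter a b) = [(a, b)] := by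
  simp [letter, toWord_mk, reduce_singleton]

theorem letter_inv (a : α) (b : Bool) : (letter a b)⁻¹ = letter a (!b) := by
  simp [letter, inv_mk, invRev]

theorem norm_letter (a : α) (b : Bool) : FreeGroup.norm (letter a b) = 1 := by
  simp [FreeGroup.norm, toWord_letter]

theorem letter_ne_one (a : α) (b : Bool) : letter a b ≠ 1 := by
  intro h
  have h1 := norm_letter a b
  rw [h] at h1
  simp at h1

/-- Either there is no cancellation with a letter on the left or the word starts with its
inverse. -/
theorem noCancel_letter_or (a : α) (b : Bool) (w : FreeGroup α) :
    NoCancel (letter a b) w ∨ ∃ v, w = letter a (!b) * v ∧ NoCancel (letter a (!b)) v := by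
  by_cases h : FreeGroup.IsReduced (toWord (letter a b) ++ toWord w)
  · exact Or.inl (noCancel_iff_isReduced.2 h)
  · right
    rw [toWord_letter] at h
    have hr : FreeGroup.IsReduced (toWord w) := isReduced_toWord
    rcases hw : toWord w with _ | ⟨⟨x, c⟩, l⟩
    · rw [hw] at h
      exact absurd (by simp) h
    · rw [hw] at h hr
      have hl : FreeGroup.IsReduced l := by
        have := hr
        rw [FreeGroup.IsReduced] at this ⊢
        exact this.tail
      rw [FreeGroup.IsReduced, List.singleton_append, List.isChain_cons_cons] at h
      have h3 : ¬ (a = x → b = c) := fun h4 => h ⟨h4, hr⟩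
      push Not at h3
      obtain ⟨rfl, h3⟩ := h3
      have hc : c = !b := by cases b <;> cases c <;> simp_all
      subst hc
      have hv : toWord (mk l) = l := by rw [toWord_mk, hl.reduce_eq]
      refine ⟨mk l, ?_, ?_⟩
      · rw [letter, mul_mk, List.singleton_append, ← hw, mk_toWord]
      · rw [noCancel_iff_isReduced, toWord_letter, hv]
        exact hr

theorem noCancel_letter_right_or (a : α) (b : Bool) (w : FreeGroup α) :
    NoCancel w (letter a b) ∨ ∃ v, w = v * letter a (!b) ∧ NoCancel v (letter a (!b)) := by
  rcases noCancel_letter_or a (!b) w⁻¹ with h | ⟨v, hv, h⟩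
  · left
    have := h.inv
    rwa [inv_inv, letter_inv, Bool.not_not] at this
  · right
    refine ⟨v⁻¹, ?_, ?_⟩
    · rw [← inv_inj, hv, mul_inv_rev, inv_inv, letter_inv]
    · have := h.inv
      rwa [letter_inv, Bool.not_not] at this

theorem mem_zpowers_of_commute_of {a : α} : ∀ {w : FreeGroup α}, Commute (of a) w →
    w ∈ Subgroup.zpowers (of a) := by
  intro w
  induction hn : FreeGroup.norm w using Nat.strong_induction_on generalizing w with
  | _ n ih =>
  intro hc
  have key : ∀ b v, w = letter a b * v → NoCancel (letter a b) v →
      w ∈ Subgroup.zpowers (of a) := by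
    intro b v hw h
    have hl : letter a b ∈ Subgroup.zpowers (of a) := by
      cases b
      · exact Subgroup.inv_mem _ (Subgroup.mem_zpowers _)
      · exact Subgroup.mem_zpowers _
    have hlc : Commute (of a) (letter a b) := by
      cases b
      · exact (Commute.refl _).inv_right
      · exact Commute.refl _
    have hv : v = (letter a b)⁻¹ * w := by rw [hw]; group
    have hvc : Commute (of a) v := by rw [hv]; exact hlc.inv_right.mul_right hc
    have h1 : FreeGroup.norm w = 1 + FreeGroup.norm v := by rw [hw, h.norm_eq, norm_letter]
    rw [hw]
    exact Subgroup.mul_mem _ hl (ih _ (by omega) rfl hvc)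
  rcases noCancel_letter_or a true w with h1 | ⟨v, hv, h1⟩
  swap
  · exact key _ v hv h1
  rcases noCancel_letter_or a false w with h2 | ⟨v, hv, h2⟩
  swap
  · exact key _ v hv h2
  have h3 : NoCancel w (letter a true) := by
    have : FreeGroup.norm (w * of a) = FreeGroup.norm (of a * w) := by rw [hc.eq]
    unfold NoCancel at *
    rw [letter_true] at *
    rw [this, h1, add_comm]
  rw [noCancel_iff_toWord] at h1 h3
  rw [letter_true] at h1 h3
  rw [hc.eq, h3] at h1
  rcases hw : toWord w with _ | ⟨x, l⟩
  · rw [toWord_eq_nil_iff] at hw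
    rw [hw]; exact Subgroup.one_mem _
  · rw [noCancel_iff_isReduced, toWord_letter, hw] at h2
    rw [hw, toWord_of] at h1
    simp only [List.cons_append, List.nil_append, List.cons.injEq] at h1
    rw [h1.1] at h2
    simp [FreeGroup.IsReduced] at h2

theorem exists_centralizer_eq_zpowers {a : FreeGroup α} (ha : a ≠ 1) :
    ∃ c : FreeGroup α, ∀ b, Commute a b ↔ b ∈ Subgroup.zpowers c := by
  classical
  let H : Subgroup (FreeGroup α) := Subgroup.centralizer {a}
  have hH : ∀ b, b ∈ H ↔ Commute a b := by
    intro b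
    rw [Subgroup.mem_centralizer_singleton_iff]
    exact ⟨fun h => h.symm, fun h => h.symm⟩
  let e := IsFreeGroup.toFreeGroup H
  let z : H := ⟨a, (hH a).2 (Commute.refl a)⟩
  have hz : ∀ h : H, Commute (e z) (e h) := by
    intro h
    have : Commute z h := by
      apply Subtype.ext
      exact ((hH h.1).1 h.2).eq
    exact this.map e
  have hz1 : e z ≠ 1 := by
    intro h
    rw [map_eq_one_iff e e.injective] at h
    exact ha (congrArg Subtype.val h)
  have hsub : ∀ g g' : IsFreeGroup.Generators H, g = g' := by
    intro g g'
    by_contra hne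
    have h1 : ∀ g, e z ∈ Subgroup.zpowers (of g) := by
      intro g
      apply mem_zpowers_of_commute_of
      have := hz (e.symm (of g))
      rw [e.apply_symm_apply] at this
      exact this.symm
    obtain ⟨k, hk⟩ := h1 g
    obtain ⟨l, hl⟩ := h1 g'
    let f : FreeGroup (IsFreeGroup.Generators H) →* Multiplicative ℤ :=
      FreeGroup.lift fun x => if x = g then Multiplicative.ofAdd 1 else 1
    have hf1 : f (e z) = Multiplicative.ofAdd k := by
      rw [← hk]
      simp [f, ← ofAdd_zsmul]
    have hf2 : f (e z) = 1 := by
      rw [← hl]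
      simp [f, Ne.symm hne]
    rw [hf1] at hf2
    have hk0 : k = 0 := by simpa using hf2
    subst hk0
    exact hz1 (by rw [← hk]; simp)
  by_cases hne : Nonempty (IsFreeGroup.Generators H)
  · obtain ⟨g⟩ := hne
    refine ⟨(e.symm (of g)).1, fun b => ⟨fun hb => ?_, fun hb => ?_⟩⟩
    · have h2 : ∀ x : FreeGroup (IsFreeGroup.Generators H), x ∈ Subgroup.zpowers (of g) := by
        intro x
        induction x using FreeGroup.induction_on with
        | C1 => exact Subgroup.one_mem _
        | of x => rw [hsub x g]; exact Subgroup.mem_zpowers _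
        | inv_of x h => exact Subgroup.inv_mem _ h
        | mul x y hx hy => exact Subgroup.mul_mem _ hx hy
      obtain ⟨k, hk⟩ := h2 (e ⟨b, (hH b).2 hb⟩)
      refine ⟨k, ?_⟩
      have : (e.symm (of g)) ^ k = ⟨b, (hH b).2 hb⟩ := by
        rw [← map_zpow]
        simp only at hk
        rw [hk, e.symm_apply_apply]
      have h3 := congrArg Subtype.val this
      simpa using h3
    · obtain ⟨k, hk⟩ := hb
      rw [← hk]
      exact ((hH _).1 (e.symm (of g)).2).zpow_right k
  · exfalso
    apply hz1
    have : IsEmpty (IsFreeGroup.Generators H) := not_nonempty_iff.1 hne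
    exact Subsingleton.elim _ _

/-- Free groups are commutative-transitive. -/
theorem commute_trans {a b c : FreeGroup α} (ha : a ≠ 1) (hb : Commute a b) (hc : Commute a c) :
    Commute b c := by
  obtain ⟨d, hd⟩ := exists_centralizer_eq_zpowers ha
  obtain ⟨k, rfl⟩ := (hd b).1 hb
  obtain ⟨l, rfl⟩ := (hd c).1 hc
  exact (Commute.refl d).zpow_zpow k l

theorem pow_eq_one_iff_free {a : FreeGroup α} {k : ℕ} (hk : k ≠ 0) : a ^ k = 1 ↔ a = 1 :=
  pow_eq_one_iff_left hk

theorem commute_of_commute_pow {a b : FreeGroup α} {k : ℕ} (hk : k ≠ 0) (h : Commute (a ^ k) b) :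
    Commute a b := by
  by_cases ha : a = 1
  · rw [ha]; exact Commute.one_left b
  · have h1 : a ^ k ≠ 1 := fun h => ha ((pow_eq_one_iff_free hk).1 h)
    exact commute_trans h1 (Commute.pow_self a k) h

theorem eq_of_braid {x y : FreeGroup α} (h : x * y * x = y * x * y) : x = y := by
  have hx : (x * y) ^ 3 = (x * y * x) * (x * y * x) := by
    calc (x * y) ^ 3 = (x * y * x) * (y * x * y) := by simp only [pow_succ, pow_zero, one_mul, mul_assoc]
      _ = _ := by rw [← h]
  have key1 : (x * y * x) * x = y * (x * y * x) := by
    calc (x * y * x) * x = (y * x * y) * x := by rw [h]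
      _ = _ := by group
  have key2 : (x * y * x) * y = x * (x * y * x) := by
    calc (x * y * x) * y = x * (y * x * y) := by group
      _ = _ := by rw [← h]
  have c1 : Commute ((x * y) ^ 3) x := by
    rw [Commute, SemiconjBy, hx]
    calc x * y * x * (x * y * x) * x = x * y * x * (x * y * x * x) := by group
      _ = (x * y * x * y) * (x * y * x) := by rw [key1]; group
      _ = x * (x * y * x * (x * y * x)) := by rw [key2]; group
  have c2 : Commute ((x * y) ^ 3) y := by
    rw [Commute, SemiconjBy, hx]
    calc x * y * x * (x * y * x) * y = x * y * x * (x * y * x * y) := by group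
      _ = (x * y * x * x) * (x * y * x) := by rw [key2]; group
      _ = y * (x * y * x * (x * y * x)) := by rw [key1]; group
  by_cases hz : (x * y) ^ 3 = 1
  · rw [pow_eq_one_iff_free (by norm_num)] at hz
    have : y * x = 1 := by
      rw [mul_eq_one_iff_eq_inv] at hz ⊢
      rw [hz]; simp
    rw [hz, this] at h
    simpa using h
  · have := commute_trans hz c1 c2
    have h2 : x * y * x = x * y * y := by
      rw [h, ← this.eq]
    exact mul_left_cancel h2

/-- The exponent sum of the letter `a`. -/
def expo (a : α) : FreeGroup α →* Multiplicative ℤ :=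
  FreeGroup.lift fun x => if x = a then Multiplicative.ofAdd 1 else 1

@[simp] theorem expo_of_self (a : α) : expo a (of a) = Multiplicative.ofAdd 1 := by simp [expo]

theorem expo_of_ne {a b : α} (h : b ≠ a) : expo a (of b) = 1 := by simp [expo, h]

theorem expo_conj (a : α) {x y : FreeGroup α} (h : IsConj x y) : expo a x = expo a y := by
  obtain ⟨c, hc⟩ := isConj_iff.1 h
  rw [← hc]; simp [mul_comm]

theorem mem_zpowers_of_commute_of_expo {a : α} {u b : FreeGroup α}
    (hu : expo a u = Multiplicative.ofAdd 1) (h : Commute u b) : b ∈ Subgroup.zpowers u := by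
  have hu1 : u ≠ 1 := by
    rintro rfl
    rw [MonoidHom.map_one] at hu
    exact absurd hu (by decide)
  obtain ⟨c, hc⟩ := exists_centralizer_eq_zpowers hu1
  obtain ⟨k, rfl⟩ := (hc u).1 (Commute.refl u)
  obtain ⟨l, rfl⟩ := (hc b).1 h
  simp only [map_zpow] at hu
  have h2 : k * Multiplicative.toAdd (expo a c) = 1 := by
    have := congrArg Multiplicative.toAdd hu
    simpa using this
  rcases Int.eq_one_or_neg_one_of_mul_eq_one h2 with rfl | rfl
  · exact ⟨l, by simp⟩
  · exact ⟨-l, by simp⟩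

theorem conj_injective {i j : α} (hij : i ≠ j) {a b : FreeGroup α}
    (h : MulAut.conj a = MulAut.conj b) : a = b := by
  classical
  have hc : ∀ y, Commute (b⁻¹ * a) y := by
    intro y
    have := DFunLike.congr_fun h y
    simp only [MulAut.conj_apply] at this
    rw [Commute, SemiconjBy]
    calc b⁻¹ * a * y = b⁻¹ * (a * y * a⁻¹) * a := by group
      _ = y * (b⁻¹ * a) := by rw [this]; group
  by_contra hne
  have h1 : b⁻¹ * a ≠ 1 := by
    intro h1; apply hne
    rw [inv_mul_eq_one] at h1; exact h1.symm
  have := commute_trans h1 (hc (of i)) (hc (of j))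
  obtain ⟨k, hk⟩ := mem_zpowers_of_commute_of this
  have h2 := congrArg (expo j) hk
  simp [expo_of_ne hij] at h2
  exact absurd h2 (by decide)

end FreeGroupBasics

end ArtinAut

namespace ArtinAut

section BraidSequences

variable {H : Type*} [Group H]

/-- `s 0, …, s (n - 1)` satisfy the braid relations. -/
structure IsBr (n : ℕ) (s : ℕ → H) : Prop where
  braid : ∀ i, i + 1 < n → s i * s (i + 1) * s i = s (i + 1) * s i * s (i + 1)
  comm : ∀ i j, i + 2 ≤ j → j < n → Commute (s i) (s j)

/-- `s 0, …, s (n - 1)` satisfy the relations of the Artin group of type `B`. -/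
structure IsArtB (n : ℕ) (s : ℕ → H) : Prop where
  braid : ∀ i, i + 2 < n → s i * s (i + 1) * s i = s (i + 1) * s i * s (i + 1)
  four : ∀ i, i + 2 = n → s i * s (i + 1) * s i * s (i + 1) = s (i + 1) * s i * s (i + 1) * s i
  comm : ∀ i j, i + 2 ≤ j → j < n → Commute (s i) (s j)

theorem IsArtB.isBr {n : ℕ} {s : ℕ → H} (h : IsArtB n s) : IsBr (n - 1) s :=
  ⟨fun i hi => h.braid i (by omega), fun i j hij hj => h.comm i j hij (by omega)⟩

theorem IsArtB.shift {n : ℕ} {s : ℕ → H} (h : IsArtB (n + 1) s) :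
    IsArtB n (fun i => s (i + 1)) :=
  ⟨fun i hi => h.braid (i + 1) (by omega), fun i hi => h.four (i + 1) (by omega),
    fun i j hij hj => h.comm _ _ (by omega) (by omega)⟩

theorem IsBr.map {K : Type*} [Group K] {n : ℕ} {s : ℕ → H} (h : IsBr n s) (f : H →* K) :
    IsBr n (fun i => f (s i)) :=
  ⟨fun i hi => by simpa using congrArg f (h.braid i hi), fun i j hij hj => (h.comm i j hij hj).map f⟩

theorem IsBr.conj_braid {n : ℕ} {s : ℕ → H} (h : IsBr n s) {i : ℕ} (hi : i + 1 < n) :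
    s (i + 1) = s i * s (i + 1) * s i * (s i * s (i + 1))⁻¹ := by
  rw [h.braid i hi]; group

/-- The product `s a * s (a + 1) * ⋯ * s (a + k - 1)`. -/
def pr (s : ℕ → H) (a : ℕ) : ℕ → H
  | 0 => 1
  | k + 1 => pr s a k * s (a + k)

@[simp] theorem pr_zero (s : ℕ → H) (a : ℕ) : pr s a 0 = 1 := rfl

theorem pr_succ (s : ℕ → H) (a k : ℕ) : pr s a (k + 1) = pr s a k * s (a + k) := rfl

theorem pr_one (s : ℕ → H) (a : ℕ) : pr s a 1 = s a := by simp [pr_succ]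

theorem pr_add (s : ℕ → H) (a k l : ℕ) : pr s a (k + l) = pr s a k * pr s (a + k) l := by
  induction l with
  | zero => simp
  | succ l ih => rw [← add_assoc, pr_succ, ih, pr_succ, mul_assoc, add_assoc]

theorem pr_succ_left (s : ℕ → H) (a k : ℕ) : pr s a (k + 1) = s a * pr s (a + 1) k := by
  rw [add_comm, pr_add, pr_one]

theorem pr_congr {s t : ℕ → H} {a k : ℕ} (h : ∀ i, a ≤ i → i < a + k → s i = t i) :
    pr s a k = pr t a k := by
  induction k with
  | zero => rfl
  | succ k ih =>
    rw [pr_succ, pr_succ, ih (fun i h1 h2 => h i h1 (by omega)), h _ (by omega) (by omega)]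

theorem pr_shift (s : ℕ → H) (a b k : ℕ) : pr (fun i => s (i + b)) a k = pr s (a + b) k := by
  induction k with
  | zero => rfl
  | succ k ih => rw [pr_succ, pr_succ, ih]; congr 2; omega

theorem map_pr {K : Type*} [Group K] (f : H →* K) (s : ℕ → H) (a k : ℕ) :
    f (pr s a k) = pr (fun i => f (s i)) a k := by
  induction k with
  | zero => simp
  | succ k ih => rw [pr_succ, pr_succ, map_mul, ih]

theorem list_range_prod_eq_pr (s : ℕ → H) (k : ℕ) :
    ((List.range k).map s).prod = pr s 0 k := by
  induction k with
  | zero => rfl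
  | succ k ih => rw [List.range_succ]; simp [ih, pr_succ]

theorem commute_pr {s : ℕ → H} {x : H} {a k : ℕ}
    (h : ∀ i, a ≤ i → i < a + k → Commute (s i) x) : Commute (pr s a k) x := by
  induction k with
  | zero => exact Commute.one_left x
  | succ k ih =>
    rw [pr_succ]
    exact (ih fun i h1 h2 => h i h1 (by omega)).mul_left (h _ (by omega) (by omega))

theorem pr_mem {s : ℕ → H} {K : Subgroup H} {a k : ℕ}
    (h : ∀ i, a ≤ i → i < a + k → s i ∈ K) : pr s a k ∈ K := by
  induction k with
  | zero => exact K.one_mem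
  | succ k ih =>
    rw [pr_succ]
    exact K.mul_mem (ih fun i h1 h2 => h i h1 (by omega)) (h _ (by omega) (by omega))

theorem IsBr.commute_pr_of_lt {n : ℕ} {s : ℕ → H} (h : IsBr n s) {a k j : ℕ} (hj : a + k < j)
    (hn : j < n) : Commute (pr s a k) (s j) :=
  commute_pr fun i _ h2 => h.comm i j (by omega) hn

theorem IsBr.pr_mul {n : ℕ} {s : ℕ → H} (h : IsBr n s) {a k i : ℕ} (h1 : a ≤ i)
    (h2 : i + 1 < a + k) (h3 : a + k ≤ n) : pr s a k * s i = s (i + 1) * pr s a k := by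
  induction k with
  | zero => omega
  | succ k ih =>
    by_cases hi : i + 1 < a + k
    · rw [pr_succ, mul_assoc, ← (h.comm i (a + k) (by omega) (by omega)).eq, ← mul_assoc,
        ih hi (by omega), mul_assoc]
    · obtain rfl : k = i - a + 1 := by omega
      have e1 : a + (i - a + 1) = i + 1 := by omega
      have e2 : a + (i - a) = i := by omega
      have hc : Commute (pr s a (i - a)) (s (i + 1)) := h.commute_pr_of_lt (by omega) (by omega)
      rw [pr_succ, pr_succ, e1, e2]
      calc pr s a (i - a) * s i * s (i + 1) * s i
          = pr s a (i - a) * (s i * s (i + 1) * s i) := by group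
        _ = (pr s a (i - a) * s (i + 1)) * s i * s (i + 1) := by
            rw [h.braid i (by omega)]; group
        _ = _ := by rw [hc.eq]; group

theorem IsBr.pr_mul_pr {n : ℕ} {s : ℕ → H} (h : IsBr n s) {a k b l : ℕ} (h1 : a ≤ b)
    (h2 : b + l < a + k) (h3 : a + k ≤ n) :
    pr s a k * pr s b l = pr s (b + 1) l * pr s a k := by
  induction l with
  | zero => simp
  | succ l ih =>
    rw [pr_succ, ← mul_assoc, ih (by omega), mul_assoc, h.pr_mul (by omega) (by omega) h3,
      pr_succ, ← mul_assoc]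
    congr 3
    omega

/-- Conjugating the first generator down equals conjugating the last generator up. -/
theorem IsBr.flip {n : ℕ} {s : ℕ → H} (h : IsBr n s) {a k : ℕ} (hk : a + k < n) :
    (pr s (a + 1) k)⁻¹ * s a * pr s (a + 1) k = pr s a k * s (a + k) * (pr s a k)⁻¹ := by
  have h1 := h.pr_mul_pr (a := a) (k := k + 1) (b := a) (l := k) le_rfl (by omega) (by omega)
  rw [mul_assoc, inv_mul_eq_iff_eq_mul, ← mul_assoc, eq_mul_inv_iff_mul_eq,
    ← pr_succ_left, ← pr_succ, h1]

/-- A rotating braid sequence yields the type `B` relations. -/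
theorem IsBr.isArtB_of_rot {m : ℕ} {t : ℕ → H} (ht : IsBr (m + 1) t) {ρ : H}
    (h1 : ∀ i, i < m → ρ * t i = t (i + 1) * ρ) (h2 : ρ ^ 2 * t m = t 0 * ρ ^ 2) :
    IsArtB (m + 2) (fun i => if i ≤ m then t i else (pr t 0 (m + 1))⁻¹ * ρ) := by
  have hP : ∀ i, i < m → pr t 0 (m + 1) * t i = t (i + 1) * pr t 0 (m + 1) := fun i hi =>
    ht.pr_mul (by omega) (by omega) (by omega)
  refine ⟨fun i hi => ?_, fun i hi => ?_, fun i j hij hj => ?_⟩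
  · beta_reduce
    rw [if_pos (by omega), if_pos (by omega)]
    exact ht.braid i (by omega)
  · obtain rfl : i = m := by omega
    beta_reduce
    rw [if_pos le_rfl, if_neg (by omega)]
    set P := pr t 0 (i + 1) with hPdef
    set c := pr t 0 i with hc
    set d := pr t 1 i with hd
    have hPc : P = c * t i := by rw [hPdef, pr_succ, zero_add]
    have hPd : P = t 0 * d := by rw [hPdef, pr_succ_left]
    have hPcd : P * c = d * P := ht.pr_mul_pr le_rfl (by omega) (by omega)
    have hρc : ρ * c = d * ρ := by
      have : ∀ l, l ≤ i → ρ * pr t 0 l = pr t 1 l * ρ := by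
        intro l hl
        induction l with
        | zero => simp
        | succ l ih =>
          rw [pr_succ, ← mul_assoc, ih (by omega), mul_assoc, zero_add, h1 l (by omega), pr_succ,
            mul_assoc, add_comm 1 l]
      exact this i le_rfl
    have hab : t i * (P⁻¹ * ρ) = c⁻¹ * ρ := by rw [hPc]; group
    have hab2 : t i * (P⁻¹ * ρ) * (t i * (P⁻¹ * ρ)) = c⁻¹ * d⁻¹ * ρ ^ 2 := by
      rw [hab]
      have : ρ * c⁻¹ = d⁻¹ * ρ := by rw [mul_inv_eq_iff_eq_mul, mul_assoc, hρc]; group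
      calc c⁻¹ * ρ * (c⁻¹ * ρ) = c⁻¹ * (ρ * c⁻¹) * ρ := by group
        _ = _ := by rw [this]; simp only [pow_two, mul_assoc]
    have hcom : t i * (c⁻¹ * d⁻¹ * ρ ^ 2) = c⁻¹ * d⁻¹ * ρ ^ 2 * t i := by
      rw [mul_assoc _ (ρ ^ 2), h2]
      have h3 : d * c * t i = t 0 * (d * c) := by
        rw [mul_assoc, ← hPc, ← hPcd, hPd, mul_assoc]
      have h4 : t i * (c⁻¹ * d⁻¹) = c⁻¹ * d⁻¹ * t 0 := by
        calc t i * (c⁻¹ * d⁻¹) = (d * c)⁻¹ * (d * c * t i) * (d * c)⁻¹ := by group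
          _ = _ := by rw [h3]; group
      calc t i * (c⁻¹ * d⁻¹ * ρ ^ 2) = t i * (c⁻¹ * d⁻¹) * ρ ^ 2 := by group
        _ = _ := by rw [h4]; group
    rw [← hab2] at hcom
    have h5 := mul_left_cancel (a := t i) (b := (t i * (P⁻¹ * ρ)) * (t i * (P⁻¹ * ρ)))
      (c := (P⁻¹ * ρ) * t i * (P⁻¹ * ρ) * t i) (by rw [hcom]; group)
    rw [← h5]; group
  · beta_reduce
    rw [if_pos (by omega)]
    by_cases hjm : j ≤ m
    · rw [if_pos hjm]
      exact ht.comm i j hij (by omega)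
    · rw [if_neg hjm]
      rw [Commute, SemiconjBy, mul_assoc, h1 i (by omega)]
      have := hP i (by omega)
      calc t i * ((pr t 0 (m + 1))⁻¹ * ρ)
          = (pr t 0 (m + 1))⁻¹ * (pr t 0 (m + 1) * t i) * ((pr t 0 (m + 1))⁻¹ * ρ) := by group
        _ = _ := by rw [this]; group

theorem IsArtB.pr_mul {n : ℕ} {s : ℕ → H} (h : IsArtB n s) {i : ℕ} (hi : i + 2 < n) :
    pr s 0 n * s i = s (i + 1) * pr s 0 n := by
  obtain ⟨m, rfl⟩ : ∃ m, n = m + 1 := ⟨n - 1, by omega⟩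
  rw [pr_succ, mul_assoc, zero_add, ← (h.comm i m (by omega) (by omega)).eq, ← mul_assoc,
    h.isBr.pr_mul (by omega) (by omega) (by omega), mul_assoc]

theorem IsArtB.pr_sq_mul {m : ℕ} {s : ℕ → H} (h : IsArtB (m + 2) s) :
    (pr s 0 (m + 2)) ^ 2 * s m = s 0 * (pr s 0 (m + 2)) ^ 2 := by
  set ρ := pr s 0 (m + 2) with hρ
  have ht : IsBr (m + 1) s := h.isBr
  set P := pr s 0 (m + 1) with hPdef
  set c := pr s 0 m with hc
  set d := pr s 1 m with hd
  have hρP : ρ = P * s (m + 1) := by rw [hρ, pr_succ, zero_add]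
  have hPc : P = c * s m := by rw [hPdef, pr_succ, zero_add]
  have hPd : P = s 0 * d := by rw [hPdef, pr_succ_left]
  have hPcd : P * c = d * P := ht.pr_mul_pr le_rfl (by omega) (by omega)
  have hρc : ρ * c = d * ρ := by
    have h0 : Commute c (s (m + 1)) := commute_pr fun i _ h2 => h.comm _ _ (by omega) (by omega)
    rw [hρP, mul_assoc, ← h0.eq, ← mul_assoc, hPcd, mul_assoc]
  have hab : s m * s (m + 1) = c⁻¹ * ρ := by rw [hρP, hPc]; group
  have hab2 : s m * s (m + 1) * (s m * s (m + 1)) = c⁻¹ * d⁻¹ * ρ ^ 2 := by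
    rw [hab]
    have : ρ * c⁻¹ = d⁻¹ * ρ := by rw [mul_inv_eq_iff_eq_mul, mul_assoc, hρc]; group
    calc c⁻¹ * ρ * (c⁻¹ * ρ) = c⁻¹ * (ρ * c⁻¹) * ρ := by group
      _ = _ := by rw [this]; simp only [pow_two, mul_assoc]
  have hcom : s m * (c⁻¹ * d⁻¹ * ρ ^ 2) = c⁻¹ * d⁻¹ * ρ ^ 2 * s m := by
    rw [← hab2]
    have := h.four m rfl
    calc s m * (s m * s (m + 1) * (s m * s (m + 1)))
        = s m * (s m * s (m + 1) * s m * s (m + 1)) := by group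
      _ = _ := by rw [this]; group
  have h3 : d * c * s m = s 0 * (d * c) := by
    rw [mul_assoc, ← hPc, ← hPcd, hPd, mul_assoc]
  have h4 : s m * (c⁻¹ * d⁻¹) = c⁻¹ * d⁻¹ * s 0 := by
    calc s m * (c⁻¹ * d⁻¹) = (d * c)⁻¹ * (d * c * s m) * (d * c)⁻¹ := by group
      _ = _ := by rw [h3]; group
  have h5 : c⁻¹ * d⁻¹ * (s 0 * ρ ^ 2) = c⁻¹ * d⁻¹ * (ρ ^ 2 * s m) := by
    rw [← mul_assoc, ← h4, mul_assoc, hcom, mul_assoc]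
  exact (mul_left_cancel h5).symm

theorem IsArtB.pr_pow_commute {m : ℕ} {s : ℕ → H} (h : IsArtB (m + 2) s) {i : ℕ}
    (hi : i < m + 2) : Commute ((pr s 0 (m + 2)) ^ (m + 2)) (s i) := by
  set ρ := pr s 0 (m + 2) with hρ
  have h1 : ∀ i, i < m → ρ * s i = s (i + 1) * ρ := fun i hi => h.pr_mul (by omega)
  have h2 : ρ ^ 2 * s m = s 0 * ρ ^ 2 := h.pr_sq_mul
  have h3 : ∀ k i, i + k ≤ m → ρ ^ k * s i = s (i + k) * ρ ^ k := by
    intro k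
    induction k with
    | zero => simp
    | succ k ih =>
      intro i hi
      rw [pow_succ, mul_assoc, h1 i (by omega), ← mul_assoc, ih _ (by omega), mul_assoc]
      congr 2; omega
  have h4 : ∀ i, i ≤ m → Commute (ρ ^ (m + 2)) (s i) := by
    intro i hi
    have e : m + 2 = i + (2 + (m - i)) := by omega
    rw [Commute, SemiconjBy, e, pow_add, pow_add, mul_assoc, mul_assoc, h3 _ _ (by omega),
      show i + (m - i) = m by omega, ← mul_assoc (ρ ^ 2), h2, mul_assoc, ← mul_assoc,
      h3 i 0 (by omega), zero_add]
    simp only [mul_assoc]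
  by_cases hi' : i ≤ m
  · exact h4 i hi'
  · obtain rfl : i = m + 1 := by omega
    have e : s (m + 1) = (pr s 0 (m + 1))⁻¹ * ρ := by
      rw [hρ, pr_succ s 0 (m + 1), zero_add]; group
    rw [e]
    apply Commute.mul_right
    · exact (commute_pr (fun i _ hi => (h4 i (by omega)).symm)).symm.inv_right
    · exact Commute.pow_self ρ _

end BraidSequences

end ArtinAut

namespace ArtinAut

section ArtinGroup

variable {H : Type*} [Group H]

/-- The generators of `ArtinB n`, numbered from `0`. -/
def sB (n i : ℕ) : ArtinB n := rB n (i + 1)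

theorem sB_of_lt {n i : ℕ} (h : i < n) : sB n i = PresentedGroup.of ⟨i, h⟩ := by
  simp [sB, rB, h]

theorem ρB_eq (n : ℕ) : ρB n = pr (sB n) 0 n := list_range_prod_eq_pr _ _

theorem isArtB_sB (n : ℕ) : IsArtB n (sB n) := by
  refine ⟨fun i hi => ?_, fun i hi => ?_, fun i j hij hj => ?_⟩
  · rw [sB_of_lt (i := i) (by omega), sB_of_lt (i := i + 1) (by omega), ← mul_inv_eq_one]
    exact PresentedGroup.one_of_mem
      (Or.inl ⟨⟨i, by omega⟩, ⟨i + 1, by omega⟩, rfl, by simp only; omega, rfl⟩)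
  · rw [sB_of_lt (i := i) (by omega), sB_of_lt (i := i + 1) (by omega), ← mul_inv_eq_one]
    exact PresentedGroup.one_of_mem
      (Or.inr (Or.inl ⟨⟨i, by omega⟩, ⟨i + 1, by omega⟩, hi, by simp only; omega, rfl⟩))
  · rw [sB_of_lt (i := i) (by omega), sB_of_lt hj, Commute, SemiconjBy, ← mul_inv_eq_one]
    exact PresentedGroup.one_of_mem (Or.inr (Or.inr ⟨⟨i, by omega⟩, ⟨j, hj⟩, hij, rfl⟩))

theorem exists_lift {n : ℕ} {s : ℕ → H} (h : IsArtB n s) :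
    ∃ f : ArtinB n →* H, ∀ i, i < n → f (sB n i) = s i := by
  refine ⟨PresentedGroup.toGroup (f := fun i : Fin n => s i) ?_, fun i hi => ?_⟩
  · rintro r (⟨i, j, hij, hj, rfl⟩ | ⟨i, j, hi, hj, rfl⟩ | ⟨i, j, hij, rfl⟩)
    · simp only [map_mul, map_inv, FreeGroup.lift_apply_of, mul_inv_eq_one, ← hij]
      exact h.braid i (by omega)
    · simp only [map_mul, map_inv, FreeGroup.lift_apply_of, mul_inv_eq_one,
        show (j : ℕ) = i + 1 by omega]
      exact h.four i hi
    · simp only [map_mul, map_inv, FreeGroup.lift_apply_of, mul_inv_eq_one]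
      exact h.comm i j hij j.2
  · rw [sB_of_lt hi, PresentedGroup.toGroup.of]

/-- The homomorphism out of `ArtinB n` given by elements satisfying the relations. -/
noncomputable def liftB {n : ℕ} {s : ℕ → H} (h : IsArtB n s) : ArtinB n →* H :=
  (exists_lift h).choose

theorem liftB_sB {n : ℕ} {s : ℕ → H} (h : IsArtB n s) {i : ℕ} (hi : i < n) :
    liftB h (sB n i) = s i := (exists_lift h).choose_spec i hi

theorem hom_ext_sB {n : ℕ} {f g : ArtinB n →* H} (h : ∀ i, i < n → f (sB n i) = g (sB n i)) :
    f = g := by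
  apply PresentedGroup.ext
  intro i
  rw [← sB_of_lt i.2]
  exact h i i.2

theorem closure_sB (n : ℕ) : Subgroup.closure {x | ∃ i, i < n ∧ x = sB n i} = ⊤ := by
  rw [eq_top_iff, ← PresentedGroup.closure_range_of (BnRels n), Subgroup.closure_le]
  rintro _ ⟨i, rfl⟩
  exact Subgroup.subset_closure ⟨i, i.2, (sB_of_lt i.2).symm⟩

theorem sB_induction {n : ℕ} {p : ArtinB n → Prop} (h1 : p 1)
    (hs : ∀ i g, i < n → p g → p (g * sB n i)) (hi : ∀ i g, i < n → p g → p (g * (sB n i)⁻¹))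
    (g : ArtinB n) : p g := by
  have hg : g ∈ Subgroup.closure {x | ∃ i, i < n ∧ x = sB n i} := by simp [closure_sB]
  induction hg using Subgroup.closure_induction_right with
  | one => exact h1
  | mul_right x _ y hy ih => obtain ⟨i, hi, rfl⟩ := hy; exact hs i x hi ih
  | mul_inv_cancel x _ y hy ih => obtain ⟨i, hi', rfl⟩ := hy; exact hi i x hi' ih

theorem mem_of_sB {n : ℕ} {K : Subgroup (ArtinB n)} (h : ∀ i, i < n → sB n i ∈ K)
    (g : ArtinB n) : g ∈ K :=
  sB_induction K.one_mem (fun i _ hi hg => K.mul_mem hg (h i hi))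
    (fun i _ hi hg => K.mul_mem hg (K.inv_mem (h i hi))) g

theorem sB_last (m : ℕ) : sB (m + 2) (m + 1) = (pr (sB (m + 2)) 0 (m + 1))⁻¹ * ρB (m + 2) := by
  rw [ρB_eq, pr_succ _ _ (m + 1), zero_add]; group

theorem hom_ext_rot {m : ℕ} {f g : ArtinB (m + 2) →* H}
    (h : ∀ i, i ≤ m → f (sB (m + 2) i) = g (sB (m + 2) i))
    (hρ : f (ρB (m + 2)) = g (ρB (m + 2))) : f = g := by
  apply hom_ext_sB
  intro i hi
  by_cases hi' : i ≤ m
  · exact h i hi'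
  · obtain rfl : i = m + 1 := by omega
    rw [sB_last, map_mul, map_mul, map_inv, map_inv, hρ, map_pr, map_pr]
    congr 2
    exact pr_congr fun i _ hi => h i (by omega)

theorem exists_hom_rot {m : ℕ} {t : ℕ → H} (ht : IsBr (m + 1) t) {ρ : H}
    (h1 : ∀ i, i < m → ρ * t i = t (i + 1) * ρ) (h2 : ρ ^ 2 * t m = t 0 * ρ ^ 2) :
    ∃ f : ArtinB (m + 2) →* H, (∀ i, i ≤ m → f (sB (m + 2) i) = t i) ∧ f (ρB (m + 2)) = ρ := by
  have hA := ht.isArtB_of_rot h1 h2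
  have h0 : ∀ i, i ≤ m → liftB hA (sB (m + 2) i) = t i := fun i hi => by
    rw [liftB_sB hA (by omega), if_pos hi]
  refine ⟨liftB hA, h0, ?_⟩
  have h3 := liftB_sB hA (i := m + 1) (by omega)
  rw [if_neg (by omega)] at h3
  rw [ρB_eq, pr_succ _ _ (m + 1), map_mul, zero_add, h3, map_pr,
    pr_congr (t := t) fun i _ hi => h0 i (by omega)]
  group

variable {n : ℕ}

theorem ρB_mul_sB {i : ℕ} (hi : i + 2 < n) : ρB n * sB n i = sB n (i + 1) * ρB n := by
  rw [ρB_eq]; exact (isArtB_sB n).pr_mul hi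

theorem ρB_sq_mul_sB (m : ℕ) : ρB (m + 2) ^ 2 * sB (m + 2) m = sB (m + 2) 0 * ρB (m + 2) ^ 2 := by
  rw [ρB_eq]; exact (isArtB_sB _).pr_sq_mul

theorem ΔB_comm (g : ArtinB n) : Commute (ΔB n) g := by
  have hg : g ∈ Subgroup.centralizer {ΔB n} := by
    refine mem_of_sB (fun i hi => ?_) g
    rw [Subgroup.mem_centralizer_singleton_iff]
    obtain rfl | rfl | ⟨m, rfl⟩ : n = 0 ∨ n = 1 ∨ ∃ m, n = m + 2 := by
      rcases n with _ | _ | m <;> simp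
    · omega
    · obtain rfl : i = 0 := by omega
      simp [ΔB, ρB_eq, pr_one]
    · rw [ΔB, ρB_eq]
      exact ((isArtB_sB _).pr_pow_commute hi).symm.eq
  rw [Subgroup.mem_centralizer_singleton_iff] at hg
  exact hg.symm

theorem tB_of_pos {i : ℕ} (h0 : 0 < i) (hi : i < n) : tB n i = sB n (i - 1) := by
  rw [tB, Nat.mod_eq_of_lt hi, if_neg (by omega), sB, Nat.sub_add_cancel h0]

theorem tB_zero (m : ℕ) : tB (m + 2) 0 = ρB (m + 2) * sB (m + 2) m * (ρB (m + 2))⁻¹ := by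
  simp [tB, sB]

/-- The exponent sums of `ρ` (first) and of the `t i` (second). -/
theorem exists_hom_comm (m : ℕ) {C : Type*} [CommGroup C] (a b : C) :
    ∃ f : ArtinB (m + 2) →* C, (∀ i, i ≤ m → f (sB (m + 2) i) = a) ∧ f (ρB (m + 2)) = b :=
  exists_hom_rot (t := fun _ => a) ⟨fun _ _ => rfl, fun _ _ _ _ => Commute.refl _⟩
    (fun _ _ => mul_comm _ _) (mul_comm _ _)

theorem exists_T (m : ℕ) : ∃ T : ArtinB (m + 2) →* ArtinB (m + 2),
    (∀ i, i ≤ m → T (sB (m + 2) i) = sB (m + 2) i * ΔB (m + 2)) ∧ T (ρB (m + 2)) = ρB (m + 2) := by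
  have hc := fun x => (ΔB_comm (n := m + 2) x).eq
  have hs := (isArtB_sB (m + 2)).isBr
  set D := ΔB (m + 2)
  have key : ∀ a b c : ArtinB (m + 2), a * D * (b * D) * (c * D) = a * b * c * D ^ 3 := by
    intro a b c
    have hD : Commute (D ^ 2) c := (ΔB_comm c).pow_left 2
    calc a * D * (b * D) * (c * D) = a * (D * b) * D * c * D := by simp only [mul_assoc]
      _ = a * b * (D ^ 2 * c) * D := by rw [hc b, pow_two]; simp only [mul_assoc]
      _ = _ := by rw [hD.eq]; simp only [pow_succ, pow_zero, one_mul, mul_assoc]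
  refine exists_hom_rot ⟨fun i hi => ?_, fun i j hij hj => ?_⟩ (fun i hi => ?_) ?_
  · rw [key, key, hs.braid i hi]
  · exact ((hs.comm i j hij hj).mul_left (ΔB_comm _)).mul_right
      (((ΔB_comm _).symm).mul_left (Commute.refl _))
  · rw [← mul_assoc, ρB_mul_sB (by omega), mul_assoc, ← hc, mul_assoc]
  · rw [← mul_assoc, ρB_sq_mul_sB, mul_assoc, ← hc, mul_assoc]

theorem exists_μ (m : ℕ) : ∃ μ : ArtinB (m + 2) →* ArtinB (m + 2),
    (∀ i, i ≤ m → μ (sB (m + 2) i) = (sB (m + 2) i)⁻¹) ∧ μ (ρB (m + 2)) = ρB (m + 2) := by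
  have hs := (isArtB_sB (m + 2)).isBr
  refine exists_hom_rot ⟨fun i hi => ?_, fun i j hij hj => ?_⟩ (fun i hi => ?_) ?_
  · have := congrArg (·⁻¹) (hs.braid i hi)
    simpa [mul_assoc] using this
  · exact (hs.comm i j hij hj).inv_inv
  · rw [mul_inv_eq_iff_eq_mul, mul_assoc, ρB_mul_sB (by omega)]; group
  · rw [mul_inv_eq_iff_eq_mul, mul_assoc, ρB_sq_mul_sB]; group

theorem exists_τ (m : ℕ) : ∃ τ : ArtinB (m + 2) →* ArtinB (m + 2),
    (∀ i, i ≤ m → τ (sB (m + 2) i) = (sB (m + 2) (m - i))⁻¹) ∧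
      τ (ρB (m + 2)) = (ρB (m + 2))⁻¹ := by
  have hs := (isArtB_sB (m + 2)).isBr
  refine exists_hom_rot ⟨fun i hi => ?_, fun i j hij hj => ?_⟩ (fun i hi => ?_) ?_
  · have := congrArg (·⁻¹) (hs.braid (m - (i + 1)) (by omega))
    rw [show m - i = m - (i + 1) + 1 by omega]
    simpa [mul_assoc] using this.symm
  · exact (hs.comm (m - j) (m - i) (by omega) (by omega)).symm.inv_inv
  · rw [show m - i = m - (i + 1) + 1 by omega, ← mul_inv_rev, ← mul_inv_rev,
      ρB_mul_sB (by omega)]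
  · rw [inv_pow, ← mul_inv_rev, ← mul_inv_rev, Nat.sub_self, Nat.sub_zero, ρB_sq_mul_sB]

end ArtinGroup

end ArtinAut

namespace ArtinAut

section BraidIdentities

variable {H : Type*} [Group H]

theorem eq_of_conj {u v x y : H} (h : u = v) (g : H) (e : x * y⁻¹ = g * (u * v⁻¹) * g⁻¹) :
    x = y := by
  rw [h, mul_inv_cancel, mul_one, mul_inv_cancel, mul_inv_eq_one] at e
  exact e

theorem conj_key (f : H ≃* H) {a x y : H} (h : a * x * a⁻¹ = x * y * x⁻¹) :
    f a * f x * (f a)⁻¹ = f x * f y * (f x)⁻¹ := by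
  simpa only [map_mul, map_inv] using congrArg f h

/-- The elements of the type `B` Artin group generating the pure free factor. -/
def Xo (s : ℕ → H) (n i : ℕ) : H :=
  pr s i (n - 1 - i) * (s (n - 1))⁻¹ * (pr s i (n - 1 - i))⁻¹

theorem Xo_last (s : ℕ → H) (m : ℕ) : Xo s (m + 1) m = (s m)⁻¹ := by simp [Xo]

theorem Xo_succ (s : ℕ → H) {n i : ℕ} (hi : i + 1 < n) :
    Xo s n i = s i * Xo s n (i + 1) * (s i)⁻¹ := by
  rw [Xo, Xo, show n - 1 - i = n - 1 - (i + 1) + 1 by omega, pr_succ_left]; group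

theorem IsArtB.commute_Xo_of_lt {n : ℕ} {s : ℕ → H} (h : IsArtB n s) {k j : ℕ} (hkj : k + 1 < j)
    (hj : j < n) : Commute (s k) (Xo s n j) := by
  have h1 : Commute (s k) (pr s j (n - 1 - j)) :=
    (commute_pr fun i hi hi' => (h.comm k i (by omega) (by omega)).symm).symm
  exact (h1.mul_right (h.comm k (n - 1) (by omega) (by omega)).inv_right).mul_right h1.inv_right

theorem IsArtB.commute_Xo_of_gt {n : ℕ} {s : ℕ → H} (h : IsArtB n s) {k j : ℕ} (hkj : j < k)
    (hk : k + 1 < n) : Commute (s k) (Xo s n j) := by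
  obtain ⟨l, rfl⟩ : ∃ l, k = l + 1 := ⟨k - 1, by omega⟩
  have h1 := h.isBr.pr_mul (a := j) (k := n - 1 - j) (i := l) (by omega) (by omega) (by omega)
  have h2 := h.comm l (n - 1) (by omega) (by omega)
  have h3 : s (l + 1) = pr s j (n - 1 - j) * s l * (pr s j (n - 1 - j))⁻¹ := by rw [h1]; group
  rw [h3, Xo]
  exact ((h2.inv_right).map (MulAut.conj (pr s j (n - 1 - j))))

theorem four_aux {a d : H} (h : a * d * a * d = d * a * d * a) :
    d * (a * d⁻¹ * a⁻¹) * d⁻¹ = a⁻¹ * d⁻¹ * a :=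
  eq_of_conj h.symm (d * a)⁻¹ (by group)

theorem four_aux' {a d : H} (h : a * d * a * d = d * a * d * a) :
    d * a⁻¹ ^ 2 * d⁻¹ = a⁻¹ * d⁻¹ * a⁻¹ ^ 2 * d * a := by
  have h1 : Commute (d * a * d) a := by
    rw [Commute, SemiconjBy, ← h]; group
  exact eq_of_conj (h1.inv_right.pow_right 2).eq (d * a)⁻¹ (by group)

theorem IsArtB.Xo_key {n : ℕ} {s : ℕ → H} (h : IsArtB n s) {k : ℕ} (hk : k + 1 < n) :
    s k * Xo s n k * (s k)⁻¹ = Xo s n k * Xo s n (k + 1) * (Xo s n k)⁻¹ := by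
  obtain ⟨d, hd⟩ : ∃ d, n = k + 2 + d := ⟨n - (k + 2), by omega⟩
  induction d generalizing k with
  | zero =>
    obtain rfl : n = k + 2 := hd
    rw [Xo_succ s (i := k) (by omega), Xo_last]
    have h4 := h.four k rfl
    set a := s k
    set d := s (k + 1)
    have h5 : a * d⁻¹ * a⁻¹ = d⁻¹ * a⁻¹ * d⁻¹ * a * d := by
      have : d * a * d * (a * d⁻¹ * a⁻¹) = d * a * d * (d⁻¹ * a⁻¹ * d⁻¹ * a * d) := by
        calc d * a * d * (a * d⁻¹ * a⁻¹) = (d * a * d * a) * d⁻¹ * a⁻¹ := by group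
          _ = _ := by rw [← h4]; group
      exact mul_left_cancel this
    calc a * (a * d⁻¹ * a⁻¹) * a⁻¹ = a * (d⁻¹ * a⁻¹ * d⁻¹ * a * d) * a⁻¹ := by rw [h5]
      _ = _ := by group
  | succ d ih =>
    have h1 := ih (k := k + 1) (by omega) (by omega)
    have e1 : MulAut.conj (s (k + 1) * s k) (s (k + 1)) = s k := by
      rw [MulAut.conj_apply, ← h.braid k (by omega)]; group
    have e2 : MulAut.conj (s (k + 1) * s k) (Xo s n (k + 2)) = Xo s n (k + 1) := by
      have := h.commute_Xo_of_lt (k := k) (j := k + 2) (by omega) (by omega)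
      rw [map_mul, MulAut.mul_apply, MulAut.conj_apply (s k), this.eq, mul_inv_cancel_right,
        Xo_succ s (i := k + 1) (by omega), MulAut.conj_apply]
    have e3 : MulAut.conj (s (k + 1) * s k) (Xo s n (k + 1)) = Xo s n k := by
      have := h.commute_Xo_of_gt (k := k + 1) (j := k) (by omega) (by omega)
      rw [map_mul, MulAut.mul_apply, MulAut.conj_apply (s k), ← Xo_succ s (i := k) (by omega),
        MulAut.conj_apply, this.eq, mul_inv_cancel_right]
    have h2 := conj_key (MulAut.conj (s (k + 1) * s k)) h1
    rw [e1, e2, e3] at h2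
    exact h2

/-- The squares of the standard band generators. -/
def bB (s : ℕ → H) (i : ℕ) : H := (pr s 1 i)⁻¹ * (s 0)⁻¹ ^ 2 * pr s 1 i

theorem bB_succ (s : ℕ → H) (i : ℕ) : bB s (i + 1) = (s (i + 1))⁻¹ * bB s i * s (i + 1) := by
  rw [bB, bB, pr_succ, add_comm 1 i]; group

theorem IsBr.bB_eq {n : ℕ} {s : ℕ → H} (h : IsBr n s) {i : ℕ} (hi : i < n) :
    bB s i = pr s 0 i * (s i)⁻¹ ^ 2 * (pr s 0 i)⁻¹ := by
  have h1 := h.flip (a := 0) (k := i) (by omega)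
  rw [zero_add, zero_add] at h1
  rw [bB]
  calc _ = ((pr s 1 i)⁻¹ * s 0 * pr s 1 i)⁻¹ ^ 2 := by
        simp only [pow_two]; group
    _ = _ := by rw [h1]; simp only [pow_two]; group

theorem IsBr.commute_bB_of_lt {n : ℕ} {s : ℕ → H} (h : IsBr n s) {k j : ℕ} (hjk : j + 1 < k)
    (hk : k < n) : Commute (s k) (bB s j) := by
  have h1 : Commute (s k) (pr s 1 j) :=
    (commute_pr fun i hi hi' => (h.comm i k (by omega) (by omega))).symm
  exact (h1.inv_right.mul_right (((h.comm 0 k (by omega) hk).symm).inv_right.pow_right 2)).mul_right h1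

theorem IsBr.commute_bB_of_gt {n : ℕ} {s : ℕ → H} (h : IsBr n s) {k j : ℕ} (hk : 0 < k)
    (hkj : k < j) (hj : j < n) : Commute (s k) (bB s j) := by
  have h1 := h.pr_mul (a := 1) (k := j) (i := k) (by omega) (by omega) (by omega)
  have h2 := (h.comm 0 (k + 1) (by omega) (by omega)).symm
  have h3 : s k = MulAut.conj (pr s 1 j)⁻¹ (s (k + 1)) := by
    rw [MulAut.conj_apply, mul_assoc, inv_inv, ← h1]; group
  have h4 : bB s j = MulAut.conj (pr s 1 j)⁻¹ ((s 0)⁻¹ ^ 2) := by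
    rw [MulAut.conj_apply, bB, inv_inv]
  rw [h3, h4]
  exact (h2.inv_right.pow_right 2).map _

theorem IsBr.bB_key {n : ℕ} {s : ℕ → H} (h : IsBr n s) {k : ℕ} (hk : k + 1 < n) :
    s (k + 1) * bB s k * (s (k + 1))⁻¹ = bB s k * bB s (k + 1) * (bB s k)⁻¹ := by
  induction k with
  | zero =>
    rw [bB_succ, bB, zero_add, pr_zero]
    have h1 := h.braid 0 hk
    rw [zero_add] at h1
    set a := s 0
    set b := s 1
    have h2 : a * (b * a ^ 2 * b) = b * a ^ 2 * b * a := by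
      calc a * (b * a ^ 2 * b) = (a * b * a) * a * b := by simp only [pow_two, mul_assoc]
        _ = b * a * (b * a * b) := by rw [h1]; simp only [mul_assoc]
        _ = _ := by rw [← h1]; simp only [pow_two, mul_assoc]
    have h3 : Commute a (b * a ^ 2 * b) := h2
    simp only [inv_one, one_mul, mul_one]
    exact eq_of_conj (h3.pow_left 2).eq (a ^ 2 * b * a ^ 2)⁻¹ (by group)
  | succ k ih =>
    have h1 := ih (by omega)
    set g := (s (k + 2) * s (k + 1))⁻¹ with hg
    have e1 : MulAut.conj g (s (k + 1)) = s (k + 2) := by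
      rw [MulAut.conj_apply, hg, inv_inv]
      calc _ = (s (k + 2) * s (k + 1))⁻¹ * (s (k + 1) * s (k + 2) * s (k + 1)) := by group
        _ = _ := by rw [h.braid (k + 1) (by omega)]; group
    have e2 : MulAut.conj g (bB s k) = bB s (k + 1) := by
      have := (h.commute_bB_of_lt (k := k + 2) (j := k) (by omega) (by omega)).inv_left
      rw [hg, mul_inv_rev, map_mul, MulAut.mul_apply, MulAut.conj_apply (s (k + 2))⁻¹, this.eq,
        mul_inv_cancel_right, bB_succ, MulAut.conj_apply, inv_inv]
    have e3 : MulAut.conj g (bB s (k + 1)) = bB s (k + 2) := by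
      have := (h.commute_bB_of_gt (k := k + 1) (j := k + 2) (by omega) (by omega)
        (by omega)).inv_left
      rw [hg, mul_inv_rev, map_mul, MulAut.mul_apply, MulAut.conj_apply (s (k + 2))⁻¹, inv_inv,
        ← bB_succ, MulAut.conj_apply, this.eq, mul_inv_cancel_right]
    have h2 := conj_key (MulAut.conj g) h1
    rw [e1, e2, e3] at h2
    exact h2

end BraidIdentities

end ArtinAut

namespace ArtinAut

section Representations

theorem freeAut_ext {α : Type*} {f g : MulAut (FreeGroup α)}
    (h : ∀ a, f (FreeGroup.of a) = g (FreeGroup.of a)) : f = g := by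
  have : f.toMonoidHom = g.toMonoidHom := FreeGroup.ext_hom _ _ h
  ext1 x
  exact DFunLike.congr_fun this x

theorem aut_mul_conj {G : Type*} [Group G] (f : MulAut G) (y : G) :
    f * MulAut.conj y = MulAut.conj (f y) * f := by
  ext x
  simp

/-- The generator of the free group on `n` letters numbered `i`. -/
def xF (n i : ℕ) : FreeGroup (Fin n) := if h : i < n then FreeGroup.of ⟨i, h⟩ else 1

theorem xF_of_lt {n i : ℕ} (h : i < n) : xF n i = FreeGroup.of ⟨i, h⟩ := dif_pos h

theorem xF_fin {n : ℕ} (i : Fin n) : xF n i = FreeGroup.of i := xF_of_lt i.2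

theorem xF_hom_ext {n : ℕ} {G : Type*} [Group G] {f g : FreeGroup (Fin n) →* G}
    (h : ∀ i, i < n → f (xF n i) = g (xF n i)) : f = g :=
  FreeGroup.ext_hom _ _ fun i => by rw [← xF_fin]; exact h i i.2

theorem xF_aut_ext {n : ℕ} {f g : MulAut (FreeGroup (Fin n))}
    (h : ∀ i, i < n → f (xF n i) = g (xF n i)) : f = g :=
  freeAut_ext fun i => by rw [← xF_fin]; exact h i i.2

/-- The homomorphism out of a free group given by a sequence of elements. -/
def liftF (n : ℕ) {G : Type*} [Group G] (f : ℕ → G) : FreeGroup (Fin n) →* G :=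
  FreeGroup.lift fun i : Fin n => f i

theorem liftF_xF {n i : ℕ} {G : Type*} [Group G] (f : ℕ → G) (h : i < n) :
    liftF n f (xF n i) = f i := by simp [liftF, xF_of_lt h]

/-- The image of the letter `j` under the standard braid automorphism `i`. -/
def brFun (n i j : ℕ) : FreeGroup (Fin n) :=
  if j = i then xF n i * xF n (i + 1) * (xF n i)⁻¹ else if j = i + 1 then xF n i else xF n j

/-- The image of the letter `j` under the inverse of the braid automorphism `i`. -/
def brInv (n i j : ℕ) : FreeGroup (Fin n) :=
  if j = i then xF n (i + 1) else
    if j = i + 1 then (xF n (i + 1))⁻¹ * xF n i * xF n (i + 1) else xF n j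

theorem exists_brAut (n i : ℕ) (hi : i + 1 < n) : ∃ f : MulAut (FreeGroup (Fin n)),
    ∀ j, j < n → f (xF n j) = brFun n i j := by
  refine ⟨MonoidHom.toMulEquiv (liftF n (brFun n i)) (liftF n (brInv n i)) ?_ ?_, ?_⟩
  · apply xF_hom_ext
    intro j hj
    simp only [MonoidHom.comp_apply, liftF_xF _ hj, MonoidHom.id_apply]
    by_cases h1 : j = i
    · subst h1
      simp [brFun, liftF_xF, hi, hj, brInv, mul_assoc]
    · by_cases h2 : j = i + 1
      · subst h2
        simp [brFun, liftF_xF, show i < n by omega, brInv]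
      · simp [brFun, liftF_xF, hj, brInv, h1, h2]
  · apply xF_hom_ext
    intro j hj
    simp only [MonoidHom.comp_apply, liftF_xF _ hj, MonoidHom.id_apply]
    by_cases h1 : j = i
    · subst h1
      simp [brFun, liftF_xF, hi, brInv]
    · by_cases h2 : j = i + 1
      · subst h2
        simp [brFun, liftF_xF, show i < n by omega, hi, brInv, mul_assoc]
      · simp [brFun, liftF_xF, hj, brInv, h1, h2]
  · intro j hj
    exact liftF_xF _ hj

/-- The standard braid automorphism `x i ↦ x i * x (i + 1) * (x i)⁻¹`, `x (i + 1) ↦ x i`. -/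
noncomputable def brAut (n i : ℕ) : MulAut (FreeGroup (Fin n)) :=
  if h : i + 1 < n then (exists_brAut n i h).choose else 1

variable {n : ℕ}

theorem brAut_apply {i j : ℕ} (hi : i + 1 < n) (hj : j < n) :
    brAut n i (xF n j) = brFun n i j := by
  rw [brAut, dif_pos hi]; exact (exists_brAut n i hi).choose_spec j hj

theorem brAut_self {i : ℕ} (hi : i + 1 < n) :
    brAut n i (xF n i) = xF n i * xF n (i + 1) * (xF n i)⁻¹ := by
  rw [brAut_apply hi (by omega), brFun, if_pos rfl]

theorem brAut_succ {i : ℕ} (hi : i + 1 < n) : brAut n i (xF n (i + 1)) = xF n i := by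
  rw [brAut_apply hi (by omega), brFun, if_neg (by omega), if_pos rfl]

theorem brAut_other {i j : ℕ} (hi : i + 1 < n) (h1 : j ≠ i) (h2 : j ≠ i + 1) :
    brAut n i (xF n j) = xF n j := by
  by_cases hj : j < n
  · rw [brAut_apply hi hj, brFun, if_neg h1, if_neg h2]
  · rw [xF, dif_neg hj, map_one]

theorem brAut_mul {i : ℕ} (hi : i + 1 < n) :
    brAut n i (xF n i * xF n (i + 1)) = xF n i * xF n (i + 1) := by
  rw [map_mul, brAut_self hi, brAut_succ hi]; group

theorem isBr_brAut (n : ℕ) : IsBr (n - 1) (brAut n) := by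
  refine ⟨fun i hi => ?_, fun i j hij hj => ?_⟩
  · apply xF_aut_ext
    intro k hk
    have h1 : i + 1 < n := by omega
    have h2 : i + 1 + 1 < n := by omega
    simp only [MulAut.mul_apply]
    by_cases e1 : k = i
    · subst e1
      rw [brAut_other h2 (j := k) (by omega) (by omega)]
      simp only [brAut_self h1, map_mul, map_inv, brAut_succ h1, brAut_self h2,
        brAut_other h2 (j := k) (by omega) (by omega),
        brAut_other h1 (j := k + 1 + 1) (by omega) (by omega)]
      group
    · by_cases e2 : k = i + 1
      · subst e2
        simp only [brAut_self h1, brAut_succ h1, map_mul, map_inv, brAut_self h2, brAut_succ h2,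
          brAut_other h2 (j := i) (by omega) (by omega),
          brAut_other h1 (j := i + 1 + 1) (by omega) (by omega)]
      · by_cases e3 : k = i + 1 + 1
        · subst e3
          simp only [brAut_succ h1, brAut_succ h2,
            brAut_other h2 (j := i) (by omega) (by omega),
            brAut_other h1 (j := i + 1 + 1) (by omega) (by omega)]
        · simp only [brAut_other h1 e1 e2, brAut_other h2 e2 e3]
  · apply xF_aut_ext
    intro k hk
    have h1 : i + 1 < n := by omega
    have h2 : j + 1 < n := by omega
    have aux : ∀ {i j : ℕ}, i + 1 < n → j + 1 < n → (k = i ∨ k = i + 1) →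
        i ≠ j → i + 1 ≠ j → i ≠ j + 1 →
        brAut n i (brAut n j (xF n k)) = brAut n j (brAut n i (xF n k)) := by
      intro i j h1 h2 hk a b c
      rw [brAut_other h2 (j := k) (by omega) (by omega)]
      rcases hk with rfl | rfl
      · simp only [brAut_self h1, map_mul, map_inv, brAut_other h2 (j := k) (by omega) (by omega),
          brAut_other h2 (j := k + 1) (by omega) (by omega)]
      · simp only [brAut_succ h1, brAut_other h2 (j := i) (by omega) (by omega)]
    simp only [MulAut.mul_apply]
    by_cases e1 : k = i ∨ k = i + 1
    · exact aux h1 h2 e1 (by omega) (by omega) (by omega)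
    · by_cases e2 : k = j ∨ k = j + 1
      · exact (aux h2 h1 e2 (by omega) (by omega) (by omega)).symm
      · simp only [brAut_other h1 (j := k) (by omega) (by omega),
          brAut_other h2 (j := k) (by omega) (by omega)]

/-- The automorphisms attached to the type `B` generators by the action on the
first free normal subgroup. -/
noncomputable def phiSeq (n i : ℕ) : MulAut (FreeGroup (Fin n)) :=
  if i + 1 < n then brAut n i else MulAut.conj (xF n i)⁻¹

theorem isArtB_phiSeq (n : ℕ) : IsArtB n (phiSeq n) := by
  have hb := isBr_brAut n
  refine ⟨fun i hi => ?_, fun i hi => ?_, fun i j hij hj => ?_⟩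
  · rw [phiSeq, if_pos (by omega), phiSeq, if_pos (by omega)]
    exact hb.braid i (by omega)
  · have h1 : i + 1 < n := by omega
    rw [phiSeq, if_pos (by omega), phiSeq, if_neg (by omega)]
    set A := brAut n i
    have e1 : A * MulAut.conj (xF n (i + 1))⁻¹ * A * MulAut.conj (xF n (i + 1))⁻¹ =
        MulAut.conj (A (xF n (i + 1)))⁻¹ * MulAut.conj (A (A (xF n (i + 1))))⁻¹ * A * A := by
      calc A * MulAut.conj (xF n (i + 1))⁻¹ * A * MulAut.conj (xF n (i + 1))⁻¹ 
          = (A * MulAut.conj (xF n (i + 1))⁻¹) * (A * MulAut.conj (xF n (i + 1))⁻¹) := by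
            simp only [mul_assoc]
        _ = MulAut.conj (A (xF n (i + 1))⁻¹) * (A * MulAut.conj (A (xF n (i + 1))⁻¹)) * A := by
            rw [aut_mul_conj A (xF n (i + 1))⁻¹]; simp only [mul_assoc]
        _ = _ := by rw [aut_mul_conj]; simp only [map_inv, mul_assoc]
    have e2 : MulAut.conj (xF n (i + 1))⁻¹ * A * MulAut.conj (xF n (i + 1))⁻¹ * A =
        MulAut.conj (xF n (i + 1))⁻¹ * MulAut.conj (A (xF n (i + 1)))⁻¹ * A * A := by
      rw [mul_assoc _ A, aut_mul_conj]
      simp only [map_inv, mul_assoc]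
    rw [e1, e2]
    congr 2
    rw [← map_mul, ← map_mul, brAut_succ h1, brAut_self h1]
    congr 1
    group
  · rw [phiSeq, if_pos (by omega), phiSeq]
    split_ifs with h
    · exact hb.comm i j hij (by omega)
    · rw [Commute, SemiconjBy, aut_mul_conj, map_inv, brAut_other (by omega) (by omega) (by omega)]

/-- The action of `ArtinB n` on its first free normal subgroup. -/
noncomputable def Φ (n : ℕ) : ArtinB n →* MulAut (FreeGroup (Fin n)) := liftB (isArtB_phiSeq n)

theorem Φ_sB {i : ℕ} (hi : i + 1 < n) : Φ n (sB n i) = brAut n i := by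
  rw [Φ, liftB_sB _ (by omega), phiSeq, if_pos hi]

theorem Φ_sB_last (m : ℕ) : Φ (m + 1) (sB (m + 1) m) = MulAut.conj (xF (m + 1) m)⁻¹ := by
  rw [Φ, liftB_sB _ (by omega), phiSeq, if_neg (by omega)]

/-- The embedding of the first free normal subgroup. -/
noncomputable def ιo (n : ℕ) : FreeGroup (Fin n) →* ArtinB n := liftF n (Xo (sB n) n)

theorem ιo_xF {i : ℕ} (hi : i < n) : ιo n (xF n i) = Xo (sB n) n i := liftF_xF _ hi

theorem equivariant_of_sB {m k : ℕ} {G : Type*} [Group G] (Ψ : ArtinB m →* MulAut (FreeGroup (Fin k)))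
    (j : ArtinB m →* G) (ι : FreeGroup (Fin k) →* G)
    (h : ∀ i, i < m → ∀ a, a < k →
      j (sB m i) * ι (xF k a) * (j (sB m i))⁻¹ = ι (Ψ (sB m i) (xF k a))) (g : ArtinB m)
    (y : FreeGroup (Fin k)) : j g * ι y * (j g)⁻¹ = ι (Ψ g y) := by
  have h' : ∀ i, i < m → ∀ y, j (sB m i) * ι y * (j (sB m i))⁻¹ = ι (Ψ (sB m i) y) := by
    intro i hi y
    have : (MulAut.conj (j (sB m i))).toMonoidHom.comp ι =
        ι.comp (Ψ (sB m i)).toMonoidHom := xF_hom_ext fun a ha => h i hi a ha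
    exact DFunLike.congr_fun this y
  induction g using sB_induction generalizing y with
  | h1 => simp
  | hs i g hi ih =>
    rw [map_mul, map_mul, MulAut.mul_apply, ← ih, ← h' i hi]; group
  | hi i g hi ih =>
    have h2 := h' i hi ((Ψ (sB m i))⁻¹ y)
    rw [MulAut.apply_inv_self] at h2
    rw [map_mul, map_mul, map_inv, map_inv, MulAut.mul_apply, ← ih, ← h2]; group

theorem ιo_equivariant (g : ArtinB n) (y : FreeGroup (Fin n)) :
    g * ιo n y * g⁻¹ = ιo n (Φ n g y) := by
  refine equivariant_of_sB (Φ n) (MonoidHom.id _) (ιo n) (fun i hi a ha => ?_) g y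
  have hB := isArtB_sB n
  rw [MonoidHom.id_apply, ιo_xF ha]
  by_cases h1 : i + 1 < n
  · rw [Φ_sB h1]
    by_cases e1 : a = i
    · subst e1
      rw [brAut_self h1, map_mul, map_mul, map_inv, ιo_xF ha, ιo_xF h1, hB.Xo_key h1]
    · by_cases e2 : a = i + 1
      · subst e2
        rw [brAut_succ h1, ιo_xF hi, Xo_succ _ h1]
      · rw [brAut_other h1 e1 e2, ιo_xF ha]
        have : Commute (sB n i) (Xo (sB n) n a) := by
          by_cases h : a < i
          · exact hB.commute_Xo_of_gt h h1
          · exact hB.commute_Xo_of_lt (by omega) ha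
        rw [this.eq, mul_inv_cancel_right]
  · obtain ⟨m, rfl⟩ : ∃ m, n = m + 1 := ⟨n - 1, by omega⟩
    obtain rfl : i = m := by omega
    rw [Φ_sB_last, MulAut.conj_apply, map_mul, map_mul, inv_inv, map_inv, ιo_xF hi, ιo_xF ha,
      Xo_last, inv_inv]

theorem Φ_ιo (y : FreeGroup (Fin n)) : Φ n (ιo n y) = MulAut.conj y := by
  have h : (Φ n).comp (ιo n) = MulAut.conj := by
    apply xF_hom_ext
    intro i hi
    obtain ⟨m, rfl⟩ : ∃ m, n = m + 1 := ⟨n - 1, by omega⟩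
    obtain ⟨d, hd⟩ : ∃ d, m = i + d := ⟨m - i, by omega⟩
    rw [MonoidHom.comp_apply, ιo_xF hi]
    induction d generalizing i with
    | zero =>
      obtain rfl : m = i := hd
      rw [Xo_last, map_inv, Φ_sB_last, map_inv, inv_inv]
    | succ d ih =>
      rw [Xo_succ _ (by omega), map_mul, map_mul, map_inv, ih (i + 1) (by omega) (by omega),
        aut_mul_conj, Φ_sB (by omega), brAut_succ (by omega), mul_inv_cancel_right]
  exact DFunLike.congr_fun h y

end Representations

end ArtinAut

namespace ArtinAut

section Permutations

theorem isConj_map {G : Type*} [Group G] (f : MulAut G) {a b : G} (h : IsConj a b) :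
    IsConj (f a) (f b) := f.toMonoidHom.map_isConj h


variable {n : ℕ}

/-- The transposition exchanging `i` and `i + 1`. -/
def swp (n i : ℕ) : Equiv.Perm (Fin n) :=
  if h : i + 1 < n then Equiv.swap ⟨i, by omega⟩ ⟨i + 1, h⟩ else 1

theorem swp_val (i : ℕ) (h : i + 1 < n) (j : Fin n) :
    (swp n i j : ℕ) = if (j : ℕ) = i then i + 1 else if (j : ℕ) = i + 1 then i else j := by
  rw [swp, dif_pos h, Equiv.swap_apply_def]
  simp only [Fin.ext_iff]
  split_ifs <;> simp

theorem swp_of_le (i : ℕ) (h : n ≤ i + 1) : swp n i = 1 := dif_neg (by omega)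

theorem isArtB_swp (n : ℕ) : IsArtB n (swp n) := by
  refine ⟨fun i hi => ?_, fun i hi => ?_, fun i j hij hj => ?_⟩
  · ext k
    simp only [Equiv.Perm.mul_apply, swp_val i (show i + 1 < n by omega),
      swp_val (i + 1) (show i + 1 + 1 < n by omega)]
    grind
  · rw [swp_of_le (i + 1) (by omega)]; simp
  · by_cases h : j + 1 < n
    · ext k
      simp only [Equiv.Perm.mul_apply, swp_val i (show i + 1 < n by omega), swp_val j h]
      grind
    · rw [swp_of_le j (by omega)]; exact Commute.one_right _

/-- The permutation of the strands. -/
noncomputable def pB (n : ℕ) : ArtinB n →* Equiv.Perm (Fin n) := liftB (isArtB_swp n)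

theorem pB_sB {i : ℕ} (hi : i < n) : pB n (sB n i) = swp n i := liftB_sB _ hi

theorem isConj_Φ_of (g : ArtinB n) (i : Fin n) :
    IsConj (Φ n g (FreeGroup.of i)) (FreeGroup.of (pB n g i)) := by
  have key : ∀ k, k < n → ∀ i : Fin n,
      IsConj (Φ n (sB n k) (FreeGroup.of i)) (FreeGroup.of (pB n (sB n k) i)) := by
    intro k hk i
    rw [pB_sB hk, ← xF_fin, ← xF_fin]
    by_cases h : k + 1 < n
    · rw [swp_val k h, Φ_sB h]
      split_ifs with h1 h2
      · rw [h1, brAut_self h]; exact (isConj_iff.2 ⟨_, rfl⟩).symm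
      · rw [h2, brAut_succ h]
      · rw [brAut_other h h1 h2]
    · obtain ⟨m, rfl⟩ : ∃ m, n = m + 1 := ⟨n - 1, by omega⟩
      obtain rfl : k = m := by omega
      rw [swp_of_le k (by omega), Φ_sB_last]
      exact (isConj_iff.2 ⟨_, rfl⟩).symm
  induction g using sB_induction generalizing i with
  | h1 => simp only [map_one]; exact IsConj.refl _
  | hs k g hk ih =>
    rw [map_mul, map_mul, MulAut.mul_apply, Equiv.Perm.mul_apply]
    exact (isConj_map _ (key k hk i)).trans (ih _)
  | hi k g hk ih =>
    have h := key k hk ((pB n (sB n k))⁻¹ i)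
    have e : pB n (sB n k) ((pB n (sB n k))⁻¹ i) = i := by simp
    rw [e] at h
    have h2 := isConj_map (Φ n (sB n k))⁻¹ h
    rw [MulAut.inv_apply_self] at h2
    rw [map_mul, map_mul, map_inv, map_inv, MulAut.mul_apply, Equiv.Perm.mul_apply]
    exact (isConj_map _ h2.symm).trans (ih _)

/-- The product of all letters. -/
def PiF (n : ℕ) : FreeGroup (Fin n) := pr (xF n) 0 n

theorem brAut_PiF {i : ℕ} (hi : i + 1 < n) : brAut n i (PiF n) = PiF n := by
  obtain ⟨d, hd⟩ : ∃ d, n = i + (2 + d) := ⟨n - i - 2, by omega⟩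
  have e : PiF n = pr (xF n) 0 i * ((xF n i * xF n (i + 1)) * pr (xF n) (i + 2) d) := by
    have : PiF n = pr (xF n) 0 (i + (2 + d)) := by rw [PiF]; congr 1
    rw [this, pr_add, pr_add]
    simp [pr_succ]
  have fx : ∀ a l, (∀ j, a ≤ j → j < a + l → j ≠ i ∧ j ≠ i + 1) →
      brAut n i (pr (xF n) a l) = pr (xF n) a l := by
    intro a l h
    have := map_pr (brAut n i).toMonoidHom (xF n) a l
    refine this.trans (pr_congr fun j h1 h2 => ?_)
    exact brAut_other hi (h j h1 h2).1 (h j h1 h2).2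
  rw [e, map_mul, map_mul, brAut_mul hi, fx _ _ (by omega), fx _ _ (by omega)]

theorem isConj_Φ_PiF (g : ArtinB n) : IsConj (Φ n g (PiF n)) (PiF n) := by
  have key : ∀ k, k < n → IsConj (Φ n (sB n k) (PiF n)) (PiF n) := by
    intro k hk
    by_cases h : k + 1 < n
    · rw [Φ_sB h, brAut_PiF h]
    · obtain ⟨m, rfl⟩ : ∃ m, n = m + 1 := ⟨n - 1, by omega⟩
      obtain rfl : k = m := by omega
      rw [Φ_sB_last]
      exact (isConj_iff.2 ⟨_, rfl⟩).symm
  induction g using sB_induction with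
  | h1 => rw [map_one]; exact IsConj.refl _
  | hs k g hk ih =>
    rw [map_mul, MulAut.mul_apply]
    exact (isConj_map _ (key k hk)).trans ih
  | hi k g hk ih =>
    have h2 := isConj_map (Φ n (sB n k))⁻¹ (key k hk)
    rw [MulAut.inv_apply_self] at h2
    rw [map_mul, map_inv, MulAut.mul_apply]
    exact (isConj_map _ h2.symm).trans ih

theorem pB_ιo (y : FreeGroup (Fin n)) : pB n (ιo n y) = 1 := by
  have : (pB n).comp (ιo n) = 1 := by
    apply xF_hom_ext
    intro i hi
    rw [MonoidHom.comp_apply, ιo_xF hi, Xo, map_mul, map_mul, map_inv, map_inv,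
      pB_sB (show n - 1 < n by omega), swp_of_le _ (by omega)]
    simp
  exact DFunLike.congr_fun this y

theorem pB_surjective (n : ℕ) : Function.Surjective (pB n) := by
  obtain _ | m := n
  · intro x; exact ⟨1, Subsingleton.elim _ _⟩
  rw [← MonoidHom.range_eq_top, eq_top_iff]
  intro x _
  have hx : x ∈ Submonoid.closure (Set.range fun i : Fin m => Equiv.swap i.castSucc i.succ) := by
    rw [Equiv.Perm.mclosure_swap_castSucc_succ]; trivial
  induction hx using Submonoid.closure_induction with
  | mem x hx =>
    obtain ⟨i, rfl⟩ := hx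
    refine ⟨sB (m + 1) i, ?_⟩
    rw [pB_sB (by omega), swp, dif_pos (by omega)]
    rfl
  | one => exact Subgroup.one_mem _
  | mul x y _ _ hx hy => exact Subgroup.mul_mem _ (hx trivial) (hy trivial)

end Permutations

section Shift

theorem IsBr.isArtB_sq {H : Type*} [Group H] {m : ℕ} {s : ℕ → H} (h : IsBr m s) :
    IsArtB m (fun i => if i + 1 < m then s i else s i ^ 2) := by
  refine ⟨fun i hi => ?_, fun i hi => ?_, fun i j hij hj => ?_⟩
  · beta_reduce
    rw [if_pos (by omega), if_pos (by omega)]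
    exact h.braid i (by omega)
  · beta_reduce
    rw [if_pos (by omega), if_neg (by omega)]
    have h1 := h.braid i (by omega)
    set a := s i
    set b := s (i + 1)
    have h2 : Commute b (a * b ^ 2 * a) := by
      calc b * (a * b ^ 2 * a) = (b * a * b) * b * a := by simp only [pow_two, mul_assoc]
        _ = a * b * (a * b * a) := by rw [← h1]; simp only [mul_assoc]
        _ = _ := by rw [h1]; simp only [pow_two, mul_assoc]
    have h3 := (h2.pow_left 2).eq
    calc _ = a * b ^ 2 * a * b ^ 2 := rfl
      _ = _ := by rw [← h3]; simp only [mul_assoc]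
  · beta_reduce
    rw [if_pos (by omega)]
    split_ifs
    · exact h.comm i j hij hj
    · exact (h.comm i j hij hj).pow_right 2

/-- The embedding of `ArtinB n` in `ArtinB (n + 1)` shifting the generators. -/
noncomputable def sh (n : ℕ) : ArtinB n →* ArtinB (n + 1) := liftB (isArtB_sB (n + 1)).shift

theorem sh_sB {n i : ℕ} (hi : i < n) : sh n (sB n i) = sB (n + 1) (i + 1) := liftB_sB _ hi

/-- The action of `ArtinB m` on the second free normal subgroup of `ArtinB (m + 1)`. -/
noncomputable def Ψ (m : ℕ) : ArtinB m →* MulAut (FreeGroup (Fin (m + 1))) :=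
  liftB (isBr_brAut (m + 1)).isArtB_sq

theorem Ψ_sB {m i : ℕ} (hi : i + 1 < m) : Ψ m (sB m i) = brAut (m + 1) i := by
  rw [Ψ, liftB_sB _ (by omega), if_pos (by omega)]

theorem Ψ_sB_last (m : ℕ) : Ψ (m + 1) (sB (m + 1) m) = brAut (m + 2) m ^ 2 := by
  rw [Ψ, liftB_sB _ (by omega), if_neg (by omega)]

/-- The embedding of the second free normal subgroup. -/
noncomputable def ι1 (m : ℕ) : FreeGroup (Fin (m + 1)) →* ArtinB (m + 1) :=
  liftF (m + 1) fun i => if i < m then bB (sB (m + 1)) i else Xo (sB (m + 1)) (m + 1) 0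

theorem ι1_xF {m i : ℕ} (hi : i < m) : ι1 m (xF (m + 1) i) = bB (sB (m + 1)) i := by
  rw [ι1, liftF_xF _ (by omega), if_pos hi]

theorem ι1_xF_last (m : ℕ) : ι1 m (xF (m + 1) m) = Xo (sB (m + 1)) (m + 1) 0 := by
  rw [ι1, liftF_xF _ (by omega), if_neg (by omega)]

theorem ι1_equivariant {m : ℕ} (g : ArtinB m) (y : FreeGroup (Fin (m + 1))) :
    sh m g * ι1 m y * (sh m g)⁻¹ = ι1 m (Ψ m g y) := by
  refine equivariant_of_sB (Ψ m) (sh m) (ι1 m) (fun i hi a ha => ?_) g y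
  have hB := isArtB_sB (m + 1)
  have hb : IsBr m (sB (m + 1)) := hB.isBr
  rw [sh_sB hi]
  by_cases h1 : i + 1 < m
  · have h1' : i + 1 < m + 1 := by omega
    rw [Ψ_sB h1]
    by_cases e1 : a = i
    · subst e1
      rw [brAut_self h1', map_mul, map_mul, map_inv, ι1_xF hi, ι1_xF h1, hb.bB_key h1]
    · by_cases e2 : a = i + 1
      · subst e2
        rw [brAut_succ h1', ι1_xF hi, ι1_xF h1, bB_succ]
        group
      · rw [brAut_other h1' e1 e2]
        have : Commute (sB (m + 1) (i + 1)) (ι1 m (xF (m + 1) a)) := by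
          by_cases h : a < m
          · rw [ι1_xF h]
            by_cases h' : a < i
            · exact hb.commute_bB_of_lt (by omega) h1
            · exact hb.commute_bB_of_gt (by omega) (by omega) h
          · obtain rfl : a = m := by omega
            rw [ι1_xF_last]
            exact hB.commute_Xo_of_gt (by omega) (by omega)
        rw [this.eq, mul_inv_cancel_right]
  · obtain ⟨l, rfl⟩ : ∃ l, m = l + 1 := ⟨m - 1, by omega⟩
    obtain rfl : i = l := by omega
    have h2 : i + 1 < i + 2 := by omega
    rw [Ψ_sB_last, pow_two, MulAut.mul_apply]
    have hβ := hb.bB_eq (i := i) (by omega)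
    have hX : Xo (sB (i + 2)) (i + 2) 0 =
        pr (sB (i + 2)) 0 i * (sB (i + 2) i * (sB (i + 2) (i + 1))⁻¹ * (sB (i + 2) i)⁻¹) *
          (pr (sB (i + 2)) 0 i)⁻¹ := by
      rw [Xo, show i + 2 - 1 - 0 = i + 1 by omega, pr_succ, show i + 2 - 1 = i + 1 by omega,
        zero_add]
      group
    have hc : Commute (sB (i + 2) (i + 1)) (pr (sB (i + 2)) 0 i) :=
      (commute_pr fun j _ hj => hB.comm j (i + 1) (by omega) (by omega)).symm
    have h4 := hB.four i rfl
    set p := pr (sB (i + 2)) 0 i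
    set c := sB (i + 2) i
    set d := sB (i + 2) (i + 1)
    have hdp : ∀ x, d * (p * x * p⁻¹) * d⁻¹ = p * (d * x * d⁻¹) * p⁻¹ := by
      intro x
      calc d * (p * x * p⁻¹) * d⁻¹ = (d * p) * x * (d * p)⁻¹ := by group
        _ = _ := by rw [hc.eq]; group
    by_cases e1 : a = i
    · subst e1
      rw [brAut_self h2]
      simp only [brAut_self h2, brAut_succ h2, map_mul, map_inv, ι1_xF (show a < a + 1 by omega), ι1_xF_last]
      rw [hβ, hX, hdp, four_aux' h4]
      simp only [pow_two]
      group
    · by_cases e2 : a = i + 1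
      · subst e2
        rw [brAut_succ h2, brAut_self h2]
        simp only [map_mul, map_inv, ι1_xF (show i < i + 1 by omega), ι1_xF_last]
        rw [hβ, hX, hdp, four_aux h4]
        simp only [pow_two]
        group
      · rw [brAut_other h2 e1 e2, brAut_other h2 e1 e2, ι1_xF (by omega)]
        have h5 : Commute d (bB (sB (i + 2)) a) := by
          have h1 : Commute d (pr (sB (i + 2)) 1 a) :=
            (commute_pr fun j _ hj => hB.comm j (i + 1) (by omega) (by omega)).symm
          exact (h1.inv_right.mul_right
            (((hB.comm 0 (i + 1) (by omega) (by omega)).symm).inv_right.pow_right 2)).mul_right h1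
        rw [h5.eq, mul_inv_cancel_right]

end Shift

end ArtinAut

namespace ArtinAut

section Generation

/-- The subgroup generated by the second free normal subgroup and the shifted subgroup. -/
noncomputable def stab0 (m : ℕ) : Subgroup (ArtinB (m + 1)) where
  carrier := {g | ∃ y h, g = ι1 m y * sh m h}
  one_mem' := ⟨1, 1, by simp⟩
  mul_mem' := by
    rintro _ _ ⟨y, h, rfl⟩ ⟨y', h', rfl⟩
    refine ⟨y * Ψ m h y', h * h', ?_⟩
    rw [map_mul, map_mul, ← ι1_equivariant]; group
  inv_mem' := by
    rintro _ ⟨y, h, rfl⟩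
    refine ⟨Ψ m h⁻¹ y⁻¹, h⁻¹, ?_⟩
    rw [← ι1_equivariant, map_inv, map_inv]; group

theorem mem_stab0 {m : ℕ} {g : ArtinB (m + 1)} : g ∈ stab0 m ↔ ∃ y h, g = ι1 m y * sh m h :=
  Iff.rfl

theorem ι1_mem_stab0 {m : ℕ} (y : FreeGroup (Fin (m + 1))) : ι1 m y ∈ stab0 m :=
  ⟨y, 1, by simp⟩

theorem sh_mem_stab0 {m : ℕ} (h : ArtinB m) : sh m h ∈ stab0 m := ⟨1, h, by simp⟩

theorem exists_coset (m : ℕ) (g : ArtinB (m + 1)) :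
    ∃ a ∈ stab0 m, ∃ k, k ≤ m ∧ g = a * pr (sB (m + 1)) 0 k := by
  have hB := isArtB_sB (m + 1)
  have hb : IsBr m (sB (m + 1)) := hB.isBr
  set s := sB (m + 1)
  have hs : ∀ j, 0 < j → j ≤ m → s j ∈ stab0 m := by
    intro j h0 hj
    have := sh_mem_stab0 (sB m (j - 1))
    rwa [sh_sB (by omega), Nat.sub_add_cancel h0] at this
  have hβ : ∀ j, j < m → bB s j ∈ stab0 m := fun j hj => by
    have := ι1_mem_stab0 (xF (m + 1) j)
    rwa [ι1_xF hj] at this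
  have hX : Xo s (m + 1) 0 ∈ stab0 m := by
    have := ι1_mem_stab0 (xF (m + 1) m)
    rwa [ι1_xF_last] at this
  have hX' : Xo s (m + 1) 0 = pr s 0 m * (s m)⁻¹ * (pr s 0 m)⁻¹ := rfl
  have step : ∀ j k, j ≤ m → k ≤ m →
      (∃ a ∈ stab0 m, ∃ l, l ≤ m ∧ pr s 0 k * s j = a * pr s 0 l) ∧
      (∃ a ∈ stab0 m, ∃ l, l ≤ m ∧ pr s 0 k * (s j)⁻¹ = a * pr s 0 l) := by
    intro j k hj hk
    rcases lt_trichotomy j k with h | h | h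
    · by_cases h' : j + 1 < k
      · have e := hb.pr_mul (a := 0) (k := k) (i := j) (by omega) (by omega) (by omega)
        exact ⟨⟨s (j + 1), hs _ (by omega) (by omega), k, hk, e⟩,
          ⟨(s (j + 1))⁻¹, (stab0 m).inv_mem (hs _ (by omega) (by omega)), k, hk, by
            rw [mul_inv_eq_iff_eq_mul, mul_assoc, e]; group⟩⟩
      · obtain rfl : k = j + 1 := by omega
        have e := hb.bB_eq (i := j) (by omega)
        refine ⟨⟨(bB s j)⁻¹, (stab0 m).inv_mem (hβ j (by omega)), j, hj, ?_⟩,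
          ⟨1, one_mem _, j, hj, ?_⟩⟩
        · rw [e, pr_succ, zero_add]
          simp only [pow_two, mul_assoc, mul_inv_rev, inv_inv, inv_mul_cancel, mul_one]
        · rw [pr_succ, zero_add]; group
    · subst h
      by_cases h' : j < m
      · have e := hb.bB_eq (i := j) (by omega)
        refine ⟨⟨1, one_mem _, j + 1, h', ?_⟩, ⟨bB s j, hβ j h', j + 1, h', ?_⟩⟩
        · rw [one_mul, pr_succ, zero_add]
        · rw [e, pr_succ, zero_add]; simp only [pow_two]; group
      · obtain rfl : j = m := by omega
        refine ⟨⟨(Xo s (j + 1) 0)⁻¹, (stab0 j).inv_mem hX, j, hj, ?_⟩, ⟨_, hX, j, hj, ?_⟩⟩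
        · rw [hX']; group
        · rw [hX']; group
    · have e : Commute (pr s 0 k) (s j) :=
        commute_pr fun i _ hi => hB.comm i j (by omega) (by omega)
      exact ⟨⟨s j, hs j (by omega) hj, k, hk, e.eq⟩,
        ⟨_, (stab0 m).inv_mem (hs j (by omega) hj), k, hk, e.inv_right.eq⟩⟩
  induction g using sB_induction with
  | h1 => exact ⟨1, one_mem _, 0, by omega, by simp⟩
  | hs i g hi ih =>
    obtain ⟨a, ha, k, hk, rfl⟩ := ih
    obtain ⟨b, hb, l, hl, e⟩ := (step i k (by omega) hk).1
    exact ⟨a * b, mul_mem ha hb, l, hl, by rw [mul_assoc, e, mul_assoc]⟩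
  | hi i g hi ih =>
    obtain ⟨a, ha, k, hk, rfl⟩ := ih
    obtain ⟨b, hb, l, hl, e⟩ := (step i k (by omega) hk).2
    exact ⟨a * b, mul_mem ha hb, l, hl, by rw [mul_assoc, e, mul_assoc]⟩

theorem pB_ι1 {m : ℕ} (y : FreeGroup (Fin (m + 1))) : pB (m + 1) (ι1 m y) = 1 := by
  have : (pB (m + 1)).comp (ι1 m) = 1 := by
    apply xF_hom_ext
    intro i hi
    rw [MonoidHom.comp_apply]
    by_cases h : i < m
    · rw [ι1_xF h, bB]
      have : pB (m + 1) (sB (m + 1) 0) ^ 2 = 1 := by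
        rw [pB_sB (by omega), swp, dif_pos (by omega), pow_two, Equiv.swap_mul_self]
      simp only [map_mul, map_inv, map_pow, inv_pow, this]
      simp
    · obtain rfl : i = m := by omega
      rw [ι1_xF_last, ← ιo_xF (by omega), pB_ιo]; rfl
  exact DFunLike.congr_fun this y

theorem pB_sh {m : ℕ} (h : ArtinB m) :
    pB (m + 1) (sh m h) 0 = 0 ∧ ∀ i : Fin m, pB (m + 1) (sh m h) i.succ = (pB m h i).succ := by
  have key : ∀ k, k < m → swp (m + 1) (k + 1) 0 = 0 ∧
      ∀ i : Fin m, swp (m + 1) (k + 1) i.succ = (swp m k i).succ := by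
    intro k hk
    by_cases h : k + 1 < m
    · refine ⟨?_, fun i => ?_⟩
      · ext; rw [swp_val _ (by omega)]; simp
      · ext; rw [swp_val _ (by omega), Fin.val_succ, Fin.val_succ, swp_val _ h]; split_ifs <;> omega
    · rw [swp_of_le _ (by omega), swp_of_le _ (by omega)]; simp
  induction h using sB_induction with
  | h1 => simp
  | hs k g hk ih =>
    simp only [map_mul, Equiv.Perm.mul_apply, sh_sB hk, pB_sB hk, pB_sB (Nat.succ_lt_succ hk), key k hk, ih]
    simp
  | hi k g hk ih =>
    have k1 := (key k hk).1
    have k2 : ∀ i : Fin m, (swp (m + 1) (k + 1))⁻¹ i.succ = ((swp m k)⁻¹ i).succ := by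
      intro i
      rw [Equiv.Perm.inv_eq_iff_eq, (key k hk).2]; simp
    have k3 : (swp (m + 1) (k + 1))⁻¹ 0 = 0 := by rw [Equiv.Perm.inv_eq_iff_eq, k1]
    simp only [map_mul, map_inv, Equiv.Perm.mul_apply, sh_sB hk, pB_sB hk,
      pB_sB (Nat.succ_lt_succ hk), k2, k3, ih]
    simp

theorem mem_stab0_iff {m : ℕ} {g : ArtinB (m + 1)} : g ∈ stab0 m ↔ pB (m + 1) g 0 = 0 := by
  have h1 : ∀ g ∈ stab0 m, pB (m + 1) g 0 = 0 := by
    rintro _ ⟨y, h, rfl⟩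
    rw [map_mul, pB_ι1, one_mul, (pB_sh h).1]
  refine ⟨h1 g, fun hg => ?_⟩
  obtain ⟨a, ha, k, hk, rfl⟩ := exists_coset m g
  have h2 : ∀ l (hl : l ≤ m), pB (m + 1) (pr (sB (m + 1)) 0 l) ⟨l, by omega⟩ = 0 := by
    intro l hl
    induction l with
    | zero => simp
    | succ l ih =>
      rw [pr_succ, map_mul, Equiv.Perm.mul_apply, zero_add, pB_sB (by omega)]
      have : swp (m + 1) l ⟨l + 1, by omega⟩ = ⟨l, by omega⟩ := by
        ext; rw [swp_val _ (by omega)]; simp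
      rw [this, ih (by omega)]
  have h3 := h2 k hk
  rw [map_mul, Equiv.Perm.mul_apply] at hg
  have h4 := (pB (m + 1) a).injective (hg.trans (h1 a ha).symm)
  have h5 := congrArg Fin.val ((pB (m + 1) _).injective (h3.trans h4.symm))
  obtain rfl : k = 0 := h5
  simpa using ha

end Generation

section Kernel

/-- The homomorphism killing the first letter. -/
def e0 (m : ℕ) : FreeGroup (Fin (m + 1)) →* FreeGroup (Fin m) :=
  liftF (m + 1) fun i => if i = 0 then 1 else xF m (i - 1)

theorem e0_zero (m : ℕ) : e0 m (xF (m + 1) 0) = 1 := by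
  rw [e0, liftF_xF _ (by omega), if_pos rfl]

theorem e0_succ (m i : ℕ) : e0 m (xF (m + 1) (i + 1)) = xF m i := by
  by_cases h : i < m
  · rw [e0, liftF_xF _ (by omega), if_neg (by omega), Nat.add_sub_cancel]
  · rw [xF, dif_neg (by omega), xF, dif_neg (by omega), map_one]

theorem e0_surjective (m : ℕ) : Function.Surjective (e0 m) := by
  have : (e0 m).comp (liftF m fun i => xF (m + 1) (i + 1)) = MonoidHom.id _ := by
    apply xF_hom_ext
    intro i hi
    rw [MonoidHom.comp_apply, liftF_xF _ hi, e0_succ]; rfl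
  exact fun y => ⟨_, DFunLike.congr_fun this y⟩

theorem e0_brAut_succ {m i : ℕ} (hi : i + 1 < m) (y : FreeGroup (Fin (m + 1))) :
    e0 m (brAut (m + 1) (i + 1) y) = brAut m i (e0 m y) := by
  have : (e0 m).comp (brAut (m + 1) (i + 1)).toMonoidHom =
      (brAut m i).toMonoidHom.comp (e0 m) := by
    apply xF_hom_ext
    intro j hj
    change e0 m (brAut (m + 1) (i + 1) (xF (m + 1) j)) = brAut m i (e0 m (xF (m + 1) j))
    have h' : i + 1 + 1 < m + 1 := by omega
    obtain _ | j := j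
    · rw [brAut_other h' (by omega) (by omega), e0_zero, map_one]
    · rw [e0_succ]
      by_cases e1 : j = i
      · subst e1
        rw [brAut_self h', brAut_self hi]; simp [e0_succ]
      · by_cases e2 : j = i + 1
        · subst e2; rw [brAut_succ h', brAut_succ hi, e0_succ]
        · rw [brAut_other h' (by omega) (by omega), brAut_other hi e1 e2, e0_succ]
  exact DFunLike.congr_fun this y

theorem apply_inv_eq {α β : Type*} [Group α] [Group β] {f : MulAut α} {f' : MulAut β} {e : α →* β}
    (h : ∀ y, e (f y) = f' (e y)) (y : α) : e (f⁻¹ y) = f'⁻¹ (e y) := by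
  have := h (f⁻¹ y)
  rw [MulAut.apply_inv_self] at this
  rw [this, MulAut.inv_apply_self]

/-- `α` conjugates the first letter by an element lifting `v` and preserves the other letters
modulo the first one. -/
def FixMod {m : ℕ} (α : MulAut (FreeGroup (Fin (m + 1)))) (v : FreeGroup (Fin m)) : Prop :=
  (∃ u, α (xF (m + 1) 0) = u⁻¹ * xF (m + 1) 0 * u ∧ e0 m u = v) ∧ ∀ y, e0 m (α y) = e0 m y

theorem FixMod.mul {m : ℕ} {α β : MulAut (FreeGroup (Fin (m + 1)))} {v w : FreeGroup (Fin m)}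
    (h1 : FixMod α v) (h2 : FixMod β w) : FixMod (α * β) (v * w) := by
  obtain ⟨⟨u, hu, rfl⟩, hα⟩ := h1
  obtain ⟨⟨t, ht, rfl⟩, hβ⟩ := h2
  refine ⟨⟨u * α t, ?_, ?_⟩, fun y => ?_⟩
  · rw [MulAut.mul_apply, ht, map_mul, map_mul, hu, map_inv]; group
  · rw [map_mul, hα]
  · rw [MulAut.mul_apply, hα, hβ]

theorem FixMod.inv {m : ℕ} {α : MulAut (FreeGroup (Fin (m + 1)))} {v : FreeGroup (Fin m)}
    (h1 : FixMod α v) : FixMod α⁻¹ v⁻¹ := by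
  obtain ⟨⟨u, hu, rfl⟩, hα⟩ := h1
  have h2 : ∀ y, e0 m (α⁻¹ y) = e0 m y := apply_inv_eq (f' := 1) hα
  refine ⟨⟨(α⁻¹ u)⁻¹, ?_, ?_⟩, h2⟩
  · have := congrArg (⇑α⁻¹) hu
    rw [MulAut.inv_apply_self, map_mul, map_mul, map_inv] at this
    nth_rewrite 2 [this]
    group
  · rw [map_inv, h2]

theorem fixMod_one (m : ℕ) : FixMod (m := m) 1 1 := ⟨⟨1, by simp, map_one _⟩, fun _ => rfl⟩

theorem fixMod_bB {m i : ℕ} (hi : i < m) : FixMod (bB (brAut (m + 1)) i) (xF m i) := by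
  induction i with
  | zero =>
    have h1 : 0 + 1 < m + 1 := by omega
    have h0 := brAut_self h1
    have h2 := brAut_succ h1
    rw [zero_add] at h2 h0
    have h3 : (brAut (m + 1) 0)⁻¹ (xF (m + 1) 0) = xF (m + 1) 1 := by
      rw [← h2, MulAut.inv_apply_self]
    have h4 : (brAut (m + 1) 0)⁻¹ (xF (m + 1) 1) =
        (xF (m + 1) 1)⁻¹ * xF (m + 1) 0 * xF (m + 1) 1 := by
      have := congrArg (⇑(brAut (m + 1) 0)⁻¹) h0
      simp only [MulAut.inv_apply_self, map_mul, map_inv, h3] at this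
      rw [this]; group
    have hb : bB (brAut (m + 1)) 0 = (brAut (m + 1) 0)⁻¹ * (brAut (m + 1) 0)⁻¹ := by
      simp [bB, pow_two]
    have h5 := e0_succ m 0
    rw [zero_add] at h5
    refine ⟨⟨xF (m + 1) 1, ?_, e0_succ m 0⟩, ?_⟩
    · rw [hb, MulAut.mul_apply, h3, h4]
    · have : (e0 m).comp (bB (brAut (m + 1)) 0).toMonoidHom = e0 m := by
        apply xF_hom_ext
        intro j hj
        change e0 m (bB (brAut (m + 1)) 0 (xF (m + 1) j)) = _
        rw [hb, MulAut.mul_apply]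
        obtain _ | _ | j := j
        · rw [h3, h4]; simp [e0_zero]
        · rw [zero_add, h4]; simp only [map_mul, map_inv, h3, h4, e0_zero, h5]; simp
        · have := brAut_other h1 (j := j + 1 + 1) (by omega) (by omega)
          have h6 : (brAut (m + 1) 0)⁻¹ (xF (m + 1) (j + 1 + 1)) = xF (m + 1) (j + 1 + 1) := by
            conv_lhs => rw [← this]
            rw [MulAut.inv_apply_self]
          rw [h6, h6]
      exact DFunLike.congr_fun this
  | succ i ih =>
    obtain ⟨⟨u, hu, hu'⟩, hα⟩ := ih (by omega)
    have h1 := e0_brAut_succ (m := m) (i := i) hi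
    have h2 := apply_inv_eq h1
    have h3 : brAut (m + 1) (i + 1) (xF (m + 1) 0) = xF (m + 1) 0 :=
      brAut_other (by omega) (by omega) (by omega)
    have h4 : (brAut (m + 1) (i + 1))⁻¹ (xF (m + 1) 0) = xF (m + 1) 0 := by
      conv_lhs => rw [← h3]
      rw [MulAut.inv_apply_self]
    rw [bB_succ]
    refine ⟨⟨(brAut (m + 1) (i + 1))⁻¹ u, ?_, ?_⟩, fun y => ?_⟩
    · rw [MulAut.mul_apply, MulAut.mul_apply, h3, hu, map_mul, map_mul, map_inv, h4]
    · rw [h2, hu', ← brAut_succ hi, MulAut.inv_apply_self]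
    · rw [MulAut.mul_apply, MulAut.mul_apply, h2, hα, h1, MulAut.inv_apply_self]

theorem Ψ_ι1_xF {m i : ℕ} (hi : i < m + 1) :
    Ψ (m + 1) (ι1 m (xF (m + 1) i)) = bB (brAut (m + 2)) i := by
  have h0 : ∀ j, j < m → Ψ (m + 1) (sB (m + 1) j) = brAut (m + 2) j := fun j hj =>
    Ψ_sB (by omega)
  by_cases h : i < m
  · rw [ι1_xF h, bB, bB, map_mul, map_mul, map_inv, map_pow, map_inv, map_pr, h0 0 (by omega),
      pr_congr (t := brAut (m + 2)) fun j _ hj => h0 j (by omega)]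
  · obtain rfl : i = m := by omega
    have hb := isBr_brAut (i + 2)
    rw [ι1_xF_last, hb.bB_eq (by omega), Xo, Nat.add_sub_cancel, Nat.sub_zero, map_mul, map_mul,
      map_inv, map_inv, map_pr, pr_congr (t := brAut (i + 2)) fun j _ hj => h0 j (by omega),
      Ψ_sB_last, inv_pow]

theorem fixMod_ι1 {m : ℕ} (y : FreeGroup (Fin (m + 1))) :
    FixMod (Ψ (m + 1) (ι1 m y)) y := by
  have hx : ∀ i : Fin (m + 1), FixMod (Ψ (m + 1) (ι1 m (FreeGroup.of i))) (FreeGroup.of i) :=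
    fun i => by rw [← xF_fin, Ψ_ι1_xF i.2]; exact fixMod_bB i.2
  induction y using FreeGroup.induction_on with
  | C1 => simp only [map_one]; exact fixMod_one _
  | of i => exact hx i
  | inv_of i _ => rw [map_inv, map_inv]; exact (hx i).inv
  | mul a b ha hb => rw [map_mul, map_mul]; exact ha.mul hb

theorem eq_one_of_Ψ_ι1 {m : ℕ} {y : FreeGroup (Fin (m + 1))} (h : Ψ (m + 1) (ι1 m y) = 1) :
    y = 1 := by
  obtain ⟨⟨u, hu, hy⟩, -⟩ := fixMod_ι1 y
  rw [h, MulAut.one_apply, xF_of_lt (by omega)] at hu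
  have hc : Commute (FreeGroup.of (⟨0, by omega⟩ : Fin (m + 2))) u := by
    rw [Commute, SemiconjBy]
    nth_rewrite 2 [hu]
    group
  obtain ⟨k, rfl⟩ := mem_zpowers_of_commute_of hc
  have := e0_zero (m + 1)
  rw [xF_of_lt (by omega)] at this
  rw [← hy]
  simp only [map_zpow, this, one_zpow]

theorem ι1_injective (m : ℕ) : Function.Injective (ι1 m) := by
  rw [injective_iff_map_eq_one]
  intro y hy
  exact eq_one_of_Ψ_ι1 (by rw [hy, map_one])

end Kernel

end ArtinAut

namespace ArtinAut

section KernelAction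

/-- The elements whose actions on the source and the target of `e` are intertwined by `e`. -/
def intertwiner {G X Y : Type*} [Group G] [Group X] [Group Y] (A : G →* MulAut X)
    (B : G →* MulAut Y) (e : X →* Y) : Subgroup G where
  carrier := {g | ∀ y, e (A g y) = B g (e y)}
  one_mem' := fun y => by simp
  mul_mem' := fun {a b} ha hb y => by
    rw [map_mul, map_mul, MulAut.mul_apply, MulAut.mul_apply, ha, hb]
  inv_mem' := fun {a} ha y => by rw [map_inv, map_inv]; exact apply_inv_eq ha y

theorem mem_intertwiner {G X Y : Type*} [Group G] [Group X] [Group Y] {A : G →* MulAut X}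
    {B : G →* MulAut Y} {e : X →* Y} {g : G} :
    g ∈ intertwiner A B e ↔ ∀ y, e (A g y) = B g (e y) := Iff.rfl

theorem mem_of_xF {n : ℕ} {K : Subgroup (FreeGroup (Fin n))} (h : ∀ i, i < n → xF n i ∈ K)
    (y : FreeGroup (Fin n)) : y ∈ K := by
  induction y using FreeGroup.induction_on with
  | C1 => exact K.one_mem
  | of i => rw [← xF_fin]; exact h i i.2
  | inv_of i _ => rw [← xF_fin]; exact K.inv_mem (h i i.2)
  | mul a b ha hb => exact K.mul_mem ha hb

theorem xF_mulHom_ext {n : ℕ} {Y : Type*} [Group Y] {a b : FreeGroup (Fin n) →* Y}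
    (h : ∀ i, i < n → a (xF n i) = b (xF n i)) (y : FreeGroup (Fin n)) : a y = b y :=
  DFunLike.congr_fun (xF_hom_ext h) y

theorem e0_Φ_sh {m : ℕ} (h : ArtinB m) (y : FreeGroup (Fin (m + 1))) :
    e0 m (Φ (m + 1) (sh m h) y) = Φ m h (e0 m y) := by
  have : h ∈ intertwiner ((Φ (m + 1)).comp (sh m)) (Φ m) (e0 m) := by
    refine mem_of_sB (fun i hi => mem_intertwiner.2 fun y => ?_) h
    rw [MonoidHom.comp_apply, sh_sB hi]
    by_cases hi' : i + 1 < m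
    · rw [Φ_sB (by omega), Φ_sB hi', e0_brAut_succ hi']
    · obtain ⟨k, rfl⟩ : ∃ k, m = k + 1 := ⟨m - 1, by omega⟩
      obtain rfl : i = k := by omega
      rw [Φ_sB_last, Φ_sB_last]
      simp [e0_succ]
  exact this y

theorem Φ_ι1_xF {m i : ℕ} (hi : i < m) :
    Φ (m + 1) (ι1 m (xF (m + 1) i)) = bB (brAut (m + 1)) i := by
  have h0 : ∀ j, j < m → Φ (m + 1) (sB (m + 1) j) = brAut (m + 1) j := fun j hj =>
    Φ_sB (by omega)
  rw [ι1_xF hi, bB, bB, map_mul, map_mul, map_inv, map_pow, map_inv, map_pr, h0 0 (by omega),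
    pr_congr (t := brAut (m + 1)) fun j _ hj => h0 j (by omega)]

theorem ι1_last_eq_ιo (m : ℕ) : ι1 m (xF (m + 1) m) = ιo (m + 1) (xF (m + 1) 0) := by
  rw [ι1_xF_last, ιo_xF (by omega)]

theorem e0_Φ_ι1 {m : ℕ} (z y : FreeGroup (Fin (m + 1))) :
    e0 m (Φ (m + 1) (ι1 m z) y) = e0 m y := by
  have : z ∈ intertwiner ((Φ (m + 1)).comp (ι1 m)) 1 (e0 m) := by
    refine mem_of_xF (fun i hi => mem_intertwiner.2 fun y => ?_) z
    rw [MonoidHom.comp_apply]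
    by_cases hi' : i < m
    · rw [Φ_ι1_xF hi', (fixMod_bB hi').2]; rfl
    · obtain rfl : i = m := by omega
      rw [ι1_last_eq_ιo, Φ_ιo]
      simp [e0_zero]
  exact this y

theorem sh_ρB_pow {m j : ℕ} (hj : j ≤ m) :
    (sh m (ρB m)) ^ j = pr (fun i => (sB (m + 1) i)⁻¹) 0 j * ρB (m + 1) ^ j := by
  have hc : sh m (ρB m) = (sB (m + 1) 0)⁻¹ * ρB (m + 1) := by
    rw [ρB_eq, ρB_eq, map_pr, pr_succ_left, inv_mul_cancel_left,
      ← pr_shift (sB (m + 1)) 0 1]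
    exact pr_congr fun i _ hi => sh_sB (by omega)
  induction j with
  | zero => simp
  | succ j ih =>
    have hr : ∀ k, k < m → ρB (m + 1) ^ k * sB (m + 1) 0 = sB (m + 1) k * ρB (m + 1) ^ k := by
      intro k
      induction k with
      | zero => simp
      | succ k ih =>
        intro hk
        rw [pow_succ', mul_assoc, ih (by omega), ← mul_assoc, ρB_mul_sB (by omega), mul_assoc]
    have h1 : ρB (m + 1) ^ j * (sB (m + 1) 0)⁻¹ = (sB (m + 1) j)⁻¹ * ρB (m + 1) ^ j := by
      rw [mul_inv_eq_iff_eq_mul, mul_assoc, hr j (by omega), inv_mul_cancel_left]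
    rw [pow_succ, ih (by omega), hc, pr_succ, zero_add, pow_succ]
    calc _ = pr (fun i => (sB (m + 1) i)⁻¹) 0 j * (ρB (m + 1) ^ j * (sB (m + 1) 0)⁻¹)
          * ρB (m + 1) := by group
      _ = _ := by rw [h1]; group

theorem pr_bB_mul {m j : ℕ} (hj : j ≤ m) : pr (bB (sB (m + 1))) 0 j * pr (sB (m + 1)) 0 j =
    pr (fun i => (sB (m + 1) i)⁻¹) 0 j := by
  induction j with
  | zero => simp
  | succ j ih =>
    have := (isArtB_sB (m + 1)).isBr
    rw [pr_succ _ _ j, pr_succ _ _ j, pr_succ _ _ j, ← ih (by omega), zero_add,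
      this.bB_eq (by omega)]
    simp only [pow_two]; group

theorem sh_ΔB (m : ℕ) : sh m (ΔB m) = ι1 m (PiF (m + 1)) * ΔB (m + 1) := by
  have h1 : ι1 m (PiF (m + 1)) = pr (bB (sB (m + 1))) 0 m * Xo (sB (m + 1)) (m + 1) 0 := by
    rw [PiF, pr_succ, zero_add, map_mul, ι1_xF_last, map_pr]
    congr 1
    exact pr_congr fun i _ hi => ι1_xF (by omega)
  have h2 : Xo (sB (m + 1)) (m + 1) 0 = pr (sB (m + 1)) 0 m * (ρB (m + 1))⁻¹ := by
    rw [Xo, ρB_eq, pr_succ]; simp only [Nat.add_sub_cancel, Nat.sub_zero, zero_add]; group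
  rw [ΔB, map_pow, sh_ρB_pow le_rfl, h1, h2, ← mul_assoc, pr_bB_mul le_rfl, ΔB, pow_succ']
  group

theorem ιo_injective (m : ℕ) : Function.Injective (ιo (m + 2)) := by
  have h01 : (0 : Fin (m + 2)) ≠ 1 := by simp
  intro a b h
  apply conj_injective h01
  rw [← Φ_ιo, ← Φ_ιo, h]

theorem Φ_ΔB (m : ℕ) : Φ (m + 2) (ΔB (m + 2)) = 1 := by
  ext1 y
  apply ιo_injective
  rw [← ιo_equivariant, (ΔB_comm _).eq, mul_inv_cancel_right]; rfl

theorem expo_injective {α : Type*} [DecidableEq α] {i j : α}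
    (h : IsConj (FreeGroup.of i) (FreeGroup.of j)) : i = j := by
  by_contra hij
  have := expo_conj i h
  rw [expo_of_self, expo_of_ne (Ne.symm hij)] at this
  exact absurd this (by decide)

theorem pB_eq_one_of_Φ {n : ℕ} {g : ArtinB n} (h : Φ n g = 1) : pB n g = 1 := by
  ext1 i
  have := isConj_Φ_of g i
  rw [h] at this
  exact (expo_injective this).symm

/-- The kernel of the action on the first free normal subgroup is generated by `Δ`. -/
theorem mem_zpowers_of_Φ_eq_one (m : ℕ) {g : ArtinB (m + 1)} (h : Φ (m + 1) g = 1) :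
    g ∈ Subgroup.zpowers (ΔB (m + 1)) := by
  induction m with
  | zero =>
    refine mem_of_sB (fun i hi => ?_) g
    obtain rfl : i = 0 := by omega
    have : ΔB (0 + 1) = sB (0 + 1) 0 := by rw [ΔB, ρB_eq, zero_add, pr_one, pow_one]
    rw [this]
    exact Subgroup.mem_zpowers _
  | succ m ih =>
    obtain ⟨y, k, rfl⟩ := mem_stab0_iff.2 (show pB (m + 1 + 1) g 0 = 0 by
      rw [pB_eq_one_of_Φ h]; rfl)
    have h1 : Φ (m + 1) k = 1 := by
      ext1 z
      obtain ⟨z, rfl⟩ := e0_surjective (m + 1) z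
      rw [← e0_Φ_sh, ← e0_Φ_ι1 y, ← MulAut.mul_apply, ← map_mul, h]; rfl
    obtain ⟨j, rfl⟩ := ih h1
    beta_reduce at h ⊢
    have hcomm : Commute (ι1 (m + 1) (PiF (m + 1 + 1))) (ΔB (m + 1 + 1)) := (ΔB_comm _).symm
    rw [map_zpow, sh_ΔB, hcomm.mul_zpow, ← mul_assoc, ← map_zpow, ← map_mul] at h ⊢
    generalize y * PiF (m + 1 + 1) ^ j = y at h ⊢
    rw [map_mul, map_zpow, Φ_ΔB, one_zpow, mul_one] at h
    have h2 : Commute (xF (m + 2) (m + 1)) y := by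
      apply ι1_injective
      have := ιo_equivariant (ι1 (m + 1) y) (xF (m + 2) 0)
      rw [h, ← ι1_last_eq_ιo, MulAut.one_apply, ← ι1_last_eq_ιo, mul_inv_eq_iff_eq_mul] at this
      rw [map_mul, map_mul, this]
    rw [xF_of_lt (by omega)] at h2
    obtain ⟨l, rfl⟩ := mem_zpowers_of_commute_of h2
    beta_reduce at h
    rw [← xF_of_lt (by omega), map_zpow, ι1_last_eq_ιo, ← map_zpow, Φ_ιo, ← map_one MulAut.conj] at h
    have h01 : (0 : Fin (m + 2)) ≠ 1 := by simp
    have h3 := conj_injective h01 h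
    have h4 : l = 0 := by
      have := congrArg (expo (0 : Fin (m + 2))) h3
      rw [xF_of_lt (by omega), map_zpow] at this
      change expo 0 (FreeGroup.of 0) ^ l = _ at this
      rw [expo_of_self, MonoidHom.map_one, ← ofAdd_zsmul, ofAdd_eq_one] at this
      simpa using this
    subst h4
    simp only [zpow_zero, map_one, one_mul]
    exact Subgroup.zpow_mem _ (Subgroup.mem_zpowers _) _

end KernelAction

end ArtinAut

namespace ArtinAut

section ConjLetter

variable {α : Type*} [DecidableEq α]

theorem norm_of (a : α) : FreeGroup.norm (FreeGroup.of a) = 1 := norm_letter a true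

theorem noCancel_of_of (a b : α) : NoCancel (FreeGroup.of a) (FreeGroup.of b) := by
  rw [noCancel_iff_isReduced]
  simp [FreeGroup.toWord_of, FreeGroup.IsReduced]

/-- `u * of a * u⁻¹` is a reduced expression. -/
def RedConj (u : FreeGroup α) (a : α) : Prop :=
  NoCancel u (FreeGroup.of a) ∧ NoCancel u (FreeGroup.of a)⁻¹

theorem RedConj.noCancel_inv {u : FreeGroup α} {a : α} (h : RedConj u a) :
    NoCancel (FreeGroup.of a) u⁻¹ := by
  have := h.2.inv; rwa [inv_inv] at this

theorem RedConj.norm_eq {u : FreeGroup α} {a : α} (h : RedConj u a) :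
    FreeGroup.norm (u * FreeGroup.of a * u⁻¹) = 2 * FreeGroup.norm u + 1 := by
  have h1 := h.1.trans h.noCancel_inv (letter_ne_one a true)
  rw [h1.norm_eq, h.1.norm_eq, norm_of, FreeGroup.norm_inv_eq]; ring

theorem norm_conj_le (u : FreeGroup α) (a : α) :
    FreeGroup.norm (u * FreeGroup.of a * u⁻¹) ≤ 2 * FreeGroup.norm u + 1 := by
  have h1 := FreeGroup.norm_mul_le (u * FreeGroup.of a) u⁻¹
  have h2 := FreeGroup.norm_mul_le u (FreeGroup.of a)
  rw [FreeGroup.norm_inv_eq] at h1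
  rw [norm_of] at h2
  omega

theorem exists_redConj (u : FreeGroup α) (a : α) :
    ∃ v, RedConj v a ∧ v * FreeGroup.of a * v⁻¹ = u * FreeGroup.of a * u⁻¹ := by
  induction hn : FreeGroup.norm u using Nat.strong_induction_on generalizing u with
  | _ n ih =>
    subst hn
    have step : ∀ b v, u = v * letter a (!b) → NoCancel v (letter a (!b)) →
        ∃ v, RedConj v a ∧ v * FreeGroup.of a * v⁻¹ = u * FreeGroup.of a * u⁻¹ := by
      intro b v hu hv
      obtain ⟨w, hw, hw'⟩ := ih (FreeGroup.norm v)
        (by rw [hu, hv.norm_eq, norm_letter]; omega) v rfl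
      refine ⟨w, hw, ?_⟩
      rw [hw', hu]
      cases b
      · rw [Bool.not_false, letter_true]; group
      · rw [Bool.not_true, letter_false]; group
    rcases noCancel_letter_right_or a true u with h1 | ⟨v, hu, hv⟩
    · rcases noCancel_letter_right_or a false u with h2 | ⟨v, hu, hv⟩
      · exact ⟨u, ⟨h1, h2⟩, rfl⟩
      · exact step _ v hu hv
    · exact step _ v hu hv

/-- Either the product of two conjugates of letters has no cancellation beyond the conjugators,
or an elementary braid shortens the pair. -/
theorem RedConj.trichotomy {u v : FreeGroup α} {a b : α} (hu : RedConj u a) (hv : RedConj v b) :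
    (NoCancel (FreeGroup.of a) (u⁻¹ * v) ∧ NoCancel (u⁻¹ * v) (FreeGroup.of b)) ∨
    FreeGroup.norm ((u * FreeGroup.of a * u⁻¹) * (v * FreeGroup.of b * v⁻¹) *
      (u * FreeGroup.of a * u⁻¹)⁻¹) < FreeGroup.norm (v * FreeGroup.of b * v⁻¹) ∨
    FreeGroup.norm ((v * FreeGroup.of b * v⁻¹)⁻¹ * (u * FreeGroup.of a * u⁻¹) *
      (v * FreeGroup.of b * v⁻¹)) < FreeGroup.norm (u * FreeGroup.of a * u⁻¹) := by
  rcases noCancel_letter_or a true (u⁻¹ * v) with h1 | ⟨k, hk, hk'⟩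
  · rcases noCancel_letter_right_or b true (u⁻¹ * v) with h2 | ⟨k, hk, hk'⟩
    · exact Or.inl ⟨h1, h2⟩
    · right; right
      rw [Bool.not_true, letter_false] at hk hk'
      have e : u = v * FreeGroup.of b * k⁻¹ := by
        rw [inv_mul_eq_iff_eq_mul] at hk; rw [hk]; group
      have e2 : (v * FreeGroup.of b * v⁻¹)⁻¹ * (u * FreeGroup.of a * u⁻¹) *
          (v * FreeGroup.of b * v⁻¹) = (v * k⁻¹) * FreeGroup.of a * (v * k⁻¹)⁻¹ := by
        rw [e]; group
      have h3 := hk'.inv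
      rw [inv_inv] at h3
      have h4 := (hv.1.trans h3 (letter_ne_one b true)).norm_eq
      rw [← e, hv.1.norm_eq, norm_of] at h4
      rw [e2, hu.norm_eq, h4]
      have := norm_conj_le (v * k⁻¹) a
      have := FreeGroup.norm_mul_le v k⁻¹
      omega
  · right; left
    rw [Bool.not_true, letter_false] at hk hk'
    have e : v = u * (FreeGroup.of a)⁻¹ * k := by
      rw [inv_mul_eq_iff_eq_mul] at hk; rw [hk]; group
    have e2 : (u * FreeGroup.of a * u⁻¹) * (v * FreeGroup.of b * v⁻¹) *
        (u * FreeGroup.of a * u⁻¹)⁻¹ = (u * k) * FreeGroup.of b * (u * k)⁻¹ := by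
      rw [e]; group
    have h4 := (hu.2.trans hk' (letter_ne_one a false)).norm_eq
    rw [← e, hu.2.norm_eq, FreeGroup.norm_inv_eq, norm_of] at h4
    rw [e2, hv.norm_eq, h4]
    have := norm_conj_le (u * k) b
    have := FreeGroup.norm_mul_le u k
    omega

theorem eq_one_of_noCancel_pr {u : ℕ → FreeGroup α} {a : ℕ → α} {n : ℕ}
    (hr : ∀ i, i ≤ n → RedConj (u i) (a i))
    (hs : ∀ i, i < n → NoCancel (FreeGroup.of (a i)) ((u i)⁻¹ * u (i + 1)) ∧
      NoCancel ((u i)⁻¹ * u (i + 1)) (FreeGroup.of (a (i + 1))))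
    (hn : FreeGroup.norm (pr (fun i => u i * FreeGroup.of (a i) * (u i)⁻¹) 0 (n + 1)) ≤ n + 1) :
    ∀ i, i ≤ n → u i = 1 := by
  have key : ∀ j, j ≤ n → ∃ w, pr (fun i => u i * FreeGroup.of (a i) * (u i)⁻¹) 0 (j + 1) =
      w * FreeGroup.of (a j) * (u j)⁻¹ ∧ NoCancel w (FreeGroup.of (a j)) ∧
      j ≤ FreeGroup.norm w ∧ (FreeGroup.norm w ≤ j → ∀ i, i ≤ j → u i = 1) := by
    intro j
    induction j with
    | zero =>
      intro h0
      refine ⟨u 0, by rw [zero_add, pr_one], (hr 0 h0).1, Nat.zero_le _, fun h i hi => ?_⟩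
      obtain rfl : i = 0 := by omega
      exact FreeGroup.norm_eq_zero.1 (by omega)
    | succ j ih =>
      intro hj
      obtain ⟨w, hw, hc, hl, he⟩ := ih (by omega)
      obtain ⟨h1, h2⟩ := hs j (by omega)
      have h3 : NoCancel (w * FreeGroup.of (a j)) ((u j)⁻¹ * u (j + 1)) :=
        hc.trans h1 (letter_ne_one _ true)
      refine ⟨w * FreeGroup.of (a j) * ((u j)⁻¹ * u (j + 1)), ?_, ?_, ?_, ?_⟩
      · rw [pr_succ, hw, zero_add]; group
      · by_cases hh : (u j)⁻¹ * u (j + 1) = 1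
        · rw [hh, mul_one]
          exact hc.trans (noCancel_of_of _ _) (letter_ne_one _ true)
        · exact h3.trans h2 hh
      · rw [h3.norm_eq, hc.norm_eq, norm_of]; omega
      · rw [h3.norm_eq, hc.norm_eq, norm_of]
        intro h i hi
        have h4 := he (by omega)
        rcases Nat.lt_or_ge i (j + 1) with h5 | h5
        · exact h4 i (by omega)
        · obtain rfl : i = j + 1 := by omega
          have h6 : (u j)⁻¹ * u (j + 1) = 1 := FreeGroup.norm_eq_zero.1 (by omega)
          rwa [h4 j le_rfl, inv_one, one_mul] at h6
  obtain ⟨w, hw, hc, hl, he⟩ := key n le_rfl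
  have h1 := (hc.trans (hr n le_rfl).noCancel_inv (letter_ne_one _ true)).norm_eq
  rw [hw, h1, hc.norm_eq, norm_of] at hn
  exact he (by omega)

theorem toWord_pr_of (a : ℕ → α) (k : ℕ) :
    (pr (fun i => FreeGroup.of (a i)) 0 k).toWord = (List.range k).map fun i => (a i, true) := by
  have h : ∀ k b, NoCancel (pr (fun i => FreeGroup.of (a i)) 0 k) (FreeGroup.of b) := by
    intro k
    induction k with
    | zero => intro b; exact noCancel_one_left _
    | succ k ih =>
      intro b; rw [pr_succ, zero_add]
      exact (ih _).trans (noCancel_of_of _ _) (letter_ne_one _ true)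
  induction k with
  | zero => simp
  | succ k ih =>
    rw [pr_succ, zero_add, noCancel_iff_toWord.1 (h k _), ih, List.range_succ, List.map_append,
      FreeGroup.toWord_of]
    rfl

end ConjLetter

section Artin

theorem PiF_eq_pr_of {n : ℕ} (a : ℕ → Fin n) (ha : ∀ i, i < n → (a i : ℕ) = i) :
    PiF n = pr (fun i => FreeGroup.of (a i)) 0 n := by
  refine pr_congr fun i _ hi => ?_
  rw [xF_of_lt (by omega)]
  congr 1
  ext
  exact (ha i (by omega)).symm

theorem norm_PiF (m : ℕ) : FreeGroup.norm (PiF (m + 1)) = m + 1 := by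
  rw [PiF_eq_pr_of (fun i => Fin.ofNat (m + 1) i) (fun i hi => Nat.mod_eq_of_lt hi),
    FreeGroup.norm, toWord_pr_of]
  simp

/-- A shortening of a sequence of conjugates, with a swap of indices. -/
theorem sum_norm_lt {m i : ℕ} (hi : i + 1 < m + 1) {X : Type*} (f f' : Fin (m + 1) → X) (N : X → ℕ)
    (h : (N (f' ⟨i, by omega⟩) < N (f ⟨i + 1, hi⟩) ∧ f' ⟨i + 1, hi⟩ = f ⟨i, by omega⟩) ∨
      (N (f' ⟨i + 1, hi⟩) < N (f ⟨i, by omega⟩) ∧ f' ⟨i, by omega⟩ = f ⟨i + 1, hi⟩))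
    (h' : ∀ j : Fin (m + 1), (j : ℕ) ≠ i → (j : ℕ) ≠ i + 1 → f' j = f j) :
    ∑ j, N (f' j) < ∑ j, N (f j) := by
  rw [← Equiv.sum_comp (swp (m + 1) i) (fun j => N (f' j))]
  have e1 : swp (m + 1) i ⟨i, by omega⟩ = ⟨i + 1, hi⟩ := by
    ext; rw [swp_val i hi, if_pos rfl]
  have e2 : swp (m + 1) i ⟨i + 1, hi⟩ = ⟨i, by omega⟩ := by
    ext; rw [swp_val i hi, if_neg (by simp), if_pos rfl]
  have e3 : ∀ j : Fin (m + 1), (j : ℕ) ≠ i → (j : ℕ) ≠ i + 1 → swp (m + 1) i j = j := by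
    intro j h1 h2; ext; rw [swp_val i hi, if_neg h1, if_neg h2]
  rcases h with ⟨h1, h2⟩ | ⟨h1, h2⟩
  all_goals
    have hle : ∀ j ∈ Finset.univ, N (f' (swp (m + 1) i j)) ≤ N (f j) := by
      intro j _
      by_cases c1 : (j : ℕ) = i
      · rw [show j = ⟨i, by omega⟩ from Fin.ext c1, e1]; simp only [h2, le_refl, h1.le]
      by_cases c2 : (j : ℕ) = i + 1
      · rw [show j = ⟨i + 1, hi⟩ from Fin.ext c2, e2]; simp only [h2, le_refl, h1.le]
      rw [e3 j c1 c2, h' j c1 c2]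
  · exact Finset.sum_lt_sum hle ⟨⟨i + 1, hi⟩, Finset.mem_univ _, by rw [e2]; exact h1⟩
  · exact Finset.sum_lt_sum hle ⟨⟨i, by omega⟩, Finset.mem_univ _, by rw [e1]; exact h1⟩

theorem exists_Φ_of_fix {m : ℕ} (f : FreeGroup (Fin (m + 1)) →* FreeGroup (Fin (m + 1)))
    (hf : ∀ i, ∃ a, IsConj (f (FreeGroup.of i)) (FreeGroup.of a)) (hP : f (PiF (m + 1)) = PiF (m + 1)) :
    ∃ g, ∀ y, f y = Φ (m + 1) g y := by
  induction hN : ∑ j, FreeGroup.norm (f (FreeGroup.of j)) using Nat.strong_induction_on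
    generalizing f with
  | _ N ih =>
  subst hN
  have step : ∀ g, Φ (m + 1) g (PiF (m + 1)) = PiF (m + 1) →
      ∑ j, FreeGroup.norm (f (Φ (m + 1) g (FreeGroup.of j))) <
        ∑ j, FreeGroup.norm (f (FreeGroup.of j)) → ∃ g, ∀ y, f y = Φ (m + 1) g y := by
    intro g hg hlt
    obtain ⟨k, hk⟩ := ih _ hlt (f.comp (Φ (m + 1) g).toMonoidHom) (fun i => by
      obtain ⟨a, ha⟩ := hf (pB _ g i)
      exact ⟨a, (f.map_isConj (isConj_Φ_of g i)).trans ha⟩) (by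
        change f (Φ (m + 1) g _) = _
        rw [hg, hP]) rfl
    refine ⟨k * g⁻¹, fun y => ?_⟩
    have := hk ((Φ (m + 1) g)⁻¹ y)
    change f (Φ (m + 1) g _) = _ at this
    rw [MulAut.apply_inv_self] at this
    rw [this, map_mul, map_inv]; rfl
  have hc : ∀ i : ℕ, ∃ (u : FreeGroup (Fin (m + 1))) (a : Fin (m + 1)), i < m + 1 →
      RedConj u a ∧ f (xF (m + 1) i) = u * FreeGroup.of a * u⁻¹ := by
    intro i
    by_cases hi : i < m + 1
    · obtain ⟨a, ha⟩ := hf ⟨i, hi⟩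
      obtain ⟨v, hv⟩ := isConj_iff.1 ha.symm
      obtain ⟨u, hu, hu'⟩ := exists_redConj v a
      exact ⟨u, a, fun _ => ⟨hu, by rw [xF_of_lt hi, ← hv, hu']⟩⟩
    · exact ⟨1, 0, fun h => absurd h hi⟩
  choose u a hua using hc
  by_cases hgood : ∀ i, i < m → NoCancel (FreeGroup.of (a i)) ((u i)⁻¹ * u (i + 1)) ∧
      NoCancel ((u i)⁻¹ * u (i + 1)) (FreeGroup.of (a (i + 1)))
  · have hPi : PiF (m + 1) = pr (fun i => u i * FreeGroup.of (a i) * (u i)⁻¹) 0 (m + 1) := by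
      rw [← hP, PiF, map_pr]
      exact pr_congr fun i _ hi => (hua i (by omega)).2
    have h1 := eq_one_of_noCancel_pr (fun i hi => (hua i (by omega)).1) hgood
      (by rw [← hPi, norm_PiF])
    have h2 : PiF (m + 1) = pr (fun i => FreeGroup.of (a i)) 0 (m + 1) := by
      rw [hPi]
      exact pr_congr fun i _ hi => by rw [h1 i (by omega)]; simp
    rw [PiF_eq_pr_of (fun i => Fin.ofNat (m + 1) i) (fun i hi => Nat.mod_eq_of_lt hi)] at h2
    have h3 := congrArg FreeGroup.toWord h2
    rw [toWord_pr_of, toWord_pr_of, List.map_inj_left] at h3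
    refine ⟨1, fun y => ?_⟩
    rw [map_one]
    refine xF_mulHom_ext (b := MonoidHom.id _) (fun i hi => ?_) y
    have h4 : Fin.ofNat (m + 1) i = a i := congrArg Prod.fst (h3 i (List.mem_range.2 hi))
    rw [(hua i hi).2, h1 i (by omega), ← h4]
    simp only [one_mul, inv_one, mul_one, MonoidHom.id_apply]
    rw [xF_of_lt hi]
    congr 1
    ext
    exact Nat.mod_eq_of_lt hi
  · push Not at hgood
    obtain ⟨i, hi, hbad⟩ := hgood
    have hi' : i + 1 < m + 1 := by omega
    obtain ⟨r1, e1⟩ := hua i (by omega)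
    obtain ⟨r2, e2⟩ := hua (i + 1) (by omega)
    have b1 := brAut_self hi'
    have b2 := brAut_succ hi'
    have b3 : (brAut (m + 1) i)⁻¹ (xF (m + 1) i) = xF (m + 1) (i + 1) := by
      rw [← b2, MulAut.inv_apply_self]
    have b4 : (brAut (m + 1) i)⁻¹ (xF (m + 1) (i + 1)) =
        (xF (m + 1) (i + 1))⁻¹ * xF (m + 1) i * xF (m + 1) (i + 1) := by
      have := congrArg (⇑(brAut (m + 1) i)⁻¹) b1
      simp only [MulAut.inv_apply_self, map_mul, map_inv, b3] at this
      rw [this]; group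
    have bP := brAut_PiF hi'
    rcases r1.trichotomy r2 with h | h | h
    · exact absurd h.2 (hbad h.1)
    · refine step (sB (m + 1) i) (by rw [Φ_sB hi', bP]) ?_
      rw [Φ_sB hi']
      refine sum_norm_lt hi' _ _ _ (Or.inl ⟨?_, ?_⟩) fun j h1 h2 => ?_
      · rw [← xF_of_lt, ← xF_of_lt, b1, map_mul, map_mul, map_inv, e1, e2]; exact h
      · rw [← xF_of_lt, ← xF_of_lt, b2]
      · rw [← xF_fin, brAut_other hi' h1 h2]
    · refine step (sB (m + 1) i)⁻¹ ?_ ?_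
      · rw [map_inv, Φ_sB hi']
        conv_lhs => rw [← bP, MulAut.inv_apply_self]
      rw [map_inv, Φ_sB hi']
      refine sum_norm_lt hi' _ _ _ (Or.inr ⟨?_, ?_⟩) fun j h1 h2 => ?_
      · rw [← xF_of_lt, ← xF_of_lt, b4, map_mul, map_mul, map_inv, e1, e2]; exact h
      · rw [← xF_of_lt, ← xF_of_lt, b3]
      · have := brAut_other hi' h1 h2
        rw [← xF_fin]
        conv_lhs => rw [← this, MulAut.inv_apply_self]

/-- Artin's characterization of braid automorphisms of the free group, up to inner automorphisms. -/
theorem exists_Φ {m : ℕ} (f : FreeGroup (Fin (m + 1)) →* FreeGroup (Fin (m + 1)))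
    (hf : ∀ i, ∃ a, IsConj (f (FreeGroup.of i)) (FreeGroup.of a))
    (hP : IsConj (f (PiF (m + 1))) (PiF (m + 1))) :
    ∃ g, ∀ y, f y = Φ (m + 1) g y := by
  obtain ⟨c, hc⟩ := isConj_iff.1 hP
  obtain ⟨g, hg⟩ := exists_Φ_of_fix ((MulAut.conj c).toMonoidHom.comp f) (fun i => by
    obtain ⟨a, ha⟩ := hf i
    exact ⟨a, (isConj_iff.2 ⟨c, rfl⟩ : IsConj (f (FreeGroup.of i)) _).symm.trans ha⟩) hc
  refine ⟨ιo (m + 1) c⁻¹ * g, fun y => ?_⟩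
  rw [map_mul, Φ_ιo, MulAut.mul_apply, ← hg y]
  change _ = MulAut.conj c⁻¹ (MulAut.conj c (f y))
  simp only [MulAut.conj_apply]; group

end Artin

end ArtinAut

namespace ArtinAut

section BraidPerm

/-- All the terms of index less than `r` coincide. -/
def AllEq {H : Type*} (r : ℕ) (s : ℕ → H) : Prop := ∀ i j, i < r → j < r → s i = s j

variable {H : Type*} [Group H]

theorem IsBr.allEq {r : ℕ} {s : ℕ → H} (h : IsBr r s) {k : ℕ} (hk : k + 1 < r)
    (he : s k = s (k + 1)) : AllEq r s := by
  have up : ∀ j, j + 2 < r → s j = s (j + 1) → s (j + 1) = s (j + 2) := by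
    intro j hj h1
    have h2 := h.comm j (j + 2) le_rfl hj
    rw [h1] at h2
    have h3 := h.braid (j + 1) hj
    change _ * s (j + 2) * _ = s (j + 2) * _ * s (j + 2) at h3
    rw [h2.eq, mul_assoc, mul_assoc, mul_left_cancel_iff, h2.eq] at h3
    exact mul_right_cancel h3
  have down : ∀ j, j + 2 < r → s (j + 1) = s (j + 2) → s j = s (j + 1) := by
    intro j hj h1
    have h2 := h.comm j (j + 2) le_rfl hj
    rw [← h1] at h2
    have h3 := h.braid j (by omega)
    rw [h2.eq, mul_assoc, mul_assoc, mul_left_cancel_iff, h2.eq] at h3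
    exact mul_right_cancel h3
  have all : ∀ j, j + 1 < r → s j = s (j + 1) := by
    have hup : ∀ d, k + d + 1 < r → s (k + d) = s (k + d + 1) := by
      intro d
      induction d with
      | zero => intro _; exact he
      | succ d ih => intro hd; exact up (k + d) (by omega) (ih (by omega))
    have hdown : ∀ d, d ≤ k → s (k - d) = s (k - d + 1) := by
      intro d
      induction d with
      | zero => intro _; exact he
      | succ d ih =>
        intro hd
        have := ih (by omega)
        rw [show k - d = k - (d + 1) + 1 by omega] at this
        exact down _ (by omega) this
    intro j hj
    rcases Nat.le_total k j with h1 | h1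
    · obtain ⟨d, rfl⟩ := Nat.exists_eq_add_of_le h1
      exact hup d hj
    · have := hdown (k - j) (by omega)
      rwa [show k - (k - j) = j by omega] at this
  have zero : ∀ j, j < r → s j = s 0 := by
    intro j
    induction j with
    | zero => intro _; rfl
    | succ j ih => intro hj; rw [← all j hj, ih (by omega)]
  intro i j hi hj
  rw [zero i hi, zero j hj]

theorem IsBr.eq_of_commute_quot {r : ℕ} {s : ℕ → H} (h : IsBr r s) (hr : 4 ≤ r)
    (hc : Commute (s 2 * (s 0)⁻¹) (s 3 * (s 0)⁻¹)) : AllEq r s := by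
  have c2 := (h.comm 0 2 (by omega) (by omega)).inv_left
  have c3 := (h.comm 0 3 (by omega) (by omega)).inv_left
  have h3 := h.braid 2 (by omega)
  have aux : ∀ u v w : H, Commute w u → Commute w v →
      u * w * (v * w) * (u * w) = u * v * u * (w * w * w) := by
    intro u v w h1 h2
    calc _ = u * (w * v) * (w * u) * w := by simp only [mul_assoc]
      _ = u * v * (w * u) * w * w := by rw [h2.eq, h1.eq]; simp only [mul_assoc]; rw [← mul_assoc w u, h1.eq]; simp only [mul_assoc]
      _ = _ := by rw [h1.eq]; simp only [mul_assoc]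
  have e1 := aux _ _ _ c2 c3
  have e2 := aux _ _ _ c3 c2
  have e3 : s 2 * (s 0)⁻¹ * (s 3 * (s 0)⁻¹) * (s 2 * (s 0)⁻¹) =
      s 3 * (s 0)⁻¹ * (s 2 * (s 0)⁻¹) * (s 3 * (s 0)⁻¹) := by
    rw [e1, e2]; exact congrArg (· * _) h3
  rw [hc.eq, mul_left_cancel_iff, mul_left_inj] at e3
  exact h.allEq (by omega) e3

open Equiv

/-- Braid sequences commuting with a fixed-point free permutation are constant, provided
the sequences of that length are constant on sets of at most half the size. -/
theorem IsBr.allEq_of_fixedPointFree {Z : Type} [Fintype Z] {a : Perm Z} (ha : ∀ z, a z ≠ z)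
    {r : ℕ} {s : ℕ → Perm Z} (h : IsBr r s) (hr : 4 ≤ r) (hc : ∀ i, Commute a (s i))
    (ih : ∀ (Y : Type) [Fintype Y], 2 * Fintype.card Y ≤ Fintype.card Z →
      ∀ s' : ℕ → Perm Y, IsBr r s' → AllEq r s') : AllEq r s := by
  classical
  letI S : Setoid Z := Perm.SameCycle.setoid a
  have hz : ∀ (f : Perm Z), Commute a f → ∀ (k : ℤ) z, f ((a ^ k) z) = (a ^ k) (f z) := by
    intro f hf k z
    have := (hf.zpow_left k).eq
    rw [← Perm.mul_apply, ← this, Perm.mul_apply]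
  have hcyc : ∀ (f : Perm Z), Commute a f → ∀ x y, a.SameCycle x y → a.SameCycle (f x) (f y) := by
    rintro f hf x y ⟨k, rfl⟩
    exact ⟨k, (hz f hf k x).symm⟩
  let t : ℕ → Perm (Quotient S) := fun i => Quotient.congr (s i) fun x y => by
    refine ⟨hcyc _ (hc i) x y, fun hxy => ?_⟩
    have := hcyc _ (hc i).inv_right _ _ hxy
    change a.SameCycle x y
    simpa using this
  have ht : ∀ i x, t i (Quotient.mk S x) = Quotient.mk S (s i x) := fun i x => rfl
  have hbr : IsBr r t := by
    refine ⟨fun i hi => ?_, fun i j hij hj => ?_⟩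
    · ext q
      induction q using Quotient.inductionOn with
      | _ x =>
      simp only [Perm.mul_apply, ht]
      exact congrArg _ (Perm.congr_fun (h.braid i hi) x)
    · rw [Commute, SemiconjBy]
      ext q
      induction q using Quotient.inductionOn with
      | _ x =>
      simp only [Perm.mul_apply, ht]
      exact congrArg _ (Perm.congr_fun (h.comm i j hij hj).eq x)
  have hcard : 2 * Fintype.card (Quotient S) ≤ Fintype.card Z := by
    rw [two_mul, ← Fintype.card_sum]
    have hout : ∀ q : Quotient S, Quotient.mk S (a q.out) = q := by
      intro q
      conv_rhs => rw [← q.out_eq]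
      exact Quotient.sound (s := S) (show a.SameCycle (a q.out) q.out from ⟨-1, by simp⟩)
    refine Fintype.card_le_of_injective (Sum.elim (fun q => q.out) fun q => a q.out) ?_
    rintro (p | p) (q | q) hpq
    · rw [Sum.elim_inl, Sum.elim_inl] at hpq
      rw [← p.out_eq, hpq, q.out_eq]
    · rw [Sum.elim_inl, Sum.elim_inr] at hpq
      have : p = q := by rw [← p.out_eq, hpq, hout]
      subst this
      exact absurd hpq.symm (ha _)
    · rw [Sum.elim_inl, Sum.elim_inr] at hpq
      have : q = p := by rw [← q.out_eq, ← hpq, hout]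
      subst this
      exact absurd hpq (ha _)
    · rw [Sum.elim_inr, Sum.elim_inr] at hpq
      rw [← hout p, hpq, hout]
  have hall := ih (Quotient S) hcard t hbr
  refine h.eq_of_commute_quot hr ?_
  have hsame : ∀ i, i < r → ∀ z, a.SameCycle z ((s i * (s 0)⁻¹) z) := by
    intro i hi z
    have h1 : Quotient.mk S (s i ((s 0)⁻¹ z)) = Quotient.mk S z := by
      rw [← ht, hall i 0 hi (by omega), ht]; simp
    exact (Quotient.exact h1 : a.SameCycle _ _).symm
  have hca : ∀ i, Commute a (s i * (s 0)⁻¹) := fun i => (hc i).mul_right (hc 0).inv_right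
  generalize hu : s 2 * (s 0)⁻¹ = u
  generalize hv : s 3 * (s 0)⁻¹ = v
  have hu1 := hca 2
  have hv1 := hca 3
  have hu2 := hsame 2 (by omega)
  have hv2 := hsame 3 (by omega)
  rw [hu] at hu1 hu2
  rw [hv] at hv1 hv2
  ext z
  obtain ⟨k, hk⟩ := hu2 z
  obtain ⟨l, hl⟩ := hv2 z
  rw [Perm.mul_apply, Perm.mul_apply, ← hk, ← hl, hz u hu1, hz v hv1, ← hk, ← hl,
    ← Perm.mul_apply, ← Perm.mul_apply, ← zpow_add, ← zpow_add, add_comm]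

theorem IsBr.subtypePerm {X : Type} {p : X → Prop} {r : ℕ} {s : ℕ → Perm X} (h : IsBr r s)
    (hp : ∀ i x, p (s i x) ↔ p x) : IsBr r fun i => (s i).subtypePerm (hp i) := by
  refine ⟨fun i hi => ?_, fun i j hij hj => ?_⟩
  · ext x; exact Perm.congr_fun (h.braid i hi) x
  · ext x; exact Perm.congr_fun (h.comm i j hij hj).eq x

/-- Braid sequences commuting with `a` agree on the support of `a`. -/
theorem IsBr.eq_on_support {X : Type} [Fintype X] [DecidableEq X] {a : Perm X}
    {r : ℕ} {s : ℕ → Perm X} (h : IsBr r s) (hr : 4 ≤ r) (hc : ∀ i, Commute a (s i))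
    (ih : ∀ (Y : Type) [Fintype Y], 2 * Fintype.card Y ≤ Fintype.card X →
      ∀ s' : ℕ → Perm Y, IsBr r s' → AllEq r s') {i j : ℕ} (hi : i < r) (hj : j < r) {x : X}
    (hx : a x ≠ x) : s i x = s j x := by
  have hp : ∀ i x, a (s i x) ≠ s i x ↔ a x ≠ x := by
    intro i x
    rw [← Perm.mul_apply, (hc i).eq, Perm.mul_apply]
    exact (s i).injective.ne_iff
  have h1 := (h.subtypePerm hp).allEq_of_fixedPointFree
    (a := a.subtypePerm (p := fun x => a x ≠ x) fun x => a.injective.ne_iff)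
    (fun z hz => z.2 (congrArg Subtype.val hz)) hr
    (fun i => by ext x; exact Perm.congr_fun (hc i).eq x)
    (fun Y _ hY => ih Y (hY.trans (Fintype.card_subtype_le _)))
  exact congrArg Subtype.val (Perm.congr_fun (h1 i j hi hj) ⟨x, hx⟩)

theorem perm_four_aux : ∀ a : Perm (Fin 4), a = 1 ∨ ∀ c, a * c = c * a → ∀ d, a * d = d * a →
    c * d * c = d * c * d → c = d := by decide +kernel

theorem IsBr.allEq_of_one {r : ℕ} {s : ℕ → H} (h : IsBr r s) (h0 : s 0 = 1) : AllEq r s := by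
  intro i j hi hj
  by_cases h1 : 1 < r
  · have := h.conj_braid (i := 0) (by omega)
    refine h.allEq (k := 0) (by omega) ?_ i j hi hj
    rw [this, h0]; group
  · rw [show i = j by omega]

/-- A braid group on at least five strands has only cyclic permutation representations on small
sets. -/
theorem IsBr.allEq_of_card {X : Type} [Fintype X] {r : ℕ} {s : ℕ → Perm X} (h : IsBr r s)
    (hr : 4 ≤ r) (hX : 2 * Fintype.card X ≤ r + 3) : AllEq r s := by
  classical
  induction hk : Fintype.card X using Nat.strong_induction_on generalizing X r with
  | _ k ih =>
  subst hk
  by_cases h4 : Fintype.card X ≤ 4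
  · obtain ⟨ι⟩ : Nonempty (X ↪ Fin 4) := by
      rw [Function.Embedding.nonempty_iff_card_le]; simpa using h4
    have hinj := Perm.viaEmbeddingHom_injective ι
    have h' := h.map (Perm.viaEmbeddingHom ι)
    rcases perm_four_aux (Perm.viaEmbeddingHom ι (s 0)) with h1 | h1
    · exact h.allEq_of_one (hinj (by rw [h1, map_one]))
    · exact h.allEq (k := 2) (by omega) (hinj (h1 _ (h'.comm 0 2 (by omega) (by omega)).eq _
        (h'.comm 0 3 (by omega) (by omega)).eq (h'.braid 2 (by omega))))
  · by_cases h1 : s 0 = 1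
    · exact h.allEq_of_one h1
    let t : ℕ → Perm X := fun i => if i + 2 < r then s (i + 2) else 1
    have ht : IsBr (r - 2) t := by
      refine ⟨fun i hi => ?_, fun i j hij hj => ?_⟩
      · simp only [t]
        rw [if_pos (by omega), if_pos (by omega)]; exact h.braid (i + 2) (by omega)
      · simp only [t]
        rw [if_pos (by omega), if_pos (by omega)]; exact h.comm (i + 2) (j + 2) (by omega) (by omega)
    have hc : ∀ i, Commute (s 0) (t i) := by
      intro i
      simp only [t]
      split_ifs with hi
      · exact h.comm 0 (i + 2) (by omega) hi
      · exact Commute.one_right _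
    have hp : ∀ i x, s 0 (t i x) = t i x ↔ s 0 x = x := by
      intro i x
      rw [← Perm.mul_apply, (hc i).eq, Perm.mul_apply]
      exact (t i).injective.eq_iff
    have hlt : Fintype.card {x // s 0 x = x} < Fintype.card X := by
      obtain ⟨x, hx⟩ : ∃ x, s 0 x ≠ x := by
        by_contra hcon
        push Not at hcon
        exact h1 (Perm.ext hcon)
      exact Fintype.card_subtype_lt hx
    have hfix := ih _ hlt (ht.subtypePerm hp) (by omega) (by omega) rfl
    have key : t 0 = t 1 := by
      ext x
      by_cases hx : s 0 x = x
      · exact congrArg Subtype.val (Perm.congr_fun (hfix 0 1 (by omega) (by omega)) ⟨x, hx⟩)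
      · exact ht.eq_on_support (by omega) hc (fun Y _ hY s' hs' =>
          ih (Fintype.card Y) (by omega) hs' (by omega) (by omega) rfl) (by omega) (by omega) hx
    simp only [t] at key
    rw [if_pos (by omega), if_pos (by omega)] at key
    exact h.allEq (k := 2) (by omega) key

end BraidPerm

end ArtinAut

namespace ArtinAut

section Center

open Equiv

theorem mem_zpowers_of_center {m : ℕ} {g : ArtinB (m + 2)} (hg : ∀ h, Commute g h) :
    g ∈ Subgroup.zpowers (ΔB (m + 2)) := by
  refine mem_zpowers_of_Φ_eq_one (m + 1) (freeAut_ext fun i => ιo_injective m ?_)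
  change ιo (m + 2) (Φ (m + 2) g _) = ιo (m + 2) _
  rw [← ιo_equivariant, (hg _).eq, mul_inv_cancel_right, MulAut.one_apply]

theorem ΔB_zpow_injective {m : ℕ} {k l : ℤ} (h : ΔB (m + 2) ^ k = ΔB (m + 2) ^ l) : k = l := by
  obtain ⟨f, -, hf⟩ := exists_hom_comm m (1 : Multiplicative ℤ) (Multiplicative.ofAdd 1)
  have h' := congrArg (fun x => (f x).toAdd) h
  simp only [ΔB, map_zpow, map_pow, hf, toAdd_zpow, toAdd_pow, toAdd_ofAdd] at h'
  have h0 : ((m + 2 : ℕ) : ℤ) ≠ 0 := by positivity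
  simpa [h0, show (m : ℤ) + 2 ≠ 0 by positivity] using h'

/-- An automorphism preserves the generator of the center up to inversion. -/
theorem aut_ΔB {m : ℕ} (f : MulAut (ArtinB (m + 2))) :
    f (ΔB (m + 2)) = ΔB (m + 2) ∨ f (ΔB (m + 2)) = (ΔB (m + 2))⁻¹ := by
  have key : ∀ f : MulAut (ArtinB (m + 2)), ∃ k : ℤ, f (ΔB (m + 2)) = ΔB (m + 2) ^ k := by
    intro f
    have : f (ΔB (m + 2)) ∈ Subgroup.zpowers (ΔB (m + 2)) := by
      refine mem_zpowers_of_center fun h => ?_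
      have := (ΔB_comm (n := m + 2) (f⁻¹ h)).map f
      rwa [MulAut.apply_inv_self] at this
    obtain ⟨k, hk⟩ := this
    exact ⟨k, hk.symm⟩
  obtain ⟨k, hk⟩ := key f
  obtain ⟨l, hl⟩ := key f⁻¹
  have h1 : ΔB (m + 2) ^ (l * k) = ΔB (m + 2) ^ (1 : ℤ) := by
    have := congrArg (⇑f⁻¹) hk
    rw [MulAut.inv_apply_self, map_zpow, hl, ← zpow_mul] at this
    rw [zpow_one]; exact this.symm
  rcases Int.eq_one_or_neg_one_of_mul_eq_one' (ΔB_zpow_injective h1) with h | h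
  · left; rw [hk, h.2, zpow_one]
  · right; rw [hk, h.2, zpow_neg_one]

theorem pr_swp (m j : ℕ) (hj : j ≤ m) (i : Fin (m + 1)) :
    (pr (swp (m + 1)) 0 j i : ℕ) = if (i : ℕ) < j then (i : ℕ) + 1 else if (i : ℕ) = j then 0 else i := by
  induction j generalizing i with
  | zero => simp
  | succ j ih =>
    rw [pr_succ, Perm.mul_apply, ih (by omega), zero_add, swp_val j (by omega)]
    grind

/-- The translation by one in the second coordinate over the last point of the first. -/
def lastShift (m : ℕ) : Perm (Fin (m + 1) × ℤ) := Perm.prodExtendRight (Fin.last m) (Equiv.addRight 1)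

theorem lastShift_last (m : ℕ) (k : ℤ) : lastShift m (Fin.last m, k) = (Fin.last m, k + 1) :=
  Perm.prodExtendRight_apply_eq _ _ _

theorem lastShift_ne {m : ℕ} {i : Fin (m + 1)} (h : (i : ℕ) ≠ m) (k : ℤ) :
    lastShift m (i, k) = (i, k) :=
  Perm.prodExtendRight_apply_ne _ (fun h' => h (by rw [h']; rfl)) _

/-- Permutations acting on the first coordinate. -/
def permFst (n : ℕ) : Perm (Fin n) →* Perm (Fin n × ℤ) where
  toFun f := prodCongr f (Equiv.refl ℤ)
  map_one' := rfl
  map_mul' _ _ := rfl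

theorem permFst_apply {n : ℕ} (f : Perm (Fin n)) (i : Fin n) (k : ℤ) :
    permFst n f (i, k) = (f i, k) := rfl

/-- The generators of `B_n` as affine permutations. -/
def tw (m i : ℕ) : Perm (Fin (m + 1) × ℤ) :=
  if i < m then permFst (m + 1) (swp (m + 1) i) else lastShift m

theorem isArtB_tw (m : ℕ) : IsArtB (m + 1) (tw m) := by
  have hs := isArtB_swp (m + 1)
  refine ⟨fun i hi => ?_, fun i hi => ?_, fun i j hij hj => ?_⟩
  · rw [tw, tw, if_pos (by omega), if_pos (by omega)]
    simp only [← map_mul, hs.braid i hi]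
  · obtain rfl : m = i + 1 := by omega
    rw [tw, tw, if_pos (by omega), if_neg (by omega)]
    have h1 : swp (i + 1 + 1) i (Fin.last (i + 1)) = ⟨i, by omega⟩ := by
      ext; rw [swp_val _ (by omega)]; simp
    have h2 : swp (i + 1 + 1) i ⟨i, by omega⟩ = Fin.last (i + 1) := by
      ext; rw [swp_val _ (by omega)]; simp
    have h4 : ∀ k, lastShift (i + 1) (⟨i, by omega⟩, k) = (⟨i, by omega⟩, k) :=
      fun k => lastShift_ne (by simp) k
    apply Perm.ext
    rintro ⟨j, k⟩
    simp only [Perm.mul_apply]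
    by_cases ha : (j : ℕ) = i
    · rw [show j = ⟨i, by omega⟩ from Fin.ext ha]
      simp only [permFst_apply, h1, h2, h4, lastShift_last]
    · by_cases hb : (j : ℕ) = i + 1
      · obtain rfl : j = Fin.last (i + 1) := Fin.ext hb
        simp only [permFst_apply, h1, h2, h4, lastShift_last]
      · have h3 : swp (i + 1 + 1) i j = j := by
          ext; rw [swp_val _ (by omega), if_neg ha, if_neg hb]
        simp only [permFst_apply, h3, lastShift_ne hb]
  · by_cases hm : j < m
    · rw [tw, tw, if_pos (by omega), if_pos hm]
      exact (hs.comm i j hij hj).map _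
    · rw [tw, tw, if_pos (by omega), if_neg hm]
      apply Perm.ext
      rintro ⟨l, k⟩
      simp only [Perm.mul_apply, permFst_apply]
      have hl := swp_val i (show i + 1 < m + 1 by omega) l
      by_cases hb : (l : ℕ) = m
      · obtain rfl : l = Fin.last m := Fin.ext hb
        have : swp (m + 1) i (Fin.last m) = Fin.last m := by
          ext; rw [hl, Fin.val_last, if_neg (by omega), if_neg (by omega)]
        simp only [lastShift_last, this, permFst_apply]
      · rw [lastShift_ne hb, permFst_apply, lastShift_ne]
        rw [hl]; split_ifs <;> omega

/-- The representation of `ArtinB` by affine permutations. -/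
noncomputable def affB (m : ℕ) : ArtinB (m + 1) →* Perm (Fin (m + 1) × ℤ) := liftB (isArtB_tw m)

theorem affB_spec {m : ℕ} (g : ArtinB (m + 1)) (i : Fin (m + 1)) :
    ∃ d : ℤ, ∀ k, affB m g (i, k) = (pB (m + 1) g i, k + d) := by
  have key : ∀ j, j < m + 1 → ∀ i, ∃ d : ℤ, ∀ k,
      affB m (sB (m + 1) j) (i, k) = (pB (m + 1) (sB (m + 1) j) i, k + d) := by
    intro j hj i
    rw [affB, liftB_sB _ hj, pB_sB hj, tw]
    split_ifs with h
    · exact ⟨0, fun k => by rw [permFst_apply, add_zero]⟩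
    · rw [swp_of_le _ (by omega)]
      by_cases hb : (i : ℕ) = m
      · obtain rfl : i = Fin.last m := Fin.ext hb
        exact ⟨1, fun k => lastShift_last _ _⟩
      · exact ⟨0, fun k => by rw [lastShift_ne hb, add_zero]; rfl⟩
  induction g using sB_induction generalizing i with
  | h1 => exact ⟨0, fun k => by simp⟩
  | hs j g hj ih =>
    obtain ⟨d, hd⟩ := key j hj i
    obtain ⟨e, he⟩ := ih (pB (m + 1) (sB (m + 1) j) i)
    exact ⟨d + e, fun k => by rw [map_mul, Perm.mul_apply, hd, he, map_mul, add_assoc]; rfl⟩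
  | hi j g hj ih =>
    obtain ⟨d, hd⟩ := key j hj ((pB (m + 1) (sB (m + 1) j))⁻¹ i)
    obtain ⟨e, he⟩ := ih ((pB (m + 1) (sB (m + 1) j))⁻¹ i)
    refine ⟨e - d, fun k => ?_⟩
    have : (affB m (sB (m + 1) j))⁻¹ (i, k) = ((pB (m + 1) (sB (m + 1) j))⁻¹ i, k - d) := by
      rw [Perm.inv_eq_iff_eq, hd]; simp
    rw [map_mul, map_inv, Perm.mul_apply, this, he, map_mul, map_inv]
    simp only [Perm.mul_apply, Prod.mk.injEq, true_and]; ring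

theorem pB_ρB (m : ℕ) (i : Fin (m + 1)) : pB (m + 1) (ρB (m + 1)) i = i + 1 := by
  rw [ρB_eq, map_pr, pr_congr (t := swp (m + 1)) fun j _ hj => pB_sB (by omega), pr_succ,
    zero_add, swp_of_le m le_rfl, mul_one]
  ext
  rw [pr_swp m m le_rfl, Fin.val_add_one]
  have := i.2
  by_cases h : i = Fin.last m
  · rw [if_pos h]; subst h; simp
  · rw [if_neg h, if_pos]
    have : (i : ℕ) ≠ m := fun h' => h (Fin.ext h')
    omega

theorem affB_ρB {m : ℕ} (p : Fin (m + 1) × ℤ) :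
    ((affB m (ρB (m + 1)) p).1 : ℤ) + (m + 1) * (affB m (ρB (m + 1)) p).2 =
      (p.1 : ℤ) + (m + 1) * p.2 + 1 := by
  obtain ⟨i, k⟩ := p
  have h : affB m (ρB (m + 1)) = permFst (m + 1) (pr (swp (m + 1)) 0 m) * lastShift m := by
    have h1 : ∀ j, j < m + 1 → affB m (sB (m + 1) j) = tw m j := fun j => liftB_sB (isArtB_tw m)
    rw [ρB_eq, map_pr, pr_congr (t := tw m) fun j _ hj => h1 j (by omega),
      pr_succ, map_pr, pr_congr (t := fun i => permFst (m + 1) (swp (m + 1) i)) fun j _ hj => ?_]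
    · rw [zero_add, tw, if_neg (by omega)]
    · rw [tw, if_pos (by omega)]
  rw [h, Perm.mul_apply]
  by_cases hb : (i : ℕ) = m
  · obtain rfl : i = Fin.last m := Fin.ext hb
    rw [lastShift_last, permFst_apply]
    simp only [pr_swp m m le_rfl]
    simp; ring
  · rw [lastShift_ne hb, permFst_apply]
    have := i.2
    simp only [pr_swp m m le_rfl, if_pos (show (i : ℕ) < m by omega)]
    push_cast; ring

theorem affB_ΔB {m : ℕ} (i : Fin (m + 1)) (k : ℤ) :
    affB m (ΔB (m + 1)) (i, k) = (i, k + 1) := by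
  have key : ∀ (j : ℕ) (p : Fin (m + 1) × ℤ),
      (((affB m (ρB (m + 1)) ^ j) p).1 : ℤ) + (m + 1) * ((affB m (ρB (m + 1)) ^ j) p).2 =
      (p.1 : ℤ) + (m + 1) * p.2 + j := by
    intro j
    induction j with
    | zero => simp
    | succ j ih => intro p; rw [pow_succ, Perm.mul_apply, ih, affB_ρB]; push_cast; ring
  have h := key (m + 1) (i, k)
  rw [← map_pow] at h
  change ((affB m (ΔB (m + 1)) (i, k)).1 : ℤ) + (m + 1) * (affB m (ΔB (m + 1)) (i, k)).2 = _ at h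
  generalize affB m (ΔB (m + 1)) (i, k) = q at h ⊢
  obtain ⟨a, b⟩ := q
  simp only at h
  have ha := a.2
  have hi := i.2
  have hb : b = k + 1 := by
    have h2 : ((m : ℤ) + 1) * (b - (k + 1)) = i - a := by push_cast at h; linarith
    have h3 : |(b - (k + 1) : ℤ)| < 1 := by
      by_contra hcon
      push Not at hcon
      have : ((m : ℤ) + 1) * 1 ≤ |((m : ℤ) + 1) * (b - (k + 1))| := by
        rw [abs_mul, abs_of_pos (show (0 : ℤ) < (m : ℤ) + 1 by positivity)]
        exact mul_le_mul_of_nonneg_left hcon (by positivity)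
      rw [h2, le_abs'] at this
      omega
    have := Int.abs_lt_one_iff.1 h3
    linarith
  subst hb
  have : a = i := by
    ext
    push_cast at h
    have : (a : ℤ) = i := by linarith
    exact_mod_cast this
  rw [this]

/-- A root of the central element acts freely on the strands. -/
theorem dvd_of_pB_pow_fix {m : ℕ} {g : ArtinB (m + 1)}
    (hg : g ^ (m + 1) = ΔB (m + 1) ∨ g ^ (m + 1) = (ΔB (m + 1))⁻¹) {k : ℕ} {i : Fin (m + 1)}
    (h : (pB (m + 1) g ^ k) i = i) : m + 1 ∣ k := by
  obtain ⟨d, hd⟩ := affB_spec (g ^ k) i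
  rw [map_pow, map_pow, h] at hd
  have h1 : ∀ j : ℕ, ((affB m g ^ k) ^ j) (i, 0) = (i, j * d) := by
    intro j
    induction j with
    | zero => simp
    | succ j ih => rw [pow_succ', Perm.mul_apply, ih, hd]; push_cast; ring_nf
  have h2 : ∀ j : ℕ, (affB m (ΔB (m + 1)) ^ j) (i, 0) = (i, (j : ℤ)) := by
    intro j
    induction j with
    | zero => simp
    | succ j ih => rw [pow_succ', Perm.mul_apply, ih, affB_ΔB]; push_cast; rfl
  have h3 := h1 (m + 1)
  rw [← pow_mul, mul_comm, pow_mul, ← map_pow] at h3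
  rcases hg with hg | hg
  · rw [hg, h2] at h3
    have := congrArg Prod.snd h3
    simp only at this
    exact Int.natCast_dvd_natCast.1 ⟨d, this⟩
  · rw [hg, map_inv, inv_pow, Perm.inv_eq_iff_eq] at h3
    have h4 : ∀ (j : ℕ) (l : ℤ), (affB m (ΔB (m + 1)) ^ j) (i, l) = (i, l + j) := by
      intro j
      induction j with
      | zero => simp
      | succ j ih => intro l; rw [pow_succ', Perm.mul_apply, ih, affB_ΔB]; push_cast; ring_nf
    rw [h4] at h3
    have := congrArg Prod.snd h3
    simp only at this
    exact Int.natCast_dvd_natCast.1 ⟨-d, by push_cast at this ⊢; linarith⟩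

end Center

end ArtinAut

namespace ArtinAut

section CyclicRigidity

open Equiv
open scoped Fin.NatCast Fin.CommRing

theorem exists_conj_rot {m : ℕ} {c : Perm (Fin (m + 1))}
    (hc : ∀ k x, (c ^ k) x = x → m + 1 ∣ k) :
    ∃ σ : Perm (Fin (m + 1)), ∀ j, c (σ j) = σ (j + 1) := by
  let f : Fin (m + 1) → Fin (m + 1) := fun j => (c ^ (j : ℕ)) 0
  have hlt : ∀ i j : ℕ, i < j → j - i < m + 1 → (c ^ i) (0 : Fin (m + 1)) ≠ (c ^ j) 0 := by
    intro i j hij hj h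
    rw [← Nat.add_sub_of_le hij.le, pow_add, Perm.mul_apply] at h
    have := hc _ _ ((c ^ i).injective h).symm
    exact absurd (Nat.le_of_dvd (by omega) this) (by omega)
  have hf : Function.Injective f := by
    intro i j h
    rcases lt_trichotomy i j with h1 | h1 | h1
    · exact absurd h (hlt i j h1 (by omega))
    · exact h1
    · exact absurd h.symm (hlt j i h1 (by omega))
  have hb := Finite.injective_iff_bijective.1 hf
  have hn : (c ^ (m + 1)) (0 : Fin (m + 1)) = 0 := by
    obtain ⟨j, hj⟩ := hb.2 ((c ^ (m + 1)) 0)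
    by_cases h0 : (j : ℕ) = 0
    · rw [← hj]; simp only [f, h0, pow_zero, Perm.one_apply]
    · exact absurd hj (hlt j (m + 1) j.2 (by omega))
  refine ⟨Equiv.ofBijective f hb, fun j => ?_⟩
  change c ((c ^ (j : ℕ)) 0) = (c ^ ((j + 1 : Fin (m + 1)) : ℕ)) 0
  rw [← Perm.mul_apply, ← pow_succ', Fin.val_add_one]
  split_ifs with h
  · subst h; simpa using hn
  · rfl

theorem rot_pow {m : ℕ} {r : Perm (Fin (m + 1))} (hr : ∀ x, r x = x + 1) (k : ℕ)
    (x : Fin (m + 1)) : (r ^ k) x = x + (k : Fin (m + 1)) := by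
  induction k with
  | zero => simp
  | succ k ih => rw [pow_succ', Perm.mul_apply, ih, hr]; push_cast; rw [add_assoc]

theorem perm_five_aux : ∀ b : Perm (Fin 5), (∀ x, b (b (x - 2) + 2) = b (b x - 2) + 2) →
    (∀ x, b (b (b x - 1) + 1) = b (b (b (x - 1) + 1) - 1) + 1) →
    (∀ x, b (x + 1) = b x + 1) ∨ ∃ x, b = swap x (x + 1) := by decide +kernel

theorem perm_six_aux : ∀ b : Perm (Fin 6), (∀ x, b (b (x - 2) + 2) = b (b x - 2) + 2) →
    (∀ x, b (b (x - 3) + 3) = b (b x - 3) + 3) →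
    (∀ x, b (b (b x - 1) + 1) = b (b (b (x - 1) + 1) - 1) + 1) →
    (∀ x, b (x + 1) = b x + 1) ∨ ∃ x, b = swap x (x + 1) := by decide +kernel

/-- A permutation whose conjugates under the rotation satisfy the cyclic braid relations commutes
with the rotation or is a transposition of neighbours. -/
theorem cyclic_braid_perm {m : ℕ} {r b : Perm (Fin (m + 5))} (hr : ∀ x, r x = x + 1)
    (hb : IsBr (m + 4) fun i => r ^ i * b * (r ^ i)⁻¹) :
    Commute b r ∨ ∃ x, b = swap x (x + 1) := by
  have hri : ∀ (k : ℕ) x, (r ^ k)⁻¹ x = x - (k : Fin (m + 5)) := by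
    intro k x
    rw [Perm.inv_eq_iff_eq, rot_pow hr, sub_add_cancel]
  obtain ⟨s, hsdef⟩ : ∃ s : ℕ → Perm (Fin (m + 5)), s = fun i => r ^ i * b * (r ^ i)⁻¹ := ⟨_, rfl⟩
  rw [← hsdef] at hb
  have hs : ∀ (k : ℕ) x, s k x = b (x - (k : Fin (m + 5))) + (k : Fin (m + 5)) := by
    intro k x
    rw [hsdef, Perm.mul_apply, Perm.mul_apply, hri, rot_pow hr]
  have hfin : (∀ x, b (x + 1) = b x + 1) → Commute b r := by
    intro h; ext x; simp only [Perm.mul_apply, hr, h]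
  have c2 := (hb.comm 0 2 (by omega) (by omega)).eq
  have b01 := hb.braid 0 (by omega)
  have e2 : ∀ x, b (b (x - 2) + 2) = b (b x - 2) + 2 := by
    intro x
    have := Perm.congr_fun c2 x
    simpa [hs] using this
  have e1 : ∀ x, b (b (b x - 1) + 1) = b (b (b (x - 1) + 1) - 1) + 1 := by
    intro x
    have := Perm.congr_fun b01 x
    simpa [hs] using this
  by_cases h5 : m = 0
  · subst h5
    rcases perm_five_aux b e2 e1 with h | h
    · exact Or.inl (hfin h)
    · exact Or.inr h
  by_cases h6 : m = 1
  · subst h6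
    have c3 := (hb.comm 0 3 (by omega) (by omega)).eq
    have e3 : ∀ x, b (b (x - 3) + 3) = b (b x - 3) + 3 := by
      intro x
      have := Perm.congr_fun c3 x
      simpa [hs] using this
    rcases perm_six_aux b e2 e3 e1 with h | h
    · exact Or.inl (hfin h)
    · exact Or.inr h
  have hadd : ∀ k i, s (k + i) = MulAut.conj (r ^ k) (s i) := by
    intro k i
    simp only [hsdef, MulAut.conj_apply, pow_add, mul_inv_rev]; simp only [mul_assoc]
  have hbk : ∀ k, IsBr (m + 4) fun i => s (k + i) := by
    intro k
    have := hb.map (MulAut.conj (r ^ k)).toMonoidHom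
    simp only [hadd]
    exact this
  have hper : ∀ i, s (i + (m + 5)) = s i := by
    have : r ^ (m + 5) = 1 := by
      ext x; rw [rot_pow hr]; simp
    intro i
    simp only [hsdef, pow_add, this, mul_one]
  have supp : ∀ k x, s k x ≠ x → ∀ i j, 2 ≤ i → i ≤ m + 3 → 2 ≤ j → j ≤ m + 3 →
      s (k + i) x = s (k + j) x := by
    intro k x hx
    let t : ℕ → Perm (Fin (m + 5)) := fun i => if i + 2 < m + 4 then s (k + (i + 2)) else 1
    have ht : IsBr (m + 2) t := by
      refine ⟨fun i hi => ?_, fun i j hij hj => ?_⟩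
      · simp only [t]
        rw [if_pos (by omega), if_pos (by omega)]; exact (hbk k).braid (i + 2) (by omega)
      · simp only [t]
        rw [if_pos (by omega), if_pos (by omega)]
        exact (hbk k).comm (i + 2) (j + 2) (by omega) (by omega)
    have hc : ∀ i, Commute (s k) (t i) := by
      intro i
      simp only [t]
      split_ifs with hi
      · exact (hbk k).comm 0 (i + 2) (by omega) hi
      · exact Commute.one_right _
    intro i j hi hi' hj hj'
    have := ht.eq_on_support (by omega) hc (fun Y _ hY s' hs' => hs'.allEq_of_card (by omega)
      (by rw [Fintype.card_fin] at hY; omega)) (i := i - 2) (j := j - 2) (by omega) (by omega) hx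
    simp only [t] at this
    rwa [if_pos (by omega), if_pos (by omega), show i - 2 + 2 = i by omega,
      show j - 2 + 2 = j by omega] at this
  have htr : ∀ x y : Fin (m + 5), ∃ j : ℕ, j < m + 5 ∧ y = x + (j : Fin (m + 5)) := by
    intro x y
    exact ⟨(y - x : Fin (m + 5)), (y - x).2, by simp⟩
  have hs0 : s 0 = b := by simp [hsdef]
  by_cases hcom : ∃ x, s 0 x ≠ x ∧ s 2 x ≠ x
  · left
    obtain ⟨x, h0, h2⟩ := hcom
    have all : ∃ x y, y ≠ x ∧ ∀ i, i < m + 5 → s i x = y := by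
      have g : ∀ i, 2 ≤ i → i ≤ m + 3 → s i x = s 2 x := by
        intro i hi hi'
        have := supp 0 x h0 i 2 hi hi' le_rfl (by omega)
        simpa using this
      have g2 : ∀ i, 4 ≤ i → i ≤ m + 5 → s i x = s 2 x := by
        intro i hi hi'
        rw [← g 4 (by omega) (by omega)]
        have := supp 2 x h2 (i - 2) 2 (by omega) (by omega) le_rfl (by omega)
        rwa [show 2 + (i - 2) = i by omega] at this
      have h4 : s 4 x ≠ x := by rw [g 4 (by omega) (by omega)]; exact h2
      have g4 : ∀ i, 6 ≤ i → i ≤ m + 7 → s i x = s 2 x := by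
        intro i hi hi'
        rw [← g2 6 (by omega) (by omega)]
        have := supp 4 x h4 (i - 4) 2 (by omega) (by omega) le_rfl (by omega)
        rwa [show 4 + (i - 4) = i by omega] at this
      refine ⟨x, s 2 x, h2, fun i hi => ?_⟩
      rcases lt_or_ge i 2 with h | h
      · rw [← hper, g4 _ (by omega) (by omega)]
      · by_cases h' : i ≤ m + 3
        · exact g i h h'
        · exact g2 i (by omega) (by omega)
    obtain ⟨x, y, -, hxy⟩ := all
    have hxy' : ∀ i, s i x = y := by
      intro i
      induction i using Nat.strong_induction_on with
      | _ i ih =>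
        rcases lt_or_ge i (m + 5) with h | h
        · exact hxy i h
        · obtain ⟨j, rfl⟩ := Nat.exists_eq_add_of_le' h
          rw [hper]; exact ih j (by omega)
    have hxk : ∀ k i : ℕ, s i (x + (k : Fin (m + 5))) = y + (k : Fin (m + 5)) := by
      intro k
      have base : ∀ i, s (k + i) (x + (k : Fin (m + 5))) = y + (k : Fin (m + 5)) := by
        intro i
        rw [hadd, MulAut.conj_apply, Perm.mul_apply, Perm.mul_apply, hri, rot_pow hr,
          add_sub_cancel_right, hxy']
      intro i
      have hmul : ∀ l, s (i + l * (m + 5)) = s i := by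
        intro l
        induction l with
        | zero => simp
        | succ l ih => rw [add_mul, one_mul, ← add_assoc, hper, ih]
      rw [← hmul k, show i + k * (m + 5) = k + (i + k * (m + 4)) by ring]
      exact base _
    have h10 : s 1 = s 0 := by
      ext z
      obtain ⟨j, -, rfl⟩ := htr x z
      rw [hxk, hxk]
    have : r * b * r⁻¹ = b := by
      have := h10; rw [hs0] at this; simpa [hsdef] using this
    exact (mul_inv_eq_iff_eq_mul.1 this).symm
  · push Not at hcom
    by_cases hb1 : ∀ x, b x = x
    · left; rw [show b = 1 from Perm.ext hb1]; exact Commute.one_left _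
    right
    push Not at hb1
    have disj : ∀ x j, 2 ≤ j → j ≤ m + 3 → b x ≠ x → s j x = x := by
      intro x j hj hj' hx
      rw [← hs0] at hx
      have := supp 0 x hx j 2 hj hj' le_rfl (by omega)
      rw [zero_add, zero_add] at this
      rw [this]; exact hcom x hx
    have near : ∀ x j : ℕ, ∀ z : Fin (m + 5), b z ≠ z → b (z + (j : Fin (m + 5))) ≠ z + (j : Fin (m + 5)) →
        j < m + 5 → j = 0 ∨ j = 1 ∨ j = m + 4 := by
      intro _ j z hz hzj hj
      by_contra hcon
      have := disj (z + (j : Fin (m + 5))) j (by omega) (by omega) hzj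
      rw [hs, add_sub_cancel_right, add_left_inj] at this
      exact hz this
    have hlast : ((m + 4 : ℕ) : Fin (m + 5)) + 1 = 0 := by
      have : ((m + 5 : ℕ) : Fin (m + 5)) = 0 := by simp
      rw [← this]; push_cast; ring
    have key : ∃ x, b x ≠ x ∧ b (x + 1) ≠ x + 1 := by
      obtain ⟨x, hx⟩ := hb1
      obtain ⟨j, hj, hxj⟩ := htr x (b x)
      have hbx : b (b x) ≠ b x := fun h => hx (b.injective h)
      rcases near 0 j x hx (by rw [← hxj]; exact hbx) hj with rfl | rfl | rfl
      · simp at hxj; exact absurd hxj hx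
      · refine ⟨x, hx, ?_⟩
        have : b x = x + 1 := by simpa using hxj
        rw [this] at hbx; exact hbx
      · refine ⟨b x, hbx, ?_⟩
        rw [show b x + 1 = x by rw [hxj, add_assoc, hlast, add_zero]]
        exact hx
    obtain ⟨x, hx, hx1⟩ := key
    have only : ∀ z, b z ≠ z → z = x ∨ z = x + 1 := by
      intro z hz
      obtain ⟨j, hj, rfl⟩ := htr x z
      rcases near 0 j x hx hz hj with rfl | rfl | rfl
      · left; simp
      · right; simp
      · exfalso
        have h2 : x + ((m + 4 : ℕ) : Fin (m + 5)) = x + 1 + ((m + 3 : ℕ) : Fin (m + 5)) := by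
          push_cast; ring
        rw [h2] at hz
        rcases near 0 (m + 3) (x + 1) hx1 hz (by omega) with h | h | h <;> omega
    refine ⟨x, ?_⟩
    have hbx : b x = x + 1 := by
      rcases only (b x) (fun h => hx (b.injective h)) with h | h
      · exact absurd h hx
      · exact h
    have hbx1 : b (x + 1) = x := by
      rcases only (b (x + 1)) (fun h => hx1 (b.injective h)) with h | h
      · exact h
      · exact absurd h hx1
    ext z
    by_cases h : b z = z
    · rw [h, swap_apply_of_ne_of_ne]
      · rintro rfl; exact hx h
      · rintro rfl; exact hx1 h
    · rcases only z h with rfl | rfl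
      · rw [swap_apply_left, hbx]
      · rw [swap_apply_right, hbx1]

end CyclicRigidity

end ArtinAut

namespace ArtinAut

section StrandPermutation

open Equiv

theorem sB_eq_conj_ρB {m i : ℕ} (hi : i ≤ m) :
    sB (m + 2) i = ρB (m + 2) ^ i * sB (m + 2) 0 * (ρB (m + 2) ^ i)⁻¹ := by
  induction i with
  | zero => simp
  | succ i ih =>
    have h := ρB_mul_sB (n := m + 2) (i := i) (by omega)
    rw [← mul_inv_eq_iff_eq_mul.2 h, ih (by omega), pow_succ']
    group

theorem hom_ext_rot_zero {H : Type*} [Group H] {m : ℕ} {f g : ArtinB (m + 2) →* H}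
    (h0 : f (sB (m + 2) 0) = g (sB (m + 2) 0)) (hρ : f (ρB (m + 2)) = g (ρB (m + 2))) : f = g := by
  refine hom_ext_rot (fun i hi => ?_) hρ
  rw [sB_eq_conj_ρB hi]
  simp only [map_mul, map_inv, map_pow, h0, hρ]

/-- Automorphisms induce inner automorphisms on the permutations of the strands. -/
theorem exists_pB_aut {m : ℕ} (f : MulAut (ArtinB (m + 5))) :
    ∃ σ : Perm (Fin (m + 5)), ∀ g, pB (m + 5) (f g) = σ * pB (m + 5) g * σ⁻¹ := by
  obtain ⟨r, hr⟩ : ∃ r, r = pB (m + 5) (ρB (m + 5)) := ⟨_, rfl⟩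
  have hr1 : ∀ x, r x = x + 1 := by rw [hr]; exact pB_ρB (m + 4)
  obtain ⟨σ, hσ⟩ := exists_conj_rot (m := m + 4) (c := pB (m + 5) (f (ρB (m + 5)))) fun k x hx => by
    refine dvd_of_pB_pow_fix ?_ hx
    rw [← map_pow]
    exact aut_ΔB f
  let ψ : ArtinB (m + 5) →* Perm (Fin (m + 5)) :=
    (MulAut.conj σ⁻¹).toMonoidHom.comp ((pB (m + 5)).comp f.toMonoidHom)
  have hψ : ∀ g, ψ g = σ⁻¹ * pB (m + 5) (f g) * σ := fun g => by
    change MulAut.conj σ⁻¹ (pB (m + 5) (f g)) = _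
    rw [MulAut.conj_apply, inv_inv]
  have hψs : Function.Surjective ψ := by
    intro p
    obtain ⟨g, hg⟩ := pB_surjective (m + 5) (σ * p * σ⁻¹)
    obtain ⟨h, rfl⟩ := f.surjective g
    exact ⟨h, by rw [hψ, hg]; group⟩
  have hψρ : ψ (ρB (m + 5)) = r := by
    rw [hψ]
    ext x
    rw [hr1, Perm.mul_apply, Perm.mul_apply, hσ]; simp
  have hψr : ∀ i, i ≤ m + 3 →
      ψ (sB (m + 5) i) = r ^ i * ψ (sB (m + 5) 0) * (r ^ i)⁻¹ := by
    intro i hi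
    conv_lhs => rw [sB_eq_conj_ρB (m := m + 3) hi]
    simp only [map_mul, map_inv, map_pow, hψρ]
  have hbr := (isArtB_sB (m + 5)).isBr.map ψ
  have hbr' : IsBr (m + 4) fun i => r ^ i * ψ (sB (m + 5) 0) * (r ^ i)⁻¹ := by
    refine ⟨fun i hi => ?_, fun i j hij hj => ?_⟩
    · simp only [← hψr i (by omega), ← hψr (i + 1) (by omega)]
      exact hbr.braid i hi
    · simp only [← hψr i (by omega), ← hψr j (by omega)]
      exact hbr.comm i j hij hj
  rcases cyclic_braid_perm hr1 hbr' with h | ⟨x, hx⟩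
  · exfalso
    have hcen : ∀ g, Commute (ψ g) r := by
      intro g
      have : ∀ g, g ∈ (Subgroup.centralizer {r}).comap ψ := by
        refine mem_of_sB fun i hi => ?_
        have hs : ∀ i, i ≤ m + 3 → sB (m + 5) i ∈ (Subgroup.centralizer {r}).comap ψ := by
          intro i hi
          rw [Subgroup.mem_comap, Subgroup.mem_centralizer_singleton_iff, hψr i hi]
          have hp : Commute (r ^ i) r := (Commute.refl r).pow_left i
          exact ((hp.mul_left h).mul_left hp.inv_left).eq
        by_cases hi' : i ≤ m + 3
        · exact hs i hi'
        · obtain rfl : i = m + 4 := by omega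
          rw [sB_last (m + 3)]
          refine mul_mem (inv_mem (pr_mem fun i _ hi => hs i (by omega))) ?_
          rw [Subgroup.mem_comap, Subgroup.mem_centralizer_singleton_iff]
          exact (hψρ ▸ rfl)
      exact Subgroup.mem_centralizer_singleton_iff.1 (this g)
    obtain ⟨g, hg⟩ := hψs (swap 0 1)
    have h1 := Perm.congr_fun (hcen g).eq 1
    rw [hg, Perm.mul_apply, Perm.mul_apply, hr1, hr1, swap_apply_right, zero_add,
      swap_apply_of_ne_of_ne] at h1
    · have := congrArg Fin.val h1
      simp [Fin.val_add, Nat.mod_eq_of_lt (show 2 < m + 5 by omega)] at this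
    · intro h2; have := congrArg Fin.val h2
      simp [Fin.val_add, Nat.mod_eq_of_lt (show 2 < m + 5 by omega)] at this
    · intro h2; have := congrArg Fin.val h2
      simp [Fin.val_add, Nat.mod_eq_of_lt (show 2 < m + 5 by omega)] at this
  · have hrp := rot_pow hr1
    refine ⟨σ * r ^ (x : ℕ), fun g => ?_⟩
    have hrx : ∀ y, (r ^ (x : ℕ)) y = y + x := by
      intro y
      rw [hrp]
      congr 1
      exact Fin.cast_val_eq_self x
    have : ψ = (MulAut.conj (r ^ (x : ℕ))).toMonoidHom.comp (pB (m + 5)) := by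
      refine hom_ext_rot_zero (m := m + 3) ?_ ?_
      · rw [hx]
        change _ = MulAut.conj (r ^ (x : ℕ)) (pB (m + 5) (sB (m + 5) 0))
        rw [pB_sB (by omega), swp, dif_pos (by omega), MulAut.conj_apply, ← swap_apply_apply, hrx,
          hrx, add_comm x]
        congr 1
        exact (zero_add x).symm
      · rw [hψρ]
        change _ = MulAut.conj (r ^ (x : ℕ)) (pB (m + 5) (ρB (m + 5)))
        rw [← hr, MulAut.conj_apply]; group
    have h1 := congrArg (fun F : ArtinB (m + 5) →* _ => F g) this
    change ψ g = MulAut.conj (r ^ (x : ℕ)) (pB (m + 5) g) at h1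
    rw [hψ, MulAut.conj_apply] at h1
    rw [show pB (m + 5) (f g) = σ * (σ⁻¹ * pB (m + 5) (f g) * σ) * σ⁻¹ by group, h1]
    group

end StrandPermutation

end ArtinAut

namespace ArtinAut

section Forgetting

variable {n : ℕ}

open Classical in
/-- The endomorphism of the free group killing the letters outside `S`. -/
noncomputable def eS (S : Set (Fin n)) : FreeGroup (Fin n) →* FreeGroup (Fin n) :=
  FreeGroup.lift fun i => if i ∈ S then FreeGroup.of i else 1

theorem eS_of_mem {S : Set (Fin n)} {i : Fin n} (h : i ∈ S) :
    eS S (FreeGroup.of i) = FreeGroup.of i := by simp [eS, h]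

theorem eS_of_notMem {S : Set (Fin n)} {i : Fin n} (h : i ∉ S) :
    eS S (FreeGroup.of i) = 1 := by simp [eS, h]

theorem eS_Φ_eS {S S' : Set (Fin n)} {h : ArtinB n} (hS : ∀ i, pB n h i ∈ S' → i ∈ S)
    (y : FreeGroup (Fin n)) : eS S' (Φ n h (eS S y)) = eS S' (Φ n h y) := by
  have : ((eS S').comp (Φ n h).toMonoidHom).comp (eS S) = (eS S').comp (Φ n h).toMonoidHom := by
    refine FreeGroup.ext_hom _ _ fun i => ?_
    by_cases hi : i ∈ S
    · simp [eS_of_mem hi]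
    · have h2 := (eS S').map_isConj (isConj_Φ_of h i)
      rw [eS_of_notMem fun h3 => hi (hS i h3), isConj_one_left] at h2
      simp [eS_of_notMem hi, h2]
  exact DFunLike.congr_fun this y

theorem eS_eS (S : Set (Fin n)) (y : FreeGroup (Fin n)) : eS S (eS S y) = eS S y := by
  simpa using eS_Φ_eS (S := S) (S' := S) (h := 1) (by simp) y

/-- The pure elements acting trivially after killing the letters outside `S`. -/
noncomputable def KB (n : ℕ) (S : Set (Fin n)) : Subgroup (ArtinB n) where
  carrier := {g | pB n g = 1 ∧ ∀ y, eS S (Φ n g y) = eS S y}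
  one_mem' := by simp
  mul_mem' := fun {a b} ha hb => ⟨by rw [map_mul, ha.1, hb.1, one_mul], fun y => by
    rw [map_mul, MulAut.mul_apply, ha.2, hb.2]⟩
  inv_mem' := fun {a} ha => ⟨by rw [map_inv, ha.1, inv_one], fun y => by
    rw [← ha.2, map_inv, ← MulAut.mul_apply, mul_inv_cancel, MulAut.one_apply]⟩

theorem mem_KB {S : Set (Fin n)} {g : ArtinB n} :
    g ∈ KB n S ↔ pB n g = 1 ∧ ∀ y, eS S (Φ n g y) = eS S y := Iff.rfl

theorem KB_conj {S S' : Set (Fin n)} {g h : ArtinB n} (hg : g ∈ KB n S)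
    (hS : ∀ i, pB n h i ∈ S' → i ∈ S) : h * g * h⁻¹ ∈ KB n S' := by
  refine ⟨by rw [map_mul, map_mul, hg.1, mul_one, ← map_mul, mul_inv_cancel, map_one], fun y => ?_⟩
  rw [map_mul, map_mul, MulAut.mul_apply, MulAut.mul_apply, ← eS_Φ_eS hS, hg.2, eS_Φ_eS hS,
    ← MulAut.mul_apply, ← map_mul, mul_inv_cancel, map_one, MulAut.one_apply]

theorem KB_mono {S S' : Set (Fin n)} (h : S' ⊆ S) : KB n S ≤ KB n S' := fun g hg => by
  simpa using KB_conj (S' := S') (h := 1) hg (fun i hi => h (by simpa using hi))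

/-- After killing the letters outside `S`, the element `g` acts as conjugation by `v`. -/
def ConjOn (S : Set (Fin n)) (g : ArtinB n) (v : FreeGroup (Fin n)) : Prop :=
  eS S v = v ∧ ∀ y, eS S (Φ n g y) = v * eS S y * v⁻¹

theorem ConjOn.mul {S : Set (Fin n)} {g h : ArtinB n} {v w : FreeGroup (Fin n)}
    (hg : ConjOn S g v) (hh : ConjOn S h w) : ConjOn S (g * h) (v * w) := by
  refine ⟨by rw [map_mul, hg.1, hh.1], fun y => ?_⟩
  rw [map_mul, MulAut.mul_apply, hg.2, hh.2]; group

theorem ConjOn.inv {S : Set (Fin n)} {g : ArtinB n} {v : FreeGroup (Fin n)}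
    (hg : ConjOn S g v) : ConjOn S g⁻¹ v⁻¹ := by
  refine ⟨by rw [map_inv, hg.1], fun y => ?_⟩
  have h := hg.2 (Φ n g⁻¹ y)
  rw [← MulAut.mul_apply, ← map_mul, mul_inv_cancel, map_one, MulAut.one_apply] at h
  rw [h]; group

theorem conjOn_one (S : Set (Fin n)) : ConjOn S 1 1 := ⟨map_one _, fun y => by simp⟩

theorem mem_KB_iff_conjOn {S : Set (Fin n)} {g : ArtinB n} :
    g ∈ KB n S ↔ pB n g = 1 ∧ ConjOn S g 1 := by
  rw [mem_KB, ConjOn]; simp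

theorem ConjOn.unique {S : Set (Fin n)} {g : ArtinB n} {v w : FreeGroup (Fin n)} {i j : Fin n}
    (hij : i ≠ j) (hi : i ∈ S) (hj : j ∈ S) (hv : ConjOn S g v) (hw : ConjOn S g w) : v = w := by
  have h : ∀ k ∈ S, Commute (FreeGroup.of k) (w⁻¹ * v) := fun k hk => by
    have h1 := (hv.2 (FreeGroup.of k)).symm.trans (hw.2 (FreeGroup.of k))
    rw [eS_of_mem hk] at h1
    have h2 : v * FreeGroup.of k = w * FreeGroup.of k * w⁻¹ * v := by rw [← h1]; group
    rw [commute_iff_eq, mul_assoc, h2]; group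
  obtain ⟨a, ha⟩ := mem_zpowers_of_commute_of (h i hi)
  obtain ⟨b, hb⟩ := mem_zpowers_of_commute_of (h j hj)
  have h1 : (FreeGroup.of i) ^ a = (FreeGroup.of j) ^ b := ha.trans hb.symm
  have h2 := congrArg (expo i) h1
  rw [map_zpow, map_zpow, expo_of_self, expo_of_ne hij.symm, one_zpow, ← ofAdd_zsmul, ofAdd_eq_one,
    smul_eq_mul, mul_one] at h2
  subst h2
  have h3 : w⁻¹ * v = 1 := by rw [← ha]; exact zpow_zero _
  exact (inv_mul_eq_one.1 h3).symm

theorem ConjOn.of_Φ {S : Set (Fin n)} {g : ArtinB n} {v : FreeGroup (Fin n)} (hv : eS S v = v)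
    (h : ∀ i ∈ S, eS S (Φ n g (FreeGroup.of i)) = v * FreeGroup.of i * v⁻¹)
    (hp : ∀ i ∈ S, pB n g i = i) : ConjOn S g v := by
  refine ⟨hv, fun y => ?_⟩
  have : (eS S).comp (Φ n g).toMonoidHom = (MulAut.conj v).toMonoidHom.comp (eS S) := by
    refine FreeGroup.ext_hom _ _ fun i => ?_
    by_cases hi : i ∈ S
    · simp [eS_of_mem hi, h i hi]
    · have h2 := (eS S).map_isConj (isConj_Φ_of g i)
      rw [eS_of_notMem fun h3 => hi ?_, isConj_one_left] at h2
      · simp [eS_of_notMem hi, h2]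
      · have := hp _ h3
        exact (pB n g).injective this ▸ h3
  simpa using DFunLike.congr_fun this y

/-- The subgroup of elements fixing the first two strands. -/
noncomputable def K01 (n : ℕ) : Subgroup (ArtinB n) where
  carrier := {g | ∀ i : Fin n, (i : ℕ) < 2 → pB n g i = i}
  one_mem' := by simp
  mul_mem' := fun {a b} ha hb i hi => by rw [map_mul, Equiv.Perm.mul_apply, hb i hi, ha i hi]
  inv_mem' := fun {a} ha i hi => by
    rw [map_inv, Equiv.Perm.inv_eq_iff_eq]; exact (ha i hi).symm

/-- The first two strands. -/
def S01 (n : ℕ) : Set (Fin n) := {i | (i : ℕ) < 2}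

theorem le_of_K01 {m : ℕ} {L : Subgroup (ArtinB (m + 2))}
    (hs : ∀ i, 2 ≤ i → i < m + 2 → sB (m + 2) i ∈ L) (h0 : sB (m + 2) 0 ^ 2 ∈ L)
    (h1 : sB (m + 2) 1 ^ 2 ∈ L) (hb : bB (sB (m + 2)) 1 ∈ L)
    (hX0 : Xo (sB (m + 2)) (m + 2) 0 ∈ L) (hX1 : Xo (sB (m + 2)) (m + 2) 1 ∈ L) :
    K01 (m + 2) ≤ L := by
  have hι : ∀ y, ι1 (m + 1) y ∈ L := by
    intro y
    change y ∈ L.comap (ι1 (m + 1))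
    refine mem_of_xF (fun i hi => ?_) y
    rw [Subgroup.mem_comap]
    rcases Nat.lt_succ_iff_lt_or_eq.1 hi with hi' | rfl
    · rw [ι1_xF hi']
      clear hi
      induction i with
      | zero => simpa [bB] using h0
      | succ i ih =>
        rcases Nat.eq_zero_or_pos i with rfl | hi0
        · exact hb
        · rw [bB_succ]
          exact L.mul_mem (L.mul_mem (L.inv_mem (hs _ (by omega) (by omega))) (ih (by omega)))
            (hs _ (by omega) (by omega))
    · rw [ι1_xF_last]; exact hX0
  have hι' : ∀ y, sh (m + 1) (ι1 m y) ∈ L := by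
    intro y
    change y ∈ L.comap ((sh (m + 1)).comp (ι1 m))
    refine mem_of_xF (fun i hi => ?_) y
    rw [Subgroup.mem_comap, MonoidHom.comp_apply]
    rcases Nat.lt_succ_iff_lt_or_eq.1 hi with hi' | rfl
    · rw [ι1_xF hi']
      clear hi
      induction i with
      | zero => simpa [bB, sh_sB] using h1
      | succ i ih =>
        rw [bB_succ, map_mul, map_mul, map_inv, sh_sB (by omega)]
        exact L.mul_mem (L.mul_mem (L.inv_mem (hs _ (by omega) (by omega))) (ih (by omega)))
          (hs _ (by omega) (by omega))
    · rw [ι1_xF_last]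
      have : sh (i + 1) (Xo (sB (i + 1)) (i + 1) 0) = Xo (sB (i + 2)) (i + 2) 1 := by
        simp only [Xo, map_mul, map_inv, map_pr]
        have hp : pr (fun k => sh (i + 1) (sB (i + 1) k)) 0 (i + 1 - 1 - 0) =
            pr (sB (i + 2)) 1 (i + 2 - 1 - 1) := by
          rw [pr_congr (t := fun k => sB (i + 2) (k + 1)) fun k _ hk => sh_sB (by omega), pr_shift]
          simp
        rw [hp, sh_sB (by omega)]
        simp
      rw [this]; exact hX1
  have hsh : ∀ h, sh (m + 1) (sh m h) ∈ L := by
    intro h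
    change h ∈ L.comap ((sh (m + 1)).comp (sh m))
    refine mem_of_sB (fun i hi => ?_) h
    rw [Subgroup.mem_comap, MonoidHom.comp_apply, sh_sB hi, sh_sB (by omega)]
    exact hs _ (by omega) (by omega)
  intro g hg
  obtain ⟨y, h, rfl⟩ := mem_stab0.1 (mem_stab0_iff.2 (hg 0 (by simp)))
  have hh : pB (m + 1) h 0 = 0 := by
    have h2 := hg (Fin.succ 0) (by simp)
    rw [map_mul, pB_ι1, one_mul, (pB_sh h).2] at h2
    exact Fin.succ_injective _ h2
  obtain ⟨z, k, rfl⟩ := mem_stab0.1 (mem_stab0_iff.2 hh)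
  rw [map_mul]
  exact L.mul_mem (hι y) (L.mul_mem (hι' z) (hsh k))

end Forgetting

end ArtinAut

namespace ArtinAut

section MulOn

variable {G H : Type*} [Group G] [Group H]

/-- `f` is multiplicative on `K`. -/
def IsMulOn (K : Subgroup G) (f : G → H) : Prop := ∀ a ∈ K, ∀ b ∈ K, f (a * b) = f a * f b

theorem IsMulOn.one {K : Subgroup G} {f : G → H} (h : IsMulOn K f) : f 1 = 1 := by
  have := h 1 K.one_mem 1 K.one_mem
  rwa [mul_one, left_eq_mul] at this

theorem IsMulOn.inv {K : Subgroup G} {f : G → H} (h : IsMulOn K f) {a : G} (ha : a ∈ K) :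
    f a⁻¹ = (f a)⁻¹ := by
  have := h a ha a⁻¹ (K.inv_mem ha)
  rw [mul_inv_cancel, h.one] at this
  exact (inv_eq_of_mul_eq_one_right this.symm).symm

theorem IsMulOn.commute {K : Subgroup G} {f : G → H} (h : IsMulOn K f) {a b : G} (ha : a ∈ K)
    (hb : b ∈ K) (hab : Commute a b) : Commute (f a) (f b) := by
  rw [commute_iff_eq, ← h a ha b hb, ← h b hb a ha, hab.eq]

/-- The elements of `K` satisfying a relation that is compatible with products. -/
def IsMulOn.eqRel {L : Type*} [Group L] {K : Subgroup G} {f : G → H} (h : IsMulOn K f)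
    (R : G → L → Prop) (h1 : R 1 1) (hm : ∀ a b v w, R a v → R b w → R (a * b) (v * w))
    (hi : ∀ a v, R a v → R a⁻¹ v⁻¹) (β : L →* H) : Subgroup G where
  carrier := {g | g ∈ K ∧ ∃ v, R g v ∧ f g = β v}
  one_mem' := ⟨K.one_mem, 1, h1, by rw [h.one, map_one]⟩
  mul_mem' := by
    rintro a b ⟨ha, v, hv, hv'⟩ ⟨hb, w, hw, hw'⟩
    exact ⟨K.mul_mem ha hb, v * w, hm _ _ _ _ hv hw, by rw [h a ha b hb, hv', hw', map_mul]⟩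
  inv_mem' := by
    rintro a ⟨ha, v, hv, hv'⟩
    exact ⟨K.inv_mem ha, v⁻¹, hi _ _ hv, by rw [h.inv ha, hv', map_inv]⟩

/-- The elements of `K` whose image under `f` commutes with `u`. -/
def IsMulOn.centralizing {K : Subgroup G} {f : G → H} (h : IsMulOn K f) (u : H) : Subgroup G where
  carrier := {g | g ∈ K ∧ Commute u (f g)}
  one_mem' := ⟨K.one_mem, by rw [h.one]; exact Commute.one_right u⟩
  mul_mem' := by
    rintro a b ⟨ha, ha'⟩ ⟨hb, hb'⟩
    exact ⟨K.mul_mem ha hb, by rw [h a ha b hb]; exact ha'.mul_right hb'⟩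
  inv_mem' := by
    rintro a ⟨ha, ha'⟩
    exact ⟨K.inv_mem ha, by rw [h.inv ha]; exact ha'.inv_right⟩

end MulOn

section Relations

variable {H : Type*} [Group H]

theorem IsArtB.commute_XX {n : ℕ} {s : ℕ → H} (h : IsArtB n s) {k : ℕ} (hk : k + 1 < n) :
    Commute ((Xo s n k * Xo s n (k + 1))⁻¹ * s k ^ 2) (Xo s n k) ∧
    Commute ((Xo s n k * Xo s n (k + 1))⁻¹ * s k ^ 2) (Xo s n (k + 1)) := by
  have h1 := h.Xo_key hk
  have h2 := Xo_succ s hk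
  set a := Xo s n k with ha
  set b := Xo s n (k + 1) with hb
  have h3 : s k * b * (s k)⁻¹ = a := h2.symm
  have h4 : s k ^ 2 * b * (s k ^ 2)⁻¹ = a * b * a⁻¹ := by
    rw [← h1, ← h3, pow_two]; group
  have h5 : s k ^ 2 * a * (s k ^ 2)⁻¹ = a * b * a * b⁻¹ * a⁻¹ := by
    calc s k ^ 2 * a * (s k ^ 2)⁻¹ = s k * (s k * a * (s k)⁻¹) * (s k)⁻¹ := by rw [pow_two]; group
      _ = s k * (a * b * a⁻¹) * (s k)⁻¹ := by rw [h1]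
      _ = (s k * a * (s k)⁻¹) * (s k * b * (s k)⁻¹) * (s k * a * (s k)⁻¹)⁻¹ := by group
      _ = _ := by rw [h1, h3]; group
  constructor
  · rw [commute_iff_eq, mul_assoc, mul_inv_eq_iff_eq_mul.1 h5]; group
  · rw [commute_iff_eq, mul_assoc, mul_inv_eq_iff_eq_mul.1 h4]; group

theorem bB_one (s : ℕ → H) : bB s 1 = ((s 1)⁻¹ * s 0 ^ 2 * s 1)⁻¹ := by
  rw [bB, pr_one]; group

/-- The analogue of `IsArtB.commute_XX` for the strands `0` and `2`. -/
theorem IsArtB.commute_X02 {n : ℕ} {s : ℕ → H} (h : IsArtB n s) (hn : 2 < n) :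
    Commute ((Xo s n 0 * Xo s n 2)⁻¹ * (bB s 1)⁻¹) (Xo s n 0) ∧
    Commute ((Xo s n 0 * Xo s n 2)⁻¹ * (bB s 1)⁻¹) (Xo s n 2) := by
  have h1 := h.commute_XX (k := 0) (by omega)
  have h2 : (s 1)⁻¹ * Xo s n 0 * s 1 = Xo s n 0 := by
    rw [mul_assoc, ← (h.commute_Xo_of_gt (k := 1) (j := 0) (by omega) hn).eq]; group
  have h3 : (s 1)⁻¹ * Xo s n 1 * s 1 = Xo s n 2 := by
    rw [Xo_succ s (i := 1) (by omega)]; group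
  have hc : ∀ x, MulAut.conj (s 1)⁻¹ x = (s 1)⁻¹ * x * s 1 := fun x => by simp
  have h4 : MulAut.conj (s 1)⁻¹ ((Xo s n 0 * Xo s n (0 + 1))⁻¹ * s 0 ^ 2) =
      (Xo s n 0 * Xo s n 2)⁻¹ * (bB s 1)⁻¹ := by
    rw [map_mul, map_inv, map_mul, hc, hc, hc, h2, zero_add, h3, bB_one, inv_inv]
  constructor
  · have := (h1.1).map (MulAut.conj (s 1)⁻¹)
    rwa [h4, hc, h2] at this
  · have := (h1.2).map (MulAut.conj (s 1)⁻¹)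
    rwa [h4, hc, zero_add, h3] at this

/-- The full twist on three strands. -/
theorem IsBr.commute_twist {n : ℕ} {s : ℕ → H} (h : IsBr n s) (hn : 1 < n) :
    Commute (s 0 ^ 2 * s 1 ^ 2 * (bB s 1)⁻¹) (s 0) ∧
    Commute (s 0 ^ 2 * s 1 ^ 2 * (bB s 1)⁻¹) (s 1) := by
  have hb := h.braid 0 (by omega)
  rw [zero_add] at hb
  have h1 : s 0 ^ 2 * s 1 ^ 2 * (bB s 1)⁻¹ = (s 0 * s 1 * s 0) * (s 0 * s 1 * s 0) := by
    rw [bB_one, inv_inv]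
    calc _ = s 0 * (s 0 * s 1 * s 0) * s 0 * s 1 := by simp only [pow_two]; group
      _ = s 0 * (s 1 * s 0 * s 1) * s 0 * s 1 := by rw [hb]
      _ = s 0 * s 1 * s 0 * (s 1 * s 0 * s 1) := by group
      _ = _ := by rw [← hb]
  have h2 : (s 0 * s 1 * s 0) * s 0 = s 1 * (s 0 * s 1 * s 0) := by
    nth_rewrite 1 [hb]; group
  have h3 : (s 0 * s 1 * s 0) * s 1 = s 0 * (s 0 * s 1 * s 0) := by
    nth_rewrite 2 [hb]; group
  rw [h1]
  constructor
  · rw [commute_iff_eq, mul_assoc, h2, ← mul_assoc, h3]; group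
  · rw [commute_iff_eq, mul_assoc, h3, ← mul_assoc, h2]; group

end Relations

section Values

variable {n : ℕ} {H : Type*} [Group H]

theorem sB_mem_K01 {i : ℕ} (h2 : 2 ≤ i) (hi : i < n) : sB n i ∈ K01 n := fun j hj => by
  rw [pB_sB hi]
  by_cases h : i + 1 < n
  · rw [Fin.ext_iff, swp_val i h]; split_ifs <;> omega
  · rw [swp_of_le i (by omega)]; rfl

theorem mem_K01_of_pB {g : ArtinB n} (h : pB n g = 1) : g ∈ K01 n := fun j _ => by rw [h]; rfl

theorem Xo_mem_K01 {i : ℕ} (hi : i < n) : Xo (sB n) n i ∈ K01 n :=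
  mem_K01_of_pB (by rw [← ιo_xF hi, pB_ιo])

theorem pB_sB_sq {i : ℕ} (hi : i < n) : pB n (sB n i ^ 2) = 1 := by
  rw [map_pow, pB_sB hi, pow_two]
  by_cases h : i + 1 < n
  · rw [swp, dif_pos h]; exact Equiv.swap_mul_self _ _
  · rw [swp_of_le i (by omega)]; rfl

theorem pB_bB {i : ℕ} (hi : i < n) : pB n (bB (sB n) i) = 1 := by
  have : bB (sB n) i = (pr (sB n) 1 i)⁻¹ * (sB n 0 ^ 2)⁻¹ * pr (sB n) 1 i := by rw [bB, inv_pow]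
  rw [this, map_mul, map_mul, map_inv, map_inv, pB_sB_sq (by omega), inv_one, mul_one,
    inv_mul_cancel]

end Values

end ArtinAut

namespace ArtinAut

section ConjOnValues

variable {n : ℕ}

theorem conjOn_ιo (S : Set (Fin n)) (y : FreeGroup (Fin n)) : ConjOn S (ιo n y) (eS S y) :=
  ⟨eS_eS S y, fun z => by rw [Φ_ιo, MulAut.conj_apply]; simp⟩

theorem Xo_mem_KB {S : Set (Fin n)} {i : ℕ} (hi : i < n) (h : (⟨i, hi⟩ : Fin n) ∉ S) :
    Xo (sB n) n i ∈ KB n S := by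
  rw [← ιo_xF hi]
  refine mem_KB_iff_conjOn.2 ⟨pB_ιo _, ?_⟩
  simpa [xF_of_lt hi, eS_of_notMem h] using conjOn_ιo S (xF n i)

theorem Φ_sq_self {i : ℕ} (hi : i + 1 < n) : Φ n (sB n i ^ 2) (xF n i) =
    xF n i * xF n (i + 1) * xF n i * (xF n i * xF n (i + 1))⁻¹ := by
  rw [map_pow, Φ_sB hi, pow_two, MulAut.mul_apply, brAut_self hi, map_mul, map_mul, map_inv,
    brAut_self hi, brAut_succ hi]; group

theorem Φ_sq_succ {i : ℕ} (hi : i + 1 < n) : Φ n (sB n i ^ 2) (xF n (i + 1)) =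
    xF n i * xF n (i + 1) * (xF n i)⁻¹ := by
  rw [map_pow, Φ_sB hi, pow_two, MulAut.mul_apply, brAut_succ hi, brAut_self hi]

theorem Φ_sq_other {i j : ℕ} (hi : i + 1 < n) (h1 : j ≠ i) (h2 : j ≠ i + 1) :
    Φ n (sB n i ^ 2) (xF n j) = xF n j := by
  rw [map_pow, Φ_sB hi, pow_two, MulAut.mul_apply, brAut_other hi h1 h2, brAut_other hi h1 h2]

theorem conjOn_sq {S : Set (Fin n)} {i : ℕ} (hi : i + 1 < n) {v : FreeGroup (Fin n)}
    (hv : eS S v = v)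
    (h1 : eS S (Φ n (sB n i ^ 2) (xF n i)) = v * eS S (xF n i) * v⁻¹)
    (h2 : eS S (Φ n (sB n i ^ 2) (xF n (i + 1))) = v * eS S (xF n (i + 1)) * v⁻¹)
    (h3 : ∀ j, j < n → j ≠ i → j ≠ i + 1 → eS S (xF n j) = v * eS S (xF n j) * v⁻¹) :
    ConjOn S (sB n i ^ 2) v := by
  refine ⟨hv, fun y => ?_⟩
  refine xF_mulHom_ext (a := (eS S).comp (Φ n (sB n i ^ 2)).toMonoidHom)
    (b := (MulAut.conj v).toMonoidHom.comp (eS S)) (fun j hj => ?_) y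
  change eS S (Φ n (sB n i ^ 2) (xF n j)) = v * eS S (xF n j) * v⁻¹
  by_cases h : j = i
  · rw [h, h1]
  · by_cases h' : j = i + 1
    · rw [h', h2]
    · rw [Φ_sq_other hi h h', ← h3 j hj h h']

theorem sq_mem_KB {S : Set (Fin n)} {i : ℕ} (hi : i + 1 < n)
    (h : (⟨i, by omega⟩ : Fin n) ∉ S ∨ (⟨i + 1, hi⟩ : Fin n) ∉ S) : sB n i ^ 2 ∈ KB n S := by
  refine mem_KB_iff_conjOn.2 ⟨pB_sB_sq (by omega), conjOn_sq hi (map_one _) ?_ ?_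
    (fun j _ _ _ => by simp)⟩
  · rw [Φ_sq_self hi]
    rcases h with h | h
    · simp [xF_of_lt (show i < n by omega), eS_of_notMem h]
    · simp [xF_of_lt hi, eS_of_notMem h]
  · rw [Φ_sq_succ hi]
    rcases h with h | h
    · simp [xF_of_lt (show i < n by omega), eS_of_notMem h]
    · simp [xF_of_lt hi, eS_of_notMem h]

theorem eS_S01 {i : ℕ} (hn : 1 < n) : eS (S01 n) (xF n i) = if i < 2 then xF n i else 1 := by
  by_cases hi : i < n
  · rw [xF_of_lt hi]
    split_ifs with h
    · exact eS_of_mem h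
    · exact eS_of_notMem h
  · rw [xF, dif_neg hi, map_one]; simp

theorem conjOn_sq_zero (hn : 1 < n) : ConjOn (S01 n) (sB n 0 ^ 2) (xF n 0 * xF n 1) := by
  have h0 : eS (S01 n) (xF n 0) = xF n 0 := by simp [eS_S01 hn]
  have h1 : eS (S01 n) (xF n 1) = xF n 1 := by simp [eS_S01 hn]
  refine conjOn_sq (i := 0) (by omega) (by rw [map_mul, h0, h1]) ?_ ?_ fun j hj hj0 hj1 => ?_
  · rw [Φ_sq_self (by omega)]; simp [h0, h1]
  · rw [Φ_sq_succ (by omega)]; simp [h0, h1]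
  · rw [eS_S01 hn, if_neg (by omega)]; simp

theorem conjOn_sB_one {j : ℕ} (hn : 1 < n) (h2 : 2 ≤ j) (hj : j < n) :
    ConjOn (S01 n) (sB n j) 1 := by
  refine ConjOn.of_Φ (map_one _) (fun i hi => ?_) fun i hi => sB_mem_K01 h2 hj i hi
  have hi' : (i : ℕ) < 2 := hi
  by_cases h : j + 1 < n
  · rw [Φ_sB h, ← xF_fin, brAut_other h (by omega) (by omega), xF_fin, eS_of_mem hi]; simp
  · obtain ⟨k, rfl⟩ : ∃ k, n = k + 1 := ⟨n - 1, by omega⟩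
    obtain rfl : j = k := by omega
    rw [Φ_sB_last, MulAut.conj_apply, map_mul, map_mul, map_inv, map_inv, map_inv, eS_S01 hn,
      if_neg (by omega), eS_of_mem hi]; simp

theorem bB_one_mem_KB (hn : 2 < n) : bB (sB n) 1 ∈ KB n (S01 n) := by
  have h : sB n 0 ^ 2 ∈ KB n {i | (i : ℕ) ≠ 1} := sq_mem_KB (i := 0) (by omega) (Or.inr (by simp))
  rw [bB_one]
  refine (KB n _).inv_mem ?_
  have := KB_conj (S' := S01 n) (h := (sB n 1)⁻¹) h fun i hi => ?_
  · simpa using this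
  · intro h1
    have h1' : (i : ℕ) = 1 := h1
    have h2 : ((pB n (sB n 1))⁻¹ i : ℕ) < 2 := by rw [← map_inv]; exact hi
    have h3 : (pB n (sB n 1))⁻¹ i = ⟨2, hn⟩ := by
      rw [Equiv.Perm.inv_eq_iff_eq, pB_sB (by omega), Fin.ext_iff, swp_val 1 (by omega)]
      simp [h1']
    rw [h3] at h2
    exact absurd h2 (by simp)

end ConjOnValues

section Dichotomy

variable {m : ℕ} {α : Type*}

/-- A map that is multiplicative on the stabilizer of two strands and takes values in a free group
either has commuting values or factors through the action on these two strands. -/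
theorem K01_dichotomy [DecidableEq α] {f : ArtinB (m + 5) → FreeGroup α}
    (hf : IsMulOn (K01 (m + 5)) f) :
    (∀ g ∈ K01 (m + 5), ∀ g' ∈ K01 (m + 5), Commute (f g) (f g')) ∨
    ∃ β : FreeGroup (Fin (m + 5)) →* FreeGroup α, ∀ g ∈ K01 (m + 5), ∀ v,
      ConjOn (S01 (m + 5)) g v → f g = β v := by
  set s := sB (m + 5) with hs
  set K := K01 (m + 5) with hK
  have hA : IsArtB (m + 5) s := isArtB_sB _
  have hB := hA.isBr
  have ks : ∀ i, 2 ≤ i → i < m + 5 → s i ∈ K := fun i => sB_mem_K01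
  have kX : ∀ i, i < m + 5 → Xo s (m + 5) i ∈ K := fun i => Xo_mem_K01
  have kq : ∀ i, i < m + 5 → s i ^ 2 ∈ K := fun i hi => mem_K01_of_pB (pB_sB_sq hi)
  have kb : ∀ i, i < m + 5 → bB s i ∈ K := fun i hi => mem_K01_of_pB (pB_bB hi)
  have eqs : ∀ i, 2 ≤ i → i + 1 < m + 5 → f (s i) = f (s 2) := by
    intro i h2 hi
    induction i, h2 using Nat.le_induction with
    | base => rfl
    | succ i h2 ih =>
      rw [← ih (by omega)]
      refine (eq_of_braid ?_).symm
      have k1 := ks i h2 (by omega)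
      have k2 := ks (i + 1) (by omega) (by omega)
      rw [← hf _ k1 _ k2, ← hf _ (K.mul_mem k1 k2) _ k1, hA.braid i (by omega),
        hf _ (K.mul_mem k2 k1) _ k2, hf _ k2 _ k1]
  -- an element commuting with the values of all generators forces commuting values
  have main : ∀ u : FreeGroup α, u ≠ 1 → Commute u (f (s 2)) → Commute u (f (s (m + 4))) →
      Commute u (f (s 0 ^ 2)) → Commute u (f (s 1 ^ 2)) → Commute u (f (bB s 1)) →
      Commute u (f (Xo s (m + 5) 0)) → Commute u (f (Xo s (m + 5) 1)) →
      ∀ g ∈ K, ∀ g' ∈ K, Commute (f g) (f g') := by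
    intro u hu c2 cl c0 c1 cb cX0 cX1
    have : K01 (m + 5) ≤ hf.centralizing u := by
      refine le_of_K01 (fun i h2 hi => ⟨ks i h2 hi, ?_⟩) ⟨kq 0 (by omega), c0⟩
        ⟨kq 1 (by omega), c1⟩ ⟨kb 1 (by omega), cb⟩ ⟨kX 0 (by omega), cX0⟩ ⟨kX 1 (by omega), cX1⟩
      rcases Nat.lt_or_ge (i + 1) (m + 5) with h | h
      · rw [← hs, eqs i h2 h]; exact c2
      · obtain rfl : i = m + 4 := by omega
        exact cl
    exact fun g hg g' hg' => commute_trans hu (this hg).2 (this hg').2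
  have c := fun {a b : ArtinB (m + 5)} (ha : a ∈ K) (hb : b ∈ K) (h : Commute a b) =>
    hf.commute ha hb h
  by_cases hs1 : f (s 2) = 1
  swap
  · left
    refine main _ hs1 (Commute.refl _) (c (ks 2 le_rfl (by omega)) (ks _ (by omega) (by omega))
      (hA.comm _ _ (by omega) (by omega))) ?_ ?_ ?_ ?_ ?_
    · exact c (ks 2 le_rfl (by omega)) (kq 0 (by omega))
        ((hA.comm 0 2 (by omega) (by omega)).symm.pow_right 2)
    · rw [← eqs 3 (by omega) (by omega)]
      exact c (ks 3 (by omega) (by omega)) (kq 1 (by omega))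
        ((hA.comm 1 3 (by omega) (by omega)).symm.pow_right 2)
    · rw [← eqs 3 (by omega) (by omega)]
      exact c (ks 3 (by omega) (by omega)) (kb 1 (by omega))
        (hB.commute_bB_of_lt (by omega) (by omega))
    · exact c (ks 2 le_rfl (by omega)) (kX 0 (by omega))
        (hA.commute_Xo_of_gt (by omega) (by omega))
    · exact c (ks 2 le_rfl (by omega)) (kX 1 (by omega))
        (hA.commute_Xo_of_gt (by omega) (by omega))
  have eqX : ∀ i, 2 ≤ i → i < m + 5 → f (Xo s (m + 5) i) = f (Xo s (m + 5) 2) := by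
    intro i h2 hi
    induction i, h2 using Nat.le_induction with
    | base => rfl
    | succ i h2 ih =>
      rw [← ih (by omega), Xo_succ s hi]
      have k1 := ks i h2 (by omega)
      have k2 := kX (i + 1) (by omega)
      rw [hf _ (K.mul_mem k1 k2) _ (K.inv_mem k1), hf _ k1 _ k2, hf.inv k1, eqs i h2 hi, hs1]
      simp
  have eqq : f (s (m + 4)) = (f (Xo s (m + 5) 2))⁻¹ := by
    rw [← eqX (m + 4) (by omega) (by omega), Xo_last, hf.inv (ks _ (by omega) (by omega)), inv_inv]
  have eqb : f (bB s 2) = f (bB s 1) := by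
    have k1 := ks 2 le_rfl (by omega)
    have k2 := kb 1 (by omega)
    rw [bB_succ, hf _ (K.mul_mem (K.inv_mem k1) k2) _ k1, hf _ (K.inv_mem k1) _ k2, hf.inv k1, hs1]
    simp
  have kX0 := kX 0 (by omega)
  have kX1 := kX 1 (by omega)
  have kX2 := kX 2 (by omega)
  have kq0 := kq 0 (by omega)
  have kq1 := kq 1 (by omega)
  have kb1 := kb 1 (by omega)
  have hX02 : f ((Xo s (m + 5) 0 * Xo s (m + 5) 2)⁻¹ * (bB s 1)⁻¹) =
      (f (Xo s (m + 5) 0) * f (Xo s (m + 5) 2))⁻¹ * (f (bB s 1))⁻¹ := by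
    rw [hf _ (K.inv_mem (K.mul_mem kX0 kX2)) _ (K.inv_mem kb1), hf.inv (K.mul_mem kX0 kX2),
      hf.inv kb1, hf _ kX0 _ kX2]
  have hX12 : f ((Xo s (m + 5) 1 * Xo s (m + 5) 2)⁻¹ * s 1 ^ 2) =
      (f (Xo s (m + 5) 1) * f (Xo s (m + 5) 2))⁻¹ * f (s 1 ^ 2) := by
    rw [hf _ (K.inv_mem (K.mul_mem kX1 kX2)) _ kq1, hf.inv (K.mul_mem kX1 kX2), hf _ kX1 _ kX2]
  have hX01 : f ((Xo s (m + 5) 0 * Xo s (m + 5) 1)⁻¹ * s 0 ^ 2) =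
      (f (Xo s (m + 5) 0) * f (Xo s (m + 5) 1))⁻¹ * f (s 0 ^ 2) := by
    rw [hf _ (K.inv_mem (K.mul_mem kX0 kX1)) _ kq0, hf.inv (K.mul_mem kX0 kX1), hf _ kX0 _ kX1]
  have hD : f (s 0 ^ 2 * s 1 ^ 2 * (bB s 1)⁻¹) = f (s 0 ^ 2) * f (s 1 ^ 2) * (f (bB s 1))⁻¹ := by
    rw [hf _ (K.mul_mem kq0 kq1) _ (K.inv_mem kb1), hf.inv kb1, hf _ kq0 _ kq1]
  have kX02 := K.mul_mem (K.inv_mem (K.mul_mem kX0 kX2)) (K.inv_mem kb1)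
  have kX12 := K.mul_mem (K.inv_mem (K.mul_mem kX1 kX2)) kq1
  have kX01 := K.mul_mem (K.inv_mem (K.mul_mem kX0 kX1)) kq0
  have kD := K.mul_mem (K.mul_mem kq0 kq1) (K.inv_mem kb1)
  have r02 := hA.commute_X02 (by omega)
  have r12 := hA.commute_XX (k := 1) (by omega)
  have r01 := hA.commute_XX (k := 0) (by omega)
  have rD := hB.commute_twist (by omega)
  have e1 := c kX02 kX0 r02.1
  have e2 := c kX02 kX2 r02.2
  have e3 := c kX12 kX1 r12.1
  have e4 := c kX12 kX2 r12.2
  have e5 := c kX01 kX0 r01.1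
  have e6 := c kX01 kX1 r01.2
  have e7 := c kD kq0 (rD.1.pow_right 2)
  have e8 := c kD kq1 (rD.2.pow_right 2)
  rw [hX02] at e1 e2
  rw [hX12] at e3 e4
  rw [hX01] at e5 e6
  rw [hD] at e7 e8
  have cu0 : Commute (f (Xo s (m + 5) 2)) (f (s 0 ^ 2)) :=
    (c kq0 kX2 ((hA.commute_Xo_of_lt (by omega) (by omega)).pow_left 2)).symm
  have cu1 : Commute (f (Xo s (m + 5) 2)) (f (s 1 ^ 2)) := by
    rw [← eqX 3 (by omega) (by omega)]
    exact (c kq1 (kX 3 (by omega))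
      ((hA.commute_Xo_of_lt (by omega) (by omega)).pow_left 2)).symm
  have cub : Commute (f (Xo s (m + 5) 2)) (f (bB s 1)) := by
    rw [← eqX 3 (by omega) (by omega)]
    refine (c kb1 (kX 3 (by omega)) ?_).symm
    have h0 := hA.commute_Xo_of_lt (k := 0) (j := 3) (by omega) (by omega)
    have h1 := hA.commute_Xo_of_lt (k := 1) (j := 3) (by omega) (by omega)
    rw [bB_one]
    exact ((h1.inv_left.mul_left (h0.pow_left 2)).mul_left h1).inv_left
  have cwb : Commute (f (s 1 ^ 2)) (f (bB s 1)) := by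
    rw [← eqb]
    exact c kq1 (kb 2 (by omega)) ((hB.commute_bB_of_gt (by omega) (by omega) (by omega)).pow_left 2)
  have cwx : Commute (f (s 1 ^ 2)) (f (Xo s (m + 5) 0)) :=
    c kq1 kX0 ((hA.commute_Xo_of_gt (by omega) (by omega)).pow_left 2)
  have cyb : Commute (f (s 1 ^ 2 * (bB s 1)⁻¹ * (s 1 ^ 2)⁻¹)) (f (Xo s (m + 5) 1)) := by
    refine c (K.mul_mem (K.mul_mem kq1 (K.inv_mem kb1)) (K.inv_mem kq1)) kX1 ?_
    have h0 := (hA.commute_Xo_of_lt (k := 0) (j := 2) (by omega) (by omega)).pow_left 2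
    have h1 := h0.map (MulAut.conj (s 1))
    rw [MulAut.conj_apply, MulAut.conj_apply, ← Xo_succ s (i := 1) (by omega)] at h1
    have h2 : s 1 ^ 2 * (bB s 1)⁻¹ * (s 1 ^ 2)⁻¹ = s 1 * s 0 ^ 2 * (s 1)⁻¹ := by
      rw [bB_one, pow_two (s 1)]; group
    rwa [h2]
  rw [hf _ (K.mul_mem kq1 (K.inv_mem kb1)) _ (K.inv_mem kq1), hf _ kq1 _ (K.inv_mem kb1),
    hf.inv kq1, hf.inv kb1] at cyb
  clear hX02 hX12 hX01 hD kX02 kX12 kX01 kD r02 r12 r01 rD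
  generalize hx : f (Xo s (m + 5) 0) = x at *
  generalize hy : f (Xo s (m + 5) 1) = y at *
  generalize hu : f (Xo s (m + 5) 2) = u at *
  generalize hz : f (s 0 ^ 2) = z at *
  generalize hw : f (s 1 ^ 2) = w at *
  generalize hb : f (bB s 1) = b at *
  rw [hs1, eqq] at main
  have strip : ∀ {p q r : FreeGroup α}, Commute (p * q) r → Commute q r → Commute p r :=
    fun h1 h2 => by simpa using h1.mul_left h2.inv_left
  have strip2 : ∀ {p q r : FreeGroup α}, Commute (p * q) r → Commute p r → Commute q r :=
    fun h1 h2 => by simpa using h2.inv_left.mul_left h1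
  by_cases hu1 : u = 1
  swap
  · left
    have h1 : Commute (x * u) u := by simpa using (strip e2 cub.symm.inv_left).inv_left
    have h2 : Commute (y * u) u := by simpa using (strip e4 cu1.symm).inv_left
    exact main u hu1 (Commute.one_right u) (Commute.refl u).inv_right cu0 cu1 cub
      (strip h1 (Commute.refl u)).symm (strip h2 (Commute.refl u)).symm
  rw [hu1, mul_one] at e1 e3
  rw [hu1, inv_one] at main
  by_cases hw1 : w = 1
  swap
  · left
    have h1 : Commute (z * w) w := strip e8 cwb.symm.inv_left
    have h2 : Commute w y := strip2 e3 (Commute.refl y).inv_left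
    exact main w hw1 (Commute.one_right w) (Commute.one_right w)
      (strip h1 (Commute.refl w)).symm (Commute.refl w) cwb cwx h2
  rw [hw1, mul_one] at e7
  rw [hw1, inv_one, mul_one, one_mul] at cyb
  by_cases hb1 : b = 1
  swap
  · left
    have h1 : Commute b⁻¹ z := strip2 e7 (Commute.refl z)
    have h2 : Commute b⁻¹ x := strip2 e1 (Commute.refl x).inv_left
    exact main b hb1 (Commute.one_right b) (Commute.one_right b) (by simpa using h1)
      (by rw [hw1]; exact Commute.one_right b) (Commute.refl b) (by simpa using h2)
      (by simpa using cyb)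
  by_cases hz1 : (x * y)⁻¹ * z = 1
  swap
  · left
    have h1 : Commute ((x * y)⁻¹ * z) z := by
      have := (e5.mul_right e6).mul_right (Commute.refl ((x * y)⁻¹ * z))
      rwa [mul_inv_cancel_left] at this
    exact main _ hz1 (Commute.one_right _) (Commute.one_right _) h1
      (by rw [hw1]; exact Commute.one_right _) (by rw [hb1]; exact Commute.one_right _) e5 e6
  right
  have hz2 : z = x * y := (inv_mul_eq_one.1 hz1).symm
  let β : FreeGroup (Fin (m + 5)) →* FreeGroup α :=
    liftF (m + 5) fun i => if i = 0 then x else if i = 1 then y else 1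
  have β0 : β (xF (m + 5) 0) = x := by simp [β, liftF_xF]
  have β1 : β (xF (m + 5) 1) = y := by simp [β, liftF_xF]
  refine ⟨β, ?_⟩
  have hle : K01 (m + 5) ≤ hf.eqRel (ConjOn (S01 (m + 5))) (conjOn_one _)
      (fun _ _ _ _ => ConjOn.mul) (fun _ _ => ConjOn.inv) β := by
    refine le_of_K01 (fun i h2 hi => ⟨ks i h2 hi, 1, conjOn_sB_one (by omega) h2 hi, ?_⟩)
      ⟨kq0, _, conjOn_sq_zero (by omega), ?_⟩
      ⟨kq1, 1, (mem_KB_iff_conjOn.1 (sq_mem_KB (by omega) (Or.inr (by simp [S01])))).2, ?_⟩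
      ⟨kb1, 1, (mem_KB_iff_conjOn.1 (bB_one_mem_KB (by omega))).2, ?_⟩
      ⟨kX0, _, ιo_xF (n := m + 5) (i := 0) (by omega) ▸ conjOn_ιo _ _, ?_⟩
      ⟨kX1, _, ιo_xF (n := m + 5) (i := 1) (by omega) ▸ conjOn_ιo _ _, ?_⟩
    · rw [map_one]
      rcases Nat.lt_or_ge (i + 1) (m + 5) with h | h
      · rw [← hs, eqs i h2 h, hs1]
      · obtain rfl : i = m + 4 := by omega
        rw [← hs, eqq, hu1, inv_one]
    · rw [map_mul, β0, β1, hz, hz2]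
    · rw [map_one, hw, hw1]
    · rw [map_one, hb, hb1]
    · rw [eS_S01 (by omega), if_pos (by omega), β0, hx]
    · rw [eS_S01 (by omega), if_pos (by omega), β1, hy]
  intro g hg v hv
  obtain ⟨-, w', hw', h⟩ := hle hg
  rw [h, ConjOn.unique (i := ⟨0, by omega⟩) (j := ⟨1, by omega⟩) (by simp) (by simp [S01])
    (by simp [S01]) hv hw']

end Dichotomy

end ArtinAut

namespace ArtinAut

section Pairs

variable {m : ℕ}

theorem exists_conjOn {g : ArtinB (m + 5)} (hg : g ∈ K01 (m + 5)) :
    ∃ v, ConjOn (S01 (m + 5)) g v := by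
  let L : Subgroup (ArtinB (m + 5)) :=
    { carrier := {g | ∃ v, ConjOn (S01 (m + 5)) g v}
      one_mem' := ⟨1, conjOn_one _⟩
      mul_mem' := fun ⟨v, hv⟩ ⟨w, hw⟩ => ⟨v * w, hv.mul hw⟩
      inv_mem' := fun ⟨v, hv⟩ => ⟨v⁻¹, hv.inv⟩ }
  have hle : K01 (m + 5) ≤ L := by
    refine le_of_K01 (fun i h2 hi => ⟨1, conjOn_sB_one (by omega) h2 hi⟩)
      ⟨_, conjOn_sq_zero (by omega)⟩
      ⟨1, (mem_KB_iff_conjOn.1 (sq_mem_KB (by omega) (Or.inr (by simp [S01])))).2⟩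
      ⟨1, (mem_KB_iff_conjOn.1 (bB_one_mem_KB (by omega))).2⟩
      ⟨_, ιo_xF (n := m + 5) (i := 0) (by omega) ▸ conjOn_ιo _ _⟩
      ⟨_, ιo_xF (n := m + 5) (i := 1) (by omega) ▸ conjOn_ιo _ _⟩
  exact hle hg

theorem ConjOn.unique01 {g : ArtinB (m + 5)} {v w : FreeGroup (Fin (m + 5))}
    (hv : ConjOn (S01 (m + 5)) g v) (hw : ConjOn (S01 (m + 5)) g w) : v = w :=
  ConjOn.unique (i := ⟨0, by omega⟩) (j := ⟨1, by omega⟩) (by simp) (by simp [S01])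
    (by simp [S01]) hv hw

open Classical in
/-- The action on the first two strands, as an element of the free group. -/
noncomputable def f01 (g : ArtinB (m + 5)) : FreeGroup (Fin (m + 5)) :=
  if h : ∃ v, ConjOn (S01 (m + 5)) g v then h.choose else 1

theorem f01_eq {g : ArtinB (m + 5)} {v : FreeGroup (Fin (m + 5))}
    (hv : ConjOn (S01 (m + 5)) g v) : f01 g = v := by
  have h : ∃ v, ConjOn (S01 (m + 5)) g v := ⟨v, hv⟩
  rw [f01, dif_pos h]
  exact h.choose_spec.unique01 hv

theorem conjOn_f01 {g : ArtinB (m + 5)} (hg : g ∈ K01 (m + 5)) :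
    ConjOn (S01 (m + 5)) g (f01 g) := by
  obtain ⟨v, hv⟩ := exists_conjOn hg
  rwa [f01_eq hv]

theorem isMulOn_f01 : IsMulOn (K01 (m + 5)) (f01 (m := m)) := fun _ ha _ hb =>
  f01_eq ((conjOn_f01 ha).mul (conjOn_f01 hb))

theorem f01_Xo {i : ℕ} (hi : i < 2) :
    f01 (Xo (sB (m + 5)) (m + 5) i) = xF (m + 5) i := by
  apply f01_eq
  have := conjOn_ιo (S01 (m + 5)) (xF (m + 5) i)
  rwa [ιo_xF (by omega), eS_S01 (by omega), if_pos hi] at this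

theorem not_commute_xF {n i j : ℕ} (hi : i < n) (hj : j < n) (hij : i ≠ j) :
    ¬ Commute (xF n i) (xF n j) := by
  intro h
  rw [xF_of_lt hi, xF_of_lt hj] at h
  obtain ⟨k, hk⟩ := mem_zpowers_of_commute_of h
  have h2 := congrArg (expo (⟨j, hj⟩ : Fin n)) hk
  simp only [map_zpow, expo_of_self] at h2
  rw [expo_of_ne (by simpa [Fin.ext_iff] using hij), one_zpow] at h2
  exact absurd h2 (by decide)

theorem pB_symm {φ : MulAut (ArtinB (m + 5))} (hφ : ∀ g, pB (m + 5) (φ g) = pB (m + 5) g)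
    (g : ArtinB (m + 5)) : pB (m + 5) (φ⁻¹ g) = pB (m + 5) g := by
  rw [← hφ, ← MulAut.mul_apply, mul_inv_cancel, MulAut.one_apply]

theorem map_K01 {φ : MulAut (ArtinB (m + 5))} (hφ : ∀ g, pB (m + 5) (φ g) = pB (m + 5) g)
    {g : ArtinB (m + 5)} (hg : g ∈ K01 (m + 5)) : φ g ∈ K01 (m + 5) := fun i hi => by
  rw [hφ]; exact hg i hi

theorem exists_f01_map {φ : MulAut (ArtinB (m + 5))}
    (hφ : ∀ g, pB (m + 5) (φ g) = pB (m + 5) g) :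
    ∃ β : FreeGroup (Fin (m + 5)) →* FreeGroup (Fin (m + 5)),
      ∀ g ∈ K01 (m + 5), f01 (φ g) = β (f01 g) := by
  have hm : IsMulOn (K01 (m + 5)) (fun g => f01 (φ g)) := fun a ha b hb => by
    simp only [map_mul]
    exact isMulOn_f01 _ (map_K01 hφ ha) _ (map_K01 hφ hb)
  rcases K01_dichotomy hm with h | ⟨β, h⟩
  · have := h _ (map_K01 (pB_symm hφ) (Xo_mem_K01 (i := 0) (by omega))) _
      (map_K01 (pB_symm hφ) (Xo_mem_K01 (i := 1) (by omega)))
    simp only [← MulAut.mul_apply, mul_inv_cancel, MulAut.one_apply] at this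
    rw [f01_Xo (by omega), f01_Xo (by omega)] at this
    exact absurd this (not_commute_xF (by omega) (by omega) (by omega))
  · exact ⟨β, fun g hg => h g hg _ (conjOn_f01 hg)⟩

theorem map_KB_pair {φ : MulAut (ArtinB (m + 5))} (hφ : ∀ g, pB (m + 5) (φ g) = pB (m + 5) g)
    {h : ArtinB (m + 5)} {S : Set (Fin (m + 5))} (hS : ∀ i, pB (m + 5) h i ∈ S ↔ (i : ℕ) < 2)
    {g : ArtinB (m + 5)} (hg : g ∈ KB (m + 5) S) : φ g ∈ KB (m + 5) S := by
  have h1 : h⁻¹ * g * h ∈ KB (m + 5) (S01 (m + 5)) := by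
    have := KB_conj (S' := S01 (m + 5)) (h := h⁻¹) hg fun i hi => by
      have := (hS ((pB (m + 5) h⁻¹) i)).2 hi
      rwa [map_inv, ← Equiv.Perm.mul_apply, mul_inv_cancel] at this
    simpa using this
  have h2 : φ (h⁻¹ * g * h) ∈ KB (m + 5) (S01 (m + 5)) := by
    obtain ⟨β, hβ⟩ := exists_f01_map hφ
    obtain ⟨h3, h4⟩ := mem_KB_iff_conjOn.1 h1
    have hK := mem_K01_of_pB h3
    refine mem_KB_iff_conjOn.2 ⟨by rw [hφ, h3], ?_⟩
    have h5 := conjOn_f01 (map_K01 hφ hK)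
    rwa [hβ _ hK, f01_eq h4, map_one] at h5
  have h3 := KB_conj (S' := S) (h := φ h) h2 fun i hi => (hS i).1 (by rwa [hφ] at hi)
  rw [← map_inv, ← map_mul, ← map_mul] at h3
  have h4 : h * (h⁻¹ * g * h) * h⁻¹ = g := by group
  rwa [h4] at h3

end Pairs

end ArtinAut

namespace ArtinAut

section Tail

/-- Kill the first `k` letters and renumber the others. -/
def dn (m : ℕ) : (k : ℕ) → FreeGroup (Fin (m + k)) →* FreeGroup (Fin m)
  | 0 => MonoidHom.id _
  | k + 1 => (dn m k).comp (e0 (m + k))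

theorem dn_of_lt {m k j : ℕ} (h : j < k) : dn m k (xF (m + k) j) = 1 := by
  induction k generalizing j with
  | zero => omega
  | succ k ih =>
    rcases j with _ | j
    · change dn m k (e0 (m + k) (xF (m + k + 1) 0)) = 1
      rw [e0_zero, map_one]
    · change dn m k (e0 (m + k) (xF (m + k + 1) (j + 1))) = 1
      rw [e0_succ, ih (by omega)]

theorem dn_add {m k j : ℕ} : dn m k (xF (m + k) (j + k)) = xF m j := by
  induction k generalizing j with
  | zero => rfl
  | succ k ih =>
    change dn m k (e0 (m + k) (xF (m + k + 1) (j + k + 1))) = xF m j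
    rw [e0_succ, ih]

theorem dn_surjective (m k : ℕ) : Function.Surjective (dn m k) := by
  induction k with
  | zero => exact fun y => ⟨y, rfl⟩
  | succ k ih => exact ih.comp (e0_surjective _)

/-- The strands from `k` on. -/
def tailSet (n k : ℕ) : Set (Fin n) := {i | k ≤ (i : ℕ)}

theorem eS_tailSet {n k i : ℕ} (hi : i < n) :
    eS (tailSet n k) (xF n i) = if k ≤ i then xF n i else 1 := by
  rw [xF_of_lt hi]
  split_ifs with h
  · exact eS_of_mem h
  · exact eS_of_notMem h

theorem dn_eS {m k : ℕ} (y : FreeGroup (Fin (m + k))) :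
    dn m k (eS (tailSet (m + k) k) y) = dn m k y := by
  refine xF_mulHom_ext (a := (dn m k).comp (eS _)) (b := dn m k) (fun i hi => ?_) y
  rw [MonoidHom.comp_apply, eS_tailSet hi]
  split_ifs with h
  · rfl
  · rw [dn_of_lt (by omega), map_one]

theorem e0_dn_eS {m k : ℕ} (y : FreeGroup (Fin (m + 1 + k))) :
    e0 m (dn (m + 1) k (eS (tailSet (m + 1 + k) (k + 1)) y)) = e0 m (dn (m + 1) k y) := by
  refine xF_mulHom_ext (a := ((e0 m).comp (dn (m + 1) k)).comp (eS _))
    (b := (e0 m).comp (dn (m + 1) k)) (fun i hi => ?_) y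
  rw [MonoidHom.comp_apply, eS_tailSet hi]
  split_ifs with h
  · rfl
  · rw [map_one, MonoidHom.comp_apply]
    rcases Nat.lt_or_ge i k with h' | h'
    · rw [dn_of_lt h', map_one]
    · obtain rfl : i = 0 + k := by omega
      rw [dn_add, e0_zero]

theorem eS_eq_of_dn {m k : ℕ} {y z : FreeGroup (Fin (m + k))} (h : dn m k y = dn m k z) :
    eS (tailSet (m + k) k) y = eS (tailSet (m + k) k) z := by
  have key : ∀ y, (liftF m fun i => xF (m + k) (i + k)) (dn m k y) = eS (tailSet (m + k) k) y := by
    intro y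
    refine xF_mulHom_ext (a := (liftF m fun i => xF (m + k) (i + k)).comp (dn m k))
      (fun i hi => ?_) y
    rw [MonoidHom.comp_apply, eS_tailSet hi]
    split_ifs with h
    · obtain ⟨j, rfl⟩ : ∃ j, i = j + k := ⟨i - k, by omega⟩
      rw [dn_add, liftF_xF _ (by omega)]
    · rw [dn_of_lt (by omega), map_one]
  rw [← key, ← key, h]

theorem exists_dn_Φ {m k : ℕ} {g : ArtinB (m + k)}
    (hg : ∀ i : Fin (m + k), (i : ℕ) < k → pB (m + k) g i = i) :
    ∃ g' : ArtinB m, ∀ y, dn m k (Φ (m + k) g y) = Φ m g' (dn m k y) := by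
  induction k with
  | zero => exact ⟨g, fun y => rfl⟩
  | succ k ih =>
    change ArtinB (m + k + 1) at g
    obtain ⟨z, h, rfl⟩ := mem_stab0.1 (mem_stab0_iff.2 (hg (0 : Fin (m + k + 1)) (by simp)))
    change ArtinB (m + k) at h
    change FreeGroup (Fin (m + k + 1)) at z
    have hh : ∀ i : Fin (m + k), (i : ℕ) < k → pB (m + k) h i = i := fun i hi => by
      have h2 := hg (Fin.succ i : Fin (m + k + 1)) (by simpa using hi)
      change pB (m + k + 1) (ι1 (m + k) z * sh (m + k) h) i.succ = i.succ at h2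
      rw [map_mul, pB_ι1, one_mul] at h2
      exact Fin.succ_injective _ (((pB_sh (m := m + k) h).2 i).symm.trans h2)
    obtain ⟨g', hg'⟩ := ih hh
    refine ⟨g', fun y => ?_⟩
    change dn m k (e0 (m + k) (Φ (m + k + 1) (ι1 (m + k) z * sh (m + k) h) y)) =
      Φ m g' (dn m k (e0 (m + k) y))
    rw [map_mul, MulAut.mul_apply, e0_Φ_ι1, e0_Φ_sh, hg']

theorem eq_one_of_Φ_ι1 {m : ℕ} {z : FreeGroup (Fin (m + 2))}
    (h : Φ (m + 2) (ι1 (m + 1) z) = 1) : z = 1 := by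
  obtain ⟨j, hj⟩ := mem_zpowers_of_Φ_eq_one (m + 1) h
  have hc : ∀ w, Commute z w := fun w => by
    refine ι1_injective (m + 1) ?_
    rw [map_mul, map_mul, ← hj]
    exact ((ΔB_comm (ι1 (m + 1) w)).zpow_left j).eq
  refine conj_injective (i := (0 : Fin (m + 2))) (j := 1) (by simp) ?_
  ext1 w
  simp [(hc w).eq]

theorem exists_ι1_of_Φ_sh {m : ℕ} {h : ArtinB (m + 1)} (hh : Φ (m + 1) h = 1) :
    ∃ (z : FreeGroup (Fin (m + 2))) (j : ℤ), sh (m + 1) h = ι1 (m + 1) z * ΔB (m + 2) ^ j := by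
  obtain ⟨j, rfl⟩ := mem_zpowers_of_Φ_eq_one m hh
  refine ⟨PiF (m + 2) ^ j, j, ?_⟩
  change sh (m + 1) (ΔB (m + 1) ^ j) = _
  rw [map_zpow, sh_ΔB, ((ΔB_comm _).symm).mul_zpow, map_zpow]

/-- The elements of `KB n (tailSet n (k + 1))` are described, modulo `KB n (tailSet n k)`,
by elements of a free group. -/
theorem exists_ι1_of_mem_KB {m k : ℕ} {g : ArtinB (m + 2 + k)}
    (hg : g ∈ KB (m + 2 + k) (tailSet (m + 2 + k) (k + 1))) :
    ∃ z, ∀ y, dn (m + 2) k (Φ (m + 2 + k) g y) = Φ (m + 2) (ι1 (m + 1) z) (dn (m + 2) k y) := by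
  obtain ⟨g', hg'⟩ := exists_dn_Φ (g := g) fun i _ => by rw [hg.1]; rfl
  have h0 : ∀ w, e0 (m + 1) (Φ (m + 2) g' w) = e0 (m + 1) w := by
    intro w
    obtain ⟨y, rfl⟩ := dn_surjective _ k w
    rw [← hg', ← e0_dn_eS, hg.2, e0_dn_eS]
  have hp : pB (m + 2) g' 0 = 0 := by
    by_contra hne
    have h1 := h0 (FreeGroup.of 0)
    have h2 := (e0 (m + 1)).map_isConj (isConj_Φ_of g' 0)
    rw [h1] at h2
    obtain ⟨i, hi⟩ := Fin.exists_succ_eq.2 hne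
    rw [← hi, ← xF_fin, ← xF_fin, Fin.val_zero, e0_zero, Fin.val_succ, e0_succ, xF_fin,
      isConj_one_right] at h2
    exact FreeGroup.of_ne_one _ h2
  obtain ⟨z, h, rfl⟩ := mem_stab0.1 (mem_stab0_iff.2 hp)
  have hh : Φ (m + 1) h = 1 := by
    ext1 w
    obtain ⟨y, rfl⟩ := e0_surjective _ w
    rw [← e0_Φ_sh, MulAut.one_apply]
    have := h0 y
    rwa [map_mul, MulAut.mul_apply, e0_Φ_ι1] at this
  obtain ⟨z', j, hz'⟩ := exists_ι1_of_Φ_sh hh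
  refine ⟨z * z', fun y => ?_⟩
  rw [hg', hz', ← mul_assoc, ← map_mul, map_mul, map_zpow, Φ_ΔB, one_zpow, mul_one]

theorem mem_KB_tail_iff {m k : ℕ} {g : ArtinB (m + 2 + k)} (hp : pB (m + 2 + k) g = 1)
    {z : FreeGroup (Fin (m + 2))}
    (hz : ∀ y, dn (m + 2) k (Φ (m + 2 + k) g y) = Φ (m + 2) (ι1 (m + 1) z) (dn (m + 2) k y)) :
    g ∈ KB (m + 2 + k) (tailSet (m + 2 + k) k) ↔ z = 1 := by
  constructor
  · intro hg
    refine eq_one_of_Φ_ι1 (MulEquiv.ext fun w => ?_)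
    obtain ⟨y, rfl⟩ := dn_surjective _ k w
    rw [← hz, ← dn_eS, hg.2, dn_eS, MulAut.one_apply]
  · rintro rfl
    refine ⟨hp, fun y => eS_eq_of_dn ?_⟩
    rw [hz]; simp

open Classical in
theorem KB_commutator {n k : ℕ} (hk : k + 1 < n) {a b e : ArtinB n}
    (ha : a ∈ KB n (tailSet n (k + 1))) (hb : b ∈ KB n (tailSet n (k + 1)))
    (he : e ∈ KB n (tailSet n (k + 1))) (hea : Commute e a) (heb : Commute e b)
    (hne : e ∉ KB n (tailSet n k)) : a * b * a⁻¹ * b⁻¹ ∈ KB n (tailSet n k) := by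
  obtain ⟨m, rfl⟩ : ∃ m, n = m + 2 + k := ⟨n - k - 2, by omega⟩
  obtain ⟨x, hx⟩ := exists_ι1_of_mem_KB ha
  obtain ⟨y, hy⟩ := exists_ι1_of_mem_KB hb
  obtain ⟨u, hu⟩ := exists_ι1_of_mem_KB he
  have hm : ∀ {g h : ArtinB (m + 2 + k)} {p q : FreeGroup (Fin (m + 2))},
      (∀ y, dn (m + 2) k (Φ (m + 2 + k) g y) = Φ (m + 2) (ι1 (m + 1) p) (dn (m + 2) k y)) →
      (∀ y, dn (m + 2) k (Φ (m + 2 + k) h y) = Φ (m + 2) (ι1 (m + 1) q) (dn (m + 2) k y)) →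
      ∀ y, dn (m + 2) k (Φ (m + 2 + k) (g * h) y) =
        Φ (m + 2) (ι1 (m + 1) (p * q)) (dn (m + 2) k y) := fun h1 h2 y => by
    rw [map_mul, MulAut.mul_apply, h1, h2, map_mul, map_mul, MulAut.mul_apply]
  have hi : ∀ {g : ArtinB (m + 2 + k)} {p : FreeGroup (Fin (m + 2))},
      (∀ y, dn (m + 2) k (Φ (m + 2 + k) g y) = Φ (m + 2) (ι1 (m + 1) p) (dn (m + 2) k y)) →
      ∀ y, dn (m + 2) k (Φ (m + 2 + k) g⁻¹ y) =
        Φ (m + 2) (ι1 (m + 1) p⁻¹) (dn (m + 2) k y) := fun {g p} h1 y => by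
    have := h1 (Φ (m + 2 + k) g⁻¹ y)
    rw [← MulAut.mul_apply, ← map_mul, mul_inv_cancel, map_one, MulAut.one_apply] at this
    rw [this, ← MulAut.mul_apply, ← map_mul, ← map_mul, inv_mul_cancel, map_one, map_one,
      MulAut.one_apply]
  have hcomm : ∀ {g h : ArtinB (m + 2 + k)} {p q : FreeGroup (Fin (m + 2))},
      pB (m + 2 + k) g = 1 → pB (m + 2 + k) h = 1 →
      (∀ y, dn (m + 2) k (Φ (m + 2 + k) g y) = Φ (m + 2) (ι1 (m + 1) p) (dn (m + 2) k y)) →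
      (∀ y, dn (m + 2) k (Φ (m + 2 + k) h y) = Φ (m + 2) (ι1 (m + 1) q) (dn (m + 2) k y)) →
      (g * h * g⁻¹ * h⁻¹ ∈ KB (m + 2 + k) (tailSet (m + 2 + k) k) ↔ Commute p q) := by
    intro g h p q hg hh h1 h2
    rw [mem_KB_tail_iff (by simp [hg, hh]) (hm (hm (hm h1 h2) (hi h1)) (hi h2)), mul_inv_eq_one,
      mul_inv_eq_iff_eq_mul, commute_iff_eq]
  have hu1 : u ≠ 1 := fun h => hne ((mem_KB_tail_iff he.1 hu).2 h)
  have c1 : Commute u x := (hcomm he.1 ha.1 hu hx).1 (by rw [hea.eq]; simp [Subgroup.one_mem])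
  have c2 : Commute u y := (hcomm he.1 hb.1 hu hy).1 (by rw [heb.eq]; simp [Subgroup.one_mem])
  exact (hcomm ha.1 hb.1 hx hy).2 (commute_trans hu1 c1 c2)

end Tail

end ArtinAut

namespace ArtinAut

section Moves

variable {n : ℕ}

/-- The subgroup generated by the standard braid generators from index `a` on. -/
def upper (n a : ℕ) : Subgroup (ArtinB n) :=
  Subgroup.closure {g | ∃ i, a ≤ i ∧ i + 1 < n ∧ g = sB n i}

theorem sB_mem_upper {a i : ℕ} (h1 : a ≤ i) (h2 : i + 1 < n) : sB n i ∈ upper n a :=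
  Subgroup.subset_closure ⟨i, h1, h2, rfl⟩

theorem upper_le {a : ℕ} {K : Subgroup (ArtinB n)}
    (h : ∀ i, a ≤ i → i + 1 < n → sB n i ∈ K) : upper n a ≤ K := by
  refine (Subgroup.closure_le _).2 ?_
  rintro _ ⟨i, h1, h2, rfl⟩
  exact h i h1 h2

theorem pB_upper {a : ℕ} {g : ArtinB n} (hg : g ∈ upper n a) {i : Fin n} (hi : (i : ℕ) < a) :
    pB n g i = i := by
  have : upper n a ≤ (MulAction.stabilizer (Equiv.Perm (Fin n)) i).comap (pB n) :=
    upper_le fun j h1 h2 => by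
      rw [Subgroup.mem_comap, MulAction.mem_stabilizer_iff, Equiv.Perm.smul_def, pB_sB (by omega),
        Fin.ext_iff, swp_val j h2, if_neg (by omega), if_neg (by omega)]
  exact this hg

theorem exists_upper {a u : ℕ} (hau : a ≤ u) (hu : u < n) :
    ∃ g ∈ upper n a, pB n g ⟨a, by omega⟩ = ⟨u, hu⟩ := by
  induction u, hau using Nat.le_induction with
  | base => exact ⟨1, one_mem _, by simp⟩
  | succ u hau ih =>
    obtain ⟨g, hg, h⟩ := ih (by omega)
    refine ⟨sB n u * g, mul_mem (sB_mem_upper hau (by omega)) hg, ?_⟩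
    rw [map_mul, Equiv.Perm.mul_apply, h, pB_sB (by omega), Fin.ext_iff, swp_val u hu, if_pos rfl]

theorem exists_upper_pair {a : ℕ} (ha : a + 1 < n) {u v : Fin n} (hu : a ≤ (u : ℕ))
    (hv : a ≤ (v : ℕ)) (huv : u ≠ v) :
    ∃ g ∈ upper n a, pB n g ⟨a, by omega⟩ = u ∧ pB n g ⟨a + 1, ha⟩ = v := by
  obtain ⟨g, hg, h⟩ := exists_upper hu u.2
  have hw : a + 1 ≤ (((pB n g)⁻¹ v : Fin n) : ℕ) := by
    by_contra hlt
    rcases Nat.lt_or_ge (((pB n g)⁻¹ v : Fin n) : ℕ) a with h' | h'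
    · have := pB_upper hg h'
      rw [← Equiv.Perm.mul_apply, mul_inv_cancel, Equiv.Perm.one_apply] at this
      rw [← this] at h'
      omega
    · have h2 : (pB n g)⁻¹ v = ⟨a, by omega⟩ := Fin.ext (by change _ = a; omega)
      rw [Equiv.Perm.inv_eq_iff_eq, h] at h2
      exact huv h2.symm
  obtain ⟨g', hg', h'⟩ := exists_upper hw ((pB n g)⁻¹ v).2
  refine ⟨g * g', mul_mem hg ?_, ?_, ?_⟩
  · exact (upper_le fun i h1 h2 => sB_mem_upper (by omega) h2) hg'
  · rw [map_mul, Equiv.Perm.mul_apply, pB_upper hg' (by simp), h]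
  · rw [map_mul, Equiv.Perm.mul_apply, h']; simp

end Moves

section Descent

theorem inv_mul_sq_mul {G : Type*} [Group G] (w x : G) :
    w⁻¹ * x ^ 2 * w = (w⁻¹ * x * w) ^ 2 := by
  rw [pow_two, pow_two]; group

variable {m : ℕ} {φ : MulAut (ArtinB (m + 5))}

theorem commutator_notMem (hφ : ∀ g, pB (m + 5) (φ g) = pB (m + 5) g) {a b w : ArtinB (m + 5)}
    {v v' : FreeGroup (Fin (m + 5))} (ha : ConjOn (S01 (m + 5)) (w⁻¹ * a * w) v)
    (hb : ConjOn (S01 (m + 5)) (w⁻¹ * b * w) v') (hne : ¬ Commute v v')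
    {S : Set (Fin (m + 5))} (hS : ∀ i, pB (m + 5) w i ∈ S ↔ (i : ℕ) < 2) :
    φ a * φ b * (φ a)⁻¹ * (φ b)⁻¹ ∉ KB (m + 5) S := by
  intro h
  have h1 := map_KB_pair (pB_symm hφ) hS h
  rw [← map_inv, ← map_inv, ← map_mul, ← map_mul, ← map_mul, ← MulAut.mul_apply, inv_mul_cancel,
    MulAut.one_apply] at h1
  have h2 := KB_conj (S' := S01 (m + 5)) (h := w⁻¹) h1 fun i hi => by
    have := (hS (pB (m + 5) w⁻¹ i)).2 hi
    rwa [map_inv, ← Equiv.Perm.mul_apply, mul_inv_cancel] at this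
  have h3 := ((ha.mul hb).mul ha.inv).mul hb.inv
  have h4 : w⁻¹ * a * w * (w⁻¹ * b * w) * (w⁻¹ * a * w)⁻¹ * (w⁻¹ * b * w)⁻¹ =
    w⁻¹ * (a * b * a⁻¹ * b⁻¹) * w⁻¹⁻¹ := by group
  rw [h4] at h3
  have h5 := h3.unique01 (mem_KB_iff_conjOn.1 h2).2
  rw [mul_inv_eq_one, mul_inv_eq_iff_eq_mul] at h5
  exact hne h5

theorem map_mem_tail_step (hφ : ∀ g, pB (m + 5) (φ g) = pB (m + 5) g) {k : ℕ} (hk : k + 1 < m + 5)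
    {h w a b e : ArtinB (m + 5)} {v v' : FreeGroup (Fin (m + 5))} (hea : Commute e a)
    (heb : Commute e b) (h0 : k ≤ ((pB (m + 5) (h * w) ⟨0, by omega⟩ : Fin (m + 5)) : ℕ))
    (h1 : k ≤ ((pB (m + 5) (h * w) ⟨1, by omega⟩ : Fin (m + 5)) : ℕ))
    (ha : ConjOn (S01 (m + 5)) (w⁻¹ * a * w) v) (hb : ConjOn (S01 (m + 5)) (w⁻¹ * b * w) v')
    (hne : ¬ Commute v v')
    (ma : φ (h * a * h⁻¹) ∈ KB (m + 5) (tailSet (m + 5) (k + 1)))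
    (mb : φ (h * b * h⁻¹) ∈ KB (m + 5) (tailSet (m + 5) (k + 1)))
    (me : φ (h * e * h⁻¹) ∈ KB (m + 5) (tailSet (m + 5) (k + 1))) :
    φ (h * e * h⁻¹) ∈ KB (m + 5) (tailSet (m + 5) k) := by
  by_contra hcon
  have hconj : ∀ {x y : ArtinB (m + 5)}, Commute x y →
      Commute (φ (h * x * h⁻¹)) (φ (h * y * h⁻¹)) := fun hxy =>
    (hxy.map (MulAut.conj h).toMonoidHom).map φ.toMonoidHom
  have hc := KB_commutator hk ma mb me (hconj hea) (hconj heb) hcon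
  refine commutator_notMem hφ (a := h * a * h⁻¹) (b := h * b * h⁻¹) (w := h * w) ?_ ?_ hne
    (S := {i | i = pB (m + 5) (h * w) ⟨0, by omega⟩ ∨ i = pB (m + 5) (h * w) ⟨1, by omega⟩})
    (fun i => ?_) (KB_mono ?_ hc)
  · convert ha using 1; group
  · convert hb using 1; group
  · rw [Set.mem_ofPred_eq, (pB (m + 5) (h * w)).injective.eq_iff,
      (pB (m + 5) (h * w)).injective.eq_iff, Fin.ext_iff, Fin.ext_iff]
    change (i : ℕ) = 0 ∨ (i : ℕ) = 1 ↔ _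
    omega
  · rintro i (rfl | rfl)
    · exact h0
    · exact h1

/-- The image under `φ` of the elements which are pure generators with a strand below `k`
acts trivially on the strands from `k` on. -/
def Below (φ : MulAut (ArtinB (m + 5))) (k : ℕ) : Prop :=
  (∀ h, ((pB (m + 5) h ⟨0, by omega⟩ : Fin (m + 5)) : ℕ) < k →
    φ (h * Xo (sB (m + 5)) (m + 5) 0 * h⁻¹) ∈ KB (m + 5) (tailSet (m + 5) k)) ∧
  ∀ h, (((pB (m + 5) h ⟨0, by omega⟩ : Fin (m + 5)) : ℕ) < k ∨
      ((pB (m + 5) h ⟨1, by omega⟩ : Fin (m + 5)) : ℕ) < k) →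
    φ (h * sB (m + 5) 0 ^ 2 * h⁻¹) ∈ KB (m + 5) (tailSet (m + 5) k)

theorem below_top (hφ : ∀ g, pB (m + 5) (φ g) = pB (m + 5) g) : Below φ (m + 3) := by
  obtain ⟨w, -, hw0, hw1⟩ := exists_upper_pair (n := m + 5) (a := 0) (by omega)
    (u := ⟨m + 3, by omega⟩) (v := ⟨m + 4, by omega⟩) (by simp) (by simp) (by simp)
  have hS : ∀ i, pB (m + 5) w i ∈ tailSet (m + 5) (m + 3) ↔ (i : ℕ) < 2 := by
    intro i
    have h : pB (m + 5) w i ∈ tailSet (m + 5) (m + 3) ↔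
        pB (m + 5) w i = pB (m + 5) w ⟨0, by omega⟩ ∨
          pB (m + 5) w i = pB (m + 5) w ⟨0 + 1, by omega⟩ := by
      rw [hw0, hw1, Fin.ext_iff, Fin.ext_iff]
      change m + 3 ≤ _ ↔ _ = m + 3 ∨ _ = m + 4
      have := (pB (m + 5) w i).2
      omega
    rw [h, (pB (m + 5) w).injective.eq_iff, (pB (m + 5) w).injective.eq_iff, Fin.ext_iff,
      Fin.ext_iff]
    change (i : ℕ) = 0 ∨ (i : ℕ) = 1 ↔ _
    omega
  constructor
  · intro h hh
    refine map_KB_pair hφ hS (KB_conj (Xo_mem_KB (S := {i | (i : ℕ) ≠ 0}) (by omega) (by simp)) ?_)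
    rintro i hi h0
    rw [show i = ⟨0, by omega⟩ from Fin.ext h0] at hi
    change m + 3 ≤ _ at hi
    omega
  · rintro h (hh | hh)
    · refine map_KB_pair hφ hS (KB_conj
        (sq_mem_KB (i := 0) (S := {i | (i : ℕ) ≠ 0}) (by omega) (by simp)) ?_)
      rintro i hi h0
      rw [show i = ⟨0, by omega⟩ from Fin.ext h0] at hi
      change m + 3 ≤ _ at hi
      omega
    · refine map_KB_pair hφ hS (KB_conj
        (sq_mem_KB (i := 0) (S := {i | (i : ℕ) ≠ 1}) (by omega) (by simp)) ?_)
      rintro i hi h0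
      rw [show i = ⟨1, by omega⟩ from Fin.ext h0] at hi
      change m + 3 ≤ _ at hi
      omega

theorem pB_sB_val {n i : ℕ} (hi : i + 1 < n) (j : Fin n) :
    ((pB n (sB n i) j : Fin n) : ℕ) =
      if (j : ℕ) = i then i + 1 else if (j : ℕ) = i + 1 then i else j := by
  rw [pB_sB (by omega), swp_val i hi]

theorem conjOn_KB {n : ℕ} {S : Set (Fin n)} {g : ArtinB n} (hg : g ∈ KB n S) : ConjOn S g 1 :=
  (mem_KB_iff_conjOn.1 hg).2

theorem conjOn_Xo_zero : ConjOn (S01 (m + 5)) (Xo (sB (m + 5)) (m + 5) 0) (xF (m + 5) 0) := by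
  have := conjOn_f01 (Xo_mem_K01 (n := m + 5) (i := 0) (by omega))
  rwa [f01_Xo (by omega)] at this

theorem Xo_two_mem_KB : Xo (sB (m + 5)) (m + 5) 2 ∈ KB (m + 5) (S01 (m + 5)) :=
  Xo_mem_KB (by omega) (by simp [S01])

theorem below_Xo_step (hφ : ∀ g, pB (m + 5) (φ g) = pB (m + 5) g) {k : ℕ} (hk : k + 2 < m + 5)
    (ih : Below φ (k + 1)) (h : ArtinB (m + 5))
    (hh : ((pB (m + 5) h ⟨0, by omega⟩ : Fin (m + 5)) : ℕ) < k) :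
    φ (h * Xo (sB (m + 5)) (m + 5) 0 * h⁻¹) ∈ KB (m + 5) (tailSet (m + 5) k) := by
  set s := sB (m + 5) with hs
  have hB : IsArtB (m + 5) s := isArtB_sB (m + 5)
  have hpos : ∀ j : Fin (m + 5), k ≤ (j : ℕ) → 1 ≤ (((pB (m + 5) h)⁻¹ j : Fin (m + 5)) : ℕ) := by
    intro j hj
    by_contra h0
    have : (pB (m + 5) h)⁻¹ j = ⟨0, by omega⟩ := Fin.ext (by change _ = 0; omega)
    rw [Equiv.Perm.inv_eq_iff_eq] at this
    rw [← this] at hh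
    omega
  obtain ⟨g, hg, hg1, hg2⟩ := exists_upper_pair (n := m + 5) (a := 1) (by omega)
    (u := (pB (m + 5) h)⁻¹ ⟨k, by omega⟩) (v := (pB (m + 5) h)⁻¹ ⟨k + 1, by omega⟩)
    (hpos _ le_rfl) (hpos _ (by simp)) (by simp)
  have hgX : Commute g (Xo s (m + 5) 0) := by
    have : upper (m + 5) 1 ≤ Subgroup.centralizer {Xo s (m + 5) 0} := upper_le fun i h1 h2 =>
      Subgroup.mem_centralizer_singleton_iff.2 (hB.commute_Xo_of_gt (by omega) h2).eq
    exact Subgroup.mem_centralizer_singleton_iff.1 (this hg)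
  have hgX' : h * Xo s (m + 5) 0 * h⁻¹ = h * g * Xo s (m + 5) 0 * (h * g)⁻¹ := by
    rw [mul_assoc h g, hgX.eq]; group
  have hp0 : ((pB (m + 5) (h * g) ⟨0, by omega⟩ : Fin (m + 5)) : ℕ) < k := by
    rw [map_mul, Equiv.Perm.mul_apply, pB_upper hg (by simp)]; exact hh
  have hp1 : pB (m + 5) (h * g) ⟨1, by omega⟩ = ⟨k, by omega⟩ := by
    rw [map_mul, Equiv.Perm.mul_apply, hg1]; simp
  have hp2 : pB (m + 5) (h * g) ⟨2, by omega⟩ = ⟨k + 1, by omega⟩ := by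
    rw [map_mul, Equiv.Perm.mul_apply, hg2]; simp
  rw [hgX']
  generalize h * g = h at hp0 hp1 hp2 ⊢
  have hXX := (hB.commute_XX (k := 0) (by omega)).1
  have hX1 : Xo s (m + 5) 1 = (s 0)⁻¹ * Xo s (m + 5) 0 * s 0 := by
    rw [Xo_succ s (show 0 + 1 < m + 5 by omega)]; group
  have hX2 : Xo s (m + 5) 2 = (s 1)⁻¹ * Xo s (m + 5) 1 * s 1 := by
    rw [Xo_succ s (show 1 + 1 < m + 5 by omega)]; group
  have hb01 : s 0 * s 1 * s 0 = s 1 * s 0 * s 1 := hB.braid 0 (by omega)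
  have hc1 : Commute (s 1) (Xo s (m + 5) 0) := hB.commute_Xo_of_gt (by omega) (by omega)
  have hs1' : (s 0 * s 1)⁻¹ * s 1 * (s 0 * s 1) = s 0 := by
    rw [mul_assoc, ← mul_assoc (s 1), ← hb01]; group
  have hw0 : pB (m + 5) (h * (s 0 * s 1)) ⟨0, by omega⟩ = ⟨k, by omega⟩ := by
    rw [← hp1, map_mul, Equiv.Perm.mul_apply, (pB (m + 5) h).injective.eq_iff, Fin.ext_iff,
      map_mul, Equiv.Perm.mul_apply, pB_sB_val (by omega), pB_sB_val (by omega)]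
    simp
  have hw1 : pB (m + 5) (h * (s 0 * s 1)) ⟨1, by omega⟩ = ⟨k + 1, by omega⟩ := by
    rw [← hp2, map_mul, Equiv.Perm.mul_apply, (pB (m + 5) h).injective.eq_iff, Fin.ext_iff,
      map_mul, Equiv.Perm.mul_apply, pB_sB_val (by omega), pB_sB_val (by omega)]
    simp
  have hw2 : pB (m + 5) (h * (s 0)⁻¹) ⟨0, by omega⟩ = ⟨k, by omega⟩ := by
    rw [← hp1, map_mul, Equiv.Perm.mul_apply, (pB (m + 5) h).injective.eq_iff, map_inv,
      Equiv.Perm.inv_eq_iff_eq, Fin.ext_iff, pB_sB_val (by omega)]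
    simp
  refine map_mem_tail_step hφ (by omega) (w := s 0 * s 1) (a := s 1 ^ 2)
    (b := (Xo s (m + 5) 0 * Xo s (m + 5) 1)⁻¹ * s 0 ^ 2) (hc1.symm.pow_right 2)
    hXX.symm (by rw [hw0]) (by rw [hw1]; simp) (v := xF (m + 5) 0 * xF (m + 5) 1)
    (v' := (xF (m + 5) 0 * 1)⁻¹ * 1⁻¹) ?_ ?_ ?_ ?_ ?_ (ih.1 h (by omega))
  · have : (s 0 * s 1)⁻¹ * s 1 ^ 2 * (s 0 * s 1) = s 0 ^ 2 := by
      rw [inv_mul_sq_mul, hs1']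
    rw [this]
    exact conjOn_sq_zero (by omega)
  · have hkey := hB.Xo_key (k := 0) (by omega)
    have h01 : (s 0)⁻¹ * (Xo s (m + 5) 0 * Xo s (m + 5) 1) * s 0 =
        Xo s (m + 5) 0 * Xo s (m + 5) 1 := by
      have e1 : s 0 * (Xo s (m + 5) 0 * Xo s (m + 5) 1) * (s 0)⁻¹ =
          s 0 * Xo s (m + 5) 0 * (s 0)⁻¹ * (s 0 * Xo s (m + 5) 1 * (s 0)⁻¹) := by group
      rw [hkey, ← Xo_succ s (show 0 + 1 < m + 5 by omega), zero_add, inv_mul_cancel_right] at e1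
      conv_lhs => rw [← e1]
      group
    have : (s 0 * s 1)⁻¹ * ((Xo s (m + 5) 0 * Xo s (m + 5) 1)⁻¹ * s 0 ^ 2) * (s 0 * s 1) =
        (Xo s (m + 5) 0 * Xo s (m + 5) 2)⁻¹ * (bB s 1)⁻¹ := by
      calc _ = (s 1)⁻¹ * (((s 0)⁻¹ * (Xo s (m + 5) 0 * Xo s (m + 5) 1) * s 0)⁻¹ * s 0 ^ 2) *
            s 1 := by group
        _ = _ := by
          have e2 : (s 1)⁻¹ * Xo s (m + 5) 0 * s 1 = Xo s (m + 5) 0 := by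
            rw [mul_assoc, ← hc1.eq]; group
          rw [h01, hX2, bB_one]
          conv_rhs => rw [← e2]
          group
    rw [this]
    exact (conjOn_Xo_zero.mul (conjOn_KB Xo_two_mem_KB)).inv.mul
      (conjOn_KB (bB_one_mem_KB (by omega))).inv
  · intro hc
    rw [mul_one, inv_one, mul_one, Commute.inv_right_iff] at hc
    refine not_commute_xF (n := m + 5) (i := 0) (j := 1) (by omega) (by omega) (by omega) ?_
    have := hc.eq
    rw [mul_assoc, mul_right_inj] at this
    exact this.symm
  · have : h * s 1 ^ 2 * h⁻¹ = h * (s 0 * s 1) * s 0 ^ 2 * (h * (s 0 * s 1))⁻¹ := by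
      have e := inv_mul_sq_mul (s 0 * s 1) (s 1)
      rw [hs1'] at e
      rw [← e]; group
    rw [this]
    exact ih.2 _ (Or.inl (by rw [hw0]; simp))
  · have : h * ((Xo s (m + 5) 0 * Xo s (m + 5) 1)⁻¹ * s 0 ^ 2) * h⁻¹ =
        (h * Xo s (m + 5) 0 * h⁻¹ * (h * (s 0)⁻¹ * Xo s (m + 5) 0 * (h * (s 0)⁻¹)⁻¹))⁻¹ *
          (h * s 0 ^ 2 * h⁻¹) := by rw [hX1]; group
    rw [this, map_mul, map_inv, map_mul]
    exact mul_mem (inv_mem (mul_mem (ih.1 _ (by omega)) (ih.1 _ (by rw [hw2]; simp))))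
      (ih.2 _ (Or.inl (by omega)))

theorem below_sq_step (hφ : ∀ g, pB (m + 5) (φ g) = pB (m + 5) g) {k : ℕ} (hk : k + 2 < m + 5)
    (ih : Below φ (k + 1)) (h : ArtinB (m + 5))
    (hh : ((pB (m + 5) h ⟨0, by omega⟩ : Fin (m + 5)) : ℕ) < k ∨
      ((pB (m + 5) h ⟨1, by omega⟩ : Fin (m + 5)) : ℕ) < k)
    (hk0 : ((pB (m + 5) h ⟨0, by omega⟩ : Fin (m + 5)) : ℕ) ≠ k)
    (hk1 : ((pB (m + 5) h ⟨1, by omega⟩ : Fin (m + 5)) : ℕ) ≠ k) :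
    φ (h * sB (m + 5) 0 ^ 2 * h⁻¹) ∈ KB (m + 5) (tailSet (m + 5) k) := by
  set s := sB (m + 5) with hs
  have hB : IsArtB (m + 5) s := isArtB_sB (m + 5)
  obtain ⟨d, hd, hkd, hd0, hd1⟩ : ∃ d, d < m + 5 ∧ k < d ∧
      ((pB (m + 5) h ⟨0, by omega⟩ : Fin (m + 5)) : ℕ) ≠ d ∧
      ((pB (m + 5) h ⟨1, by omega⟩ : Fin (m + 5)) : ℕ) ≠ d := by
    by_cases h1 : ((pB (m + 5) h ⟨0, by omega⟩ : Fin (m + 5)) : ℕ) ≠ k + 1 ∧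
        ((pB (m + 5) h ⟨1, by omega⟩ : Fin (m + 5)) : ℕ) ≠ k + 1
    · exact ⟨k + 1, by omega, by omega, h1.1, h1.2⟩
    · exact ⟨k + 2, by omega, by omega, by omega, by omega⟩
  have hpos : ∀ j : Fin (m + 5), ((pB (m + 5) h ⟨0, by omega⟩ : Fin (m + 5)) : ℕ) ≠ j →
      ((pB (m + 5) h ⟨1, by omega⟩ : Fin (m + 5)) : ℕ) ≠ j →
      2 ≤ (((pB (m + 5) h)⁻¹ j : Fin (m + 5)) : ℕ) := by
    intro j hj0 hj1
    by_contra h0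
    have : (pB (m + 5) h)⁻¹ j = ⟨0, by omega⟩ ∨ (pB (m + 5) h)⁻¹ j = ⟨1, by omega⟩ := by
      rw [Fin.ext_iff, Fin.ext_iff]; change _ = 0 ∨ _ = 1; omega
    rw [Equiv.Perm.inv_eq_iff_eq, Equiv.Perm.inv_eq_iff_eq] at this
    rcases this with h' | h'
    · exact hj0 (congrArg Fin.val h'.symm)
    · exact hj1 (congrArg Fin.val h'.symm)
  obtain ⟨g, hg, hg2, hg3⟩ := exists_upper_pair (n := m + 5) (a := 2) (by omega)
    (u := (pB (m + 5) h)⁻¹ ⟨k, by omega⟩) (v := (pB (m + 5) h)⁻¹ ⟨d, hd⟩)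
    (hpos _ hk0 hk1) (hpos _ hd0 hd1) (by simp; omega)
  have hgX : Commute g (s 0) := by
    have : upper (m + 5) 2 ≤ Subgroup.centralizer {s 0} := upper_le fun i h1 h2 =>
      Subgroup.mem_centralizer_singleton_iff.2 (hB.comm 0 i (by omega) (by omega)).symm.eq
    exact Subgroup.mem_centralizer_singleton_iff.1 (this hg)
  have hgX' : h * s 0 ^ 2 * h⁻¹ = h * g * s 0 ^ 2 * (h * g)⁻¹ := by
    rw [mul_assoc h g, (hgX.pow_right 2).eq]; group
  have hp0 : ((pB (m + 5) (h * g) ⟨0, by omega⟩ : Fin (m + 5)) : ℕ) < k ∨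
      ((pB (m + 5) (h * g) ⟨1, by omega⟩ : Fin (m + 5)) : ℕ) < k := by
    rw [map_mul, Equiv.Perm.mul_apply, Equiv.Perm.mul_apply, pB_upper hg (by simp),
      pB_upper hg (by simp)]; exact hh
  have hp2 : pB (m + 5) (h * g) ⟨2, by omega⟩ = ⟨k, by omega⟩ := by
    rw [map_mul, Equiv.Perm.mul_apply, hg2]; simp
  have hp3 : pB (m + 5) (h * g) ⟨3, by omega⟩ = ⟨d, hd⟩ := by
    rw [map_mul, Equiv.Perm.mul_apply, hg3]; simp
  rw [hgX']
  generalize h * g = h at hp0 hp2 hp3 ⊢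
  have hX1 : Xo s (m + 5) 1 = (s 0)⁻¹ * Xo s (m + 5) 0 * s 0 := by
    rw [Xo_succ s (show 0 + 1 < m + 5 by omega)]; group
  have hX2 : Xo s (m + 5) 2 = (s 1)⁻¹ * Xo s (m + 5) 1 * s 1 := by
    rw [Xo_succ s (show 1 + 1 < m + 5 by omega)]; group
  have hb01 : s 0 * s 1 * s 0 = s 1 * s 0 * s 1 := hB.braid 0 (by omega)
  have hb12 : s 1 * s 2 * s 1 = s 2 * s 1 * s 2 := hB.braid 1 (by omega)
  have hc02 : s 0 * s 2 = s 2 * s 0 := (hB.comm 0 2 (by omega) (by omega)).eq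
  have hc1 : Commute (s 1) (Xo s (m + 5) 0) := hB.commute_Xo_of_gt (by omega) (by omega)
  have hc2 : Commute (s 2) (Xo s (m + 5) 0) := hB.commute_Xo_of_gt (by omega) (by omega)
  obtain ⟨w, hw⟩ : ∃ w, w = (s 1 * s 2 * s 0 * s 1)⁻¹ := ⟨_, rfl⟩
  have hs2 : w⁻¹ * s 2 * w = s 0 := by
    have : s 1 * s 2 * s 0 * s 1 * s 2 = s 0 * (s 1 * s 2 * s 0 * s 1) := by
      calc _ = s 1 * (s 2 * s 0) * s 1 * s 2 := by group
        _ = s 1 * s 0 * (s 2 * s 1 * s 2) := by rw [← hc02]; group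
        _ = s 1 * s 0 * s 1 * s 2 * s 1 := by rw [← hb12]; group
        _ = s 0 * s 1 * (s 0 * s 2) * s 1 := by rw [← hb01]; group
        _ = _ := by rw [hc02]; group
    rw [hw, inv_inv, this]; group
  have hwX : w⁻¹ * Xo s (m + 5) 2 * w = Xo s (m + 5) 0 := by
    have e : s 1 * s 2 * Xo s (m + 5) 0 * (s 1 * s 2)⁻¹ = Xo s (m + 5) 0 := by
      rw [(hc1.mul_left hc2).eq]; group
    rw [hX2, hX1, hw]
    conv_rhs => rw [← e]
    group
  have hw0 : pB (m + 5) (h * w) ⟨0, by omega⟩ = ⟨k, by omega⟩ := by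
    rw [← hp2, map_mul, Equiv.Perm.mul_apply, (pB (m + 5) h).injective.eq_iff, hw, map_inv,
      Equiv.Perm.inv_eq_iff_eq, Fin.ext_iff, map_mul, map_mul, map_mul, Equiv.Perm.mul_apply,
      Equiv.Perm.mul_apply, Equiv.Perm.mul_apply, pB_sB_val (by omega), pB_sB_val (by omega),
      pB_sB_val (by omega), pB_sB_val (by omega)]
    simp
  have hw1 : pB (m + 5) (h * w) ⟨1, by omega⟩ = ⟨d, hd⟩ := by
    rw [← hp3, map_mul, Equiv.Perm.mul_apply, (pB (m + 5) h).injective.eq_iff, hw, map_inv,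
      Equiv.Perm.inv_eq_iff_eq, Fin.ext_iff, map_mul, map_mul, map_mul, Equiv.Perm.mul_apply,
      Equiv.Perm.mul_apply, Equiv.Perm.mul_apply, pB_sB_val (by omega), pB_sB_val (by omega),
      pB_sB_val (by omega), pB_sB_val (by omega)]
    simp
  refine map_mem_tail_step hφ (by omega) (w := w) (a := Xo s (m + 5) 2) (b := s 2 ^ 2)
    ((hB.commute_Xo_of_lt (by omega) (by omega)).pow_left 2)
    ((hB.comm 0 2 (by omega) (by omega)).pow_pow 2 2) (by rw [hw0]) (by rw [hw1]; exact hkd.le)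
    (v := xF (m + 5) 0) (v' := xF (m + 5) 0 * xF (m + 5) 1) ?_ ?_ ?_ ?_ ?_
    (ih.2 h (by omega))
  · rw [hwX]; exact conjOn_Xo_zero
  · have : w⁻¹ * s 2 ^ 2 * w = s 0 ^ 2 := by
      rw [inv_mul_sq_mul, hs2]
    rw [this]
    exact conjOn_sq_zero (by omega)
  · intro hc
    refine not_commute_xF (n := m + 5) (i := 0) (j := 1) (by omega) (by omega) (by omega) ?_
    have := hc.eq
    rwa [mul_assoc, mul_right_inj] at this
  · have : h * Xo s (m + 5) 2 * h⁻¹ = h * w * Xo s (m + 5) 0 * (h * w)⁻¹ := by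
      rw [← hwX]; group
    rw [this]
    exact ih.1 _ (by rw [hw0]; simp)
  · have : h * s 2 ^ 2 * h⁻¹ = h * w * s 0 ^ 2 * (h * w)⁻¹ := by
      have e := inv_mul_sq_mul w (s 2)
      rw [hs2] at e
      rw [← e]; group
    rw [this]
    exact ih.2 _ (Or.inl (by rw [hw0]; simp))

theorem below_step (hφ : ∀ g, pB (m + 5) (φ g) = pB (m + 5) g) {k : ℕ} (hk : k + 2 < m + 5)
    (ih : Below φ (k + 1)) : Below φ k := by
  refine ⟨below_Xo_step hφ hk ih, fun h hh => ?_⟩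
  by_cases hc : ((pB (m + 5) h ⟨0, by omega⟩ : Fin (m + 5)) : ℕ) ≠ k ∧
    ((pB (m + 5) h ⟨1, by omega⟩ : Fin (m + 5)) : ℕ) ≠ k
  · exact below_sq_step hφ hk ih h hh hc.1 hc.2
  · have hne : ((pB (m + 5) h ⟨0, by omega⟩ : Fin (m + 5)) : ℕ) ≠
        ((pB (m + 5) h ⟨1, by omega⟩ : Fin (m + 5)) : ℕ) := by
      rw [Ne, ← Fin.ext_iff, (pB (m + 5) h).injective.eq_iff]; simp
    have h1 := below_sq_step hφ hk ih (sB (m + 5) k * h)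
    simp only [map_mul (pB (m + 5)), Equiv.Perm.mul_apply,
      pB_sB_val (show k + 1 < m + 5 by omega)] at h1
    have h2 := h1 (by split_ifs <;> omega) (by split_ifs <;> omega) (by split_ifs <;> omega)
    have h3 := KB_conj (S' := tailSet (m + 5) k) (h := (φ (sB (m + 5) k))⁻¹) h2 fun i hi => by
      rw [← map_inv, hφ, map_inv] at hi
      change k ≤ _ at hi
      change k ≤ _
      obtain ⟨j, rfl⟩ := (pB (m + 5) (sB (m + 5) k)).surjective i
      rw [← Equiv.Perm.mul_apply, inv_mul_cancel, Equiv.Perm.one_apply] at hi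
      rw [pB_sB_val (by omega)]
      split_ifs <;> omega
    convert h3 using 1
    simp only [map_mul, map_inv]
    group

theorem below_one (hφ : ∀ g, pB (m + 5) (φ g) = pB (m + 5) g) : Below φ 1 := by
  have : ∀ k, k ≤ m + 2 → Below φ (m + 3 - k) := by
    intro k hk
    induction k with
    | zero => exact below_top hφ
    | succ k ih =>
      refine below_step hφ (by omega) ?_
      rw [show m + 3 - (k + 1) + 1 = m + 3 - k by omega]
      exact ih (by omega)
  have h := this (m + 2) le_rfl
  rwa [show m + 3 - (m + 2) = 1 by omega] at h

theorem exists_ι1_zpow_of_mem_KB {n : ℕ} {g : ArtinB (n + 2)}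
    (hg : g ∈ KB (n + 2) (tailSet (n + 2) 1)) :
    ∃ (z : FreeGroup (Fin (n + 2))) (j : ℤ), g = ι1 (n + 1) z * ΔB (n + 2) ^ j := by
  have h0 : ∀ w, e0 (n + 1) (Φ (n + 2) g w) = e0 (n + 1) w := by
    have h1 : ∀ y, e0 (n + 1) (eS (tailSet (n + 2) 1) y) = e0 (n + 1) y :=
      fun y => e0_dn_eS (m := n + 1) (k := 0) y
    intro w
    rw [← h1, hg.2, h1]
  obtain ⟨z, h, rfl⟩ := mem_stab0.1 (mem_stab0_iff.2 (by rw [hg.1]; rfl))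
  have hh : Φ (n + 1) h = 1 := by
    ext1 w
    obtain ⟨y, rfl⟩ := e0_surjective _ w
    rw [← e0_Φ_sh, MulAut.one_apply]
    have := h0 y
    rwa [map_mul, MulAut.mul_apply, e0_Φ_ι1] at this
  obtain ⟨z', j, hz'⟩ := exists_ι1_of_Φ_sh hh
  exact ⟨z * z', j, by rw [hz', map_mul, mul_assoc]⟩

theorem map_Xo_zero (hφ : ∀ g, pB (m + 5) (φ g) = pB (m + 5) g) :
    ∃ (z : FreeGroup (Fin (m + 5))) (j : ℤ),
      φ (Xo (sB (m + 5)) (m + 5) 0) = ι1 (m + 4) z * ΔB (m + 5) ^ j := by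
  have := (below_one hφ).1 1 (by simp)
  rw [one_mul, inv_one, mul_one] at this
  exact exists_ι1_zpow_of_mem_KB this

theorem map_ι1 (hφ : ∀ g, pB (m + 5) (φ g) = pB (m + 5) g) (y : FreeGroup (Fin (m + 5))) :
    ∃ (z : FreeGroup (Fin (m + 5))) (j : ℤ), φ (ι1 (m + 4) y) = ι1 (m + 4) z * ΔB (m + 5) ^ j := by
  refine exists_ι1_zpow_of_mem_KB ?_
  change y ∈ (KB (m + 5) (tailSet (m + 5) 1)).comap (φ.toMonoidHom.comp (ι1 (m + 4)))
  refine mem_of_xF (fun i hi => ?_) y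
  rw [Subgroup.mem_comap]
  change φ (ι1 (m + 4) (xF (m + 5) i)) ∈ _
  rcases Nat.lt_or_ge i (m + 4) with h | h
  · rw [ι1_xF h, bB]
    have hp : pr (sB (m + 5)) 1 i ∈ upper (m + 5) 1 :=
      pr_mem fun j h1 h2 => sB_mem_upper h1 (by omega)
    have := (below_one hφ).2 (pr (sB (m + 5)) 1 i)⁻¹
      (Or.inl (by rw [pB_upper (inv_mem hp) (by simp)]; simp))
    convert inv_mem this using 1
    rw [← map_inv]; congr 1; group
  · obtain rfl : i = m + 4 := by omega
    rw [ι1_xF_last]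
    have := (below_one hφ).1 1 (by simp)
    rwa [one_mul, inv_one, mul_one] at this

end Descent

end ArtinAut

namespace ArtinAut

section Split

variable {α : Type*} [DecidableEq α]

open FreeGroup (of toWord)

/-- The subgroup generated by a set of letters. -/
def letters (S : Set α) : Subgroup (FreeGroup α) := Subgroup.closure (Set.image of S)

theorem of_mem_letters {S : Set α} {i : α} (h : i ∈ S) : of i ∈ letters S :=
  Subgroup.subset_closure ⟨i, h, rfl⟩

theorem mem_of_mem_letters {S : Set α} {x : FreeGroup α} (hx : x ∈ letters S) :
    ∀ p ∈ toWord x, p.1 ∈ S := by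
  induction hx using Subgroup.closure_induction with
  | mem x h => obtain ⟨i, hi, rfl⟩ := h; simpa using hi
  | one => simp
  | mul x y _ _ hx hy =>
    intro p hp
    rcases List.mem_append.1 ((FreeGroup.toWord_mul_sublist x y).subset hp) with h | h
    · exact hx p h
    · exact hy p h
  | inv x _ hx =>
    intro p hp
    rw [FreeGroup.toWord_inv, FreeGroup.invRev, List.mem_reverse, List.mem_map] at hp
    obtain ⟨q, hq, rfl⟩ := hp
    exact hx q hq

theorem noCancel_of_letters {S S' : Set α} (hS : ∀ i ∈ S, i ∉ S') {x y : FreeGroup α}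
    (hx : x ∈ letters S) (hy : y ∈ letters S') : NoCancel x y := by
  rw [noCancel_iff_isReduced, FreeGroup.IsReduced, List.isChain_append]
  refine ⟨FreeGroup.isReduced_toWord, FreeGroup.isReduced_toWord, fun p hp q hq h => ?_⟩
  have h1 := mem_of_mem_letters hx p (List.mem_of_getLast? hp)
  have h2 := mem_of_mem_letters hy q (List.mem_of_head? hq)
  rw [h] at h1
  exact absurd h2 (hS _ h1)

/-- Nontrivial elements of complementary sets of letters. -/
def Alt (S : Set α) (x y : FreeGroup α) : Prop :=
  x ≠ 1 ∧ y ≠ 1 ∧ ((x ∈ letters S ∧ y ∈ letters Sᶜ) ∨ (x ∈ letters Sᶜ ∧ y ∈ letters S))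

theorem Alt.noCancel {S : Set α} {x y : FreeGroup α} (h : Alt S x y) : NoCancel x y := by
  rcases h.2.2 with ⟨h1, h2⟩ | ⟨h1, h2⟩
  · exact noCancel_of_letters (S := S) (S' := Sᶜ) (fun i hi hi' => hi' hi) h1 h2
  · exact noCancel_of_letters (S := Sᶜ) (S' := S) (fun i hi hi' => hi hi') h1 h2

theorem mul_mem_of_not_alt {S : Set α} {x y : FreeGroup α}
    (hx : x ∈ letters S ∨ x ∈ letters Sᶜ) (hy : y ∈ letters S ∨ y ∈ letters Sᶜ)
    (h : ¬ Alt S x y) : x * y ∈ letters S ∨ x * y ∈ letters Sᶜ := by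
  by_cases hx1 : x = 1
  · rwa [hx1, one_mul]
  by_cases hy1 : y = 1
  · rwa [hy1, mul_one]
  rcases hx with hx | hx <;> rcases hy with hy | hy
  · exact Or.inl (mul_mem hx hy)
  · exact absurd ⟨hx1, hy1, Or.inl ⟨hx, hy⟩⟩ h
  · exact absurd ⟨hx1, hy1, Or.inr ⟨hx, hy⟩⟩ h
  · exact Or.inr (mul_mem hx hy)

theorem noCancel_prod_of_isChain {S : Set α} {x : FreeGroup α} {l : List (FreeGroup α)}
    (h : (x :: l).IsChain (Alt S)) : NoCancel x l.prod := by
  induction l generalizing x with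
  | nil => exact noCancel_one_right x
  | cons y l ih =>
    rw [List.isChain_cons_cons] at h
    rw [List.prod_cons]
    exact h.1.noCancel.trans_left (ih h.2) h.1.2.1

theorem norm_prod_of_isChain {S : Set α} {l : List (FreeGroup α)} (h : l.IsChain (Alt S)) :
    l.prod.norm = (l.map FreeGroup.norm).sum := by
  induction l with
  | nil => simp
  | cons x l ih =>
    rw [List.prod_cons, (noCancel_prod_of_isChain h).norm_eq, ih h.tail, List.map_cons,
      List.sum_cons]

theorem norm_pow_of_noCancel {w : FreeGroup α} (h : NoCancel w w) (hw : w ≠ 1) (m : ℕ) :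
    NoCancel w (w ^ m) ∧ (w ^ m).norm = m * w.norm := by
  induction m with
  | zero => simp [noCancel_one_right]
  | succ m ih =>
    rw [pow_succ']
    refine ⟨h.trans_left ih.1 hw, ?_⟩
    rw [ih.1.norm_eq, ih.2]; ring

theorem norm_le_of_isConj {w w' : FreeGroup α} (h : NoCancel w w) (hw : w ≠ 1)
    (hc : IsConj w w') : w.norm ≤ w'.norm := by
  obtain ⟨c, rfl⟩ := isConj_iff.1 hc
  by_contra hlt
  push Not at hlt
  have key : ∀ m : ℕ, m * w.norm ≤ 2 * c.norm + m * (c * w * c⁻¹).norm := fun m => by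
    rw [← (norm_pow_of_noCancel h hw m).2]
    have e : w ^ m = c⁻¹ * (c * w * c⁻¹) ^ m * c := by rw [conj_pow]; group
    have h1 : ∀ (x : FreeGroup α) (m : ℕ), (x ^ m).norm ≤ m * x.norm := fun x m => by
      induction m with
      | zero => simp
      | succ m ih =>
        rw [pow_succ]
        have := FreeGroup.norm_mul_le (x ^ m) x
        linarith
    have h2 := h1 (c * w * c⁻¹) m
    have h3 := FreeGroup.norm_mul_le (c⁻¹ * (c * w * c⁻¹) ^ m) c
    have h4 := FreeGroup.norm_mul_le c⁻¹ ((c * w * c⁻¹) ^ m)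
    rw [FreeGroup.norm_inv_eq] at h4
    rw [e]
    linarith
  have := key (2 * c.norm + 1)
  nlinarith

theorem exists_list {S : Set α} (w : FreeGroup α) :
    ∃ l : List (FreeGroup α), (∀ x ∈ l, x ∈ letters S ∨ x ∈ letters Sᶜ) ∧ l.prod = w := by
  have hof : ∀ i, of i ∈ letters S ∨ of i ∈ letters Sᶜ := fun i => by
    by_cases h : i ∈ S
    · exact Or.inl (of_mem_letters h)
    · exact Or.inr (of_mem_letters h)
  induction w using FreeGroup.induction_on with
  | C1 => exact ⟨[], by simp, rfl⟩
  | of i => exact ⟨[of i], by simpa using hof i, by simp⟩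
  | inv_of i _ => exact ⟨[(of i)⁻¹], by simpa using hof i, by simp⟩
  | mul x y hx hy =>
    obtain ⟨l, hl, rfl⟩ := hx
    obtain ⟨l', hl', rfl⟩ := hy
    refine ⟨l ++ l', fun x hx => ?_, by simp⟩
    rcases List.mem_append.1 hx with h | h
    · exact hl x h
    · exact hl' x h

theorem exists_not_of_not_isChain {β : Type*} {R : β → β → Prop} {l : List β}
    (h : ¬ l.IsChain R) : ∃ l1 x y l2, l = l1 ++ x :: y :: l2 ∧ ¬ R x y := by
  induction l with
  | nil => simp at h
  | cons x l ih =>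
    rcases l with _ | ⟨y, l⟩
    · simp at h
    · rw [List.isChain_cons_cons, not_and_or] at h
      rcases h with h | h
      · exact ⟨[], x, y, l, rfl, h⟩
      · obtain ⟨l1, x', y', l2, h1, h2⟩ := ih h
        exact ⟨x :: l1, x', y', l2, by rw [h1]; rfl, h2⟩

/-- Every element is conjugate to an element of one of the two complementary free factors,
or to a cyclically alternating product. -/
theorem exists_cyclic_list (S : Set α) (w : FreeGroup α) :
    (∃ w', IsConj w w' ∧ (w' ∈ letters S ∨ w' ∈ letters Sᶜ)) ∨
    ∃ l : List (FreeGroup α), (∀ x ∈ l, x ∈ letters S ∨ x ∈ letters Sᶜ) ∧ IsConj w l.prod ∧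
      l ≠ [] ∧ (l ++ l).IsChain (Alt S) := by
  classical
  have hex : ∃ k, ∃ l : List (FreeGroup α), (∀ x ∈ l, x ∈ letters S ∨ x ∈ letters Sᶜ) ∧
      IsConj w l.prod ∧ l.length = k := by
    obtain ⟨l, hl, h⟩ := exists_list (S := S) w
    exact ⟨_, l, hl, by rw [h], rfl⟩
  obtain ⟨l, hl, hc, hk⟩ := Nat.find_spec hex
  have hmin : ∀ l' : List (FreeGroup α), (∀ x ∈ l', x ∈ letters S ∨ x ∈ letters Sᶜ) →
      IsConj w l'.prod → l.length ≤ l'.length := fun l' h1 h2 => by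
    rw [hk]; exact Nat.find_min' hex ⟨l', h1, h2, rfl⟩
  rcases l with _ | ⟨x, l⟩
  · exact Or.inl ⟨1, by simpa using hc, Or.inl (one_mem _)⟩
  rcases List.eq_nil_or_concat l with rfl | ⟨l, y, rfl⟩
  · exact Or.inl ⟨x, by simpa using hc, hl x (by simp)⟩
  right
  simp only [List.concat_eq_append] at hl hc hk hmin ⊢
  refine ⟨_, hl, hc, by simp, ?_⟩
  have hchain : (x :: (l ++ [y])).IsChain (Alt S) := by
    by_contra hn
    obtain ⟨l1, a, b, l2, h1, h2⟩ := exists_not_of_not_isChain hn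
    have := hmin (l1 ++ (a * b) :: l2) ?_ ?_
    · rw [h1] at this
      simp at this
    · rw [h1] at hl
      intro z hz
      simp only [List.mem_append, List.mem_cons] at hz
      rcases hz with hz | rfl | hz
      · exact hl z (by simp [hz])
      · exact mul_mem_of_not_alt (hl a (by simp)) (hl b (by simp)) h2
      · exact hl z (by simp [hz])
    · rw [h1] at hc
      simpa [mul_assoc] using hc
  rw [List.isChain_append]
  refine ⟨hchain, hchain, fun a ha b hb => ?_⟩
  obtain rfl : y = a := by
    rw [← List.cons_append, List.getLast?_append] at ha
    simpa using ha
  obtain rfl : x = b := by simpa using hb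
  by_contra hn
  have := hmin ((y * x) :: l) ?_ ?_
  · simp at this
  · intro z hz
    rcases List.mem_cons.1 hz with rfl | hz
    · exact mul_mem_of_not_alt (hl y (by simp)) (hl x (by simp)) hn
    · exact hl z (by simp [hz])
  · refine hc.trans (isConj_iff.2 ⟨y, ?_⟩)
    simp [mul_assoc]

theorem ne_one_of_isChain {S : Set α} {l : List (FreeGroup α)} (hl : l ≠ [])
    (h : (l ++ l).IsChain (Alt S)) : NoCancel l.prod l.prod ∧ l.prod ≠ 1 := by
  have h1 := norm_prod_of_isChain h
  have h2 := norm_prod_of_isChain (List.isChain_append.1 h).1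
  rw [List.map_append, List.sum_append, ← h2, List.prod_append] at h1
  refine ⟨h1, fun h3 => ?_⟩
  rw [h3, FreeGroup.norm_one] at h2
  rcases l with _ | ⟨x, l⟩
  · exact hl rfl
  have hx : x ≠ 1 := by
    rcases l with _ | ⟨y, l⟩
    · exact (List.isChain_cons_cons.1 h).1.1
    · exact (List.isChain_cons_cons.1 h).1.1
  rw [List.map_cons, List.sum_cons] at h2
  exact hx (FreeGroup.norm_eq_zero.1 (by omega))

theorem exists_twist_pow {S : Set α} {u : FreeGroup α} (hu : u ∈ letters S)
    {z : FreeGroup α →* FreeGroup α} (h1 : ∀ i ∈ S, z (of i) = u * of i * u⁻¹)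
    (h2 : ∀ i ∉ S, z (of i) = of i) {w : FreeGroup α} (hw : IsConj w (z w)) (j : ℕ) :
    ∃ zj : FreeGroup α →* FreeGroup α, (∀ a ∈ letters S, zj a = u ^ j * a * (u ^ j)⁻¹) ∧
      (∀ c ∈ letters Sᶜ, zj c = c) ∧ IsConj w (zj w) := by
  have hA : ∀ a ∈ letters S, z a = u * a * u⁻¹ := fun a ha => by
    induction ha using Subgroup.closure_induction with
    | mem x h => obtain ⟨i, hi, rfl⟩ := h; exact h1 i hi
    | one => simp
    | mul x y _ _ hx hy => rw [map_mul, hx, hy]; group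
    | inv x _ hx => rw [map_inv, hx]; group
  have hC : ∀ a ∈ letters Sᶜ, z a = a := fun a ha => by
    induction ha using Subgroup.closure_induction with
    | mem x h => obtain ⟨i, hi, rfl⟩ := h; exact h2 i hi
    | one => simp
    | mul x y _ _ hx hy => rw [map_mul, hx, hy]
    | inv x _ hx => rw [map_inv, hx]
  induction j with
  | zero => exact ⟨MonoidHom.id _, by simp, by simp, IsConj.refl _⟩
  | succ j ih =>
    obtain ⟨zj, h3, h4, h5⟩ := ih
    refine ⟨z.comp zj, fun a ha => ?_, fun c hc => ?_, hw.trans (MonoidHom.map_isConj z h5)⟩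
    · rw [MonoidHom.comp_apply, h3 a ha, hA _ (mul_mem (mul_mem (pow_mem hu j) ha)
        (inv_mem (pow_mem hu j))), pow_succ']
      group
    · rw [MonoidHom.comp_apply, h4 c hc, hC c hc]

theorem finite_norm_le [Finite α] (B : ℕ) : {x : FreeGroup α | x.norm ≤ B}.Finite := by
  have h := List.finite_length_le (α × Bool) B
  exact Set.Finite.of_finite_image (f := toWord)
    (h.subset (by rintro _ ⟨x, hx, rfl⟩; exact hx)) FreeGroup.toWord_injective.injOn

/-- An element whose conjugacy class is preserved by a partial conjugation of a free product
is conjugate into a smaller subgroup. -/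
theorem exists_isConj_of_twist [Finite α] {S : Set α} {u : FreeGroup α} (hu : u ∈ letters S)
    {z : FreeGroup α →* FreeGroup α} (h1 : ∀ i ∈ S, z (of i) = u * of i * u⁻¹)
    (h2 : ∀ i ∉ S, z (of i) = of i) {w : FreeGroup α} (hw : IsConj w (z w)) :
    ∃ w', IsConj w w' ∧ (w' ∈ letters S ∨ w' ∈ Subgroup.closure
      ((letters Sᶜ : Set (FreeGroup α)) ∪ {a | a ∈ letters S ∧ Commute u a})) := by
  rcases exists_cyclic_list S w with ⟨w', h3, h4 | h4⟩ | ⟨l, hl, hc, hne, hch⟩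
  · exact ⟨w', h3, Or.inl h4⟩
  · exact ⟨w', h3, Or.inr (Subgroup.subset_closure (Or.inl h4))⟩
  refine ⟨l.prod, hc, Or.inr (Subgroup.list_prod_mem _ fun a ha => ?_)⟩
  rcases hl a ha with h | h
  swap
  · exact Subgroup.subset_closure (Or.inl h)
  refine Subgroup.subset_closure (Or.inr ⟨h, ?_⟩)
  have hb : ∀ j : ℕ, (u ^ j * a * (u ^ j)⁻¹).norm ≤ l.prod.norm := fun j => by
    obtain ⟨zj, h3, h4, h5⟩ := exists_twist_pow hu h1 h2 hw j
    have hone : ∀ x, x ∈ letters S ∨ x ∈ letters Sᶜ → x ≠ 1 → zj x ≠ 1 := fun x hx hx1 => by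
      rcases hx with hx | hx
      · rw [h3 x hx]; simpa using hx1
      · rwa [h4 x hx]
    have hmem : ∀ x, (x ∈ letters S → zj x ∈ letters S) := fun x hx => by
      rw [h3 x hx]
      exact mul_mem (mul_mem (pow_mem hu j) hx) (inv_mem (pow_mem hu j))
    have hch' : (l.map zj ++ l.map zj).IsChain (Alt S) := by
      rw [← List.map_append]
      refine List.isChain_map_of_isChain zj (fun x y hxy => ?_) hch
      obtain ⟨hx, hy, h | h⟩ := hxy
      · refine ⟨hone x (Or.inl h.1) hx, hone y (Or.inr h.2) hy, Or.inl ⟨hmem x h.1, ?_⟩⟩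
        rw [h4 y h.2]; exact h.2
      · refine ⟨hone x (Or.inr h.1) hx, hone y (Or.inl h.2) hy, Or.inr ⟨?_, hmem y h.2⟩⟩
        rw [h4 x h.1]; exact h.1
    obtain ⟨h6, h7⟩ := ne_one_of_isChain (by simpa using hne) hch'
    have h8 : IsConj (l.map zj).prod l.prod := by
      rw [← map_list_prod]
      exact (MonoidHom.map_isConj zj hc.symm).trans (h5.symm.trans hc)
    refine le_trans ?_ (norm_le_of_isConj h6 h7 h8)
    rw [norm_prod_of_isChain (List.isChain_append.1 hch').1, ← h3 a h]
    exact List.le_sum_of_mem (List.mem_map.2 ⟨_, List.mem_map.2 ⟨a, ha, rfl⟩, rfl⟩)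
  obtain ⟨j, k, hjk, h9⟩ := (finite_norm_le l.prod.norm).exists_lt_map_eq_of_forall_mem
    (f := fun j : ℕ => u ^ j * a * (u ^ j)⁻¹) hb
  obtain ⟨d, rfl⟩ := Nat.exists_eq_add_of_lt hjk
  refine commute_of_commute_pow (k := d + 1) (by omega) ?_
  have h10 : a = u ^ (d + 1) * a * (u ^ (d + 1))⁻¹ := by
    refine eq_of_conj h9 (u ^ j)⁻¹ ?_
    simp only [add_assoc, pow_add (u) j]
    group
  rw [Commute, SemiconjBy]
  nth_rewrite 2 [h10]
  group

end Split

end ArtinAut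

namespace ArtinAut

section Rotation

variable {n : ℕ}

theorem pr_brAut {k : ℕ} (hk : k < n) (j : ℕ) :
    (j < k → pr (brAut n) 0 k (xF n j) = xF n 0 * xF n (j + 1) * (xF n 0)⁻¹) ∧
    (j = k → pr (brAut n) 0 k (xF n j) = xF n 0) ∧
    (k < j → pr (brAut n) 0 k (xF n j) = xF n j) := by
  induction k generalizing j with
  | zero => exact ⟨fun h => by omega, fun h => by rw [h]; simp, fun _ => by simp⟩
  | succ k ih =>
    have ih := ih (by omega)
    rw [pr_succ, zero_add, MulAut.mul_apply]
    refine ⟨fun h => ?_, ?_, fun h => ?_⟩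
    · rcases Nat.lt_succ_iff_lt_or_eq.1 h with h | rfl
      · rw [brAut_other hk (by omega) (by omega), (ih j).1 h]
      · rw [brAut_self hk, map_mul, map_mul, map_inv, (ih j).2.1 rfl,
          (ih (j + 1)).2.2 (by omega)]
    · rintro rfl
      rw [brAut_succ hk, (ih k).2.1 rfl]
    · rw [brAut_other hk (by omega) (by omega), (ih j).2.2 (by omega)]

theorem pr_conj_mul {H : Type*} [Group H] (s : ℕ → H) (g : H) (a k : ℕ) :
    pr (fun i => g * s i * g⁻¹) a k = g * pr s a k * g⁻¹ := by
  induction k with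
  | zero => simp
  | succ k ih => rw [pr_succ, ih, pr_succ]; group

theorem rot_pow_apply {N : ℕ} (hN : N < n) (k j : ℕ) (h : j + k ≤ N) :
    (pr (brAut n) 0 N ^ k) (xF n j) =
      pr (xF n) 0 k * xF n (j + k) * (pr (xF n) 0 k)⁻¹ := by
  induction k generalizing j with
  | zero => simp
  | succ k ih =>
    rw [pow_succ, MulAut.mul_apply, (pr_brAut hN j).1 (by omega), map_mul, map_mul, map_inv,
      ih 0 (by omega), ih (j + 1) (by omega), pr_succ, zero_add,
      show j + 1 + k = j + (k + 1) by omega]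
    group

theorem rot_pow_succ_apply {N : ℕ} (hN : N < n) {j : ℕ} (hj : j ≤ N) :
    (pr (brAut n) 0 N ^ (N + 1)) (xF n j) =
      pr (xF n) 0 (N + 1) * xF n j * (pr (xF n) 0 (N + 1))⁻¹ := by
  obtain ⟨k, rfl⟩ := Nat.exists_eq_add_of_le hj
  have hP : ∀ i l, i + l ≤ j + k → (pr (brAut n) 0 (j + k) ^ i) (pr (xF n) 0 (l + 1)) =
      pr (xF n) 0 (i + (l + 1)) * (pr (xF n) 0 i)⁻¹ := fun i l hil => by
    rw [← MulEquiv.coe_toMonoidHom, map_pr, pr_congr (t := fun r => pr (xF n) 0 i *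
      xF n (r + i) * (pr (xF n) 0 i)⁻¹), pr_conj_mul, pr_shift, pr_add _ 0 i (l + 1), zero_add]
    intro r _ hr
    exact rot_pow_apply hN i r (by omega)
  have h1 : pr (brAut n) 0 (j + k) (pr (xF n) 0 k) = pr (xF n) 0 (k + 1) * (xF n 0)⁻¹ := by
    rcases k with _ | k
    · simp [pr_one]
    · have := hP 1 k (by omega)
      rw [pow_one, pr_one] at this
      rw [this]; congr 2; omega
  have h2 : (pr (brAut n) 0 (j + k) ^ (k + 1)) (xF n j) =
      pr (xF n) 0 (k + 1) * xF n 0 * (pr (xF n) 0 (k + 1))⁻¹ := by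
    rw [pow_succ', MulAut.mul_apply, rot_pow_apply hN k j le_rfl, map_mul, map_mul, map_inv, h1,
      (pr_brAut hN (j + k)).2.1 rfl]
    group
  rw [add_assoc, pow_add, MulAut.mul_apply, h2, map_mul, map_mul, map_inv, hP j k le_rfl,
    rot_pow_apply hN j 0 (by omega), zero_add]
  group

theorem rot_pow_fix {N j : ℕ} (hN : N < n) (h : N < j) (k : ℕ) :
    (pr (brAut n) 0 N ^ k) (xF n j) = xF n j := by
  induction k with
  | zero => rfl
  | succ k ih => rw [pow_succ, MulAut.mul_apply, (pr_brAut hN j).2.2 h, ih]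

theorem brAut_sq_self {i : ℕ} (hi : i + 1 < n) {j : ℕ} (hj : j = i ∨ j = i + 1) :
    (brAut n i ^ 2) (xF n j) =
      xF n i * xF n (i + 1) * xF n j * (xF n i * xF n (i + 1))⁻¹ := by
  rw [pow_two, MulAut.mul_apply]
  rcases hj with rfl | rfl
  · rw [brAut_self hi, map_mul, map_mul, map_inv, brAut_self hi, brAut_succ hi]; group
  · rw [brAut_succ hi, brAut_self hi]; group

end Rotation

section Invariant

open FreeGroup (of)

theorem pr_single {H : Type*} [Group H] (c : ℕ) (x : H) (k : ℕ) :
    pr (fun i => if i = c then x else 1) 0 k = if c < k then x else 1 := by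
  induction k with
  | zero => simp
  | succ k ih =>
    rw [pr_succ, ih, zero_add]
    by_cases h : c < k
    · rw [if_pos h, if_neg (by omega), if_pos (by omega), mul_one]
    · by_cases h' : k = c
      · rw [if_neg h, if_pos h', if_pos (by omega), one_mul]
      · rw [if_neg h, if_neg h', if_neg (by omega), mul_one]

theorem xF_mem_letters {n : ℕ} {S : Set (Fin n)} {i : ℕ} (hi : i < n) (h : ⟨i, hi⟩ ∈ S) :
    xF n i ∈ letters S := by
  rw [xF_of_lt hi]; exact of_mem_letters h

theorem letters_le {n : ℕ} {S : Set (Fin n)} {K : Subgroup (FreeGroup (Fin n))}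
    (h : ∀ i ∈ S, xF n i ∈ K) : letters S ≤ K := by
  rw [letters, Subgroup.closure_le]
  rintro _ ⟨i, hi, rfl⟩
  rw [← xF_fin]; exact h i hi

theorem map_mem_of_closure {H K : Type*} [Group H] [Group K] {X : Set H} {f : H →* K}
    {L : Subgroup K} (h : ∀ x ∈ X, f x ∈ L) {x : H} (hx : x ∈ Subgroup.closure X) : f x ∈ L :=
  (Subgroup.closure_le (L.comap f)).2 h hx

theorem eq_of_closure {H : Type*} [Group H] {X : Set H} {f : H →* H}
    (h : ∀ x ∈ X, f x = x) {x : H} (hx : x ∈ Subgroup.closure X) : f x = x := by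
  have : Set.EqOn f (MonoidHom.id H) X := h
  exact MonoidHom.eqOn_closure this hx

theorem expo_pr_xF {n k : ℕ} (hk : k ≤ n) (i : Fin n) (hi : i.val < k) :
    expo i (pr (xF n) 0 k) = Multiplicative.ofAdd 1 := by
  rw [map_pr, pr_congr (t := fun j => if j = i.val then Multiplicative.ofAdd 1 else 1),
    pr_single, if_pos hi]
  intro j _ hj
  rw [xF_of_lt (show j < n by omega)]
  split_ifs with h
  · subst h; exact expo_of_self _
  · exact expo_of_ne (fun h' => h (congrArg Fin.val h'))

/-- Conjugacy classes invariant under the parabolic subgroup acting on the free group. -/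
theorem isConj_of_invariant (m : ℕ) {w : FreeGroup (Fin (m + 2 + 1))}
    (hw : ∀ h : ArtinB (m + 2), IsConj (Ψ (m + 2) h w) w) :
    (∃ a ∈ letters {i : Fin (m + 2 + 1) | i.val < m + 2}, IsConj w a) ∨
    (∃ e : ℤ, IsConj w (xF (m + 2 + 1) (m + 2) ^ e)) ∨
    ∃ e : ℤ, IsConj w (PiF (m + 2 + 1) ^ e) := by
  set y := xF (m + 2 + 1) with hy
  set u := pr y 0 (m + 2) with hu
  have hz1 : Ψ (m + 2) (pr (sB (m + 2)) 0 (m + 1) ^ (m + 2)) =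
      pr (brAut (m + 2 + 1)) 0 (m + 1) ^ (m + 2) := by
    rw [map_pow, map_pr, pr_congr]
    intro i _ hi
    exact Ψ_sB (by omega)
  have h1 := hw (pr (sB (m + 2)) 0 (m + 1) ^ (m + 2))
  rw [hz1] at h1
  obtain ⟨p, hp, hp' | hp'⟩ := exists_isConj_of_twist (S := {i : Fin (m + 2 + 1) | i.val < m + 2})
    (u := u) (z := (pr (brAut (m + 2 + 1)) 0 (m + 1) ^ (m + 2)).toMonoidHom)
    (pr_mem fun i _ hi => xF_mem_letters (by omega) (by simpa using hi))
    (fun i hi => by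
      rw [← xF_fin]
      exact rot_pow_succ_apply (by omega) (show i.val ≤ m + 1 from Nat.le_of_lt_succ hi))
    (fun i hi => by
      rw [← xF_fin]
      refine rot_pow_fix (by omega) ?_ _
      simp only [Set.mem_ofPred_eq] at hi; omega) h1.symm
  · exact Or.inl ⟨p, hp', hp⟩
  right
  have hp1 : p ∈ Subgroup.closure {u, y (m + 2)} := by
    refine (Subgroup.closure_le _).2 ?_ hp'
    rintro x (hx | hx)
    · refine letters_le (fun i hi => ?_) hx
      simp only [Set.mem_compl_iff, Set.mem_ofPred_eq] at hi
      rw [show i.val = m + 2 by omega]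
      exact Subgroup.subset_closure (by simp [hy])
    · have := mem_zpowers_of_commute_of_expo
        (expo_pr_xF (show m + 2 ≤ m + 2 + 1 by omega) ⟨0, by omega⟩ (by simp)) hx.2
      exact (Subgroup.zpowers_le.2 (Subgroup.subset_closure (by simp [hu, hy]))) this
  have key : ∀ c, c < m + 2 → ∃ f : FreeGroup (Fin (m + 2 + 1)) →* FreeGroup (Fin (m + 2 + 1)),
      f (y c) = u ∧ f (y (m + 2)) = y (m + 2) ∧ (∀ i, i ≠ c → i < m + 2 → f (y i) = 1) ∧
      f p = p := fun c hc => by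
    have h1 : ∀ i, i < m + 2 → liftF (m + 2 + 1)
        (fun i => if i = m + 2 then y (m + 2) else if i = c then u else 1) (y i) =
        if i = c then u else 1 := fun i hi => by
      rw [hy, liftF_xF _ (by omega), if_neg (by omega)]
    have h2 : liftF (m + 2 + 1)
        (fun i => if i = m + 2 then y (m + 2) else if i = c then u else 1) (y (m + 2)) =
        y (m + 2) := by rw [hy, liftF_xF _ (by omega), if_pos rfl]
    refine ⟨liftF (m + 2 + 1)
      (fun i => if i = m + 2 then y (m + 2) else if i = c then u else 1), ?_, h2, ?_, ?_⟩
    · rw [h1 c hc, if_pos rfl]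
    · intro i hi hi'
      rw [h1 i hi', if_neg hi]
    · refine eq_of_closure ?_ hp1
      rintro x (rfl | rfl)
      · nth_rewrite 1 [hu]
        rw [map_pr, pr_congr (t := fun i => if i = c then u else 1) fun i _ hi => h1 i (by omega),
          pr_single, if_pos hc]
      · exact h2
  have h2 := hw (sB (m + 2) (m + 1))
  rw [Ψ_sB_last] at h2
  obtain ⟨p', hq, hq' | hq'⟩ := exists_isConj_of_twist
    (S := {i : Fin (m + 2 + 1) | m + 1 ≤ i.val})
    (u := y (m + 1) * y (m + 2)) (z := (brAut (m + 2 + 1) (m + 1) ^ 2).toMonoidHom)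
    (mul_mem (xF_mem_letters (by omega) (by simp)) (xF_mem_letters (by omega) (by simp)))
    (fun i hi => by
      rw [← xF_fin]
      refine brAut_sq_self (by omega) ?_
      simp only [Set.mem_ofPred_eq] at hi; omega)
    (fun i hi => by
      simp only [Set.mem_ofPred_eq] at hi
      rw [← xF_fin]
      change (brAut (m + 2 + 1) (m + 1) ^ 2) _ = _
      rw [pow_two, MulAut.mul_apply, brAut_other (by omega) (by omega) (by omega),
        brAut_other (by omega) (by omega) (by omega)]) h2.symm
  · left
    obtain ⟨f, -, h4, h5, h6⟩ := key 0 (by omega)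
    have h7 : f p' ∈ Subgroup.zpowers (y (m + 2)) := by
      refine map_mem_of_closure ?_ hq'
      rintro _ ⟨i, hi, rfl⟩
      simp only [Set.mem_ofPred_eq] at hi
      rw [← xF_fin]
      rcases Nat.lt_or_ge i.val (m + 2) with h | h
      · rw [h5 i (by omega) h]; exact one_mem _
      · rw [show i.val = m + 2 by omega, h4]; exact Subgroup.mem_zpowers _
    obtain ⟨e, he⟩ := h7
    refine ⟨e, hp.trans ?_⟩
    have h8 := MonoidHom.map_isConj f (hp.symm.trans hq)
    rw [h6, ← he] at h8
    exact h8
  · right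
    obtain ⟨f, h3, h4, h5, h6⟩ := key (m + 1) (by omega)
    have hP : PiF (m + 2 + 1) = u * y (m + 2) := by rw [PiF, pr_succ, zero_add]
    have h7 : f p' ∈ Subgroup.zpowers (PiF (m + 2 + 1)) := by
      refine map_mem_of_closure ?_ hq'
      rintro x (hx | hx)
      · refine letters_le (K := (Subgroup.zpowers (PiF (m + 2 + 1))).comap f) (fun i hi => ?_) hx
        simp only [Set.mem_compl_iff, Set.mem_ofPred_eq] at hi
        rw [Subgroup.mem_comap, h5 i (by omega) (by omega)]
        exact one_mem _
      · have hex : expo (⟨m + 1, by omega⟩ : Fin (m + 2 + 1)) (y (m + 1) * y (m + 2)) =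
            Multiplicative.ofAdd 1 := by
          rw [map_mul, hy, xF_of_lt (show m + 1 < m + 2 + 1 by omega),
            xF_of_lt (show m + 2 < m + 2 + 1 by omega), expo_of_self, expo_of_ne, mul_one]
          simp [Fin.ext_iff]
        have hx2 := mem_zpowers_of_commute_of_expo hex hx.2
        obtain ⟨e, rfl⟩ := hx2
        change f (_ ^ e) ∈ _
        rw [map_zpow, map_mul, h3, h4, ← hP]
        exact Subgroup.zpow_mem _ (Subgroup.mem_zpowers _) _
    obtain ⟨e, he⟩ := h7
    refine ⟨e, hp.trans ?_⟩
    have h8 := MonoidHom.map_isConj f (hp.symm.trans hq)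
    rw [h6, ← he] at h8
    exact h8

end Invariant

end ArtinAut

namespace ArtinAut

section FirstLetter

variable {m : ℕ}

open FreeGroup (of)

theorem isConj_Ψ_last (h : ArtinB m) : IsConj (Ψ m h (xF (m + 1) m)) (xF (m + 1) m) := by
  have key : ∀ i, i < m → IsConj (Ψ m (sB m i) (xF (m + 1) m)) (xF (m + 1) m) := fun i hi => by
    by_cases h : i + 1 < m
    · rw [Ψ_sB h, brAut_other (by omega) (by omega) (by omega)]
    · obtain ⟨k, rfl⟩ : ∃ k, m = k + 1 := ⟨m - 1, by omega⟩
      obtain rfl : i = k := by omega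
      rw [Ψ_sB_last, brAut_sq_self (by omega) (Or.inr rfl)]
      exact (isConj_iff.2 ⟨_, rfl⟩ : IsConj _ _).symm
  induction h using sB_induction with
  | h1 => rw [map_one]; exact IsConj.refl _
  | hs i g hi ih =>
    rw [map_mul, MulAut.mul_apply]
    exact (isConj_map _ (key i hi)).trans ih
  | hi i g hi ih =>
    rw [map_mul, MulAut.mul_apply, map_inv]
    have h1 := isConj_map (Ψ m (sB m i))⁻¹ (key i hi)
    rw [← MulAut.mul_apply, inv_mul_cancel, MulAut.one_apply] at h1
    exact (isConj_map _ h1.symm).trans ih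

theorem conj_mul_central {G : Type*} [Group G] (z x : G) {c d : G} (hc : ∀ g, c * g = g * c)
    (hd : ∀ g, d * g = g * d) : z * c * (x * d) * (z * c)⁻¹ = z * x * z⁻¹ * d := by
  have h1 : z * c * (x * d) * (z * c)⁻¹ = z * (c * (x * d)) * c⁻¹ * z⁻¹ := by group
  rw [h1, hc, ← hd x, ← hd (z * x * z⁻¹), ← mul_assoc, ← mul_assoc, ← mul_assoc,
    ← mul_assoc, ← hd z]
  group

theorem isConj_Ψ_of_map {φ : MulAut (ArtinB (m + 5))}
    (hφ : ∀ g, pB (m + 5) (φ g) = pB (m + 5) g) {w : FreeGroup (Fin (m + 5))} {k : ℤ}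
    (hw : φ (Xo (sB (m + 5)) (m + 5) 0) = ι1 (m + 4) w * ΔB (m + 5) ^ k) (h : ArtinB (m + 4)) :
    IsConj (Ψ (m + 4) h w) w := by
  obtain ⟨y, h1, hg⟩ : φ⁻¹ (sh (m + 4) h) ∈ stab0 (m + 4) := by
    rw [mem_stab0_iff, pB_symm hφ]; exact (pB_sh h).1
  have hg' : sh (m + 4) h = φ (ι1 (m + 4) y * sh (m + 4) h1) := by
    rw [← hg, ← MulAut.mul_apply, mul_inv_cancel, MulAut.one_apply]
  obtain ⟨c, hc⟩ := isConj_iff.1 (isConj_Ψ_last h1).symm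
  have e1 : ι1 (m + 4) y * sh (m + 4) h1 * Xo (sB (m + 5)) (m + 5) 0 *
      (ι1 (m + 4) y * sh (m + 4) h1)⁻¹ =
      ι1 (m + 4) (y * c) * Xo (sB (m + 5)) (m + 5) 0 * (ι1 (m + 4) (y * c))⁻¹ := by
    have := ι1_equivariant h1 (xF (m + 4 + 1) (m + 4))
    rw [← hc, map_mul, map_mul, map_inv, ι1_xF_last] at this
    rw [mul_inv_rev, map_mul, mul_inv_rev]
    calc _ = ι1 (m + 4) y * (sh (m + 4) h1 * Xo (sB (m + 5)) (m + 5) 0 *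
          (sh (m + 4) h1)⁻¹) * (ι1 (m + 4) y)⁻¹ := by group
      _ = _ := by rw [this]; group
  have e2 := congrArg φ e1
  rw [map_mul, map_mul, map_inv, ← hg', map_mul, map_mul, map_inv, hw] at e2
  obtain ⟨z, j, hz⟩ := map_ι1 hφ (y * c)
  rw [hz] at e2
  have hD := fun (i : ℤ) (g : ArtinB (m + 5)) => (((ΔB_comm g).zpow_left i)).eq
  have e3 : sh (m + 4) h * ι1 (m + 4) w * (sh (m + 4) h)⁻¹ * ΔB (m + 5) ^ k =
      ι1 (m + 4) z * ι1 (m + 4) w * (ι1 (m + 4) z)⁻¹ * ΔB (m + 5) ^ k := by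
    have e := conj_mul_central (sh (m + 4) h) (ι1 (m + 4) w) (hD 0) (hD k)
    rw [zpow_zero, mul_one] at e
    rw [← e, e2, conj_mul_central _ _ (hD j) (hD k)]
  have e4 := mul_right_cancel e3
  rw [ι1_equivariant, ← map_mul, ← map_inv, ← map_mul] at e4
  have e5 := ι1_injective _ e4
  exact (isConj_iff.2 ⟨z, e5.symm⟩ : IsConj _ _).symm

theorem ConjOn.conj {n : ℕ} {S : Set (Fin n)} {k t : ArtinB n} {v : FreeGroup (Fin n)}
    (hk : ConjOn S k v) (ht : ∀ i, pB n t i ∈ S → i ∈ S) :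
    ConjOn S (t * k * t⁻¹) (eS S (Φ n t v)) := by
  refine ⟨eS_eS _ _, fun y => ?_⟩
  rw [map_mul, map_mul, MulAut.mul_apply, MulAut.mul_apply, ← eS_Φ_eS ht, hk.2, map_mul, map_mul,
    map_mul, map_mul, eS_Φ_eS ht (Φ n t⁻¹ y), map_inv, map_inv, ← MulAut.mul_apply, ← map_mul,
    mul_inv_cancel, MulAut.one_apply, map_mul, map_inv]

/-- The difference of the exponents of the first two letters. -/
def expo01 (m : ℕ) : FreeGroup (Fin (m + 5)) →* Multiplicative ℤ :=
  expo ⟨0, by omega⟩ / expo ⟨1, by omega⟩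

theorem expo01_of (i : Fin (m + 5)) : expo01 m (of i) =
    if i = ⟨0, by omega⟩ then Multiplicative.ofAdd 1 else
      if i = ⟨1, by omega⟩ then (Multiplicative.ofAdd 1)⁻¹ else 1 := by
  rw [expo01, MonoidHom.div_apply]
  split_ifs with h h'
  · subst h; rw [expo_of_self, expo_of_ne (by simp [Fin.ext_iff]), div_one]
  · subst h'; rw [expo_of_self, expo_of_ne h, one_div]
  · rw [expo_of_ne h, expo_of_ne h', div_one]

theorem expo01_eS (y : FreeGroup (Fin (m + 5))) : expo01 m (eS (S01 (m + 5)) y) = expo01 m y := by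
  have : (expo01 m).comp (eS (S01 (m + 5))) = expo01 m := by
    refine FreeGroup.ext_hom _ _ fun i => ?_
    rw [MonoidHom.comp_apply]
    by_cases h : i ∈ S01 (m + 5)
    · rw [eS_of_mem h]
    · rw [eS_of_notMem h, map_one, expo01_of, if_neg, if_neg]
      · rintro rfl; exact h (by simp [S01])
      · rintro rfl; exact h (by simp [S01])
  exact DFunLike.congr_fun this y

theorem expo01_Φ {t : ArtinB (m + 5)} (h0 : pB (m + 5) t ⟨0, by omega⟩ = ⟨1, by omega⟩)
    (h1 : pB (m + 5) t ⟨1, by omega⟩ = ⟨0, by omega⟩) (y : FreeGroup (Fin (m + 5))) :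
    expo01 m (Φ (m + 5) t y) = (expo01 m y)⁻¹ := by
  have : (expo01 m).comp (Φ (m + 5) t).toMonoidHom = (expo01 m)⁻¹ := by
    refine FreeGroup.ext_hom _ _ fun i => ?_
    have h2 := (expo01 m).map_isConj (isConj_Φ_of t i)
    rw [isConj_iff_eq] at h2
    change expo01 m (Φ (m + 5) t (of i)) = (expo01 m (of i))⁻¹
    rw [h2, expo01_of, expo01_of]
    by_cases hi : i = ⟨0, by omega⟩
    · rw [hi, h0]; simp [Fin.ext_iff]
    · by_cases hi' : i = ⟨1, by omega⟩
      · rw [hi', h1]; simp [Fin.ext_iff]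
      · rw [if_neg, if_neg, if_neg hi, if_neg hi', inv_one]
        · rw [← h0]; exact fun h => hi ((pB (m + 5) t).injective h)
        · rw [← h1]; exact fun h => hi' ((pB (m + 5) t).injective h)
  exact DFunLike.congr_fun this y

theorem expo01_f01_mul {a b : ArtinB (m + 5)} (ha : a ∈ K01 (m + 5)) (hb : b ∈ K01 (m + 5)) :
    expo01 m (f01 (a * b)) = expo01 m (f01 a) * expo01 m (f01 b) := by
  rw [isMulOn_f01 a ha b hb, map_mul]

theorem expo01_f01_bB {i : ℕ} (hi : i < m + 4) :
    expo01 m (f01 (bB (sB (m + 5)) i)) = 1 := by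
  have hinv : ∀ a ∈ K01 (m + 5), expo01 m (f01 a⁻¹) = (expo01 m (f01 a))⁻¹ := fun a ha => by
    rw [isMulOn_f01.inv ha, map_inv]
  induction i with
  | zero =>
    have h1 : bB (sB (m + 5)) 0 = (sB (m + 5) 0 ^ 2)⁻¹ := by simp [bB]
    rw [h1, hinv _ (mem_K01_of_pB (pB_sB_sq (by omega))), f01_eq (conjOn_sq_zero (by omega)),
      map_mul, xF_of_lt (show 0 < m + 5 by omega), xF_of_lt (show 1 < m + 5 by omega), expo01_of,
      expo01_of]
    simp [Fin.ext_iff]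
  | succ i ih =>
    rcases i with _ | i
    · rw [f01_eq (conjOn_KB (bB_one_mem_KB (by omega))), map_one]
    · have hs : sB (m + 5) (i + 1 + 1) ∈ K01 (m + 5) := sB_mem_K01 (by omega) (by omega)
      have hb : bB (sB (m + 5)) (i + 1) ∈ K01 (m + 5) := mem_K01_of_pB (pB_bB (by omega))
      rw [bB_succ, expo01_f01_mul ((K01 _).mul_mem ((K01 _).inv_mem hs) hb) hs,
        expo01_f01_mul ((K01 _).inv_mem hs) hb, hinv _ hs,
        f01_eq (conjOn_sB_one (by omega) (by omega) (by omega)), map_one, ih (by omega)]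
      rfl

theorem expo01_f01_ι1 {a : FreeGroup (Fin (m + 5))}
    (ha : a ∈ letters {i : Fin (m + 5) | i.val < m + 4}) :
    expo01 m (f01 (ι1 (m + 4) a)) = 1 := by
  have hK : ∀ a, ι1 (m + 4) a ∈ K01 (m + 5) := fun a => mem_K01_of_pB (pB_ι1 a)
  induction ha using Subgroup.closure_induction with
  | mem x h =>
    obtain ⟨i, hi, rfl⟩ := h
    rw [← xF_fin, ι1_xF hi]
    exact expo01_f01_bB hi
  | one => rw [map_one, isMulOn_f01.one, map_one]
  | mul x y _ _ hx hy => rw [map_mul, expo01_f01_mul (hK _) (hK _), hx, hy, one_mul]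
  | inv x _ hx => rw [map_inv, isMulOn_f01.inv (hK _), map_inv, hx, inv_one]

theorem ΔB_mem_K01 (k : ℤ) : ΔB (m + 5) ^ k ∈ K01 (m + 5) ∧ f01 (ΔB (m + 5) ^ k) = 1 := by
  have h : Φ (m + 5) (ΔB (m + 5) ^ k) = 1 := by rw [map_zpow, Φ_ΔB, one_zpow]
  exact ⟨mem_K01_of_pB (pB_eq_one_of_Φ h), f01_eq ⟨map_one _, fun y => by rw [h]; simp⟩⟩

theorem not_isConj_letters {φ : MulAut (ArtinB (m + 5))}
    (hφ : ∀ g, pB (m + 5) (φ g) = pB (m + 5) g) {w : FreeGroup (Fin (m + 5))} {k : ℤ}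
    (hw : φ (Xo (sB (m + 5)) (m + 5) 0) = ι1 (m + 4) w * ΔB (m + 5) ^ k) :
    ¬ ∃ a ∈ letters {i : Fin (m + 5) | i.val < m + 4}, IsConj w a := by
  rintro ⟨a, ha, hwa⟩
  have hK : ∀ a, ι1 (m + 4) a ∈ K01 (m + 5) := fun a => mem_K01_of_pB (pB_ι1 a)
  have hX : ∀ i, i < 2 → Xo (sB (m + 5)) (m + 5) i ∈ K01 (m + 5) := fun i hi =>
    Xo_mem_K01 (by omega)
  obtain ⟨β, hβ⟩ := exists_f01_map hφ
  have h0 : expo01 m (β (xF (m + 5) 0)) = 1 := by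
    obtain ⟨c, rfl⟩ := isConj_iff.1 hwa.symm
    rw [← f01_Xo (by omega), ← hβ _ (hX 0 (by omega)), hw,
      expo01_f01_mul (hK _) (ΔB_mem_K01 k).1, (ΔB_mem_K01 k).2, map_one, mul_one, map_mul, map_mul,
      expo01_f01_mul ((K01 _).mul_mem (hK _) (hK _)) (hK _), expo01_f01_mul (hK _) (hK _),
      expo01_f01_ι1 ha, mul_one, ← expo01_f01_mul (hK _) (hK _), ← map_mul, mul_inv_cancel,
      map_one, isMulOn_f01.one, map_one]
  have h1 : expo01 m (β (xF (m + 5) 1)) = 1 := by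
    have e : φ (Xo (sB (m + 5)) (m + 5) 0) = φ (sB (m + 5) 0) * φ (Xo (sB (m + 5)) (m + 5) 1) *
        (φ (sB (m + 5) 0))⁻¹ := by
      rw [Xo_succ _ (show 0 + 1 < m + 5 by omega), map_mul, map_mul, map_inv]
    have hc := conjOn_f01 (map_K01 hφ (hX 1 (by omega)))
    have hv : ∀ i, (pB (m + 5) (φ (sB (m + 5) 0)) i : ℕ) =
        if (i : ℕ) = 0 then 1 else if (i : ℕ) = 1 then 0 else (i : ℕ) := fun i => by
      rw [hφ, pB_sB_val (by omega)]
    have h2 := f01_eq (hc.conj (t := φ (sB (m + 5) 0)) fun i hi => by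
      have : (pB (m + 5) (φ (sB (m + 5) 0)) i : ℕ) < 2 := hi
      rw [hv] at this
      change (i : ℕ) < 2
      split_ifs at this <;> omega)
    rw [← e, hβ _ (hX 0 (by omega)), f01_Xo (by omega)] at h2
    rw [h2, expo01_eS, expo01_Φ (Fin.ext (hv _)) (Fin.ext (hv _)), hβ _ (hX 1 (by omega)),
      f01_Xo (by omega), inv_eq_one] at h0
    exact h0
  have h2 : ∀ y, expo01 m (β (eS (S01 (m + 5)) y)) = 1 := fun y => by
    have : ((expo01 m).comp β).comp (eS (S01 (m + 5))) = 1 := by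
      refine xF_hom_ext fun i hi => ?_
      rw [MonoidHom.comp_apply, eS_S01 (by omega), MonoidHom.one_apply]
      split_ifs with h
      · obtain rfl | rfl : i = 0 ∨ i = 1 := by omega
        · exact h0
        · exact h1
      · exact map_one _
    exact DFunLike.congr_fun this y
  have hg : φ⁻¹ (Xo (sB (m + 5)) (m + 5) 0) ∈ K01 (m + 5) :=
    map_K01 (φ := φ⁻¹) (pB_symm hφ) (hX 0 (by omega))
  have h3 := hβ _ hg
  rw [← MulAut.mul_apply, mul_inv_cancel, MulAut.one_apply, f01_Xo (by omega),
    ← (conjOn_f01 hg).1] at h3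
  have h4 := congrArg (expo01 m) h3
  rw [h2, xF_of_lt (by omega), expo01_of, if_pos rfl] at h4
  exact absurd h4 (by decide)

end FirstLetter

end ArtinAut

namespace ArtinAut

section Degrees

variable {m : ℕ}

/-- The exponent sum of the generators `t i`. -/
noncomputable def degt (m : ℕ) (x : ArtinB (m + 2)) : ℤ :=
  ((exists_hom_comm m (Multiplicative.ofAdd (1 : ℤ)) 1).choose x).toAdd

/-- The exponent sum of `ρ`. -/
noncomputable def degr (m : ℕ) (x : ArtinB (m + 2)) : ℤ :=
  ((exists_hom_comm m 1 (Multiplicative.ofAdd (1 : ℤ))).choose x).toAdd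

@[simp] theorem degt_mul (x y : ArtinB (m + 2)) : degt m (x * y) = degt m x + degt m y := by
  simp [degt]

@[simp] theorem degt_inv (x : ArtinB (m + 2)) : degt m x⁻¹ = -degt m x := by simp [degt]

@[simp] theorem degt_pow (x : ArtinB (m + 2)) (k : ℕ) : degt m (x ^ k) = k * degt m x := by
  simp [degt]

@[simp] theorem degt_zpow (x : ArtinB (m + 2)) (k : ℤ) : degt m (x ^ k) = k * degt m x := by
  simp [degt]

@[simp] theorem degr_mul (x y : ArtinB (m + 2)) : degr m (x * y) = degr m x + degr m y := by
  simp [degr]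

@[simp] theorem degr_inv (x : ArtinB (m + 2)) : degr m x⁻¹ = -degr m x := by simp [degr]

@[simp] theorem degr_pow (x : ArtinB (m + 2)) (k : ℕ) : degr m (x ^ k) = k * degr m x := by
  simp [degr]

@[simp] theorem degr_zpow (x : ArtinB (m + 2)) (k : ℤ) : degr m (x ^ k) = k * degr m x := by
  simp [degr]

theorem degt_sB {i : ℕ} (hi : i ≤ m) : degt m (sB (m + 2) i) = 1 := by
  rw [degt, (exists_hom_comm m (Multiplicative.ofAdd (1 : ℤ)) 1).choose_spec.1 i hi]; rfl

theorem degr_sB {i : ℕ} (hi : i ≤ m) : degr m (sB (m + 2) i) = 0 := by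
  rw [degr, (exists_hom_comm m 1 (Multiplicative.ofAdd (1 : ℤ))).choose_spec.1 i hi]; rfl

theorem degt_ρB : degt m (ρB (m + 2)) = 0 := by
  rw [degt, (exists_hom_comm m (Multiplicative.ofAdd (1 : ℤ)) 1).choose_spec.2]; rfl

theorem degr_ρB : degr m (ρB (m + 2)) = 1 := by
  rw [degr, (exists_hom_comm m 1 (Multiplicative.ofAdd (1 : ℤ))).choose_spec.2]; rfl

theorem degt_ΔB : degt m (ΔB (m + 2)) = 0 := by simp [ΔB, degt_ρB]

theorem degr_ΔB : degr m (ΔB (m + 2)) = m + 2 := by simp [ΔB, degr_ρB]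

theorem degt_one : degt m 1 = 0 := by simp [degt]

theorem degr_one : degr m 1 = 0 := by simp [degr]

theorem hom_deg (f : ArtinB (m + 2) →* Multiplicative ℤ) (x : ArtinB (m + 2)) :
    f x = f (sB (m + 2) 0) ^ degt m x * f (ρB (m + 2)) ^ degr m x := by
  let F : ArtinB (m + 2) →* Multiplicative ℤ :=
    { toFun := fun x => f (sB (m + 2) 0) ^ degt m x * f (ρB (m + 2)) ^ degr m x
      map_one' := by simp [degt_one, degr_one]
      map_mul' := fun x y => by
        simp only [degt_mul, degr_mul, zpow_add]
        exact mul_mul_mul_comm _ _ _ _ }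
  have : f = F := hom_ext_rot_zero (by simp [F, degt_sB, degr_sB]) (by simp [F, degt_ρB, degr_ρB])
  exact DFunLike.congr_fun this x

theorem degt_map (f : MulAut (ArtinB (m + 2))) (x : ArtinB (m + 2)) :
    degt m (f x) = degt m (f (sB (m + 2) 0)) * degt m x +
      degt m (f (ρB (m + 2))) * degr m x := by
  have := congrArg Multiplicative.toAdd
    (hom_deg ((exists_hom_comm m (Multiplicative.ofAdd (1 : ℤ)) 1).choose.comp f.toMonoidHom) x)
  simp only [toAdd_mul, toAdd_zpow, smul_eq_mul] at this
  rw [mul_comm, mul_comm (degt m (f (ρB (m + 2))))]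
  exact this

theorem degr_map (f : MulAut (ArtinB (m + 2))) (x : ArtinB (m + 2)) :
    degr m (f x) = degr m (f (sB (m + 2) 0)) * degt m x +
      degr m (f (ρB (m + 2))) * degr m x := by
  have := congrArg Multiplicative.toAdd
    (hom_deg ((exists_hom_comm m 1 (Multiplicative.ofAdd (1 : ℤ))).choose.comp f.toMonoidHom) x)
  simp only [toAdd_mul, toAdd_zpow, smul_eq_mul] at this
  rw [mul_comm, mul_comm (degr m (f (ρB (m + 2))))]
  exact this

theorem degt_map_ρB (f : MulAut (ArtinB (m + 2))) : degt m (f (ρB (m + 2))) = 0 := by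
  have h : degt m (f (ΔB (m + 2))) = 0 := by
    rcases aut_ΔB f with h | h <;> simp [h, degt_ΔB]
  rw [ΔB, map_pow, degt_pow] at h
  exact (mul_eq_zero.1 h).resolve_left (by positivity)

theorem degr_map_ρB (f : MulAut (ArtinB (m + 2))) :
    degr m (f (ρB (m + 2))) = 1 ∨ degr m (f (ρB (m + 2))) = -1 := by
  have h0 : ((m + 2 : ℕ) : ℤ) ≠ 0 := by positivity
  rcases aut_ΔB f with h | h
  · left
    have := congrArg (degr m) h
    rw [ΔB, map_pow, degr_pow, degr_pow, degr_ρB] at this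
    exact mul_left_cancel₀ h0 this
  · right
    have := congrArg (degr m) h
    rw [ΔB, map_pow, degr_pow, degr_inv, degr_pow, degr_ρB, ← mul_neg] at this
    exact mul_left_cancel₀ h0 this

theorem degt_map_eq (f : MulAut (ArtinB (m + 2))) (x : ArtinB (m + 2)) :
    degt m (f x) = degt m (f (sB (m + 2) 0)) * degt m x := by
  rw [degt_map, degt_map_ρB, zero_mul, add_zero]

theorem degt_map_sB (f : MulAut (ArtinB (m + 2))) :
    degt m (f (sB (m + 2) 0)) = 1 ∨ degt m (f (sB (m + 2) 0)) = -1 := by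
  have h := degt_map_eq f⁻¹ (f (sB (m + 2) 0))
  rw [← MulAut.mul_apply, inv_mul_cancel, MulAut.one_apply, degt_sB (Nat.zero_le _)] at h
  rcases Int.eq_one_or_neg_one_of_mul_eq_one' h.symm with h | h
  · exact Or.inl h.2
  · exact Or.inr h.2

end Degrees

section Generators

variable {m : ℕ}

/-- The automorphism fixing `ρ` and inverting the generators `t i`. -/
noncomputable def autμ (m : ℕ) : MulAut (ArtinB (m + 2)) :=
  have h : (exists_μ m).choose.comp (exists_μ m).choose = MonoidHom.id _ := by
    have h := (exists_μ m).choose_spec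
    refine hom_ext_rot_zero ?_ ?_
    · simp [h.1 0 (Nat.zero_le _)]
    · simp [h.2]
  MonoidHom.toMulEquiv (exists_μ m).choose (exists_μ m).choose h h

theorem autμ_sB {i : ℕ} (hi : i ≤ m) : autμ m (sB (m + 2) i) = (sB (m + 2) i)⁻¹ :=
  (exists_μ m).choose_spec.1 i hi

theorem autμ_ρB : autμ m (ρB (m + 2)) = ρB (m + 2) := (exists_μ m).choose_spec.2

/-- The automorphism reversing the order of the generators `t i` and inverting everything. -/
noncomputable def autτ (m : ℕ) : MulAut (ArtinB (m + 2)) :=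
  have h : (exists_τ m).choose.comp (exists_τ m).choose = MonoidHom.id _ := by
    have h := (exists_τ m).choose_spec
    refine hom_ext_rot_zero ?_ ?_
    · simp [h.1 0 (Nat.zero_le _), h.1 m le_rfl]
    · simp [h.2]
  MonoidHom.toMulEquiv (exists_τ m).choose (exists_τ m).choose h h

theorem autτ_sB {i : ℕ} (hi : i ≤ m) : autτ m (sB (m + 2) i) = (sB (m + 2) (m - i))⁻¹ :=
  (exists_τ m).choose_spec.1 i hi

theorem autτ_ρB : autτ m (ρB (m + 2)) = (ρB (m + 2))⁻¹ := (exists_τ m).choose_spec.2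

theorem autμ_ΔB : autμ m (ΔB (m + 2)) = ΔB (m + 2) := by rw [ΔB, map_pow, autμ_ρB]

theorem autτ_ΔB : autτ m (ΔB (m + 2)) = (ΔB (m + 2))⁻¹ := by rw [ΔB, map_pow, autτ_ρB, inv_pow]

/-- The transvection multiplying the generators `t i` by `Δ`. -/
noncomputable def autT (m : ℕ) : MulAut (ArtinB (m + 2)) :=
  have h := (exists_T m).choose_spec
  have hΔ : (exists_T m).choose (ΔB (m + 2)) = ΔB (m + 2) :=
    (map_pow (exists_T m).choose (ρB (m + 2)) (m + 2)).trans (congrArg (· ^ (m + 2)) h.2)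
  let S : ArtinB (m + 2) →* ArtinB (m + 2) :=
    ((autμ m).toMonoidHom.comp (exists_T m).choose).comp (autμ m).toMonoidHom
  have hs : S (sB (m + 2) 0) = sB (m + 2) 0 * (ΔB (m + 2))⁻¹ := by
    simp [S, autμ_sB, h.1 0 (Nat.zero_le _), autμ_ΔB, (ΔB_comm _).inv_left.eq]
  have hρ : S (ρB (m + 2)) = ρB (m + 2) := by
    simp [S, autμ_ρB, h.2]
  MonoidHom.toMulEquiv (exists_T m).choose S
    (hom_ext_rot_zero (by
      have : S (ΔB (m + 2)) = ΔB (m + 2) := by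
        simp only [ΔB, map_pow, hρ]
      simp [h.1 0 (Nat.zero_le _), hs, this]) (by simp [h.2, hρ]))
    (hom_ext_rot_zero (by simp [h.1 0 (Nat.zero_le _), hs, hΔ]) (by simp [h.2, hρ]))

theorem autT_sB {i : ℕ} (hi : i ≤ m) : autT m (sB (m + 2) i) = sB (m + 2) i * ΔB (m + 2) :=
  (exists_T m).choose_spec.1 i hi

theorem autT_ρB : autT m (ρB (m + 2)) = ρB (m + 2) := (exists_T m).choose_spec.2

theorem autT_ΔB : autT m (ΔB (m + 2)) = ΔB (m + 2) := by rw [ΔB, map_pow, autT_ρB]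

theorem mulAut_ext {f g : MulAut (ArtinB (m + 2))}
    (h0 : f (sB (m + 2) 0) = g (sB (m + 2) 0)) (hρ : f (ρB (m + 2)) = g (ρB (m + 2))) : f = g :=
  MulEquiv.toMonoidHom_injective (hom_ext_rot_zero (f := f.toMonoidHom) (g := g.toMonoidHom) h0 hρ)

theorem autμ_sq : autμ m ^ 2 = 1 := by
  apply mulAut_ext
  · simp [pow_two, autμ_sB]
  · simp [pow_two, autμ_ρB]

theorem autτ_sq : autτ m ^ 2 = 1 := by
  apply mulAut_ext
  · simp [pow_two, autτ_sB]
  · simp [pow_two, autτ_ρB]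

theorem autτ_mul_autμ : autτ m * autμ m = autμ m * autτ m := by
  apply mulAut_ext
  · simp [autτ_sB, autμ_sB]
  · simp [autτ_ρB, autμ_ρB]

theorem autτ_mul_autT : autτ m * autT m = autT m * autτ m := by
  apply mulAut_ext
  · simp [autτ_sB, autT_sB, autτ_ΔB, (ΔB_comm _).inv_inv.eq]
  · simp [autτ_ρB, autT_ρB]

theorem autμ_mul_autT_mul_autμ : autμ m * autT m * autμ m = (autT m)⁻¹ := by
  rw [eq_inv_iff_mul_eq_one]
  apply mulAut_ext
  · simp [autμ_sB, autT_sB, autμ_ΔB, autT_ΔB]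
    rw [mul_assoc, (ΔB_comm (sB (m + 2) 0)).symm.eq, inv_mul_cancel_left]
  · simp [autμ_ρB, autT_ρB]

theorem autT_zpow_ρB (p : ℤ) : (autT m ^ p) (ρB (m + 2)) = ρB (m + 2) :=
  MulAction.mem_stabilizer_iff.1 (zpow_mem (S := Subgroup (MulAut (ArtinB (m + 2))))
    (K := MulAction.stabilizer (MulAut (ArtinB (m + 2))) (ρB (m + 2))) autT_ρB p)

theorem autT_zpow_sB (p : ℤ) : (autT m ^ p) (sB (m + 2) 0) = sB (m + 2) 0 * ΔB (m + 2) ^ p := by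
  have key : ∀ p : ℤ, (autT m ^ (p + 1)) (sB (m + 2) 0) =
      (autT m ^ p) (sB (m + 2) 0) * ΔB (m + 2) := fun p => by
    rw [zpow_add, zpow_one, MulAut.mul_apply, autT_sB (Nat.zero_le _), map_mul]
    congr 1
    rw [ΔB, map_pow, autT_zpow_ρB]
  induction p with
  | zero => simp
  | succ i ih => rw [key, ih, zpow_add_one, mul_assoc]
  | pred i ih =>
    have h := key (-(i : ℤ) - 1)
    rw [sub_add_cancel, ih] at h
    rw [zpow_sub_one (ΔB _), ← mul_assoc, h, mul_inv_cancel_right]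

end Generators

end ArtinAut

namespace ArtinAut

section FirstStrand

variable {m : ℕ}

theorem Xo_zero_eq (m : ℕ) :
    Xo (sB (m + 1)) (m + 1) 0 = pr (sB (m + 1)) 0 m * (ρB (m + 1))⁻¹ := by
  rw [Xo, ρB_eq, pr_succ]
  simp only [Nat.add_sub_cancel, Nat.sub_zero, zero_add]
  group

theorem ι1_PiF (m : ℕ) :
    ι1 m (PiF (m + 1)) = pr (fun i => (sB (m + 1) i)⁻¹) 0 m * (ρB (m + 1))⁻¹ := by
  have h := sh_ΔB m
  rw [ΔB, map_pow, sh_ρB_pow le_rfl, ΔB, pow_succ, ← mul_assoc] at h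
  have h2 : ι1 m (PiF (m + 1)) * ρB (m + 1) = pr (fun i => (sB (m + 1) i)⁻¹) 0 m := by
    have hc : ∀ a b c r : ArtinB (m + 1), a * r ^ m = b * r ^ m * r → b * r = a := by
      intro a b c r h
      rw [mul_assoc, ← pow_succ, pow_succ', ← mul_assoc] at h
      exact (mul_right_cancel h).symm
    exact hc _ _ 1 _ h
  rw [← h2, mul_inv_cancel_right]

theorem autμ_Xo (m : ℕ) :
    autμ m (Xo (sB (m + 2)) (m + 2) 0) = ι1 (m + 1) (PiF (m + 2)) := by
  rw [ι1_PiF, Xo_zero_eq, map_mul, map_inv, autμ_ρB]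
  congr 1
  refine (map_pr (autμ m).toMonoidHom _ _ _).trans (pr_congr fun i _ hi => autμ_sB (by omega))

theorem pr_inv_eq {H : Type*} [Group H] (s : ℕ → H) (k : ℕ) :
    (pr s 0 k)⁻¹ = pr (fun i => (s (k - 1 - i))⁻¹) 0 k := by
  induction k with
  | zero => simp
  | succ k ih =>
    rw [pr_succ, mul_inv_rev, ih, pr_succ_left, ← pr_shift _ 0 1]
    congr 1
    · simp
    · exact pr_congr fun i _ hi => by rw [show k + 1 - 1 - (i + 1) = k - 1 - i by omega]

theorem autτ_Xo (m : ℕ) : ∃ g, (Xo (sB (m + 2)) (m + 2) 0)⁻¹ =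
    g * autτ m (Xo (sB (m + 2)) (m + 2) 0) * g⁻¹ := by
  have h : autτ m (pr (sB (m + 2)) 0 (m + 1)) = (pr (sB (m + 2)) 0 (m + 1))⁻¹ := by
    rw [pr_inv_eq]
    exact (map_pr (autτ m).toMonoidHom _ _ _).trans (pr_congr fun i _ hi => autτ_sB (by omega))
  refine ⟨pr (sB (m + 2)) 0 (m + 1), ?_⟩
  rw [Xo_zero_eq, map_mul, map_inv, autτ_ρB, h]
  group

theorem degt_Xo (m : ℕ) : degt m (Xo (sB (m + 2)) (m + 2) 0) = m + 1 := by
  have h : ∀ k, k ≤ m + 1 → degt m (pr (sB (m + 2)) 0 k) = k := by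
    intro k hk
    induction k with
    | zero => simp [degt_one]
    | succ k ih => rw [pr_succ, degt_mul, ih (by omega), zero_add, degt_sB (by omega)]; simp
  rw [Xo_zero_eq, degt_mul, degt_inv, degt_ρB, h _ le_rfl]; simp

theorem map_ΔB_zpow (f : MulAut (ArtinB (m + 2))) (k : ℤ) :
    ∃ l : ℤ, f (ΔB (m + 2) ^ k) = ΔB (m + 2) ^ l := by
  rcases aut_ΔB f with h | h
  · exact ⟨k, by rw [map_zpow, h]⟩
  · exact ⟨-k, by rw [map_zpow, h, inv_zpow, zpow_neg]⟩

theorem exists_map_Xo {φ : MulAut (ArtinB (m + 5))}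
    (hφ : ∀ g, pB (m + 5) (φ g) = pB (m + 5) g) :
    ∃ (ψ : MulAut (ArtinB (m + 5))) (g : ArtinB (m + 5)) (k : ℤ),
      (ψ = 1 ∨ ψ = autμ (m + 3) ∨ ψ = autτ (m + 3) ∨ ψ = autμ (m + 3) * autτ (m + 3)) ∧
      φ (Xo (sB (m + 5)) (m + 5) 0) =
        g * ψ (Xo (sB (m + 5)) (m + 5) 0) * g⁻¹ * ΔB (m + 5) ^ k := by
  obtain ⟨w, k, hw⟩ := map_Xo_zero hφ
  set X := Xo (sB (m + 5)) (m + 5) 0 with hX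
  have hd : ∀ {e : ℤ} {c x : ArtinB (m + 5)}, (degt (m + 3) x = m + 4 ∨ degt (m + 3) x = -(m + 4)) →
      φ X = c * x ^ e * c⁻¹ * ΔB (m + 5) ^ k → e = 1 ∨ e = -1 := by
    intro e c x hx h
    have h1 := degt_map_eq φ X
    have h0 : ((m + 4 : ℕ) : ℤ) ≠ 0 := by positivity
    have h2 : degt (m + 3) X = (m + 4 : ℕ) := by rw [hX, degt_Xo]; push_cast; ring
    rw [h2, h, degt_mul, degt_mul, degt_mul, degt_zpow, degt_zpow, degt_ΔB, degt_inv] at h1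
    have h3 : degt (m + 3) x = (m + 4 : ℕ) ∨ degt (m + 3) x = -(m + 4 : ℕ) := by
      push_cast; exact hx
    have h4 : e = degt (m + 3) (φ (sB (m + 5) 0)) ∨ e = -degt (m + 3) (φ (sB (m + 5) 0)) := by
      rcases h3 with h3 | h3
      · left
        rw [h3] at h1
        exact mul_right_cancel₀ h0 (by linarith)
      · right
        rw [h3] at h1
        exact mul_right_cancel₀ h0 (by linarith)
    have : degt (m + 3) (φ (sB (m + 5) 0)) = 1 ∨ degt (m + 3) (φ (sB (m + 5) 0)) = -1 :=
      degt_map_sB φ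
    omega
  obtain ⟨t, ht⟩ : ∃ t, X⁻¹ = t * autτ (m + 3) X * t⁻¹ := autτ_Xo (m + 3)
  have hdX : degt (m + 3) X = m + 4 := by rw [hX, degt_Xo]; push_cast; ring
  rcases isConj_of_invariant (m + 2) (isConj_Ψ_of_map hφ hw) with h | ⟨e, h⟩ | ⟨e, h⟩
  · exact (not_isConj_letters hφ hw h).elim
  · obtain ⟨c, rfl⟩ := isConj_iff.1 h.symm
    have hw' : φ X = ι1 (m + 4) c * X ^ e * (ι1 (m + 4) c)⁻¹ * ΔB (m + 5) ^ k := by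
      rw [hw, map_mul, map_mul, map_inv, map_zpow, ι1_xF_last]
    rcases hd (Or.inl hdX) hw' with rfl | rfl
    · exact ⟨1, _, _, Or.inl rfl, by rw [hw', zpow_one, MulAut.one_apply]⟩
    · refine ⟨autτ (m + 3), ι1 (m + 4) c * t, k, Or.inr (Or.inr (Or.inl rfl)), ?_⟩
      rw [hw', zpow_neg_one, ht]; simp only [mul_inv_rev, mul_assoc]
  · obtain ⟨c, rfl⟩ := isConj_iff.1 h.symm
    have hw' : φ X = ι1 (m + 4) c * autμ (m + 3) X ^ e * (ι1 (m + 4) c)⁻¹ * ΔB (m + 5) ^ k := by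
      rw [hw, map_mul, map_mul, map_inv, map_zpow, autμ_Xo]
    have hdμ : degt (m + 3) (autμ (m + 3) X) = -(m + 4) := by
      rw [degt_map_eq, autμ_sB (Nat.zero_le _), degt_inv, degt_sB (Nat.zero_le _), hdX]; ring
    rcases hd (Or.inr hdμ) hw' with rfl | rfl
    · exact ⟨autμ (m + 3), _, _, Or.inr (Or.inl rfl), by rw [hw', zpow_one]⟩
    · refine ⟨autμ (m + 3) * autτ (m + 3), ι1 (m + 4) c * autμ (m + 3) t, k,
        Or.inr (Or.inr (Or.inr rfl)), ?_⟩
      rw [hw', zpow_neg_one, ← map_inv, ht, MulAut.mul_apply, map_mul, map_mul, map_inv]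
      simp only [mul_inv_rev, mul_assoc]

/-- Up to the known automorphisms, every automorphism fixes the first pure generator modulo the
center. -/
theorem exists_reduction (φ : MulAut (ArtinB (m + 5))) :
    ∃ (ψ φ₁ : MulAut (ArtinB (m + 5))) (g : ArtinB (m + 5)) (k : ℤ),
      (ψ = 1 ∨ ψ = autμ (m + 3) ∨ ψ = autτ (m + 3) ∨ ψ = autμ (m + 3) * autτ (m + 3)) ∧
      φ = MulAut.conj g * ψ * φ₁ ∧
      φ₁ (Xo (sB (m + 5)) (m + 5) 0) = Xo (sB (m + 5)) (m + 5) 0 * ΔB (m + 5) ^ k := by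
  obtain ⟨σ, hσ⟩ := exists_pB_aut φ
  obtain ⟨h, rfl⟩ := pB_surjective (m + 5) σ
  obtain ⟨ψ, g, k, hψ, hk⟩ := exists_map_Xo (φ := (MulAut.conj h)⁻¹ * φ) fun g => by
    rw [← map_inv, MulAut.mul_apply, MulAut.conj_apply, map_mul, map_mul, hσ, map_inv]; group
  obtain ⟨l, hl⟩ := map_ΔB_zpow ψ⁻¹ k
  refine ⟨ψ, ψ⁻¹ * (MulAut.conj (h * g))⁻¹ * φ, h * g, l, hψ, by group, ?_⟩
  rw [show ψ⁻¹ * (MulAut.conj (h * g))⁻¹ * φ =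
      ψ⁻¹ * (MulAut.conj g⁻¹ * ((MulAut.conj h)⁻¹ * φ)) by rw [map_mul, map_inv]; group,
    MulAut.mul_apply, MulAut.mul_apply, hk, MulAut.conj_apply]
  have hc : ∀ x : ArtinB (m + 5), g⁻¹ * (g * x * g⁻¹ * ΔB (m + 5) ^ k) * g⁻¹⁻¹ =
      x * ΔB (m + 5) ^ k := fun x => by
    rw [inv_inv, mul_assoc _ _ g, mul_assoc _ _ g, ((ΔB_comm (n := m + 5) g).zpow_left k).eq]
    group
  rw [hc, map_mul, hl, ← MulAut.mul_apply, inv_mul_cancel, MulAut.one_apply]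

end FirstStrand

end ArtinAut

namespace ArtinAut

section CentralTwist

open FreeGroup (of)

variable {m : ℕ}

theorem exists_conj_Xo {i : ℕ} (hi : i ≤ m) :
    ∃ h, Xo (sB (m + 1)) (m + 1) i = h * Xo (sB (m + 1)) (m + 1) 0 * h⁻¹ := by
  induction i with
  | zero => exact ⟨1, by group⟩
  | succ i ih =>
    obtain ⟨h, hh⟩ := ih (by omega)
    refine ⟨(sB (m + 1) i)⁻¹ * h, ?_⟩
    rw [Xo_succ _ (by omega)] at hh
    rw [mul_inv_rev, inv_inv, mul_assoc, mul_assoc, ← mul_assoc h, ← mul_assoc (h * _), ← hh]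
    group

theorem conj_Φ (g : ArtinB (m + 2)) (y : FreeGroup (Fin (m + 2))) :
    MulAut.conj (Φ (m + 2) g y) = Φ (m + 2) g * MulAut.conj y * (Φ (m + 2) g)⁻¹ := by
  rw [← Φ_ιo, ← Φ_ιo, ← ιo_equivariant, map_mul, map_mul, map_inv]

theorem mem_zpowers_of_Φ_eq {g h : ArtinB (m + 2)} (e : Φ (m + 2) g = Φ (m + 2) h) :
    ∃ k : ℤ, h = g * ΔB (m + 2) ^ k := by
  obtain ⟨k, hk⟩ := mem_zpowers_of_Φ_eq_one (m + 1) (g := g⁻¹ * h)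
    (by rw [map_mul, map_inv, e, inv_mul_cancel])
  exact ⟨k, by rw [show ΔB (m + 2) ^ k = g⁻¹ * h from hk, mul_inv_cancel_left]⟩

theorem conj_inj {a b : FreeGroup (Fin (m + 2))} (h : MulAut.conj a = MulAut.conj b) : a = b :=
  conj_injective (show (0 : Fin (m + 2)) ≠ 1 by simp) h

theorem exists_induced {φ : MulAut (ArtinB (m + 2))} {k : ℤ}
    (hφ : φ (Xo (sB (m + 2)) (m + 2) 0) = Xo (sB (m + 2)) (m + 2) 0 * ΔB (m + 2) ^ k) :
    ∃ α : FreeGroup (Fin (m + 2)) →* FreeGroup (Fin (m + 2)),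
      (∀ y, Φ (m + 2) (φ (ιo (m + 2) y)) = MulAut.conj (α y)) ∧
      ∀ i, ∃ a, IsConj (α (of i)) (of a) := by
  have hX : ∀ i : ℕ, ∃ h, i ≤ m + 1 → Xo (sB (m + 2)) (m + 2) i =
      h * Xo (sB (m + 2)) (m + 2) 0 * h⁻¹ := fun i => by
    by_cases hi : i ≤ m + 1
    · obtain ⟨h, hh⟩ := exists_conj_Xo hi; exact ⟨h, fun _ => hh⟩
    · exact ⟨1, fun h => (hi h).elim⟩
  choose h hh using hX
  refine ⟨liftF (m + 2) fun i => Φ (m + 2) (φ (h i)) (xF (m + 2) 0), fun y => ?_, fun i => ?_⟩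
  · have : ((Φ (m + 2)).comp φ.toMonoidHom).comp (ιo (m + 2)) =
        MulAut.conj.comp (liftF (m + 2) fun i => Φ (m + 2) (φ (h i)) (xF (m + 2) 0)) := by
      refine xF_hom_ext fun i hi => ?_
      simp only [MonoidHom.comp_apply, MulEquiv.toMonoidHom_eq_coe, MonoidHom.coe_coe]
      rw [liftF_xF _ hi, ιo_xF hi, hh i (by omega), map_mul φ, map_mul φ, map_inv φ, hφ, conj_Φ,
        map_mul, map_mul, map_mul, map_zpow, Φ_ΔB, one_zpow, mul_one, map_inv,
        ← ιo_xF (by omega), Φ_ιo]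
    exact DFunLike.congr_fun this y
  · refine ⟨pB (m + 2) (φ (h i)) ⟨0, by omega⟩, ?_⟩
    rw [← xF_fin, liftF_xF _ i.2, xF_of_lt (by omega)]
    exact isConj_Φ_of _ _

theorem induced_surjective {φ : MulAut (ArtinB (m + 2))} {k : ℤ}
    (hφ : φ (Xo (sB (m + 2)) (m + 2) 0) = Xo (sB (m + 2)) (m + 2) 0 * ΔB (m + 2) ^ k)
    {α : FreeGroup (Fin (m + 2)) →* FreeGroup (Fin (m + 2))}
    (hα : ∀ y, Φ (m + 2) (φ (ιo (m + 2) y)) = MulAut.conj (α y)) : Function.Surjective α := by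
  obtain ⟨l, hl⟩ := map_ΔB_zpow φ⁻¹ k
  obtain ⟨β, hβ, -⟩ := exists_induced (φ := φ⁻¹) (k := -l) <| by
    have := congrArg (fun x => φ⁻¹ x) hφ
    beta_reduce at this
    rw [← MulAut.mul_apply, inv_mul_cancel, MulAut.one_apply, map_mul, hl] at this
    rw [zpow_neg, eq_mul_inv_iff_mul_eq]; exact this.symm
  intro y
  refine ⟨β y, conj_inj ?_⟩
  obtain ⟨j, hj⟩ := mem_zpowers_of_Φ_eq ((hβ y).trans (Φ_ιo (β y)).symm)
  obtain ⟨i, hi⟩ := map_ΔB_zpow φ j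
  rw [← hα, hj, map_mul, hi, ← MulAut.mul_apply, mul_inv_cancel, MulAut.one_apply, map_mul,
    map_zpow, Φ_ΔB, one_zpow, mul_one, Φ_ιo]

theorem expo_induced_PiF {n : ℕ} {α : FreeGroup (Fin n) →* FreeGroup (Fin n)}
    (hs : Function.Surjective α) (hα : ∀ i, ∃ a, IsConj (α (of i)) (of a)) (j : Fin n) :
    expo j (α (PiF n)) = Multiplicative.ofAdd 1 := by
  choose p hp using hα
  have hps : Function.Surjective p := by
    intro j
    by_contra! hj
    have h1 : (expo j).comp α = 1 := FreeGroup.ext_hom _ _ fun i => by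
      rw [MonoidHom.comp_apply, expo_conj j (hp i), expo_of_ne (hj i), MonoidHom.one_apply]
    obtain ⟨y, hy⟩ := hs (of j)
    have h2 := DFunLike.congr_fun h1 y
    rw [MonoidHom.comp_apply, hy, expo_of_self] at h2
    exact one_ne_zero (congrArg Multiplicative.toAdd h2 : (1 : ℤ) = 0)
  obtain ⟨c, hc⟩ := hps j
  rw [PiF, map_pr, map_pr, pr_congr (t := fun i => if i = c.val then Multiplicative.ofAdd 1 else 1),
    pr_single, if_pos c.2]
  intro i _ hi
  rw [xF_of_lt (by omega), expo_conj j (hp _)]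
  split_ifs with h
  · rw [show (⟨i, by omega⟩ : Fin n) = c from Fin.ext h, hc, expo_of_self]
  · refine expo_of_ne fun e => h ?_
    exact congrArg Fin.val (Finite.injective_iff_surjective.2 hps (e.trans hc.symm))

theorem isConj_Ψ_of_Φ {w : FreeGroup (Fin (m + 3))}
    (hw : ∀ h : ArtinB (m + 3), IsConj (Φ (m + 3) h w) w) (h : ArtinB (m + 2)) :
    IsConj (Ψ (m + 2) h w) w := by
  have key : ∀ i, i < m + 2 → IsConj (Ψ (m + 2) (sB (m + 2) i) w) w := fun i hi => by
    by_cases h : i + 1 < m + 2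
    · rw [Ψ_sB h, ← Φ_sB (by omega)]; exact hw _
    · obtain rfl : i = m + 1 := by omega
      rw [Ψ_sB_last, ← Φ_sB (n := m + 3) (by omega), ← map_pow]; exact hw _
  induction h using sB_induction with
  | h1 => rw [map_one]; exact IsConj.refl _
  | hs i g hi ih =>
    rw [map_mul, MulAut.mul_apply]
    exact (isConj_map _ (key i hi)).trans ih
  | hi i g hi ih =>
    rw [map_mul, MulAut.mul_apply, map_inv]
    have h1 := isConj_map (Ψ (m + 2) (sB (m + 2) i))⁻¹ (key i hi)
    rw [← MulAut.mul_apply, inv_mul_cancel, MulAut.one_apply] at h1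
    exact (isConj_map _ h1.symm).trans ih

theorem isConj_PiF_of_invariant {w : FreeGroup (Fin (m + 3))}
    (hw : ∀ h : ArtinB (m + 3), IsConj (Φ (m + 3) h w) w)
    (he : ∀ j, expo j w = Multiplicative.ofAdd 1) : IsConj w (PiF (m + 3)) := by
  have h10 : (Multiplicative.ofAdd (1 : ℤ)) ≠ 1 := fun h => one_ne_zero (congrArg Multiplicative.toAdd h : (1 : ℤ) = 0)
  rcases isConj_of_invariant m (isConj_Ψ_of_Φ hw) with ⟨a, ha, h⟩ | ⟨e, h⟩ | ⟨e, h⟩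
  · have h1 : expo (⟨m + 2, by omega⟩ : Fin (m + 3)) a ∈ (⊥ : Subgroup (Multiplicative ℤ)) := by
      refine map_mem_of_closure ?_ ha
      rintro _ ⟨i, hi, rfl⟩
      refine Subgroup.mem_bot.2 (expo_of_ne ?_)
      rintro rfl
      exact lt_irrefl (m + 2) hi
    rw [← expo_conj _ h, he] at h1
    exact (h10 (Subgroup.mem_bot.1 h1)).elim
  · have h1 := expo_conj ⟨0, by omega⟩ h
    rw [he, map_zpow, xF_of_lt (by omega), expo_of_ne (by simp), one_zpow] at h1
    exact (h10 h1).elim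
  · have h1 := expo_conj ⟨0, by omega⟩ h
    rw [he, map_zpow, PiF, expo_pr_xF le_rfl _ (by simp)] at h1
    have h2 : (1 : ℤ) = e * 1 := congrArg Multiplicative.toAdd h1
    obtain rfl : e = 1 := by omega
    rwa [zpow_one] at h

theorem exists_conj_mul_autT {φ : MulAut (ArtinB (m + 3))} {k : ℤ}
    (hφ : φ (Xo (sB (m + 3)) (m + 3) 0) = Xo (sB (m + 3)) (m + 3) 0 * ΔB (m + 3) ^ k) :
    ∃ (g : ArtinB (m + 3)) (p : ℤ), φ = MulAut.conj g * autT (m + 1) ^ p := by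
  obtain ⟨α, hα, hα'⟩ := exists_induced hφ
  have hs := induced_surjective hφ hα
  have hP : IsConj (α (PiF (m + 3))) (PiF (m + 3)) := by
    refine isConj_PiF_of_invariant (fun h => ?_) (expo_induced_PiF hs hα')
    obtain ⟨h, rfl⟩ := φ.surjective h
    have : Φ (m + 3) (φ h) (α (PiF (m + 3))) = α (Φ (m + 3) h (PiF (m + 3))) := conj_inj <| by
      rw [conj_Φ, ← hα, ← hα, ← ιo_equivariant]; simp only [map_mul, map_inv]
    rw [this]
    exact α.map_isConj (isConj_Φ_PiF h)
  obtain ⟨g, hg⟩ := exists_Φ α hα' hP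
  obtain ⟨f, hf⟩ : ∃ f, f = (MulAut.conj g)⁻¹ * φ := ⟨_, rfl⟩
  have hfΦ : ∀ x, Φ (m + 3) (f x) = Φ (m + 3) g⁻¹ * Φ (m + 3) (φ x) * Φ (m + 3) g := fun x => by
    rw [hf, ← map_inv, MulAut.mul_apply, MulAut.conj_apply, inv_inv, map_mul, map_mul]
  have h1 : ∀ y, Φ (m + 3) (f (ιo (m + 3) y)) = MulAut.conj y := fun y => by
    rw [hfΦ, hα, hg, conj_Φ, map_inv]; group
  have h2 : ∀ x, Φ (m + 3) x = Φ (m + 3) (f x) := fun x => by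
    ext1 y
    refine conj_inj ?_
    rw [← h1 (Φ (m + 3) x y), ← ιo_equivariant, conj_Φ (f x), ← h1 y]
    simp only [map_mul, map_inv]
  obtain ⟨p, hp⟩ := mem_zpowers_of_Φ_eq (h2 (sB (m + 3) 0))
  obtain ⟨q, hq⟩ := mem_zpowers_of_Φ_eq (h2 (ρB (m + 3)))
  have hq0 : q = 0 := by
    have h : degr (m + 1) (f (ρB (m + 3))) = 1 ∨ degr (m + 1) (f (ρB (m + 3))) = -1 :=
      degr_map_ρB f
    rw [hq, degr_mul, degr_ρB, degr_zpow, degr_ΔB] at h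
    have h3 : (3 : ℤ) ≤ ((m + 1 : ℕ) : ℤ) + 2 := by omega
    by_contra hq
    rcases h with h | h
    · rcases Int.lt_or_gt_of_ne hq with h' | h' <;> nlinarith
    · rcases Int.lt_or_gt_of_ne hq with h' | h' <;> nlinarith
  refine ⟨g, p, ?_⟩
  rw [← inv_mul_eq_iff_eq_mul, ← hf]
  refine mulAut_ext ?_ ?_
  · rw [hp, autT_zpow_sB]
  · rw [hq, hq0, zpow_zero, mul_one, autT_zpow_ρB]

/-- Every automorphism is a product of an inner one and the known ones. -/
theorem exists_normal_form (φ : MulAut (ArtinB (m + 5))) :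
    ∃ (g : ArtinB (m + 5)) (ψ : MulAut (ArtinB (m + 5))) (p : ℤ),
      (ψ = 1 ∨ ψ = autμ (m + 3) ∨ ψ = autτ (m + 3) ∨ ψ = autμ (m + 3) * autτ (m + 3)) ∧
      φ = MulAut.conj g * ψ * autT (m + 3) ^ p := by
  obtain ⟨ψ, φ₁, g, k, hψ, hφ, h⟩ := exists_reduction φ
  obtain ⟨a, p, rfl⟩ := exists_conj_mul_autT h
  refine ⟨g * ψ a, ψ, p, hψ, ?_⟩
  rw [hφ, map_mul]
  have : MulAut.conj (ψ a) = ψ * MulAut.conj a * ψ⁻¹ := by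
    ext1 x
    simp [MulAut.mul_apply]
  rw [this]; group

end CentralTwist

end ArtinAut

namespace ArtinAut

section CyclicGenerators

variable {m : ℕ}

theorem tB_self (m : ℕ) : tB (m + 2) (m + 2) = tB (m + 2) 0 := by simp [tB]

theorem autT_tB {i : ℕ} (hi : i < m + 2) : autT m (tB (m + 2) i) = tB (m + 2) i * ΔB (m + 2) := by
  rcases Nat.eq_zero_or_pos i with rfl | h
  · rw [tB_zero, map_mul, map_mul, map_inv, autT_ρB, autT_sB le_rfl]
    simp only [mul_assoc, (ΔB_comm (n := m + 2) (ρB (m + 2))⁻¹).eq]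
  · rw [tB_of_pos h hi, autT_sB (by omega)]

theorem autμ_tB {i : ℕ} (hi : i < m + 2) : autμ m (tB (m + 2) i) = (tB (m + 2) i)⁻¹ := by
  rcases Nat.eq_zero_or_pos i with rfl | h
  · rw [tB_zero, map_mul, map_mul, map_inv, autμ_ρB, autμ_sB le_rfl]; group
  · rw [tB_of_pos h hi, autμ_sB (by omega)]

theorem autτ_tB {i : ℕ} (hi : i < m + 2) :
    autτ m (tB (m + 2) i) = (tB (m + 2) (m + 2 - i))⁻¹ := by
  rcases Nat.eq_zero_or_pos i with rfl | h
  · rw [Nat.sub_zero, tB_self, tB_zero, map_mul, map_mul, map_inv, autτ_ρB, autτ_sB le_rfl,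
      Nat.sub_self, inv_inv, eq_inv_iff_mul_eq_one]
    have h := ρB_sq_mul_sB m
    rw [pow_two] at h
    have h' : ρB (m + 2) * sB (m + 2) m * (ρB (m + 2))⁻¹ =
        (ρB (m + 2))⁻¹ * sB (m + 2) 0 * ρB (m + 2) := by
      rw [mul_inv_eq_iff_eq_mul, mul_assoc, mul_assoc, ← h]; group
    rw [h']; group
  · rw [tB_of_pos h hi, tB_of_pos (by omega) (by omega), autτ_sB (by omega)]
    congr 2; omega

end CyclicGenerators

section Outer

variable {m : ℕ}

theorem degt_mul_map (f g : MulAut (ArtinB (m + 2))) :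
    degt m ((f * g) (sB (m + 2) 0)) = degt m (f (sB (m + 2) 0)) * degt m (g (sB (m + 2) 0)) := by
  rw [MulAut.mul_apply, degt_map_eq]

theorem degr_mul_map_ρB (f g : MulAut (ArtinB (m + 2))) :
    degr m ((f * g) (ρB (m + 2))) = degr m (f (ρB (m + 2))) * degr m (g (ρB (m + 2))) := by
  rw [MulAut.mul_apply, degr_map, degt_map_ρB, mul_zero, zero_add]

theorem degr_mul_map_sB (f g : MulAut (ArtinB (m + 2))) :
    degr m ((f * g) (sB (m + 2) 0)) =
      degr m (f (sB (m + 2) 0)) * degt m (g (sB (m + 2) 0)) +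
        degr m (f (ρB (m + 2))) * degr m (g (sB (m + 2) 0)) := by
  rw [MulAut.mul_apply, degr_map]

/-- The action on the exponent sums, up to the transvections. -/
noncomputable def signs (m : ℕ) : MulAut (ArtinB (m + 2)) →* ℤ × ℤ where
  toFun f := (degt m (f (sB (m + 2) 0)), degr m (f (ρB (m + 2))))
  map_one' := by simp [degt_sB, degr_ρB]
  map_mul' f g := Prod.ext (degt_mul_map f g) (degr_mul_map_ρB f g)

theorem signs_conj (g : ArtinB (m + 2)) : signs m (MulAut.conj g) = 1 := by
  simp [signs, degt_sB, degr_ρB]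

theorem signs_autT : signs m (autT m) = 1 := by
  simp [signs, autT_sB, autT_ρB, degt_sB, degr_ρB, degt_ΔB]

theorem signs_autT_zpow (p : ℤ) : signs m (autT m ^ p) = 1 :=
  zpow_mem (K := (signs m).ker) (MonoidHom.mem_ker.2 signs_autT) p

theorem signs_autμ : signs m (autμ m) = (-1, 1) := by
  simp [signs, autμ_sB, autμ_ρB, degt_sB, degr_ρB]

theorem signs_autτ : signs m (autτ m) = (-1, -1) := by
  simp [signs, autτ_sB, autτ_ρB, degt_sB, degr_ρB]

/-- The subgroup generated by `μ` and `τ`. -/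
def IsSignAut (ψ : MulAut (ArtinB (m + 2))) : Prop :=
  ψ = 1 ∨ ψ = autμ m ∨ ψ = autτ m ∨ ψ = autμ m * autτ m

theorem autμ_mul_self : autμ m * autμ m = 1 := by rw [← pow_two, autμ_sq]

theorem autτ_mul_self : autτ m * autτ m = 1 := by rw [← pow_two, autτ_sq]

theorem autμ_inv : (autμ m)⁻¹ = autμ m := inv_eq_of_mul_eq_one_left autμ_mul_self

theorem autτ_inv : (autτ m)⁻¹ = autτ m := inv_eq_of_mul_eq_one_left autτ_mul_self

theorem IsSignAut.mul_autμ {ψ : MulAut (ArtinB (m + 2))} (h : IsSignAut ψ) :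
    IsSignAut (ψ * autμ m) := by
  rcases h with rfl | rfl | rfl | rfl
  · exact Or.inr (Or.inl (one_mul _))
  · exact Or.inl autμ_mul_self
  · exact Or.inr (Or.inr (Or.inr autτ_mul_autμ))
  · exact Or.inr (Or.inr (Or.inl (by
      rw [mul_assoc, autτ_mul_autμ, ← mul_assoc, autμ_mul_self, one_mul])))

theorem IsSignAut.mul_autτ {ψ : MulAut (ArtinB (m + 2))} (h : IsSignAut ψ) :
    IsSignAut (ψ * autτ m) := by
  rcases h with rfl | rfl | rfl | rfl
  · exact Or.inr (Or.inr (Or.inl (one_mul _)))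
  · exact Or.inr (Or.inr (Or.inr rfl))
  · exact Or.inl autτ_mul_self
  · exact Or.inr (Or.inl (by rw [mul_assoc, autτ_mul_self, mul_one]))

theorem IsSignAut.eq_one {ψ : MulAut (ArtinB (m + 2))} (h : IsSignAut ψ)
    (h1 : signs m ψ = 1) : ψ = 1 := by
  rcases h with rfl | rfl | rfl | rfl
  · rfl
  · rw [signs_autμ] at h1; exact absurd (congrArg Prod.fst h1) (by decide)
  · rw [signs_autτ] at h1; exact absurd (congrArg Prod.fst h1) (by decide)
  · rw [map_mul, signs_autμ, signs_autτ] at h1; exact absurd (congrArg Prod.snd h1) (by decide)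

theorem isSignAut_of_mem_closure {ψ : MulAut (ArtinB (m + 2))}
    (h : ψ ∈ Subgroup.closure {autμ m, autτ m}) : IsSignAut ψ := by
  induction h using Subgroup.closure_induction_right with
  | one => exact Or.inl rfl
  | mul_right x hx y hy ih =>
    rcases hy with rfl | rfl
    · exact ih.mul_autμ
    · exact ih.mul_autτ
  | mul_inv_cancel x hx y hy ih =>
    rcases hy with rfl | rfl
    · rw [autμ_inv]; exact ih.mul_autμ
    · rw [autτ_inv]; exact ih.mul_autτ

theorem autT_zpow_mul_autμ (p : ℤ) : autT m ^ p * autμ m = autμ m * autT m ^ (-p) := by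
  have h : autμ m * autT m * (autμ m)⁻¹ = (autT m)⁻¹ := by rw [autμ_inv, autμ_mul_autT_mul_autμ]
  have h1 : autμ m * autT m ^ (-p) * (autμ m)⁻¹ = autT m ^ p := by
    rw [← conj_zpow, h, inv_zpow', neg_neg]
  rw [← h1, inv_mul_cancel_right]

theorem autT_zpow_mul_autτ (p : ℤ) : autT m ^ p * autτ m = autτ m * autT m ^ p :=
  (Commute.zpow_right (show Commute (autτ m) (autT m) from autτ_mul_autT) p).symm.eq

theorem exists_of_mem_closure {φ : MulAut (ArtinB (m + 2))}
    (h : φ ∈ Subgroup.closure {autT m, autτ m, autμ m}) :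
    ∃ ψ, IsSignAut ψ ∧ ∃ p : ℤ, φ = ψ * autT m ^ p := by
  have hμ : ∀ {φ : MulAut (ArtinB (m + 2))}, (∃ ψ, IsSignAut ψ ∧ ∃ p : ℤ, φ = ψ * autT m ^ p) →
      ∃ ψ, IsSignAut ψ ∧ ∃ p : ℤ, φ * autμ m = ψ * autT m ^ p := by
    rintro _ ⟨ψ, hψ, p, rfl⟩
    exact ⟨_, hψ.mul_autμ, -p, by rw [mul_assoc, autT_zpow_mul_autμ, mul_assoc]⟩
  have hτ : ∀ {φ : MulAut (ArtinB (m + 2))}, (∃ ψ, IsSignAut ψ ∧ ∃ p : ℤ, φ = ψ * autT m ^ p) →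
      ∃ ψ, IsSignAut ψ ∧ ∃ p : ℤ, φ * autτ m = ψ * autT m ^ p := by
    rintro _ ⟨ψ, hψ, p, rfl⟩
    exact ⟨_, hψ.mul_autτ, p, by rw [mul_assoc, autT_zpow_mul_autτ, mul_assoc]⟩
  induction h using Subgroup.closure_induction_right with
  | one => exact ⟨1, Or.inl rfl, 0, by simp⟩
  | mul_right x hx y hy ih =>
    rcases hy with rfl | rfl | rfl
    · obtain ⟨ψ, hψ, p, rfl⟩ := ih
      exact ⟨ψ, hψ, p + 1, by rw [zpow_add_one, mul_assoc]⟩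
    · exact hτ ih
    · exact hμ ih
  | mul_inv_cancel x hx y hy ih =>
    rcases hy with rfl | rfl | rfl
    · obtain ⟨ψ, hψ, p, rfl⟩ := ih
      exact ⟨ψ, hψ, p - 1, by rw [zpow_sub_one, mul_assoc]⟩
    · rw [autτ_inv]; exact hτ ih
    · rw [autμ_inv]; exact hμ ih

theorem autT_zpow_eq_one {p : ℤ} (h : degr m ((autT m ^ p) (sB (m + 2) 0)) = 0) : p = 0 := by
  rw [autT_zpow_sB, degr_mul, degr_sB (Nat.zero_le _), degr_zpow, degr_ΔB, zero_add] at h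
  exact (mul_eq_zero.1 h).resolve_right (by positivity)

theorem degr_conj_map (g x : ArtinB (m + 2)) : degr m (MulAut.conj g x) = degr m x := by
  rw [MulAut.conj_apply]; simp

theorem eq_one_of_conj {ψ : MulAut (ArtinB (m + 2))} (hψ : IsSignAut ψ) {p : ℤ} {g : ArtinB (m + 2)}
    (h : MulAut.conj g = ψ * autT m ^ p) : ψ = 1 ∧ p = 0 := by
  have h1 : ψ = 1 := hψ.eq_one <| by
    have := congrArg (signs m) h
    rwa [signs_conj, map_mul, signs_autT_zpow, mul_one, eq_comm] at this
  subst h1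
  refine ⟨rfl, autT_zpow_eq_one (m := m) ?_⟩
  rw [one_mul] at h
  rw [← h, degr_conj_map, degr_sB (Nat.zero_le _)]

end Outer

end ArtinAut

namespace ArtinAut

section OuterGroup

variable {m : ℕ}

theorem IsSignAut.degr_sB {ψ : MulAut (ArtinB (m + 2))} (h : IsSignAut ψ) :
    degr m (ψ (sB (m + 2) 0)) = 0 := by
  rcases h with rfl | rfl | rfl | rfl
  · exact ArtinAut.degr_sB (Nat.zero_le _)
  · rw [autμ_sB (Nat.zero_le _), degr_inv, ArtinAut.degr_sB (Nat.zero_le _), neg_zero]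
  · rw [autτ_sB (Nat.zero_le _), degr_inv, ArtinAut.degr_sB (Nat.sub_le _ _), neg_zero]
  · rw [MulAut.mul_apply, autτ_sB (Nat.zero_le _), map_inv, autμ_sB (Nat.sub_le _ _), inv_inv,
      ArtinAut.degr_sB (Nat.sub_le _ _)]

theorem exists_normal_form_sign (φ : MulAut (ArtinB (m + 5))) :
    ∃ (g : ArtinB (m + 5)) (ψ : MulAut (ArtinB (m + 3 + 2))) (p : ℤ),
      IsSignAut ψ ∧ φ = MulAut.conj g * ψ * autT (m + 3) ^ p := exists_normal_form φ

theorem dvd_degr_map (φ : MulAut (ArtinB (m + 5))) :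
    (m : ℤ) + 5 ∣ degr (m + 3) (φ (sB (m + 5) 0)) := by
  obtain ⟨g, ψ, p, hψ, rfl⟩ := exists_normal_form_sign φ
  have h : degr (m + 3) (ψ (ΔB (m + 3 + 2))) = (m + 5) * degr (m + 3) (ψ (ρB (m + 3 + 2))) := by
    rw [ΔB, map_pow, degr_pow]; push_cast; ring
  rw [MulAut.mul_apply, MulAut.mul_apply, autT_zpow_sB, degr_conj_map, map_mul, map_zpow,
    degr_mul, degr_zpow, hψ.degr_sB, h]
  exact ⟨p * degr (m + 3) (ψ (ρB (m + 3 + 2))), by ring⟩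

/-- The amount by which an automorphism shears the exponent sums. -/
noncomputable def shear (φ : MulAut (ArtinB (m + 5))) : ℤ :=
  degr (m + 3) (φ (sB (m + 5) 0)) / (m + 5)

theorem shear_eq_iff {φ : MulAut (ArtinB (m + 5))} {k : ℤ} :
    shear φ = k ↔ degr (m + 3) (φ (sB (m + 5) 0)) = (m + 5) * k :=
  Int.ediv_eq_iff_eq_mul_right (by positivity) (dvd_degr_map φ)

theorem degr_eq_shear (φ : MulAut (ArtinB (m + 5))) :
    degr (m + 3) (φ (sB (m + 5) 0)) = (m + 5) * shear φ := shear_eq_iff.1 rfl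

theorem shear_mul (f g : MulAut (ArtinB (m + 5))) :
    shear (f * g) = shear f * (signs (m + 3) g).1 + (signs (m + 3) f).2 * shear g := by
  rw [shear_eq_iff]
  refine (degr_mul_map_sB (m := m + 3) f g).trans ?_
  rw [show degr (m + 3) (f (sB (m + 3 + 2) 0)) = (m + 5) * shear f from degr_eq_shear f,
    show degr (m + 3) (g (sB (m + 3 + 2) 0)) = (m + 5) * shear g from degr_eq_shear g]
  simp only [signs, MonoidHom.coe_mk, OneHom.coe_mk]
  ring

theorem signs_fst (f : MulAut (ArtinB (m + 2))) : (signs m f).1 = 1 ∨ (signs m f).1 = -1 :=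
  degt_map_sB f

theorem signs_snd (f : MulAut (ArtinB (m + 2))) : (signs m f).2 = 1 ∨ (signs m f).2 = -1 :=
  degr_map_ρB f

/-- The outer class of an automorphism. -/
noncomputable def outer (m : ℕ) :
    MulAut (ArtinB (m + 5)) →* DihedralGroup 0 × Multiplicative (ZMod 2) :=
  MonoidHom.mk' (fun f =>
    (if (signs (m + 3) f).1 = (signs (m + 3) f).2 then
      .r ((shear f * (signs (m + 3) f).2 : ℤ) : ZMod 0)
      else .sr ((shear f * (signs (m + 3) f).2 : ℤ) : ZMod 0),
      if (signs (m + 3) f).2 = 1 then 1 else Multiplicative.ofAdd 1)) <| by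
  intro f g
  have h2 : (Multiplicative.ofAdd (1 : ZMod 2)) * Multiplicative.ofAdd 1 = 1 := by decide
  simp only [map_mul (signs (m + 3)), Prod.fst_mul, Prod.snd_mul, shear_mul, Prod.mk_mul_mk]
  rcases signs_fst (m := m + 3) f with a | a <;> rcases signs_fst (m := m + 3) g with b | b <;>
    rcases signs_snd (m := m + 3) f with c | c <;> rcases signs_snd (m := m + 3) g with d | d <;>
    simp [a, b, c, d, h2]
  all_goals first
    | refine congrArg (DihedralGroup.r (n := 0)) ?_
    | refine congrArg (DihedralGroup.sr (n := 0)) ?_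
  all_goals first
    | rfl
    | (change (_ : ℤ) = (_ : ℤ) + (_ : ℤ); ring)

theorem outer_conj (g : ArtinB (m + 5)) : outer m (MulAut.conj g) = 1 := by
  have h : shear (MulAut.conj g) = 0 := by
    rw [shear_eq_iff, mul_zero]
    exact (degr_conj_map _ _).trans (degr_sB (Nat.zero_le _))
  have h1 : signs (m + 3) (MulAut.conj g) = 1 := signs_conj g
  simp [outer, h, h1]; rfl

theorem outer_autT_zpow (p : ℤ) : outer m (autT (m + 3) ^ p) = (.r p, 1) := by
  have h : shear (autT (m + 3) ^ p) = p := by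
    rw [shear_eq_iff]
    refine (congrArg (degr (m + 3)) (autT_zpow_sB p)).trans ?_
    rw [degr_mul, degr_sB (Nat.zero_le _), degr_zpow, degr_ΔB]; push_cast; ring
  have h1 : signs (m + 3) (autT (m + 3) ^ p) = 1 := signs_autT_zpow p
  simp [outer, h, h1]

theorem shear_of_isSignAut {ψ : MulAut (ArtinB (m + 5))} (h : IsSignAut (m := m + 3) ψ) :
    shear ψ = 0 := by
  rw [shear_eq_iff, mul_zero]; exact h.degr_sB

theorem outer_autμ : outer m (autμ (m + 3)) = (.sr 0, 1) := by
  have h : shear (autμ (m + 3)) = 0 := shear_of_isSignAut (Or.inr (Or.inl rfl))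
  have h1 : signs (m + 3) (autμ (m + 3)) = _ := signs_autμ
  simp [outer, h, h1]; rfl

theorem outer_autτ : outer m (autτ (m + 3)) = (1, Multiplicative.ofAdd 1) := by
  have h : shear (autτ (m + 3)) = 0 := shear_of_isSignAut (Or.inr (Or.inr (Or.inl rfl)))
  have h1 : signs (m + 3) (autτ (m + 3)) = _ := signs_autτ
  simp [outer, h, h1]; rfl

theorem outer_surjective (m : ℕ) : Function.Surjective (outer m) := by
  have hc : ∀ c : Multiplicative (ZMod 2), c = 1 ∨ c = Multiplicative.ofAdd 1 := by decide
  have hx : ∀ x : DihedralGroup 0, ∃ φ, outer m φ = (x, 1) := by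
    have hsr (i : ℤ) : outer m (autμ (m + 3) * autT (m + 3) ^ i) = (.sr i, 1) := by
      rw [map_mul, outer_autμ, outer_autT_zpow]
      exact Prod.ext (congrArg (DihedralGroup.sr (n := 0)) (zero_add i)) rfl
    rintro (i | i)
    · exact ⟨_, outer_autT_zpow i⟩
    · exact ⟨_, hsr i⟩
  rintro ⟨x, c⟩
  obtain ⟨φ, hφ⟩ := hx x
  rcases hc c with rfl | rfl
  · exact ⟨φ, hφ⟩
  · refine ⟨φ * autτ (m + 3), ?_⟩
    rw [map_mul, hφ, outer_autτ, Prod.mk_mul_mk, mul_one, one_mul]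

theorem outer_ker (m : ℕ) :
    (outer m).ker = (MulAut.conj : ArtinB (m + 5) →* MulAut (ArtinB (m + 5))).range := by
  refine le_antisymm (fun φ hφ => ?_) ?_
  · obtain ⟨g, ψ, p, hψ, rfl⟩ := exists_normal_form φ
    rw [MonoidHom.mem_ker, map_mul, map_mul, outer_conj, one_mul, outer_autT_zpow] at hφ
    have h1 := congrArg Prod.fst hφ
    have h2 := congrArg Prod.snd hφ
    rcases hψ with rfl | rfl | rfl | rfl
    · rw [map_one, one_mul] at h1
      obtain rfl : p = 0 := DihedralGroup.r.inj h1
      exact ⟨g, by rw [zpow_zero, mul_one, mul_one]⟩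
    · rw [outer_autμ] at h1
      cases h1
    · rw [outer_autτ] at h2
      exact absurd (show Multiplicative.ofAdd (1 : ZMod 2) * 1 = 1 from h2) (by decide)
    · rw [map_mul, outer_autμ, outer_autτ] at h2
      exact absurd (show 1 * Multiplicative.ofAdd (1 : ZMod 2) * 1 = 1 from h2) (by decide)
  · rintro _ ⟨g, rfl⟩
    exact outer_conj g

theorem closure_conj_autT (m : ℕ) :
    Subgroup.closure (↑(MulAut.conj : ArtinB (m + 5) →* MulAut (ArtinB (m + 5))).range ∪
      {autT (m + 3)}) = (signs (m + 3)).ker := by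
  refine le_antisymm ((Subgroup.closure_le _).2 ?_) fun φ hφ => ?_
  · rintro _ (⟨g, rfl⟩ | rfl)
    · exact signs_conj g
    · exact signs_autT
  · obtain ⟨g, ψ, p, hψ, rfl⟩ := exists_normal_form_sign φ
    rw [MonoidHom.mem_ker, map_mul, map_mul, signs_autT_zpow, mul_one,
      show signs (m + 3) (MulAut.conj g) = 1 from signs_conj g, one_mul] at hφ
    rw [hψ.eq_one hφ, mul_one]
    have hT : autT (m + 3) ∈ Subgroup.closure
      (↑(MulAut.conj : ArtinB (m + 5) →* MulAut (ArtinB (m + 5))).range ∪ {autT (m + 3)}) :=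
      Subgroup.subset_closure (by simp)
    exact mul_mem (Subgroup.subset_closure (Or.inl ⟨g, rfl⟩)) (zpow_mem hT p)

theorem closure_conj_generators (m : ℕ) :
    Subgroup.closure (↑(MulAut.conj : ArtinB (m + 5) →* MulAut (ArtinB (m + 5))).range ∪
      {autT (m + 3), autτ (m + 3), autμ (m + 3)}) = ⊤ := by
  refine eq_top_iff.2 fun φ _ => ?_
  obtain ⟨g, ψ, p, hψ, rfl⟩ := exists_normal_form φ
  have hT : autT (m + 3) ∈ Subgroup.closure
    (↑(MulAut.conj : ArtinB (m + 5) →* MulAut (ArtinB (m + 5))).range ∪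
      {autT (m + 3), autτ (m + 3), autμ (m + 3)}) := Subgroup.subset_closure (by simp)
  have hτ : autτ (m + 3) ∈ Subgroup.closure
    (↑(MulAut.conj : ArtinB (m + 5) →* MulAut (ArtinB (m + 5))).range ∪
      {autT (m + 3), autτ (m + 3), autμ (m + 3)}) := Subgroup.subset_closure (by simp)
  have hμ : autμ (m + 3) ∈ Subgroup.closure
    (↑(MulAut.conj : ArtinB (m + 5) →* MulAut (ArtinB (m + 5))).range ∪
      {autT (m + 3), autτ (m + 3), autμ (m + 3)}) := Subgroup.subset_closure (by simp)
  refine mul_mem (mul_mem (Subgroup.subset_closure (Or.inl ⟨g, rfl⟩)) ?_) (zpow_mem hT p)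
  rcases hψ with rfl | rfl | rfl | rfl
  exacts [one_mem _, hμ, hτ, mul_mem hμ hτ]

theorem not_isOfFinOrder_autT (m : ℕ) : ¬ IsOfFinOrder (autT m) := by
  rw [isOfFinOrder_iff_zpow_eq_one]
  rintro ⟨k, hk, h⟩
  refine hk (autT_zpow_eq_one (m := m) ?_)
  rw [h, MulAut.one_apply, degr_sB (Nat.zero_le _)]

theorem closure_inf_range_conj (m : ℕ) :
    Subgroup.closure {autT m, autτ m, autμ m} ⊓
      (MulAut.conj : ArtinB (m + 2) →* MulAut (ArtinB (m + 2))).range = ⊥ := by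
  refine eq_bot_iff.2 ?_
  rintro φ ⟨h1, g, hg⟩
  obtain ⟨ψ, hψ, p, rfl⟩ := exists_of_mem_closure h1
  obtain ⟨rfl, rfl⟩ := eq_one_of_conj hψ hg
  simp

theorem range_conj_inf_zpowers (m : ℕ) :
    (MulAut.conj : ArtinB (m + 2) →* MulAut (ArtinB (m + 2))).range ⊓ Subgroup.zpowers (autT m) =
      ⊥ := by
  refine eq_bot_iff.2 (le_trans ?_ (closure_inf_range_conj m).le)
  rw [inf_comm]
  exact inf_le_inf_right _ ((Subgroup.zpowers_le).2 (Subgroup.subset_closure (by simp)))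

theorem signs_ker_inf_closure (m : ℕ) : (signs m).ker ⊓ Subgroup.closure {autμ m, autτ m} = ⊥ := by
  refine eq_bot_iff.2 ?_
  rintro φ ⟨h1, h2⟩
  exact Subgroup.mem_bot.2 ((isSignAut_of_mem_closure h2).eq_one h1)

theorem zpowers_autμ_inf_zpowers_autτ (m : ℕ) :
    Subgroup.zpowers (autμ m) ⊓ Subgroup.zpowers (autτ m) = ⊥ := by
  refine eq_bot_iff.2 ?_
  rintro φ ⟨⟨k, rfl⟩, l, h⟩
  beta_reduce at h ⊢
  refine Subgroup.mem_bot.2 ?_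
  rcases Int.even_or_odd' k with ⟨j, rfl | rfl⟩
  · rw [zpow_mul, zpow_ofNat, autμ_sq, one_zpow]
  · rw [zpow_add_one, zpow_mul, zpow_ofNat, autμ_sq, one_zpow, one_mul] at h
    rcases Int.even_or_odd' l with ⟨i, rfl | rfl⟩
    · rw [zpow_mul, zpow_ofNat, autτ_sq, one_zpow] at h
      have := congrArg (signs m) h
      rw [map_one, signs_autμ] at this
      exact absurd (congrArg Prod.fst this) (by decide)
    · rw [zpow_add_one, zpow_mul, zpow_ofNat, autτ_sq, one_zpow, one_mul] at h
      have := congrArg (signs m) h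
      rw [signs_autμ, signs_autτ] at this
      exact absurd (congrArg Prod.snd this) (by decide)

end OuterGroup

end ArtinAut

/-- the automorphisms `T, τ, μ` of `A[Bₙ]`, their relations, and the
structure of `Aut(A[Bₙ])` and `Out(A[Bₙ])` for `n ≥ 5`. -/
theorem aut_structure (n : ℕ) (hn : 5 ≤ n) :
    ∃ T τ μ : MulAut (ArtinB n),
      -- the defining actions on the generators t_0, …, t_{n-1}, ρ_B
      (∀ i < n, T (tB n i) = tB n i * ΔB n) ∧ T (ρB n) = ρB n ∧
      (∀ i < n, τ (tB n i) = (tB n (n - i))⁻¹) ∧ τ (ρB n) = (ρB n)⁻¹ ∧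
      (∀ i < n, μ (tB n i) = (tB n i)⁻¹) ∧ μ (ρB n) = ρB n ∧
      -- relations among T, τ, μ
      ¬ IsOfFinOrder T ∧ τ ^ 2 = 1 ∧ μ ^ 2 = 1 ∧ τ * μ = μ * τ ∧
      μ * T * μ = T⁻¹ ∧ τ * T = T * τ ∧
      -- Aut is generated by Inn together with T, τ, μ
      Subgroup.closure
        (↑(MulAut.conj : ArtinB n →* MulAut (ArtinB n)).range ∪ {T, τ, μ}) = ⊤ ∧
      -- ⟨T, τ, μ⟩ meets Inn trivially
      Subgroup.closure {T, τ, μ} ⊓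
        (MulAut.conj : ArtinB n →* MulAut (ArtinB n)).range = ⊥ ∧
      -- the internal semidirect decomposition (Inn ⋊ ⟨T⟩) ⋊ (⟨μ⟩ × ⟨τ⟩)
      (MulAut.conj : ArtinB n →* MulAut (ArtinB n)).range.Normal ∧
      (Subgroup.closure
        (↑(MulAut.conj : ArtinB n →* MulAut (ArtinB n)).range ∪ {T})).Normal ∧
      (MulAut.conj : ArtinB n →* MulAut (ArtinB n)).range ⊓ Subgroup.zpowers T = ⊥ ∧
      Subgroup.closure (↑(MulAut.conj : ArtinB n →* MulAut (ArtinB n)).range ∪ {T}) ⊓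
        Subgroup.closure {μ, τ} = ⊥ ∧
      Subgroup.zpowers μ ⊓ Subgroup.zpowers τ = ⊥ ∧
      -- Out(A[Bₙ]) ≅ D∞ × ℤ/2ℤ, realized by a surjection with kernel Inn
      ∃ f : MulAut (ArtinB n) →* DihedralGroup 0 × Multiplicative (ZMod 2),
        Function.Surjective f ∧
        f.ker = (MulAut.conj : ArtinB n →* MulAut (ArtinB n)).range := by
  obtain ⟨m, rfl⟩ : ∃ m, n = m + 5 := ⟨n - 5, by omega⟩
  open ArtinAut in
  exact ⟨autT (m + 3), autτ (m + 3), autμ (m + 3), fun i hi => autT_tB hi, autT_ρB,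
    fun i hi => autτ_tB hi, autτ_ρB, fun i hi => autμ_tB hi, autμ_ρB, not_isOfFinOrder_autT _,
    autτ_sq, autμ_sq, autτ_mul_autμ, autμ_mul_autT_mul_autμ, autτ_mul_autT,
    closure_conj_generators m, closure_inf_range_conj (m + 3),
    by rw [← outer_ker m]; exact (outer m).normal_ker,
    by rw [closure_conj_autT]; exact MonoidHom.normal_ker _,
    range_conj_inf_zpowers (m + 3),
    by rw [closure_conj_autT]; exact signs_ker_inf_closure (m + 3),
    zpowers_autμ_inf_zpowers_autτ (m + 3), outer m, outer_surjective m, outer_ker m⟩
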